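/- On $[0,\infty)\times\mathbb R^2$ consider the inhomogeneous incompressible Navier–Stokes system $$\partial_t\rho+u\cdot\nabla\rho=0,\qquad \rho\,\partial_tu+\rho\,(u\cdot\nabla)u-\Delta u+\nabla\Pi=0,\qquad \operatorname{div}u=0,\qquad (\rho,u)|_{t=0}=(\rho_0,u_0).$$ Let $(\rho,u,\nabla\Pi)$ be a smooth global solution with $\rho>0$ such that $\rho-1$, $u$ and $\nabla\Pi$ are smooth functions of $t\in[0,\infty)$ with values in $H^k(\mathbb R^2)$ for every $k$, and suppose that $$U_0:=\int_{\mathbb R^2}|x||u_0(x)|\,dx<\infty,\qquad \int_{\mathbb R^2}\rho_0u_0\,dx=0,\qquad \tfrac34\le\rho_0\le\tfrac54 .$$ Put $$E_0=\int\rho_0|u_0|^2dx,\quad E_1=\|\nabla u_0\|_{L^2}^2,\quad E_2=\|\sqrt{\rho_0}\,\partial_tu|_{t=0}\|_{L^2}^2+\|\nabla u_0\|_{L^2}^4,$$ $$E_3=\|\nabla\partial_tu|_{t=0}\|_{L^2}^2+E_2^{3/2}+E_2\|\nabla\rho_0\|_{L^\infty}^2,$$ $$T_3=\max\Big\{\frac{U_0}{E_0},\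 \|\rho_0-1\|_{L^2}^2,\ \frac{E_0}{E_1},\ \frac{E_2}{E_1},\ \frac{E_2}{E_3}\Big\}$$ (with quotients $0/0$ read as $0$ if $u_0=0$), and $\langle t\rangle_T=e+t/T$. There is an increasing function $\mathcal C$ of one real variable, independent of the solution, such that for every such solution, all $T\ge T_3$ and all $t\ge0$, $$\|\nabla^3u(t)\|_{L^2}^2+\|\nabla^2\Pi(t)\|_{L^2}^2\le\mathcal C(E_0)\,(1+\|\nabla\rho_0\|_{L^2})^2\,E_3\,\langle t\rangle_T^{-5}\log^2\langle t\rangle_T,$$ $$\|\nabla u(t)\|_{L^\infty}\le\mathcal C(E_0)\,(1+\|\nabla\rho_0\|_{L^2})^{1/4}E_1^{1/4}E_3^{1/4}\,\langle t\rangle_T^{-2}\log^{1/2}\langle t\rangle_T .$$ -/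

import Mathlib

noncomputable section

open MeasureTheory Set
open scoped ENNReal ContDiff

namespace INS2D

/-- The plane `ℝ²` with its Euclidean norm. -/
abbrev Plane : Type := EuclideanSpace ℝ (Fin 2)

/-- Canonical basis vector of `ℝ²`. -/
def e (i : Fin 2) : Plane := EuclideanSpace.single i 1

section Calculus

variable {F : Type*} [NormedAddCommGroup F] [NormedSpace ℝ F]

/-- The iterated partial derivative `∂_{v 0} ⋯ ∂_{v (k-1)} f`. -/
def partialD {k : ℕ} (v : Fin k → Fin 2) (f : Plane → F) (x : Plane) : F :=
  iteratedFDeriv ℝ k f x (fun j => e (v j))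

/-- The pointwise Euclidean length of the tensor `∇ᵏ f`, that is
`|∇ᵏ f|² = ∑ |∂_{i₁} ⋯ ∂_{i_k} f|²`, the sum running over all `(i₁, …, i_k)`. -/
def gradLen (k : ℕ) (f : Plane → F) (x : Plane) : ℝ :=
  Real.sqrt (∑ v : Fin k → Fin 2, ‖partialD v f x‖ ^ 2)

/-- The Laplacian on `ℝ²`. -/
def lap (f : Plane → F) (x : Plane) : F := ∑ i, partialD (fun _ : Fin 2 => i) f x

/-- The time derivative of a function given for times in `[0, ∞)` (one-sided at `t = 0`). -/
def tderiv (f : ℝ → Plane → F) (t : ℝ) (x : Plane) : F :=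
  derivWithin (fun s => f s x) (Ici 0) t

/-- The function `f` is smooth in time on `[0, ∞)` with values in every Sobolev space `H^k(ℝ²)`:
each spatial derivative `∂^v f` is a smooth map from `[0, ∞)` to `L²(ℝ²)`. -/
def SmoothInSobolev (f : ℝ → Plane → F) : Prop :=
  ∀ (k : ℕ) (v : Fin k → Fin 2), ∃ g : ℝ → Lp F 2 (volume : Measure Plane),
    ContDiffOn ℝ ∞ g (Ici 0) ∧ ∀ t, 0 ≤ t → g t =ᵐ[volume] partialD v (f t)

end Calculus

/-- The divergence of a vector field on `ℝ²`. -/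
def div (f : Plane → Plane) (x : Plane) : ℝ := ∑ i, fderiv ℝ f x (e i) i

/-- The `L^p(ℝ²)` norm, as a real number. -/
def LpN {F : Type*} [NormedAddCommGroup F] (p : ℝ≥0∞) (f : Plane → F) : ℝ :=
  (eLpNorm f p volume).toReal

/-- `⟨t⟩_T = e + t / T`. -/
def brk (T t : ℝ) : ℝ := Real.exp 1 + t / T

/-- `(ρ, u, ∇P)` is a smooth global solution (on the time interval `[0, ∞)`) of the
two-dimensional inhomogeneous incompressible Navier–Stokes system; `ρ - 1`, `u` and `∇P` are
smooth in time with values in all Sobolev spaces. -/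
structure IsSmoothSolution (ρ : ℝ → Plane → ℝ) (u : ℝ → Plane → Plane) (P : ℝ → Plane → ℝ) :
    Prop where
  smooth_rho : ContDiffOn ℝ ∞ (fun q : ℝ × Plane => ρ q.1 q.2) (Ici 0 ×ˢ univ)
  smooth_u : ContDiffOn ℝ ∞ (fun q : ℝ × Plane => u q.1 q.2) (Ici 0 ×ˢ univ)
  smooth_P : ContDiffOn ℝ ∞ (fun q : ℝ × Plane => P q.1 q.2) (Ici 0 ×ˢ univ)
  sobolev_rho : SmoothInSobolev (fun t x => ρ t x - 1)
  sobolev_u : SmoothInSobolev u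
  sobolev_gradP : SmoothInSobolev (fun t x => gradient (P t) x)
  rho_pos : ∀ t, 0 ≤ t → ∀ x, 0 < ρ t x
  mass : ∀ t, 0 ≤ t → ∀ x, tderiv ρ t x + fderiv ℝ (ρ t) x (u t x) = 0
  momentum : ∀ t, 0 ≤ t → ∀ x,
    ρ t x • tderiv u t x + ρ t x • fderiv ℝ (u t) x (u t x)
      - lap (u t) x + gradient (P t) x = 0
  incomp : ∀ t, 0 ≤ t → ∀ x, div (u t) x = 0

/-- `E₀ = ∫ ρ₀ |u₀|²`. -/
def E0 (ρ : ℝ → Plane → ℝ) (u : ℝ → Plane → Plane) : ℝ := ∫ x, ρ 0 x * ‖u 0 x‖ ^ 2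

/-- `E₁ = ‖∇u₀‖²_{L²}`. -/
def E1 (u : ℝ → Plane → Plane) : ℝ := LpN 2 (gradLen 1 (u 0)) ^ 2

/-- `E₂ = ‖√ρ₀ ∂ₜu|_{t=0}‖²_{L²} + ‖∇u₀‖⁴_{L²}`. -/
def E2 (ρ : ℝ → Plane → ℝ) (u : ℝ → Plane → Plane) : ℝ :=
  LpN 2 (fun x => Real.sqrt (ρ 0 x) • tderiv u 0 x) ^ 2 + LpN 2 (gradLen 1 (u 0)) ^ 4

/-- `E₃ = ‖∇∂ₜu|_{t=0}‖²_{L²} + E₂^{3/2} + E₂ ‖∇ρ₀‖²_{L^∞}`. -/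
def E3 (ρ : ℝ → Plane → ℝ) (u : ℝ → Plane → Plane) : ℝ :=
  LpN 2 (gradLen 1 (tderiv u 0)) ^ 2 + E2 ρ u ^ ((3 : ℝ) / 2)
    + E2 ρ u * LpN ⊤ (gradLen 1 (ρ 0)) ^ 2

/-- `U₀ = ∫ |x| |u₀(x)| dx`. -/
def U0 (u : ℝ → Plane → Plane) : ℝ := ∫ x, ‖x‖ * ‖u 0 x‖

/-- `T₀ = max {U₀ / E₀, ‖ρ₀ - 1‖²_{L²}}`. -/
def T0 (ρ : ℝ → Plane → ℝ) (u : ℝ → Plane → Plane) : ℝ :=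
  max (U0 u / E0 ρ u) (LpN 2 (fun x => ρ 0 x - 1) ^ 2)

/-- `T₁ = max {T₀, E₀ / E₁}`. -/
def T1 (ρ : ℝ → Plane → ℝ) (u : ℝ → Plane → Plane) : ℝ := max (T0 ρ u) (E0 ρ u / E1 u)

/-- `T₂ = max {T₁, E₂ / E₁}`. -/
def T2 (ρ : ℝ → Plane → ℝ) (u : ℝ → Plane → Plane) : ℝ := max (T1 ρ u) (E2 ρ u / E1 u)

/-- `T₃ = max {T₂, E₂ / E₃}`. -/
def T3 (ρ : ℝ → Plane → ℝ) (u : ℝ → Plane → Plane) : ℝ := max (T2 ρ u) (E2 ρ u / E3 ρ u)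

/-- The assumptions on the initial data: `U₀ < ∞`, `∫ ρ₀ u₀ = 0` and `3/4 ≤ ρ₀ ≤ 5/4`. -/
structure AdmissibleData (ρ : ℝ → Plane → ℝ) (u : ℝ → Plane → Plane) : Prop where
  moment : Integrable (fun x => ‖x‖ * ‖u 0 x‖) volume
  momentum_zero : ∫ x, ρ 0 x • u 0 x = 0
  bounds : ∀ x, 3 / 4 ≤ ρ 0 x ∧ ρ 0 x ≤ 5 / 4

end INS2D

end

noncomputable section

open MeasureTheory Set Filter Topology
open scoped ENNReal ContDiff NNReal

namespace INS2D

/-! ### Space-time functions and their partial derivatives -/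

/-- The closed space-time half space `[0, ∞) × ℝ²`. -/
def slab : Set (ℝ × Plane) := Ici 0 ×ˢ univ

lemma mem_slab {t : ℝ} (ht : 0 ≤ t) (x : Plane) : (t, x) ∈ slab := ⟨ht, mem_univ _⟩

lemma uniqueDiffOn_slab : UniqueDiffOn ℝ slab := (uniqueDiffOn_Ici 0).prod uniqueDiffOn_univ

lemma slab_subset_closure_interior : slab ⊆ closure (interior slab) := by
  rw [slab, interior_prod_eq, interior_Ici, interior_univ, closure_prod_eq, closure_Ioi,
    closure_univ]

/-- Space-time partial derivatives: `none` is the time direction, `some i` the `i`-th direction of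
the plane. For negative times the value at `t = 0` is used. -/
def pd : Option (Fin 2) → (ℝ → Plane → ℝ) → ℝ → Plane → ℝ
  | none, F => fun t x => derivWithin (fun s => F s x) (Ici 0) (max t 0)
  | some i, F => fun t x => fderiv ℝ (F t) x (e i)

/-- The direction of differentiation of `pd`. -/
def dir : Option (Fin 2) → ℝ × Plane
  | none => (1, 0)
  | some i => (0, e i)

/-- Jointly smooth functions on `[0, ∞) × ℝ²`, extended to negative times as constants. -/
structure JS (F : ℝ → Plane → ℝ) : Prop where
  ext : ∀ t, F t = F (max t 0)
  smooth : ContDiffOn ℝ ∞ (fun q : ℝ × Plane => F q.1 q.2) slab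

lemma JS.differentiableWithinAt {F : ℝ → Plane → ℝ} (hF : JS F) {q : ℝ × Plane} (hq : q ∈ slab) :
    DifferentiableWithinAt ℝ (fun q : ℝ × Plane => F q.1 q.2) slab q :=
  (hF.smooth q hq).differentiableWithinAt (by simp)

lemma JS.contDiff {F : ℝ → Plane → ℝ} (hF : JS F) (t : ℝ) : ContDiff ℝ ∞ (F t) := by
  rw [hF.ext t, ← contDiffOn_univ]
  exact hF.smooth.comp (f := fun x : Plane => (max t 0, x)) (by fun_prop)
    (fun x _ => mem_slab (le_max_right _ _) x)

lemma JS.hasDerivWithinAt_time {F : ℝ → Plane → ℝ} (hF : JS F) {t : ℝ} (ht : 0 ≤ t) (x : Plane) :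
    HasDerivWithinAt (fun s => F s x)
      (fderivWithin ℝ (fun q : ℝ × Plane => F q.1 q.2) slab (t, x) (1, 0)) (Ici 0) t := by
  have h1 := (hF.differentiableWithinAt (mem_slab ht x)).hasFDerivWithinAt
  have h2 : HasDerivWithinAt (fun s : ℝ => (s, x)) ((1 : ℝ), (0 : Plane)) (Ici 0) t :=
    (hasDerivWithinAt_id t _).prodMk (hasDerivWithinAt_const t _ x)
  exact h1.comp_hasDerivWithinAt t h2 (fun s hs => mem_slab hs x)

lemma JS.pd_eq {F : ℝ → Plane → ℝ} (hF : JS F) (a : Option (Fin 2)) {t : ℝ} (ht : 0 ≤ t)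
    (x : Plane) :
    pd a F t x = fderivWithin ℝ (fun q : ℝ × Plane => F q.1 q.2) slab (t, x) (dir a) := by
  have h1 := (hF.differentiableWithinAt (mem_slab ht x)).hasFDerivWithinAt
  cases a with
  | none =>
    simp only [pd, dir, max_eq_left ht]
    exact (hF.hasDerivWithinAt_time ht x).derivWithin (uniqueDiffOn_Ici 0 t ht)
  | some i =>
    simp only [pd, dir]
    have h2 : HasFDerivAt (fun y : Plane => (t, y)) (ContinuousLinearMap.inr ℝ ℝ Plane) x :=
      (hasFDerivAt_const t x).prodMk (hasFDerivAt_id x)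
    have h3 := h1.comp_hasFDerivAt x h2 (Eventually.of_forall fun y => mem_slab ht y)
    have h4 : HasFDerivAt (F t) _ x := h3
    rw [h4.fderiv]
    simp

lemma pd_ext {F : ℝ → Plane → ℝ} (hF : ∀ t, F t = F (max t 0)) (a : Option (Fin 2)) (t : ℝ) :
    pd a F t = pd a F (max t 0) := by
  cases a with
  | none => funext x; simp [pd]
  | some i => funext x; simp only [pd]; rw [hF t]

lemma JS.hasDerivWithinAt {F : ℝ → Plane → ℝ} (hF : JS F) {t : ℝ} (ht : 0 ≤ t) (x : Plane) :
    HasDerivWithinAt (fun s => F s x) (pd none F t x) (Ici 0) t := by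
  rw [hF.pd_eq none ht x]
  exact hF.hasDerivWithinAt_time ht x

lemma JS.pd {F : ℝ → Plane → ℝ} (hF : JS F) (a : Option (Fin 2)) : JS (pd a F) := by
  refine ⟨pd_ext hF.ext a, ?_⟩
  have h : ContDiffOn ℝ ∞ (fun q => fderivWithin ℝ (fun q : ℝ × Plane => F q.1 q.2) slab q (dir a))
      slab :=
    (hF.smooth.fderivWithin uniqueDiffOn_slab (m := ∞) (by simp)).clm_apply contDiffOn_const
  exact h.congr fun q hq => hF.pd_eq a hq.1 q.2

lemma JS.ext_of_nonneg {F G : ℝ → Plane → ℝ} (hF : ∀ t, F t = F (max t 0))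
    (hG : ∀ t, G t = G (max t 0)) (h : ∀ t, 0 ≤ t → ∀ x, F t x = G t x) : F = G := by
  funext t x
  rw [hF, hG]
  exact h _ (le_max_right _ _) x

lemma pd_comm {F : ℝ → Plane → ℝ} (hF : JS F) (a b : Option (Fin 2)) :
    pd a (pd b F) = pd b (pd a F) := by
  refine JS.ext_of_nonneg ((hF.pd b).pd a).ext ((hF.pd a).pd b).ext fun t ht x => ?_
  have hs := mem_slab ht x
  have hsym : IsSymmSndFDerivWithinAt ℝ (fun q : ℝ × Plane => F q.1 q.2) slab (t, x) :=
    (hF.smooth (t, x) hs).isSymmSndFDerivWithinAt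
      (by rw [minSmoothness_of_isRCLikeNormedField]; exact WithTop.coe_le_coe.2 (le_top : (2 : ℕ∞) ≤ ⊤)) uniqueDiffOn_slab
      (slab_subset_closure_interior hs) hs
  have key : ∀ a b, INS2D.pd a (INS2D.pd b F) t x =
      fderivWithin ℝ (fderivWithin ℝ (fun q : ℝ × Plane => F q.1 q.2) slab) slab (t, x)
        (dir a) (dir b) := by
    intro a b
    rw [(hF.pd b).pd_eq a ht x]
    have h1 : fderivWithin ℝ (fun q : ℝ × Plane => INS2D.pd b F q.1 q.2) slab (t, x) =
        fderivWithin ℝ (fun q => fderivWithin ℝ (fun q : ℝ × Plane => F q.1 q.2) slab q (dir b))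
          slab (t, x) :=
      fderivWithin_congr (fun q hq => hF.pd_eq b hq.1 q.2) (hF.pd_eq b ht x)
    rw [h1]
    have h2 : DifferentiableWithinAt ℝ (fderivWithin ℝ (fun q : ℝ × Plane => F q.1 q.2) slab) slab
        (t, x) :=
      ((hF.smooth.fderivWithin uniqueDiffOn_slab (m := ∞) (by simp)) _ hs).differentiableWithinAt
        (by simp)
    rw [fderivWithin_clm_apply (uniqueDiffOn_slab _ hs) h2 (differentiableWithinAt_const _)]
    simp
  rw [key, key]
  exact hsym _ _

lemma JS.add {F G : ℝ → Plane → ℝ} (hF : JS F) (hG : JS G) : JS (F + G) :=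
  ⟨fun t => by simp [Pi.add_apply, ← hF.ext, ← hG.ext], hF.smooth.add hG.smooth⟩

lemma JS.mul {F G : ℝ → Plane → ℝ} (hF : JS F) (hG : JS G) : JS (F * G) :=
  ⟨fun t => by simp [Pi.mul_apply, ← hF.ext, ← hG.ext], hF.smooth.mul hG.smooth⟩

lemma JS.const (c : ℝ) : JS (fun _ _ => c) := ⟨fun _ => rfl, contDiffOn_const⟩

lemma pd_add {F G : ℝ → Plane → ℝ} (hF : JS F) (hG : JS G) (a : Option (Fin 2)) :
    pd a (F + G) = pd a F + pd a G := by
  refine JS.ext_of_nonneg ((hF.add hG).pd a).ext ((hF.pd a).add (hG.pd a)).ext fun t ht x => ?_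
  simp only [Pi.add_apply]
  rw [(hF.add hG).pd_eq a ht, hF.pd_eq a ht, hG.pd_eq a ht]
  have hs := mem_slab ht x
  have := fderivWithin_fun_add (uniqueDiffOn_slab _ hs) (hF.differentiableWithinAt hs)
    (hG.differentiableWithinAt hs)
  simp only [Pi.add_apply]
  rw [this]
  rfl

lemma pd_mul {F G : ℝ → Plane → ℝ} (hF : JS F) (hG : JS G) (a : Option (Fin 2)) :
    pd a (F * G) = F * pd a G + pd a F * G := by
  refine JS.ext_of_nonneg ((hF.mul hG).pd a).ext
    ((hF.mul (hG.pd a)).add ((hF.pd a).mul hG)).ext fun t ht x => ?_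
  simp only [Pi.add_apply, Pi.mul_apply]
  rw [(hF.mul hG).pd_eq a ht, hF.pd_eq a ht, hG.pd_eq a ht]
  have hs := mem_slab ht x
  have := fderivWithin_fun_mul (uniqueDiffOn_slab _ hs) (hF.differentiableWithinAt hs)
    (hG.differentiableWithinAt hs)
  simp only [Pi.mul_apply]
  rw [this]
  simp [mul_comm]

lemma pd_const (c : ℝ) (a : Option (Fin 2)) : pd a (fun _ _ => c) = fun _ _ => 0 := by
  cases a with
  | none => funext t x; simp [pd]
  | some i => funext t x; simp [pd]

/-- Iterated space-time partial derivatives. -/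
def pdW (w : List (Option (Fin 2))) (F : ℝ → Plane → ℝ) : ℝ → Plane → ℝ := w.foldr pd F

@[simp] lemma pdW_nil (F : ℝ → Plane → ℝ) : pdW [] F = F := rfl
@[simp] lemma pdW_cons (a) (w) (F : ℝ → Plane → ℝ) : pdW (a :: w) F = pd a (pdW w F) := rfl
lemma pdW_append (w w') (F : ℝ → Plane → ℝ) : pdW (w ++ w') F = pdW w (pdW w' F) := by
  simp [pdW]

lemma JS.pdW {F : ℝ → Plane → ℝ} (hF : JS F) (w) : JS (pdW w F) := by
  induction w with
  | nil => exact hF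
  | cons a w ih => exact ih.pd a

lemma pdW_pd {F : ℝ → Plane → ℝ} (hF : JS F) (a) (w) : pdW w (pd a F) = pd a (pdW w F) := by
  induction w with
  | nil => rfl
  | cons b w ih => rw [pdW_cons, pdW_cons, ih, pd_comm (hF.pdW w)]

lemma pdW_add {F G : ℝ → Plane → ℝ} (hF : JS F) (hG : JS G) (w) :
    pdW w (F + G) = pdW w F + pdW w G := by
  induction w with
  | nil => rfl
  | cons b w ih => rw [pdW_cons, pdW_cons, pdW_cons, ih, pd_add (hF.pdW w) (hG.pdW w)]

/-- `F` is jointly smooth and all its space-time derivatives satisfy `P`. -/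
structure Adm (P : (ℝ → Plane → ℝ) → Prop) (F : ℝ → Plane → ℝ) : Prop where
  js : JS F
  all : ∀ w, P (pdW w F)

lemma Adm.self {P} {F : ℝ → Plane → ℝ} (h : Adm P F) : P F := h.all []

lemma Adm.pd {P} {F : ℝ → Plane → ℝ} (h : Adm P F) (a) : Adm P (pd a F) :=
  ⟨h.js.pd a, fun w => by rw [pdW_pd h.js]; exact h.all (a :: w)⟩

lemma Adm.add {P} (hP : ∀ F G, JS F → JS G → P F → P G → P (F + G)) {F G : ℝ → Plane → ℝ}
    (hF : Adm P F) (hG : Adm P G) : Adm P (F + G) :=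
  ⟨hF.js.add hG.js, fun w => by
    rw [pdW_add hF.js hG.js]
    exact hP _ _ (hF.js.pdW w) (hG.js.pdW w) (hF.all w) (hG.all w)⟩

lemma Adm.mul {P Q R} (hR : ∀ F G, JS F → JS G → R F → R G → R (F + G))
    (h : ∀ F G, JS F → JS G → P F → Q G → R (F * G)) {F G : ℝ → Plane → ℝ}
    (hF : Adm P F) (hG : Adm Q G) : Adm R (F * G) := by
  refine ⟨hF.js.mul hG.js, fun w => ?_⟩
  induction w using List.reverseRecOn generalizing F G with
  | nil => exact h _ _ hF.js hG.js hF.self hG.self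
  | append_singleton w a ih =>
    rw [pdW_append]
    simp only [pdW_cons, pdW_nil]
    rw [pd_mul hF.js hG.js, pdW_add (hF.js.mul (hG.js.pd a)) ((hF.js.pd a).mul hG.js)]
    exact hR _ _ ((hF.js.mul (hG.js.pd a)).pdW w) (((hF.js.pd a).mul hG.js).pdW w)
      (ih hF (hG.pd a)) (ih (hF.pd a) hG)

/-- Boundedness, locally uniform in time. -/
def BB (F : ℝ → Plane → ℝ) : Prop := ∀ S : ℝ, ∃ C : ℝ, ∀ t ∈ Icc 0 S, ∀ x, |F t x| ≤ C

/-- Square integrability in space, locally uniform in time. -/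
def BL2 (F : ℝ → Plane → ℝ) : Prop :=
  ∀ S : ℝ, ∃ C : ℝ, ∀ t ∈ Icc 0 S, Integrable (fun x => F t x ^ 2) ∧ ∫ x, F t x ^ 2 ≤ C

/-- Integrability in space, locally uniform in time. -/
def BL1 (F : ℝ → Plane → ℝ) : Prop :=
  ∀ S : ℝ, ∃ C : ℝ, ∀ t ∈ Icc 0 S, Integrable (F t) ∧ ∫ x, |F t x| ≤ C

lemma BB.add {F G : ℝ → Plane → ℝ} (hF : BB F) (hG : BB G) : BB (F + G) := fun S => by
  obtain ⟨C, hC⟩ := hF S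
  obtain ⟨C', hC'⟩ := hG S
  exact ⟨C + C', fun t ht x => (abs_add_le _ _).trans (add_le_add (hC t ht x) (hC' t ht x))⟩

lemma BB.mul {F G : ℝ → Plane → ℝ} (hF : BB F) (hG : BB G) : BB (F * G) := fun S => by
  obtain ⟨C, hC⟩ := hF S
  obtain ⟨C', hC'⟩ := hG S
  refine ⟨C * C', fun t ht x => ?_⟩
  simp only [Pi.mul_apply, abs_mul]
  exact mul_le_mul (hC t ht x) (hC' t ht x) (abs_nonneg _) ((abs_nonneg _).trans (hC t ht x))

lemma BL1.add {F G : ℝ → Plane → ℝ} (hF : BL1 F) (hG : BL1 G) : BL1 (F + G) := fun S => by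
  obtain ⟨C, hC⟩ := hF S
  obtain ⟨C', hC'⟩ := hG S
  refine ⟨C + C', fun t ht => ⟨(hC t ht).1.add (hC' t ht).1, ?_⟩⟩
  calc ∫ x, |(F + G) t x| ≤ ∫ x, (|F t x| + |G t x|) :=
        integral_mono ((hC t ht).1.add (hC' t ht).1).abs ((hC t ht).1.abs.add (hC' t ht).1.abs)
          fun x => abs_add_le _ _
    _ = _ := integral_add (hC t ht).1.abs (hC' t ht).1.abs
    _ ≤ _ := add_le_add (hC t ht).2 (hC' t ht).2

lemma BL2.add {F G : ℝ → Plane → ℝ} (jF : JS F) (jG : JS G) (hF : BL2 F) (hG : BL2 G) :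
    BL2 (F + G) := fun S => by
  obtain ⟨C, hC⟩ := hF S
  obtain ⟨C', hC'⟩ := hG S
  have hb : ∀ t x, (F + G) t x ^ 2 ≤ 2 * F t x ^ 2 + 2 * G t x ^ 2 := fun t x => by
    simp only [Pi.add_apply]; nlinarith [sq_nonneg (F t x - G t x)]
  refine ⟨2 * C + 2 * C', fun t ht => ?_⟩
  have hi : Integrable (fun x => 2 * F t x ^ 2 + 2 * G t x ^ 2) :=
    ((hC t ht).1.const_mul 2).add ((hC' t ht).1.const_mul 2)
  have hi' : Integrable (fun x => (F + G) t x ^ 2) := by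
    refine hi.mono' ?_ (Eventually.of_forall fun x => ?_)
    · exact ((((jF.add jG).contDiff t).continuous).pow 2).aestronglyMeasurable
    · rw [Real.norm_eq_abs, abs_of_nonneg (sq_nonneg _)]; exact hb t x
  refine ⟨hi', (integral_mono hi' hi (hb t)).trans ?_⟩
  rw [integral_add ((hC t ht).1.const_mul 2) ((hC' t ht).1.const_mul 2), integral_const_mul,
    integral_const_mul]
  linarith [(hC t ht).2, (hC' t ht).2]

lemma BL2.mul_BB {F G : ℝ → Plane → ℝ} (jF : JS F) (jG : JS G) (hF : BL2 F) (hG : BB G) :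
    BL2 (F * G) := fun S => by
  obtain ⟨C, hC⟩ := hF S
  obtain ⟨C', hC'⟩ := hG S
  refine ⟨C' ^ 2 * C, fun t ht => ?_⟩
  have hb : ∀ x, (F * G) t x ^ 2 ≤ C' ^ 2 * F t x ^ 2 := fun x => by
    simp only [Pi.mul_apply, mul_pow]
    rw [mul_comm]
    exact mul_le_mul_of_nonneg_right (sq_le_sq' (abs_le.1 (hC' t ht x)).1 (abs_le.1 (hC' t ht x)).2)
      (sq_nonneg _)
  have hi : Integrable (fun x => C' ^ 2 * F t x ^ 2) := (hC t ht).1.const_mul _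
  have hi' : Integrable (fun x => (F * G) t x ^ 2) := by
    refine hi.mono' ?_ (Eventually.of_forall fun x => ?_)
    · exact ((((jF.mul jG).contDiff t).continuous).pow 2).aestronglyMeasurable
    · rw [Real.norm_eq_abs, abs_of_nonneg (sq_nonneg _)]; exact hb x
  refine ⟨hi', (integral_mono hi' hi hb).trans ?_⟩
  rw [integral_const_mul]
  exact mul_le_mul_of_nonneg_left (hC t ht).2 (sq_nonneg _)

lemma BL2.mul {F G : ℝ → Plane → ℝ} (jF : JS F) (jG : JS G) (hF : BL2 F) (hG : BL2 G) :
    BL1 (F * G) := fun S => by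
  obtain ⟨C, hC⟩ := hF S
  obtain ⟨C', hC'⟩ := hG S
  refine ⟨C + C', fun t ht => ?_⟩
  have hb : ∀ x, |(F * G) t x| ≤ F t x ^ 2 + G t x ^ 2 := fun x => by
    simp only [Pi.mul_apply]
    rw [abs_le]
    constructor <;> nlinarith [sq_nonneg (F t x + G t x), sq_nonneg (F t x - G t x),
      sq_nonneg (F t x), sq_nonneg (G t x)]
  have hi := (hC t ht).1.add (hC' t ht).1
  have hi' : Integrable ((F * G) t) :=
    hi.mono' (((jF.mul jG).contDiff t).continuous).aestronglyMeasurable (Eventually.of_forall hb)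
  refine ⟨hi', (integral_mono hi'.abs hi hb).trans ?_⟩
  simp only [Pi.add_apply]
  rw [integral_add (hC t ht).1 (hC' t ht).1]
  exact add_le_add (hC t ht).2 (hC' t ht).2

lemma BL1.mul_BB {F G : ℝ → Plane → ℝ} (jF : JS F) (jG : JS G) (hF : BL1 F) (hG : BB G) :
    BL1 (F * G) := fun S => by
  obtain ⟨C, hC⟩ := hF S
  obtain ⟨C', hC'⟩ := hG S
  refine ⟨C * max C' 0, fun t ht => ?_⟩
  have hb : ∀ x, |(F * G) t x| ≤ |F t x| * max C' 0 := fun x => by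
    simp only [Pi.mul_apply, abs_mul]
    exact mul_le_mul_of_nonneg_left ((hC' t ht x).trans (le_max_left _ _)) (abs_nonneg _)
  have hi := (hC t ht).1.abs.mul_const (max C' 0)
  have hi' : Integrable ((F * G) t) :=
    hi.mono' (((jF.mul jG).contDiff t).continuous).aestronglyMeasurable (Eventually.of_forall hb)
  refine ⟨hi', (integral_mono hi'.abs hi hb).trans ?_⟩
  rw [integral_mul_const]
  exact mul_le_mul_of_nonneg_right (hC t ht).2 (le_max_right _ _)

/-! ### The Sobolev embedding `H² ⊆ L^∞` -/

lemma sq_le_intervalIntegral {g g' : ℝ → ℝ} (hg : ∀ s, HasDerivAt g (g' s) s)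
    (hg' : Continuous g') : g 0 ^ 2 ≤ 2 * ∫ s in (0 : ℝ)..1, (g s ^ 2 + g' s ^ 2) := by
  have hc : Continuous g := continuous_iff_continuousAt.2 fun s => (hg s).continuousAt
  have hI : ∀ a b : ℝ, IntervalIntegrable (fun s => g s ^ 2 + g' s ^ 2) volume a b := fun a b =>
    (by fun_prop : Continuous fun s => g s ^ 2 + g' s ^ 2).intervalIntegrable a b
  have key : ∀ s ∈ Icc (0 : ℝ) 1,
      g 0 ^ 2 ≤ g s ^ 2 + ∫ r in (0 : ℝ)..1, (g r ^ 2 + g' r ^ 2) := by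
    intro s hs
    have h1 : ∫ r in (0 : ℝ)..s, 2 * (g r * g' r) = g s ^ 2 - g 0 ^ 2 := by
      refine intervalIntegral.integral_eq_sub_of_hasDerivAt (f := fun r => g r ^ 2)
        (fun r _ => ?_) ((by fun_prop : Continuous fun r => 2 * (g r * g' r)).intervalIntegrable _ _)
      convert! (hg r).pow 2 using 1
      ring
    have h2 : ∫ r in (0 : ℝ)..s, (-(2 * (g r * g' r))) ≤ ∫ r in (0 : ℝ)..s, (g r ^ 2 + g' r ^ 2) :=
      intervalIntegral.integral_mono_on hs.1
        ((by fun_prop : Continuous fun r => -(2 * (g r * g' r))).intervalIntegrable _ _) (hI _ _)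
        fun r _ => by nlinarith [sq_nonneg (g r + g' r)]
    have h3 : ∫ r in (0 : ℝ)..s, (g r ^ 2 + g' r ^ 2) ≤ ∫ r in (0 : ℝ)..1, (g r ^ 2 + g' r ^ 2) :=
      intervalIntegral.integral_mono_interval le_rfl hs.1 hs.2
        (Eventually.of_forall fun r => by positivity) (hI _ _)
    rw [intervalIntegral.integral_neg, h1] at h2
    linarith
  have h4 : ∫ _ in (0 : ℝ)..1, g 0 ^ 2 ≤
      ∫ s in (0 : ℝ)..1, (g s ^ 2 + ∫ r in (0 : ℝ)..1, (g r ^ 2 + g' r ^ 2)) :=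
    intervalIntegral.integral_mono_on zero_le_one (by simp)
      ((by fun_prop : Continuous fun s => g s ^ 2 + _).intervalIntegrable _ _) key
  rw [intervalIntegral.integral_add ((by fun_prop : Continuous fun s => g s ^ 2).intervalIntegrable
    _ _) (by simp)] at h4
  have h5 : ∫ s in (0 : ℝ)..1, g s ^ 2 ≤ ∫ r in (0 : ℝ)..1, (g r ^ 2 + g' r ^ 2) :=
    intervalIntegral.integral_mono_on zero_le_one
      ((by fun_prop : Continuous fun s => g s ^ 2).intervalIntegrable _ _) (hI _ _)
      fun r _ => by nlinarith [sq_nonneg (g' r)]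
  simp at h4
  linarith

/-- Cartesian coordinates on the plane. -/
def cart : ℝ × ℝ ≃ᵐ Plane :=
  (MeasurableEquiv.finTwoArrow (α := ℝ)).symm.trans (MeasurableEquiv.toLp 2 (Fin 2 → ℝ))

lemma cart_apply (q : ℝ × ℝ) : cart q = q.1 • e 0 + q.2 • e 1 := by
  ext i
  fin_cases i <;> simp [cart, e, MeasurableEquiv.finTwoArrow, MeasurableEquiv.piFinTwo]

lemma measurePreserving_cart : MeasurePreserving cart (volume : Measure (ℝ × ℝ)) volume :=
  (EuclideanSpace.volume_preserving_symm_measurableEquiv_toLp (Fin 2)).symm.comp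
    (volume_preserving_finTwoArrow ℝ).symm

lemma hasDerivAt_line {f : Plane → ℝ} (hf : Differentiable ℝ f) (x : Plane) (i : Fin 2) (s : ℝ) :
    HasDerivAt (fun s => f (x + s • e i)) (fderiv ℝ f (x + s • e i) (e i)) s := by
  have h1 : HasDerivAt (fun s : ℝ => x + s • e i) (e i) s := by
    simpa using ((hasDerivAt_id s).smul_const (e i)).const_add x
  exact (hf _).hasFDerivAt.comp_hasDerivAt s h1

lemma sq_le_integral_derivs {f : Plane → ℝ} (hf : ContDiff ℝ 2 f)
    (h : Integrable fun y => f y ^ 2 + fderiv ℝ f y (e 1) ^ 2 + (fderiv ℝ f y (e 0) ^ 2 +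
      fderiv ℝ (fun z => fderiv ℝ f z (e 0)) y (e 1) ^ 2)) (x : Plane) :
    f x ^ 2 ≤ 4 * ∫ y, (f y ^ 2 + fderiv ℝ f y (e 1) ^ 2 + (fderiv ℝ f y (e 0) ^ 2 +
      fderiv ℝ (fun z => fderiv ℝ f z (e 0)) y (e 1) ^ 2)) := by
  set H : Plane → ℝ := fun y => f y ^ 2 + fderiv ℝ f y (e 1) ^ 2 + (fderiv ℝ f y (e 0) ^ 2 +
      fderiv ℝ (fun z => fderiv ℝ f z (e 0)) y (e 1) ^ 2) with hH
  have hf0 : ContDiff ℝ 1 (fun z => fderiv ℝ f z (e 0)) :=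
    (hf.fderiv_right (m := 1) (by norm_num)).clm_apply contDiff_const
  have hf1 : ContDiff ℝ 1 (fun z => fderiv ℝ f z (e 1)) :=
    (hf.fderiv_right (m := 1) (by norm_num)).clm_apply contDiff_const
  have hf01 : Continuous (fun y => fderiv ℝ (fun z => fderiv ℝ f z (e 0)) y (e 1)) :=
    ((hf0.fderiv_right (m := 0) (by norm_num)).clm_apply contDiff_const).continuous
  have hd : Differentiable ℝ f := hf.differentiable (by norm_num)
  have hd0 : Differentiable ℝ (fun z => fderiv ℝ f z (e 0)) := hf0.differentiable (by norm_num)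
  have c := hf.continuous
  have c0 := hf0.continuous
  have c1 := hf1.continuous
  have cH : Continuous H := by simp only [hH]; fun_prop
  have hHn : ∀ y, 0 ≤ H y := fun y => by simp only [hH]; positivity
  have s1 : f x ^ 2 ≤ 2 * ∫ a in (0 : ℝ)..1, (f (x + a • e 0) ^ 2 +
      fderiv ℝ f (x + a • e 0) (e 0) ^ 2) := by
    have := sq_le_intervalIntegral (hasDerivAt_line hd x 0) (by fun_prop)
    simpa using this
  have s2 : ∀ a : ℝ, f (x + a • e 0) ^ 2 + fderiv ℝ f (x + a • e 0) (e 0) ^ 2 ≤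
      2 * ∫ b in (0 : ℝ)..1, H (x + a • e 0 + b • e 1) := by
    intro a
    have k1 := sq_le_intervalIntegral (hasDerivAt_line hd (x + a • e 0) 1) (by fun_prop)
    have k2 := sq_le_intervalIntegral (hasDerivAt_line hd0 (x + a • e 0) 1) (by fun_prop)
    simp only [zero_smul, add_zero] at k1 k2
    have : ∫ b in (0 : ℝ)..1, H (x + a • e 0 + b • e 1) = _ :=
      intervalIntegral.integral_add
        ((by fun_prop : Continuous fun b : ℝ => f (x + a • e 0 + b • e 1) ^ 2 +
          fderiv ℝ f (x + a • e 0 + b • e 1) (e 1) ^ 2).intervalIntegrable 0 1)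
        ((by fun_prop : Continuous fun b : ℝ => fderiv ℝ f (x + a • e 0 + b • e 1) (e 0) ^ 2 +
      fderiv ℝ (fun z => fderiv ℝ f z (e 0)) (x + a • e 0 + b • e 1) (e 1) ^ 2).intervalIntegrable
        0 1)
    rw [this]
    linarith
  have cI : Continuous fun a : ℝ => ∫ b in (0 : ℝ)..1, H (x + a • e 0 + b • e 1) :=
    intervalIntegral.continuous_parametric_intervalIntegral_of_continuous' (by fun_prop) 0 1
  have s3 : f x ^ 2 ≤ 4 * ∫ a in (0 : ℝ)..1, ∫ b in (0 : ℝ)..1, H (x + a • e 0 + b • e 1) := by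
    have := intervalIntegral.integral_mono_on (μ := volume) zero_le_one
      ((by fun_prop : Continuous fun a : ℝ => f (x + a • e 0) ^ 2 +
        fderiv ℝ f (x + a • e 0) (e 0) ^ 2).intervalIntegrable 0 1)
      ((continuous_const.mul cI).intervalIntegrable 0 1) (fun a _ => s2 a)
    simp only [Pi.mul_apply] at this
    rw [intervalIntegral.integral_const_mul] at this
    linarith
  have hHi : Integrable (fun q : ℝ × ℝ => H (x + cart q)) := by
    have h1 : Integrable (fun y => H (x + y)) := h.comp_add_left x
    exact (measurePreserving_cart.integrable_comp_emb cart.measurableEmbedding).2 h1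
  have s4 : ∫ a in (0 : ℝ)..1, ∫ b in (0 : ℝ)..1, H (x + a • e 0 + b • e 1) ≤ ∫ y, H y := by
    calc ∫ a in (0 : ℝ)..1, ∫ b in (0 : ℝ)..1, H (x + a • e 0 + b • e 1)
        = ∫ a in Ioc (0 : ℝ) 1, ∫ b in Ioc (0 : ℝ) 1, H (x + cart (a, b)) := by
          rw [intervalIntegral.integral_of_le zero_le_one]
          refine integral_congr_ae (Eventually.of_forall fun a => ?_)
          simp only [cart_apply, intervalIntegral.integral_of_le zero_le_one, add_assoc]
      _ = ∫ q in Ioc (0 : ℝ) 1 ×ˢ Ioc (0 : ℝ) 1, H (x + cart q) := by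
          rw [Measure.volume_eq_prod]
          exact (setIntegral_prod _ (hHi.integrableOn)).symm
      _ ≤ ∫ q, H (x + cart q) := setIntegral_le_integral hHi (Eventually.of_forall fun q => hHn _)
      _ = ∫ y, H (x + y) :=
          measurePreserving_cart.integral_comp cart.measurableEmbedding (fun y => H (x + y))
      _ = ∫ y, H y := integral_add_left_eq_self H x
  linarith

lemma Adm.bb_of_bl2 {F : ℝ → Plane → ℝ} (h : Adm BL2 F) : BB F := fun S => by
  obtain ⟨C, hC⟩ := h.all [] S
  obtain ⟨C0, hC0⟩ := h.all [some 0] S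
  obtain ⟨C1, hC1⟩ := h.all [some 1] S
  obtain ⟨C01, hC01⟩ := h.all [some 1, some 0] S
  refine ⟨Real.sqrt (4 * (C + C1 + (C0 + C01))), fun t ht x => ?_⟩
  rw [← Real.sqrt_sq_eq_abs]
  refine Real.sqrt_le_sqrt ?_
  have i := hC t ht
  have i0 := hC0 t ht
  have i1 := hC1 t ht
  have i01 := hC01 t ht
  simp only [pdW_cons, pdW_nil, INS2D.pd] at i i0 i1 i01
  refine (sq_le_integral_derivs ((h.js.contDiff t).of_le (WithTop.coe_le_coe.2 (le_top : (2 : ℕ∞) ≤ ⊤)))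
    ((i.1.add i1.1).add (i0.1.add i01.1)) x).trans ?_
  have e1 := integral_add i.1 i1.1
  have e2 := integral_add i0.1 i01.1
  have e3 := integral_add (i.1.add i1.1) (i0.1.add i01.1)
  simp only [Pi.add_apply] at e3
  rw [e3, e1, e2]
  linarith [i.2, i0.2, i1.2, i01.2]

lemma Adm.bb {F : ℝ → Plane → ℝ} (h : Adm BL2 F) : Adm BB F := by
  refine ⟨h.js, fun w => ?_⟩
  have : Adm BL2 (pdW w F) := by
    induction w with
    | nil => exact h
    | cons a w ih => exact ih.pd a
  exact this.bb_of_bl2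

/-! ### The ring of fields -/

/-- The algebra of jointly smooth functions on `[0, ∞) × ℝ²` all of whose derivatives are bounded,
locally uniformly in time. -/
def fldAlg : Subalgebra ℝ (ℝ → Plane → ℝ) where
  carrier := {F | Adm BB F}
  mul_mem' hF hG := hF.mul (fun _ _ _ _ => BB.add) (fun _ _ _ _ => BB.mul) hG
  add_mem' hF hG := hF.add (fun _ _ _ _ => BB.add) hG
  algebraMap_mem' c := by
    refine ⟨JS.const c, fun w => ?_⟩
    have : ∃ c', pdW w (algebraMap ℝ (ℝ → Plane → ℝ) c) = fun _ _ => c' := by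
      induction w with
      | nil => exact ⟨c, rfl⟩
      | cons a w ih => obtain ⟨c', h⟩ := ih; exact ⟨0, by rw [pdW_cons, h, pd_const]⟩
    obtain ⟨c', h⟩ := this
    rw [h]
    exact fun S => ⟨|c'|, fun _ _ _ => le_rfl⟩

/-- Fields: elements of `fldAlg`. -/
@[ext] structure Fld where
  /-- The underlying function. -/
  val : ℝ → Plane → ℝ
  adm : Adm BB val

/-- Fields as elements of the algebra `fldAlg`. -/
def Fld.equiv : Fld ≃ fldAlg := ⟨fun f => ⟨f.1, f.2⟩, fun f => ⟨f.1, f.2⟩, fun _ => rfl, fun _ => rfl⟩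

instance : CommRing Fld := Fld.equiv.commRing
instance : Algebra ℝ Fld := Fld.equiv.algebra ℝ

namespace Fld

lemma js (f : Fld) : JS f.1 := f.2.js

lemma contDiff (f : Fld) (t : ℝ) : ContDiff ℝ ∞ (f.1 t) := f.js.contDiff t

lemma continuous (f : Fld) (t : ℝ) : Continuous (f.1 t) := (f.js.contDiff t).continuous

@[simp] lemma add_val (f g : Fld) (t : ℝ) (x : Plane) : (f + g).1 t x = f.1 t x + g.1 t x := rfl
@[simp] lemma mul_val (f g : Fld) (t : ℝ) (x : Plane) : (f * g).1 t x = f.1 t x * g.1 t x := rfl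
@[simp] lemma sub_val (f g : Fld) (t : ℝ) (x : Plane) : (f - g).1 t x = f.1 t x - g.1 t x := rfl
@[simp] lemma neg_val (f : Fld) (t : ℝ) (x : Plane) : (-f).1 t x = -f.1 t x := rfl
@[simp] lemma smul_val (c : ℝ) (f : Fld) (t : ℝ) (x : Plane) : (c • f).1 t x = c * f.1 t x := rfl
@[simp] lemma one_val (t : ℝ) (x : Plane) : (1 : Fld).1 t x = 1 := rfl
@[simp] lemma zero_val (t : ℝ) (x : Plane) : (0 : Fld).1 t x = 0 := rfl
@[simp] lemma pow_val (f : Fld) (n : ℕ) (t : ℝ) (x : Plane) : (f ^ n).1 t x = f.1 t x ^ n := rfl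

/-- Space-time derivations of the ring of fields. -/
def D (a : Option (Fin 2)) : Derivation ℝ Fld Fld :=
  Derivation.mk' (R := ℝ)
    { toFun := fun f => ⟨pd a f.1, f.2.pd a⟩
      map_add' := fun f g => Fld.ext (pd_add f.js g.js a)
      map_smul' := fun c f => Fld.ext (by
        change pd a ((fun _ _ => c) * f.1) = (fun _ _ => c) * pd a f.1
        rw [pd_mul (JS.const c) f.js, pd_const]
        funext t x
        simp) }
    (fun f g => Fld.ext (by
      change pd a (f.1 * g.1) = f.1 * pd a g.1 + g.1 * pd a f.1
      rw [pd_mul f.js g.js, mul_comm (pd a f.1)]))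

/-- The time derivative of a field. -/
abbrev Dt : Derivation ℝ Fld Fld := D none

/-- The space derivatives of a field. -/
abbrev Dx (i : Fin 2) : Derivation ℝ Fld Fld := D (some i)

lemma D_val (a) (f : Fld) : (D a f).1 = pd a f.1 := rfl

lemma Dx_val (i) (f : Fld) (t : ℝ) (x : Plane) : (Dx i f).1 t x = fderiv ℝ (f.1 t) x (e i) := rfl

lemma D_comm (a b) (f : Fld) : D a (D b f) = D b (D a f) := Fld.ext (pd_comm f.js a b)

lemma D_mul (a) (f g : Fld) : D a (f * g) = f * D a g + D a f * g := by
  rw [Derivation.leibniz, smul_eq_mul, smul_eq_mul, mul_comm g]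

lemma ext_nonneg {f g : Fld} (h : ∀ t, 0 ≤ t → ∀ x, f.1 t x = g.1 t x) : f = g :=
  Fld.ext (JS.ext_of_nonneg f.js.ext g.js.ext h)

/-- All derivatives are square integrable in space, locally uniformly in time. -/
class IsL2 (f : Fld) : Prop where
  adm : Adm BL2 f.1

/-- All derivatives are integrable in space, locally uniformly in time. -/
class IsL1 (f : Fld) : Prop where
  adm : Adm BL1 f.1

section inst
variable (f g : Fld)

instance [hf : IsL2 f] [hg : IsL2 g] : IsL2 (f + g) := ⟨hf.adm.add (fun _ _ => BL2.add) hg.adm⟩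
instance [hf : IsL1 f] [hg : IsL1 g] : IsL1 (f + g) :=
  ⟨hf.adm.add (fun _ _ _ _ => BL1.add) hg.adm⟩
instance isL2_mul_left [hf : IsL2 f] : IsL2 (f * g) :=
  ⟨hf.adm.mul (fun _ _ => BL2.add) (fun _ _ => BL2.mul_BB) g.adm⟩
instance isL2_mul_right [hg : IsL2 g] : IsL2 (f * g) := by
  rw [mul_comm]; infer_instance
instance isL1_mul_left [hf : IsL1 f] : IsL1 (f * g) :=
  ⟨hf.adm.mul (fun _ _ _ _ => BL1.add) (fun _ _ => BL1.mul_BB) g.adm⟩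
instance isL1_mul_right [hg : IsL1 g] : IsL1 (f * g) := by
  rw [mul_comm]; infer_instance
instance isL1_mul [hf : IsL2 f] [hg : IsL2 g] : IsL1 (f * g) :=
  ⟨hf.adm.mul (fun _ _ _ _ => BL1.add) (fun _ _ => BL2.mul) hg.adm⟩
instance [hf : IsL2 f] : IsL2 (-f) := by
  rw [← neg_one_mul]; infer_instance
instance [hf : IsL1 f] : IsL1 (-f) := by
  rw [← neg_one_mul]; infer_instance
instance [hf : IsL2 f] [hg : IsL2 g] : IsL2 (f - g) := by
  rw [sub_eq_add_neg]; infer_instance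
instance [hf : IsL1 f] [hg : IsL1 g] : IsL1 (f - g) := by
  rw [sub_eq_add_neg]; infer_instance
instance (c : ℝ) [hf : IsL1 f] : IsL1 (c • f) := by
  rw [Algebra.smul_def]; infer_instance
instance (a) [hf : IsL2 f] : IsL2 (D a f) := ⟨hf.adm.pd a⟩
instance (a) [hf : IsL1 f] : IsL1 (D a f) := ⟨hf.adm.pd a⟩
instance [hf : IsL2 f] : IsL1 (f ^ 2) := by
  rw [pow_two]; infer_instance
lemma isL1_pow [hf : IsL1 f] {n : ℕ} (hn : n ≠ 0) : IsL1 (f ^ n) := by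
  obtain ⟨m, rfl⟩ := Nat.exists_eq_succ_of_ne_zero hn
  rw [pow_succ]; infer_instance
end inst

end Fld

/-! ### Integrals of fields -/

lemma integral_sub_eq_of_deriv {F F' : ℝ → Plane → ℝ} {a b C : ℝ} (hab : a ≤ b)
    (h : ∀ t ∈ Icc a b, ∀ x, HasDerivWithinAt (fun s => F s x) (F' t x) (Icc a b) t)
    (hm : ContinuousOn (fun q : ℝ × Plane => F' q.1 q.2) (Icc a b ×ˢ univ))
    (hC : ∀ t ∈ Icc a b, Integrable (F' t) ∧ ∫ x, |F' t x| ≤ C)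
    (ha : Integrable (F a)) (hb : Integrable (F b)) :
    IntervalIntegrable (fun s => ∫ x, F' s x) volume a b ∧
      (∫ x, F b x) - ∫ x, F a x = ∫ s in a..b, ∫ x, F' s x := by
  rw [← integral_sub hb ha]
  have hx : ∀ x, ContinuousOn (fun s => F' s x) (Icc a b) := fun x =>
    hm.comp (f := fun s : ℝ => (s, x)) (by fun_prop) fun s hs => ⟨hs, mem_univ _⟩
  have h1 : ∀ x, F b x - F a x = ∫ s in a..b, F' s x := fun x => by
    symm
    refine intervalIntegral.integral_eq_sub_of_hasDerivAt_of_le hab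
      (fun t ht => (h t ht x).continuousWithinAt) (fun t ht => ?_)
      ((hx x).intervalIntegrable_of_Icc hab)
    exact (h t (Ioo_subset_Icc_self ht) x).hasDerivAt (Icc_mem_nhds ht.1 ht.2)
  simp_rw [h1, intervalIntegral.integral_of_le hab]
  have hmeas : AEStronglyMeasurable (fun q : ℝ × Plane => F' q.1 q.2)
      ((volume.restrict (Ioc a b)).prod volume) := by
    have h3 : ((volume : Measure ℝ).restrict (Ioc a b)).prod (volume : Measure Plane) =
        (volume : Measure (ℝ × Plane)).restrict (Ioc a b ×ˢ univ) := by
      rw [Measure.volume_eq_prod, ← Measure.prod_restrict, Measure.restrict_univ]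
    rw [h3]
    exact (hm.mono (prod_mono Ioc_subset_Icc_self le_rfl)).aestronglyMeasurable
      (measurableSet_Ioc.prod MeasurableSet.univ)
  have hIb : Integrable (fun q : ℝ × Plane => F' q.1 q.2)
      ((volume.restrict (Ioc a b)).prod volume) := by
    rw [integrable_prod_iff hmeas]
    constructor
    · filter_upwards [ae_restrict_mem measurableSet_Ioc] with s hs
      exact (hC s (Ioc_subset_Icc_self hs)).1
    · refine Integrable.mono' (g := fun _ => C) (integrable_const _)
        hmeas.norm.integral_prod_right' ?_
      filter_upwards [ae_restrict_mem measurableSet_Ioc] with s hs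
      rw [Real.norm_eq_abs, abs_of_nonneg (integral_nonneg fun x => norm_nonneg _)]
      exact (hC s (Ioc_subset_Icc_self hs)).2
  exact ⟨(intervalIntegrable_iff_integrableOn_Ioc_of_le hab).2 hIb.integral_prod_left,
    (integral_integral_swap hIb).symm⟩

namespace Fld

/-- The space integral of a field. -/
def Int (f : Fld) (t : ℝ) : ℝ := ∫ x, f.1 t x

lemma val_max (f : Fld) (t : ℝ) : f.1 t = f.1 (max t 0) := f.js.ext t

lemma Int_max (f : Fld) (t : ℝ) : Int f t = Int f (max t 0) := by rw [Int, val_max, ← Int]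

lemma integrable (f : Fld) [hf : IsL1 f] (t : ℝ) : Integrable (f.1 t) := by
  rw [val_max]
  obtain ⟨C, hC⟩ := hf.adm.self (max t 0)
  exact (hC _ ⟨le_max_right _ _, le_rfl⟩).1

lemma Int_add (f g : Fld) [IsL1 f] [IsL1 g] (t : ℝ) : Int (f + g) t = Int f t + Int g t :=
  integral_add (f.integrable t) (g.integrable t)

lemma Int_sub (f g : Fld) [IsL1 f] [IsL1 g] (t : ℝ) : Int (f - g) t = Int f t - Int g t :=
  integral_sub (f.integrable t) (g.integrable t)

lemma Int_neg (f : Fld) (t : ℝ) : Int (-f) t = -Int f t := integral_neg _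

lemma Int_smul (c : ℝ) (f : Fld) (t : ℝ) : Int (c • f) t = c * Int f t :=
  integral_const_mul c _

lemma Int_zero (t : ℝ) : Int 0 t = 0 := by simp [Int]

lemma Int_mono {f g : Fld} [IsL1 f] [IsL1 g] {t : ℝ} (h : ∀ x, f.1 t x ≤ g.1 t x) :
    Int f t ≤ Int g t := integral_mono (f.integrable t) (g.integrable t) h

lemma Int_nonneg {f : Fld} {t : ℝ} (h : ∀ x, 0 ≤ f.1 t x) : 0 ≤ Int f t := integral_nonneg h

lemma Int_sq_nonneg (f : Fld) (t : ℝ) : 0 ≤ Int (f * f) t :=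
  Int_nonneg fun _ => mul_self_nonneg _

lemma Int_Dx (i : Fin 2) (f : Fld) [hf : IsL1 f] (t : ℝ) : Int (Dx i f) t = 0 := by
  have h := integral_mul_fderiv_eq_neg_fderiv_mul_of_integrable (μ := (volume : Measure Plane))
    (f := fun _ : Plane => (1 : ℝ)) (g := f.1 t) (v := e i) (by simp)
    (by simp only [one_mul]; exact (Dx i f).integrable t) (by simpa using f.integrable t)
    (fun _ _ => by fun_prop)
    (fun x _ => (f.contDiff t).contDiffAt.differentiableAt (by simp))
  have h' : ∫ x, fderiv ℝ (f.1 t) x (e i) = 0 := by simpa using h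
  exact h'

lemma Int_sub_eq (f : Fld) [hf : IsL1 f] {a b : ℝ} (ha : 0 ≤ a) (hab : a ≤ b) :
    Int f b - Int f a = ∫ s in a..b, Int (Dt f) s := by
  obtain ⟨C, hC⟩ := (hf.adm.pd none).self b
  have hsub : Icc a b ⊆ Ici 0 := fun s hs => ha.trans hs.1
  refine (integral_sub_eq_of_deriv (C := C) hab (fun t ht x => ?_) ?_ (fun t ht => ?_)
    (f.integrable a) (f.integrable b)).2
  · exact (f.js.hasDerivWithinAt (hsub ht) x).mono hsub
  · exact (Dt f).js.smooth.continuousOn.mono (prod_mono hsub le_rfl)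
  · exact hC t ⟨hsub ht, ht.2⟩

lemma continuous_Int (f : Fld) [hf : IsL1 f] : Continuous (Int f) := by
  have h1 : ContinuousOn (Int f) (Ici 0) := by
    intro t ht
    obtain ⟨C, hC⟩ := (hf.adm.pd none).self (t + 1)
    have hC' : ∀ s ∈ Icc 0 (t + 1), ‖Int (Dt f) s‖ ≤ C := fun s hs =>
      (norm_integral_le_integral_norm _).trans (hC s hs).2
    have key : ∀ a b, 0 ≤ a → a ≤ b → b ≤ t + 1 → |Int f b - Int f a| ≤ C * |b - a| := by
      intro a b ha hab hb
      rw [Int_sub_eq f ha hab, ← Real.norm_eq_abs]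
      refine intervalIntegral.norm_integral_le_of_norm_le_const fun s hs => ?_
      rw [uIoc_of_le hab] at hs
      exact hC' s ⟨ha.trans hs.1.le, hs.2.trans hb⟩
    have key2 : ∀ s ∈ Icc 0 (t + 1), |Int f s - Int f t| ≤ C * |s - t| := by
      intro s hs
      rcases le_total s t with h | h
      · rw [abs_sub_comm, abs_sub_comm s]; exact key s t hs.1 h (by linarith)
      · exact key t s ht h hs.2
    rw [ContinuousWithinAt, tendsto_iff_dist_tendsto_zero]
    refine squeeze_zero' (g := fun s => C * |s - t|) (Eventually.of_forall fun _ => dist_nonneg)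
      ?_ ?_
    · have : ∀ᶠ s in 𝓝[Ici 0] t, s < t + 1 :=
        nhdsWithin_le_nhds (Iio_mem_nhds (by linarith))
      filter_upwards [this, self_mem_nhdsWithin] with s h1 h2
      exact key2 s ⟨h2, h1.le⟩
    · have : Continuous fun s : ℝ => C * |s - t| := by fun_prop
      simpa using (this.tendsto t).mono_left nhdsWithin_le_nhds
  have h2 : Int f = fun t => Int f (max t 0) := funext (Int_max f)
  rw [h2]
  exact h1.comp_continuous (by fun_prop) fun t => le_max_right t 0

lemma hasDerivWithinAt_Int (f : Fld) [IsL1 f] {t : ℝ} (ht : 0 ≤ t) :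
    HasDerivWithinAt (Int f) (Int (Dt f) t) (Ici 0) t := by
  have h1 : HasDerivAt (fun t => Int f 0 + ∫ s in (0 : ℝ)..t, Int (Dt f) s) (Int (Dt f) t) t := by
    have := intervalIntegral.integral_hasDerivAt_right
      ((continuous_Int (Dt f)).intervalIntegrable 0 t)
      ((continuous_Int (Dt f)).stronglyMeasurableAtFilter _ _)
      (continuous_Int (Dt f)).continuousAt
    exact this.const_add _
  refine h1.hasDerivWithinAt.congr (fun s hs => ?_) ?_
  · rw [← Int_sub_eq f le_rfl hs]; ring
  · rw [← Int_sub_eq f le_rfl ht]; ring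

/-- The Cauchy-Schwarz inequality. -/
lemma Int_mul_sq_le (f g : Fld) [IsL2 f] [IsL2 g] (t : ℝ) :
    Int (f * g) t ^ 2 ≤ Int (f * f) t * Int (g * g) t := by
  have h : ∀ s : ℝ, 0 ≤ Int (g * g) t * (s * s) + 2 * Int (f * g) t * s + Int (f * f) t := by
    intro s
    have h1 : 0 ≤ Int ((f + s • g) * (f + s • g)) t := Int_sq_nonneg _ _
    have h2 : (f + s • g) * (f + s • g) = (f * f + (2 * s) • (f * g)) + (s * s) • (g * g) := by
      refine Fld.ext ?_
      funext t x
      simp only [add_val, mul_val, smul_val]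
      ring
    rw [h2, Int_add, Int_add, Int_smul, Int_smul] at h1
    linarith
  have := discrim_le_zero h
  rw [discrim] at this
  linarith

lemma abs_Int_mul_le (f g : Fld) [IsL2 f] [IsL2 g] (t : ℝ) :
    |Int (f * g) t| ≤ √(Int (f * f) t) * √(Int (g * g) t) := by
  rw [← Real.sqrt_mul (Int_sq_nonneg _ _), ← Real.sqrt_sq_eq_abs]
  exact Real.sqrt_le_sqrt (Int_mul_sq_le f g t)

end Fld

/-! ### Gagliardo-Nirenberg inequalities -/

lemma norm_clm_le (L : Plane →L[ℝ] ℝ) : ‖L‖ ≤ |L (e 0)| + |L (e 1)| := by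
  refine L.opNorm_le_bound (by positivity) fun x => ?_
  have hx : x = x 0 • e 0 + x 1 • e 1 := by
    ext i; fin_cases i <;> simp [e]
  have h0 : |x 0| ≤ ‖x‖ := by simpa using PiLp.norm_apply_le x 0
  have h1 : |x 1| ≤ ‖x‖ := by simpa using PiLp.norm_apply_le x 1
  have h2 : L x = x 0 * L (e 0) + x 1 * L (e 1) := by
    conv_lhs => rw [hx]
    simp
  rw [h2, Real.norm_eq_abs]
  refine (abs_add_le _ _).trans ?_
  rw [abs_mul, abs_mul]
  nlinarith [abs_nonneg (L (e 0)), abs_nonneg (L (e 1))]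

lemma sq_integral_abs_mul_le {g h : Plane → ℝ} (cg : Continuous g) (ch : Continuous h)
    (hg : Integrable fun x => g x ^ 2) (hh : Integrable fun x => h x ^ 2) :
    Integrable (fun x => |g x| * |h x|) ∧
      (∫ x, |g x| * |h x|) ^ 2 ≤ (∫ x, g x ^ 2) * ∫ x, h x ^ 2 := by
  have hi : Integrable (fun x => |g x| * |h x|) := by
    refine (hg.add hh).mono' (by fun_prop) (Eventually.of_forall fun x => ?_)
    rw [Real.norm_eq_abs, abs_of_nonneg (by positivity)]
    simp only [Pi.add_apply]
    nlinarith [sq_abs (g x), sq_abs (h x), sq_nonneg (|g x| - |h x|)]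
  refine ⟨hi, ?_⟩
  have key : ∀ s : ℝ, 0 ≤ (∫ x, h x ^ 2) * (s * s) + 2 * (∫ x, |g x| * |h x|) * s +
      ∫ x, g x ^ 2 := by
    intro s
    have h1 : 0 ≤ ∫ x, (|g x| + s * |h x|) ^ 2 := integral_nonneg fun x => sq_nonneg _
    have h2 : ∀ x, (|g x| + s * |h x|) ^ 2 =
        (s * s) * h x ^ 2 + ((2 * s) * (|g x| * |h x|) + g x ^ 2) := fun x => by
      rw [← sq_abs (g x), ← sq_abs (h x)]; ring
    simp_rw [h2] at h1
    have ii : Integrable (fun x => (2 * s) * (|g x| * |h x|) + g x ^ 2) :=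
      (hi.const_mul _).add hg
    rw [integral_add (hh.const_mul _) ii,
      integral_add (hi.const_mul _) hg, integral_const_mul, integral_const_mul] at h1
    linarith
  have := discrim_le_zero key
  rw [discrim] at this
  linarith

/-- The constant in the Sobolev inequality for compactly supported functions. -/
lemma exists_sobolev_compact : ∃ K : ℝ, 0 < K ∧ ∀ f : Plane → ℝ, ContDiff ℝ 1 f →
    HasCompactSupport f → ∫ x, f x ^ 2 ≤ K * (∫ x, ‖fderiv ℝ f x‖) ^ 2 := by
  set c : ℝ≥0 := eLpNormLESNormFDerivOneConst (volume : Measure Plane) 2 with hc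
  refine ⟨(c : ℝ) ^ 2 + 1, by positivity, fun f hf hs => ?_⟩
  have hp : NNReal.HolderConjugate (Module.finrank ℝ Plane : ℝ≥0) 2 := by
    have : (Module.finrank ℝ Plane : ℝ≥0) = 2 := by simp
    rw [this]
    exact NNReal.HolderConjugate.two_two
  have h := eLpNorm_le_eLpNorm_fderiv_one (volume : Measure Plane) hf hs hp
  have hf2 : MemLp f 2 volume := hf.continuous.memLp_of_hasCompactSupport hs
  have hcd : Continuous (fderiv ℝ f) := hf.continuous_fderiv (by norm_num)
  have hd : Integrable (fderiv ℝ f) := hcd.integrable_of_hasCompactSupport (hs.fderiv ℝ)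
  have h2 : eLpNorm f 2 volume = ENNReal.ofReal (√(∫ x, f x ^ 2)) := by
    rw [hf2.eLpNorm_eq_integral_rpow_norm (by norm_num) (by norm_num)]
    congr 1
    rw [Real.sqrt_eq_rpow]
    norm_num
  have h1 : eLpNorm (fderiv ℝ f) 1 volume = ENNReal.ofReal (∫ x, ‖fderiv ℝ f x‖) := by
    rw [eLpNorm_one_eq_lintegral_enorm, ← ofReal_integral_norm_eq_lintegral_enorm hd]
  have h' : ENNReal.ofReal (√(∫ x, f x ^ 2)) ≤ ENNReal.ofReal (c * ∫ x, ‖fderiv ℝ f x‖) := by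
    rw [ENNReal.ofReal_mul (by positivity), ← h1, ← h2, ENNReal.ofReal_coe_nnreal]
    exact_mod_cast h
  have hn : 0 ≤ ∫ x, ‖fderiv ℝ f x‖ := integral_nonneg fun _ => norm_nonneg _
  rw [ENNReal.ofReal_le_ofReal_iff (by positivity), Real.sqrt_le_left (by positivity)] at h'
  refine h'.trans ?_
  rw [mul_pow]
  nlinarith [sq_nonneg (∫ x, ‖fderiv ℝ f x‖)]

lemma exists_sobolev : ∃ K : ℝ, 0 < K ∧ ∀ f : Plane → ℝ, ContDiff ℝ 1 f →
    Integrable f → Integrable (fun x => f x ^ 2) → Integrable (fun x => ‖fderiv ℝ f x‖) →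
    ∫ x, f x ^ 2 ≤ K * (∫ x, ‖fderiv ℝ f x‖) ^ 2 := by
  obtain ⟨K, hK, hKf⟩ := exists_sobolev_compact
  refine ⟨K, hK, fun f hf h1 h2 hd => ?_⟩
  let χ : ContDiffBump (0 : Plane) := ⟨1, 2, one_pos, one_lt_two⟩
  have hχ : ContDiff ℝ 1 χ := χ.contDiff
  have hχc : HasCompactSupport χ := χ.hasCompactSupport
  obtain ⟨B, hB⟩ : ∃ B : ℝ, ∀ x, ‖fderiv ℝ χ x‖ ≤ B := by
    obtain ⟨B, hB⟩ := (hχ.continuous_fderiv (by norm_num)).bounded_above_of_compact_support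
      (hχc.fderiv ℝ)
    exact ⟨B, hB⟩
  have hB0 : 0 ≤ B := (norm_nonneg _).trans (hB 0)
  set ε : ℕ → ℝ := fun n => 1 / ((n : ℝ) + 1) with hε
  have hεp : ∀ n, 0 < ε n := fun n => by simp only [hε]; positivity
  have hε0 : Tendsto ε atTop (𝓝 0) := tendsto_one_div_add_atTop_nhds_zero_nat
  set u : ℕ → Plane → ℝ := fun n x => χ (ε n • x) * f x with hu
  have hsm : ∀ n, ContDiff ℝ 1 fun x : Plane => χ (ε n • x) := fun n =>
    hχ.comp (contDiff_const_smul (ε n))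
  have huc : ∀ n, ContDiff ℝ 1 (u n) := fun n => (hsm n).mul hf
  have hus : ∀ n, HasCompactSupport (u n) := fun n =>
    (hχc.comp_smul (hεp n).ne').mul_right
  have hfd : ∀ n x, fderiv ℝ (fun x : Plane => χ (ε n • x)) x = ε n • fderiv ℝ χ (ε n • x) := by
    intro n x
    have hh : HasFDerivAt (fun x : Plane => ε n • x) (ε n • ContinuousLinearMap.id ℝ Plane) x :=
      (hasFDerivAt_id x).const_smul (ε n)
    have := ((hχ.differentiable (by norm_num)) (ε n • x)).hasFDerivAt.comp x hh
    have h3 : HasFDerivAt (fun x : Plane => χ (ε n • x)) _ x := this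
    rw [h3.fderiv]
    ext v
    simp
  have hud : ∀ n x, ‖fderiv ℝ (u n) x‖ ≤ ‖fderiv ℝ f x‖ + ε n * B * |f x| := by
    intro n x
    have h3 : fderiv ℝ (u n) x = χ (ε n • x) • fderiv ℝ f x +
        f x • fderiv ℝ (fun x : Plane => χ (ε n • x)) x :=
      fderiv_fun_mul ((hsm n).differentiable (by norm_num) x) (hf.differentiable (by norm_num) x)
    rw [h3, hfd]
    refine (norm_add_le _ _).trans ?_
    rw [norm_smul, norm_smul, norm_smul, Real.norm_eq_abs, Real.norm_eq_abs, Real.norm_eq_abs,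
      abs_of_nonneg χ.nonneg, abs_of_pos (hεp n)]
    refine add_le_add (mul_le_of_le_one_left (norm_nonneg _) χ.le_one) ?_
    rw [mul_comm]
    exact mul_le_mul_of_nonneg_right (mul_le_mul_of_nonneg_left (hB _) (hεp n).le) (abs_nonneg _)
  have hbound : ∀ n, ∫ x, u n x ^ 2 ≤
      K * ((∫ x, ‖fderiv ℝ f x‖) + ε n * B * ∫ x, |f x|) ^ 2 := by
    intro n
    refine (hKf _ (huc n) (hus n)).trans ?_
    refine mul_le_mul_of_nonneg_left ?_ hK.le
    refine pow_le_pow_left₀ (integral_nonneg fun _ => norm_nonneg _) ?_ 2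
    rw [← integral_const_mul, ← integral_add hd (h1.abs.const_mul _)]
    refine integral_mono ?_ (hd.add (h1.abs.const_mul _)) (hud n)
    exact (((huc n).continuous_fderiv (by norm_num)).integrable_of_hasCompactSupport
      ((hus n).fderiv ℝ)).norm
  have hlim1 : Tendsto (fun n => ∫ x, u n x ^ 2) atTop (𝓝 (∫ x, f x ^ 2)) := by
    refine tendsto_integral_of_dominated_convergence (fun x => f x ^ 2)
      (fun n => ((huc n).continuous.pow 2).aestronglyMeasurable) h2
      (fun n => Eventually.of_forall fun x => ?_) (Eventually.of_forall fun x => ?_)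
    · rw [Real.norm_eq_abs, abs_of_nonneg (sq_nonneg _)]
      simp only [hu, mul_pow]
      exact mul_le_of_le_one_left (sq_nonneg _) (pow_le_one₀ χ.nonneg χ.le_one)
    · have h3 : Tendsto (fun n => χ (ε n • x)) atTop (𝓝 (χ ((0 : ℝ) • x))) :=
        (hχ.continuous.tendsto _).comp (hε0.smul_const x)
      have h4 : χ ((0 : ℝ) • x) = 1 := by
        rw [zero_smul]
        exact χ.one_of_mem_closedBall (by simp [χ])
      rw [h4] at h3
      simpa using (h3.mul_const (f x)).pow 2
  have hlim2 : Tendsto (fun n => K * ((∫ x, ‖fderiv ℝ f x‖) + ε n * B * ∫ x, |f x|) ^ 2) atTop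
      (𝓝 (K * ((∫ x, ‖fderiv ℝ f x‖) + 0 * B * ∫ x, |f x|) ^ 2)) :=
    ((((hε0.mul_const B).mul_const _).const_add _).pow 2).const_mul K
  have := le_of_tendsto_of_tendsto' hlim1 hlim2 hbound
  simpa using this

namespace Fld

/-- `∫ |∇f|²`. -/
def Nd (f : Fld) (t : ℝ) : ℝ := Int (Dx 0 f * Dx 0 f) t + Int (Dx 1 f * Dx 1 f) t

lemma Nd_nonneg (f : Fld) (t : ℝ) : 0 ≤ Nd f t :=
  add_nonneg (Int_sq_nonneg _ _) (Int_sq_nonneg _ _)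

lemma exists_gagliardo : ∃ K : ℝ, 1 ≤ K ∧ ∀ (f : Fld) [IsL2 f] (m : ℕ), 1 ≤ m → ∀ t,
    Int (f ^ (2 * m + 2)) t ≤ K * (m + 1) ^ 2 * Int (f ^ (2 * m)) t * Nd f t := by
  obtain ⟨K, hK, hKf⟩ := exists_sobolev
  refine ⟨2 * K + 1, by linarith, fun f _ m hm t => ?_⟩
  have hpow : ∀ k : ℕ, 2 ≤ k → IsL1 (f ^ k) := fun k hk => by
    obtain ⟨j, rfl⟩ := Nat.exists_eq_add_of_le hk
    rw [pow_add]; infer_instance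
  have := hpow (m + 1) (by omega)
  have := hpow (2 * m + 2) (by omega)
  have := hpow (2 * m) (by omega)
  have hcd : ContDiff ℝ 1 (f.1 t) := (f.contDiff t).of_le (by exact_mod_cast le_top)
  have hF : ContDiff ℝ 1 ((f ^ (m + 1)).1 t) := hcd.pow (m + 1)
  have c := f.continuous t
  have hsq : ∀ x, (f ^ (m + 1)).1 t x ^ 2 = (f ^ (2 * m + 2)).1 t x := fun x => by
    simp only [pow_val]; ring
  have hsq' : ∀ x, (f.1 t x ^ m) ^ 2 = (f ^ (2 * m)).1 t x := fun x => by
    simp only [pow_val]; ring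
  have hD : ∀ i x, fderiv ℝ ((f ^ (m + 1)).1 t) x (e i) =
      (m + 1) * (f.1 t x ^ m * (Dx i f).1 t x) := fun i x => by
    have h1 : fderiv ℝ (fun x => f.1 t x ^ (m + 1)) x = _ :=
      fderiv_fun_pow (m + 1) (hcd.differentiable (by norm_num) x)
    change fderiv ℝ (fun x => f.1 t x ^ (m + 1)) x (e i) = _
    rw [h1, Dx_val]
    simp
    ring
  have hi0 : Integrable (fun x => (f.1 t x ^ m) ^ 2) := by
    simp_rw [hsq']; exact (f ^ (2 * m)).integrable t
  have hiD : ∀ i, Integrable (fun x => (Dx i f).1 t x ^ 2) := fun i => by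
    have := (Dx i f * Dx i f).integrable t
    simpa only [sq] using! this
  have hcs := fun i => sq_integral_abs_mul_le (c.pow m) ((Dx i f).continuous t) hi0 (hiD i)
  simp only [Pi.pow_apply] at hcs
  have hb : ∀ x, ‖fderiv ℝ ((f ^ (m + 1)).1 t) x‖ ≤ (m + 1) * (|f.1 t x ^ m| * |(Dx 0 f).1 t x| +
      |f.1 t x ^ m| * |(Dx 1 f).1 t x|) := fun x => by
    refine (norm_clm_le _).trans (le_of_eq ?_)
    rw [hD, hD, abs_mul, abs_mul, abs_mul, abs_mul, abs_of_nonneg (by positivity : (0:ℝ) ≤ m + 1)]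
    ring
  have hid : Integrable (fun x => (m + 1) * (|f.1 t x ^ m| * |(Dx 0 f).1 t x| +
      |f.1 t x ^ m| * |(Dx 1 f).1 t x|)) := ((hcs 0).1.add (hcs 1).1).const_mul ((m : ℝ) + 1)
  have hidf : Integrable (fun x => ‖fderiv ℝ ((f ^ (m + 1)).1 t) x‖) :=
    hid.mono' (hF.continuous_fderiv (by norm_num)).norm.aestronglyMeasurable
      (Eventually.of_forall fun x => by simpa using hb x)
  have h := hKf _ hF ((f ^ (m + 1)).integrable t)
    (by simp_rw [hsq]; exact (f ^ (2 * m + 2)).integrable t) hidf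
  simp_rw [hsq] at h
  have h2 : ∫ x, ‖fderiv ℝ ((f ^ (m + 1)).1 t) x‖ ≤ (m + 1) * ((∫ x, |f.1 t x ^ m| *
      |(Dx 0 f).1 t x|) + ∫ x, |f.1 t x ^ m| * |(Dx 1 f).1 t x|) := by
    refine (integral_mono hidf hid hb).trans (le_of_eq ?_)
    rw [integral_const_mul, integral_add (hcs 0).1 (hcs 1).1]
  have hn : 0 ≤ ∫ x, ‖fderiv ℝ ((f ^ (m + 1)).1 t) x‖ := integral_nonneg fun _ => norm_nonneg _
  have e0 : ∫ x, (f.1 t x ^ m) ^ 2 = Int (f ^ (2 * m)) t := by simp_rw [hsq']; rfl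
  have eD : ∀ i, ∫ x, (Dx i f).1 t x ^ 2 = Int (Dx i f * Dx i f) t := fun i => by
    simp only [sq]; rfl
  have k0 := (hcs 0).2
  have k1 := (hcs 1).2
  rw [e0, eD] at k0 k1
  set a := ∫ x, |f.1 t x ^ m| * |(Dx 0 f).1 t x|
  set b := ∫ x, |f.1 t x ^ m| * |(Dx 1 f).1 t x|
  have hA : 0 ≤ Int (f ^ (2 * m)) t := by rw [← e0]; exact integral_nonneg fun x => sq_nonneg _
  have hN := Nd_nonneg f t
  calc Int (f ^ (2 * m + 2)) t ≤ K * ((m + 1) * (a + b)) ^ 2 :=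
        h.trans (mul_le_mul_of_nonneg_left (pow_le_pow_left₀ hn h2 2) hK.le)
    _ = K * (m + 1) ^ 2 * (a + b) ^ 2 := by ring
    _ ≤ K * (m + 1) ^ 2 * (2 * (Int (f ^ (2 * m)) t * Nd f t)) := by
        refine mul_le_mul_of_nonneg_left ?_ (by positivity)
        rw [Nd]
        nlinarith [sq_nonneg (a - b)]
    _ ≤ _ := by
        have : 0 ≤ ((m : ℝ) + 1) ^ 2 * Int (f ^ (2 * m)) t * Nd f t := by positivity
        nlinarith

end Fld

/-! ### Gaussian averages -/

/-- The standard Gaussian density on the plane. -/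
def gs (z : Plane) : ℝ := (2 * Real.pi)⁻¹ * Real.exp (-(1 / 2) * ‖z‖ ^ 2)

lemma gs_pos (z : Plane) : 0 < gs z := by unfold gs; positivity

lemma integrable_exp_neg_norm_sq {b : ℝ} (hb : 0 < b) :
    Integrable fun z : Plane => Real.exp (-b * ‖z‖ ^ 2) := by
  by_contra h
  have h1 := GaussianFourier.integral_rexp_neg_mul_sq_norm (V := Plane) hb
  rw [integral_undef h] at h1
  have : 0 < (Real.pi / b) ^ (Module.finrank ℝ Plane / 2 : ℝ) :=
    Real.rpow_pos_of_pos (div_pos Real.pi_pos hb) _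
  linarith

lemma integral_gs : ∫ z, gs z = 1 := by
  unfold gs
  rw [integral_const_mul, GaussianFourier.integral_rexp_neg_mul_sq_norm (V := Plane) (by norm_num)]
  have : (Module.finrank ℝ Plane / 2 : ℝ) = 1 := by simp
  rw [this, Real.rpow_one]
  have := Real.pi_pos
  field_simp

lemma hasFDerivAt_gs (z : Plane) :
    HasFDerivAt gs (gs z • (-(1 / 2 : ℝ)) • (2 : ℝ) • innerSL ℝ z) z := by
  have h1 : HasFDerivAt (fun z : Plane => ‖z‖ ^ 2) ((2 : ℝ) • innerSL ℝ z) z := by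
    convert! (hasStrictFDerivAt_norm_sq z).hasFDerivAt using 1
    simp [two_smul]
  have h2 := ((h1.const_mul (-(1 / 2 : ℝ))).exp).const_mul (2 * Real.pi)⁻¹
  convert! h2 using 1
  rw [smul_smul (2 * Real.pi)⁻¹]
  rfl

lemma fderiv_gs (z : Plane) (i : Fin 2) : fderiv ℝ gs z (e i) = -(z i * gs z) := by
  rw [(hasFDerivAt_gs z).fderiv]
  simp [e, EuclideanSpace.inner_single_right, mul_comm]

/-- Polynomials times the Gaussian density. -/
inductive PolyG : (Plane → ℝ) → Prop
  | gs : PolyG gs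
  | add {k l} : PolyG k → PolyG l → PolyG (fun z => k z + l z)
  | smul (c : ℝ) {k} : PolyG k → PolyG (fun z => c * k z)
  | coord (i : Fin 2) {k} : PolyG k → PolyG (fun z => z i * k z)

lemma hasFDerivAt_coord (i : Fin 2) (z : Plane) :
    HasFDerivAt (fun z : Plane => z i) (EuclideanSpace.proj i : Plane →L[ℝ] ℝ) z :=
  (EuclideanSpace.proj i : Plane →L[ℝ] ℝ).hasFDerivAt

lemma PolyG.differentiable {k : Plane → ℝ} (hk : PolyG k) : Differentiable ℝ k := by
  induction hk with
  | gs => exact fun z => (hasFDerivAt_gs z).differentiableAt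
  | add _ _ h1 h2 => exact h1.add h2
  | smul c _ h => exact h.const_mul c
  | coord i _ h => exact fun z => (hasFDerivAt_coord i z).differentiableAt.mul (h z)

lemma PolyG.continuous {k : Plane → ℝ} (hk : PolyG k) : Continuous k := hk.differentiable.continuous

lemma PolyG.fderiv {k : Plane → ℝ} (hk : PolyG k) (j : Fin 2) :
    PolyG (fun z => fderiv ℝ k z (e j)) := by
  induction hk with
  | gs =>
    have : (fun z => _root_.fderiv ℝ INS2D.gs z (e j)) = fun z => (-1) * (z j * INS2D.gs z) := by
      funext z
      rw [fderiv_gs]; ring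
    rw [this]
    exact .smul _ (.coord _ .gs)
  | @add k l h1 h2 i1 i2 =>
    have : (fun z => _root_.fderiv ℝ (fun z => k z + l z) z (e j)) =
        fun z => _root_.fderiv ℝ k z (e j) + _root_.fderiv ℝ l z (e j) := by
      funext z
      rw [fderiv_fun_add (h1.differentiable z) (h2.differentiable z)]; rfl
    rw [this]; exact .add i1 i2
  | @smul c k h ih =>
    have : (fun z => _root_.fderiv ℝ (fun z => c * k z) z (e j)) =
        fun z => c * _root_.fderiv ℝ k z (e j) := by
      funext z
      rw [fderiv_const_mul (h.differentiable z)]; rfl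
    rw [this]; exact .smul _ ih
  | @coord i k h ih =>
    have : (fun z => _root_.fderiv ℝ (fun z : Plane => z i * k z) z (e j)) =
        fun z => z i * _root_.fderiv ℝ k z (e j) + (e j) i * k z := by
      funext z
      have h1 := (hasFDerivAt_coord i z).mul (h.differentiable z).hasFDerivAt
      have h2 : HasFDerivAt (fun z : Plane => z i * k z) _ z := h1
      rw [h2.fderiv]
      simp [mul_comm]
    rw [this]; exact .add (.coord _ ih) (.smul _ h)

lemma PolyG.bound {k : Plane → ℝ} (hk : PolyG k) :
    ∀ c : ℝ, c < 1 / 2 → ∃ C, ∀ z, |k z| ≤ C * Real.exp (-c * ‖z‖ ^ 2) := by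
  induction hk with
  | gs =>
    intro c hc
    refine ⟨(2 * Real.pi)⁻¹, fun z => ?_⟩
    rw [abs_of_pos (gs_pos z), INS2D.gs]
    refine mul_le_mul_of_nonneg_left (Real.exp_le_exp.2 ?_) (by positivity)
    nlinarith [sq_nonneg ‖z‖]
  | add _ _ h1 h2 =>
    intro c hc
    obtain ⟨C1, hC1⟩ := h1 c hc
    obtain ⟨C2, hC2⟩ := h2 c hc
    refine ⟨C1 + C2, fun z => (abs_add_le _ _).trans ?_⟩
    rw [add_mul]
    exact add_le_add (hC1 z) (hC2 z)
  | smul a _ h =>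
    intro c hc
    obtain ⟨C, hC⟩ := h c hc
    refine ⟨|a| * C, fun z => ?_⟩
    rw [abs_mul, mul_assoc]
    exact mul_le_mul_of_nonneg_left (hC z) (abs_nonneg _)
  | coord i _ h =>
    intro c hc
    obtain ⟨d, hd1, hd2⟩ := exists_between hc
    obtain ⟨C, hC⟩ := h d hd2
    have hC0 : 0 ≤ C := by simpa using (abs_nonneg _).trans (hC 0)
    refine ⟨(1 + 1 / (d - c)) * C, fun z => ?_⟩
    have hdc : 0 < d - c := by linarith
    rw [abs_mul]
    have h0 : |z i| ≤ ‖z‖ := by simpa using PiLp.norm_apply_le z i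
    have h1 : ‖z‖ ≤ (1 + 1 / (d - c)) * Real.exp ((d - c) * ‖z‖ ^ 2) := by
      have h2 := Real.add_one_le_exp ((d - c) * ‖z‖ ^ 2)
      have h3 : (1 + 1 / (d - c)) * ((d - c) * ‖z‖ ^ 2 + 1) ≤
          (1 + 1 / (d - c)) * Real.exp ((d - c) * ‖z‖ ^ 2) :=
        mul_le_mul_of_nonneg_left h2 (by positivity)
      refine le_trans ?_ h3
      have h4 : (1 + 1 / (d - c)) * ((d - c) * ‖z‖ ^ 2 + 1) =
          (d - c) * ‖z‖ ^ 2 + 1 + ‖z‖ ^ 2 + 1 / (d - c) := by field_simp; ring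
      rw [h4]
      have : 0 < 1 / (d - c) := by positivity
      nlinarith [sq_nonneg (‖z‖ - 1), mul_nonneg hdc.le (sq_nonneg ‖z‖)]
    calc |z i| * |_| ≤ ((1 + 1 / (d - c)) * Real.exp ((d - c) * ‖z‖ ^ 2)) *
          (C * Real.exp (-d * ‖z‖ ^ 2)) :=
          mul_le_mul (h0.trans h1) (hC z) (abs_nonneg _) (by positivity)
      _ = _ := by
          rw [show -c * ‖z‖ ^ 2 = (d - c) * ‖z‖ ^ 2 + -d * ‖z‖ ^ 2 by ring, Real.exp_add]; ring

lemma PolyG.integrable {k : Plane → ℝ} (hk : PolyG k) : Integrable k := by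
  obtain ⟨C, hC⟩ := hk.bound (1 / 4) (by norm_num)
  exact ((integrable_exp_neg_norm_sq (by norm_num)).const_mul C).mono'
    hk.continuous.aestronglyMeasurable (Eventually.of_forall hC)

/-- The average of `f` around `x` at scale `r` with weight `k`. -/
def avg (k : Plane → ℝ) (r : ℝ) (f : Plane → ℝ) (x : Plane) : ℝ := ∫ z, k z * f (x + r • z)

lemma PolyG.integrable_mul {k : Plane → ℝ} (hk : PolyG k) {f : Plane → ℝ} (hf : Continuous f)
    {B : ℝ} (hB : ∀ x, |f x| ≤ B) (r : ℝ) (x : Plane) :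
    Integrable fun z => k z * f (x + r • z) :=
  hk.integrable.mul_bdd (c := B) (by fun_prop) (Eventually.of_forall fun z => hB _)

lemma avg_add {k : Plane → ℝ} (hk : PolyG k) {f g : Plane → ℝ} (hf : Continuous f)
    (hg : Continuous g) {B B' : ℝ} (hB : ∀ x, |f x| ≤ B) (hB' : ∀ x, |g x| ≤ B') (r : ℝ)
    (x : Plane) : avg k r (fun y => f y + g y) x = avg k r f x + avg k r g x := by
  simp only [avg, mul_add]
  exact integral_add (hk.integrable_mul hf hB r x) (hk.integrable_mul hg hB' r x)

lemma avg_neg (k : Plane → ℝ) (f : Plane → ℝ) (r : ℝ) (x : Plane) :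
    avg k r (fun y => -f y) x = -avg k r f x := by
  simp only [avg, mul_neg, integral_neg]

lemma avg_zero_radius (f : Plane → ℝ) (x : Plane) : avg gs 0 f x = f x := by
  simp [avg, integral_mul_const, integral_gs]

lemma hasFDerivAt_comp_affine {f : Plane → ℝ} (hf : Differentiable ℝ f) (r : ℝ) (x z : Plane) :
    HasFDerivAt (fun z => f (x + r • z)) (r • fderiv ℝ f (x + r • z)) z := by
  have h1 : HasFDerivAt (fun z : Plane => x + r • z) (r • ContinuousLinearMap.id ℝ Plane) z :=
    ((hasFDerivAt_id z).const_smul r).const_add x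
  have h2 := (hf (x + r • z)).hasFDerivAt.comp z h1
  have h3 : HasFDerivAt (fun z => f (x + r • z)) _ z := h2
  convert! h3 using 1
  ext v; simp

/-- Integration by parts in Gaussian averages. -/
lemma avg_fderiv {k : Plane → ℝ} (hk : PolyG k) {f : Plane → ℝ} (hf : ContDiff ℝ 1 f) {B B' : ℝ}
    (hB : ∀ x, |f x| ≤ B) (i : Fin 2) (hB' : ∀ x, |fderiv ℝ f x (e i)| ≤ B') (r : ℝ) (x : Plane) :
    r * avg k r (fun y => fderiv ℝ f y (e i)) x = -avg (fun z => fderiv ℝ k z (e i)) r f x := by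
  have hd := hf.differentiable (by norm_num)
  have hfd : ∀ z, fderiv ℝ (fun z => f (x + r • z)) z (e i) = r * fderiv ℝ f (x + r • z) (e i) :=
    fun z => by rw [(hasFDerivAt_comp_affine hd r x z).fderiv]; rfl
  have hcf : Continuous fun y => fderiv ℝ f y (e i) :=
    (hf.continuous_fderiv (by norm_num)).clm_apply continuous_const
  have hI : Integrable fun z => k z * (r * fderiv ℝ f (x + r • z) (e i)) := by
    have := (hk.integrable_mul hcf hB' r x).const_mul r
    refine this.congr (Eventually.of_forall fun z => ?_)
    ring
  have h := integral_mul_fderiv_eq_neg_fderiv_mul_of_integrable (μ := (volume : Measure Plane))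
    (f := k) (g := fun z => f (x + r • z)) (v := e i)
    ((hk.fderiv i).integrable_mul hf.continuous hB r x)
    (by simp_rw [hfd]; exact hI)
    (hk.integrable_mul hf.continuous hB r x)
    (fun z _ => hk.differentiable z)
    (fun z _ => (hasFDerivAt_comp_affine hd r x z).differentiableAt)
  simp_rw [hfd] at h
  simp only [avg]
  rw [← h, ← integral_const_mul]
  refine integral_congr_ae (Eventually.of_forall fun z => ?_)
  ring

lemma integral_comp_affine (f : Plane → ℝ) {r : ℝ} (_ : 0 < r) (x : Plane) :
    ∫ z, f (x + r • z) = (r ^ 2)⁻¹ * ∫ z, f z := by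
  have h1 := Measure.integral_comp_smul (volume : Measure Plane) (fun z => f (x + z)) r
  rw [h1, integral_add_left_eq_self f x]
  simp

lemma integrable_comp_affine {f : Plane → ℝ} (hf : Integrable f) {r : ℝ} (hr : 0 < r) (x : Plane) :
    Integrable fun z => f (x + r • z) :=
  (hf.comp_add_left x).comp_smul hr.ne'

lemma abs_avg_le {k : Plane → ℝ} (r : ℝ) (f : Plane → ℝ) (x : Plane) :
    |avg k r f x| ≤ ∫ z, |k z| * |f (x + r • z)| := by
  refine (norm_integral_le_integral_norm fun z => k z * f (x + r • z)).trans (le_of_eq ?_)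
  simp only [norm_mul, Real.norm_eq_abs]

lemma PolyG.integrable_sq {k : Plane → ℝ} (hk : PolyG k) : Integrable fun z => k z ^ 2 := by
  obtain ⟨C, hC⟩ := hk.bound (1 / 4) (by norm_num)
  refine ((integrable_exp_neg_norm_sq (b := 1 / 2) (by norm_num)).const_mul (C ^ 2)).mono'
    (hk.continuous.pow 2).aestronglyMeasurable (Eventually.of_forall fun z => ?_)
  rw [Real.norm_eq_abs, abs_of_nonneg (sq_nonneg _), ← sq_abs]
  refine (pow_le_pow_left₀ (abs_nonneg _) (hC z) 2).trans (le_of_eq ?_)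
  rw [mul_pow, ← Real.exp_nat_mul]
  congr 2
  push_cast; ring

/-- `L²` bound for Gaussian averages. -/
lemma PolyG.avg_sq_le {k : Plane → ℝ} (hk : PolyG k) : ∃ C : ℝ, 0 < C ∧ ∀ (f : Plane → ℝ) (r : ℝ)
    (x : Plane), Continuous f → Integrable (fun y => f y ^ 2) → 0 < r →
    (r * avg k r f x) ^ 2 ≤ C * ∫ y, f y ^ 2 := by
  refine ⟨(∫ z, k z ^ 2) + 1, by positivity, fun f r x hf hi hr => ?_⟩
  have h1 := (sq_integral_abs_mul_le hk.continuous (h := fun z => f (x + r • z)) (by fun_prop)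
    hk.integrable_sq (integrable_comp_affine hi hr x)).2
  rw [integral_comp_affine (fun y => f y ^ 2) hr x] at h1
  have h2 : avg k r f x ^ 2 ≤ (∫ z, k z ^ 2) * ((r ^ 2)⁻¹ * ∫ y, f y ^ 2) := by
    rw [← sq_abs]
    exact (pow_le_pow_left₀ (abs_nonneg _) (abs_avg_le r f x) 2).trans h1
  have h3 : 0 ≤ ∫ y, f y ^ 2 := integral_nonneg fun _ => sq_nonneg _
  calc (r * avg k r f x) ^ 2 = r ^ 2 * avg k r f x ^ 2 := by ring
    _ ≤ r ^ 2 * ((∫ z, k z ^ 2) * ((r ^ 2)⁻¹ * ∫ y, f y ^ 2)) :=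
        mul_le_mul_of_nonneg_left h2 (sq_nonneg r)
    _ = (∫ z, k z ^ 2) * ∫ y, f y ^ 2 := by field_simp
    _ ≤ _ := by rw [add_mul, one_mul]; linarith

/-- `L⁴` bound for Gaussian averages. -/
lemma PolyG.avg_pow_four_le {k : Plane → ℝ} (hk : PolyG k) : ∃ C : ℝ, 0 < C ∧ ∀ (f : Plane → ℝ)
    (r : ℝ) (x : Plane) (B : ℝ), Continuous f → (∀ y, |f y| ≤ B) → Integrable (fun y => f y ^ 4) →
    0 < r → r ^ 2 * avg k r f x ^ 4 ≤ C * ∫ y, f y ^ 4 := by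
  obtain ⟨C, hC⟩ := hk.bound (1 / 4) (by norm_num)
  have hC0 : 0 ≤ C := by simpa using (abs_nonneg _).trans (hC 0)
  set w : Plane → ℝ := fun z => Real.exp (-(1 / 8) * ‖z‖ ^ 2) with hw
  have cw : Continuous w := by simp only [hw]; fun_prop
  have hw0 : ∀ z, 0 < w z := fun z => Real.exp_pos _
  have hw1 : ∀ z, w z ≤ 1 := fun z => by
    simp only [hw]; rw [Real.exp_le_one_iff]; nlinarith [sq_nonneg ‖z‖]
  have hww : ∀ z, w z ^ 2 = Real.exp (-(1 / 4) * ‖z‖ ^ 2) := fun z => by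
    simp only [hw]; rw [← Real.exp_nat_mul]; congr 1; push_cast; ring
  have hw2 : Integrable fun z => w z ^ 2 := by
    simp_rw [hww]; exact integrable_exp_neg_norm_sq (by norm_num)
  have hw4 : Integrable fun z => (w z ^ 2) ^ 2 := by
    refine hw2.mono' (by fun_prop) (Eventually.of_forall fun z => ?_)
    rw [Real.norm_eq_abs, abs_of_nonneg (by positivity)]
    nlinarith [hw0 z, hw1 z, pow_le_one₀ (hw0 z).le (hw1 z) (n := 2), sq_nonneg (w z)]
  set a := ∫ z, w z ^ 2
  set b := ∫ z, (w z ^ 2) ^ 2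
  have ha : 0 ≤ a := integral_nonneg fun _ => sq_nonneg _
  have hb : 0 ≤ b := integral_nonneg fun _ => sq_nonneg _
  refine ⟨C ^ 4 * a ^ 2 * b + 1, by positivity, fun f r x B hf hB hi hr => ?_⟩
  set F : Plane → ℝ := fun z => f (x + r • z)
  have cF : Continuous F := by fun_prop
  have hF4 : Integrable fun z => (F z ^ 2) ^ 2 := by
    refine (integrable_comp_affine hi hr x).congr (Eventually.of_forall fun z => ?_)
    simp only [F]; ring
  have hF4' : ∫ z, (F z ^ 2) ^ 2 = (r ^ 2)⁻¹ * ∫ y, f y ^ 4 := by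
    rw [← integral_comp_affine (fun y => f y ^ 4) hr x]
    refine integral_congr_ae (Eventually.of_forall fun z => ?_)
    simp only [F]; ring
  have h1 := sq_integral_abs_mul_le (g := fun z => w z ^ 2) (h := fun z => F z ^ 2)
    (by fun_prop) (by fun_prop) hw4 hF4
  simp only [abs_pow, sq_abs] at h1
  have h2i : Integrable fun z => (w z * F z) ^ 2 := h1.1.congr
    (Eventually.of_forall fun z => by ring)
  have h2 := sq_integral_abs_mul_le cw (h := fun z => w z * F z) (by fun_prop) hw2 h2i
  have h2e : ∫ z, (w z * F z) ^ 2 = ∫ z, w z ^ 2 * F z ^ 2 :=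
    integral_congr_ae (Eventually.of_forall fun z => by ring)
  rw [h2e] at h2
  have h3 : |avg k r f x| ≤ C * ∫ z, |w z| * |w z * F z| := by
    refine (abs_avg_le r f x).trans ?_
    rw [← integral_const_mul]
    refine integral_mono (hk.integrable.abs.mul_bdd (c := B) (by fun_prop)
      (Eventually.of_forall fun z => ?_)) (h2.1.const_mul C) fun z => ?_
    · rw [Real.norm_eq_abs, abs_abs]; exact hB _
    · have h4 := hC z
      simp only
      rw [abs_mul, abs_of_pos (hw0 z)]
      calc |k z| * |F z| ≤ C * Real.exp (-(1 / 4) * ‖z‖ ^ 2) * |F z| :=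
            mul_le_mul_of_nonneg_right h4 (abs_nonneg _)
        _ = _ := by rw [← hww]; ring
  set J := ∫ z, |w z| * |w z * F z|
  set I := ∫ z, w z ^ 2 * F z ^ 2
  have hI : 0 ≤ I := integral_nonneg fun _ => by positivity
  have h5 : J ^ 4 ≤ a ^ 2 * (b * ((r ^ 2)⁻¹ * ∫ y, f y ^ 4)) := by
    calc J ^ 4 = (J ^ 2) ^ 2 := by ring
      _ ≤ (a * I) ^ 2 := pow_le_pow_left₀ (sq_nonneg _) h2.2 2
      _ = a ^ 2 * I ^ 2 := by ring
      _ ≤ _ := by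
        rw [← hF4']
        exact mul_le_mul_of_nonneg_left h1.2 (sq_nonneg a)
  have h6 : avg k r f x ^ 4 ≤ C ^ 4 * J ^ 4 := by
    rw [← mul_pow, ← (show Even 4 by decide).pow_abs]
    exact pow_le_pow_left₀ (abs_nonneg _) h3 4
  have hf4 : 0 ≤ ∫ y, f y ^ 4 := integral_nonneg fun y => by positivity
  calc r ^ 2 * avg k r f x ^ 4 ≤ r ^ 2 * (C ^ 4 * (a ^ 2 * (b * ((r ^ 2)⁻¹ * ∫ y, f y ^ 4)))) :=
        mul_le_mul_of_nonneg_left (h6.trans (mul_le_mul_of_nonneg_left h5 (by positivity)))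
          (sq_nonneg r)
    _ = C ^ 4 * a ^ 2 * b * ∫ y, f y ^ 4 := by field_simp
    _ ≤ _ := by rw [add_mul, one_mul]; linarith

/-- The heat equation for Gaussian averages, for functions with directional derivatives. -/
lemma hasDerivAt_avg {f : Plane → ℝ} {f' f'' : Fin 2 → Plane → ℝ} (hf : Continuous f)
    (hf' : ∀ i, Continuous (f' i)) (hf'' : ∀ i, Continuous (f'' i)) {B : ℝ} (hB : ∀ x, |f x| ≤ B)
    (hB' : ∀ i x, |f' i x| ≤ B) (hB'' : ∀ i x, |f'' i x| ≤ B)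
    (hl : ∀ (x z : Plane) (r : ℝ), HasDerivAt (fun r : ℝ => f (x + r • z))
      (z 0 * f' 0 (x + r • z) + z 1 * f' 1 (x + r • z)) r)
    (hl' : ∀ i x, HasLineDerivAt ℝ (f' i) (f'' i x) x (e i)) (x : Plane) (r : ℝ) :
    HasDerivAt (fun r => avg gs r f x) (r * avg gs r (fun y => f'' 0 y + f'' 1 y) x) r := by
  have g : ∀ i, PolyG fun z : Plane => z i * gs z := fun i => .coord i .gs
  have h1 : HasDerivAt (fun r => avg gs r f x)
      (∫ z, gs z * (z 0 * f' 0 (x + r • z) + z 1 * f' 1 (x + r • z))) r := by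
    refine (hasDerivAt_integral_of_dominated_loc_of_deriv_le (F := fun r z => gs z * f (x + r • z))
      (F' := fun r z => gs z * (z 0 * f' 0 (x + r • z) + z 1 * f' 1 (x + r • z))) (s := univ)
      (x₀ := r) (bound := fun z => (|z 0 * gs z| + |z 1 * gs z|) * B) univ_mem
      (Eventually.of_forall fun r => ?_) (PolyG.gs.integrable_mul hf hB r x) ?_
      (Eventually.of_forall fun z r _ => ?_)
      (((g 0).integrable.abs.add (g 1).integrable.abs).mul_const B)
      (Eventually.of_forall fun z r _ => (hl x z r).const_mul (gs z))).2
    · exact (PolyG.gs.integrable_mul hf hB r x).aestronglyMeasurable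
    · have h0 := hf' 0
      have h1 := hf' 1
      have h2 := PolyG.gs.continuous
      have : Continuous fun z : Plane => gs z * (z 0 * f' 0 (x + r • z) + z 1 * f' 1 (x + r • z)) :=
        by fun_prop
      exact this.aestronglyMeasurable
    · rw [Real.norm_eq_abs]
      calc |gs z * (z 0 * f' 0 (x + r • z) + z 1 * f' 1 (x + r • z))|
          = |(z 0 * gs z) * f' 0 (x + r • z) + (z 1 * gs z) * f' 1 (x + r • z)| := by
            congr 1; ring
        _ ≤ |z 0 * gs z| * B + |z 1 * gs z| * B := by
            refine (abs_add_le _ _).trans ?_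
            rw [abs_mul _ (f' 0 _), abs_mul _ (f' 1 _)]
            exact add_le_add (mul_le_mul_of_nonneg_left (hB' _ _) (abs_nonneg _))
              (mul_le_mul_of_nonneg_left (hB' _ _) (abs_nonneg _))
        _ = _ := by ring
  convert! h1 using 1
  have h3 : ∀ i, r * avg gs r (f'' i) x = ∫ z, z i * gs z * f' i (x + r • z) := fun i => by
    have hld : ∀ z, HasLineDerivAt ℝ (fun z => f' i (x + r • z)) (r * f'' i (x + r • z)) z (e i) :=
      fun z => by
        have h4 : HasDerivAt (fun s : ℝ => f' i (x + r • z + s • e i)) (f'' i (x + r • z))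
          (r * 0) := by rw [mul_zero]; exact hl' i (x + r • z)
        have h5 := h4.comp (0 : ℝ) ((hasDerivAt_id (0 : ℝ)).const_mul r)
        simp only [HasLineDerivAt]
        convert! h5 using 1
        · funext s
          simp [smul_add, smul_smul, add_assoc]
        · ring
    have h := integral_bilinear_hasLineDerivAt_right_eq_neg_left_of_integrable
      (μ := (volume : Measure Plane)) (B := ContinuousLinearMap.mul ℝ ℝ) (v := e i)
      (f := gs) (f' := fun z => fderiv ℝ gs z (e i)) (g := fun z => f' i (x + r • z))
      (g' := fun z => r * f'' i (x + r • z))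
      ((PolyG.gs.fderiv i).integrable_mul (hf' i) (hB' i) r x)
      (((PolyG.gs.integrable_mul (hf'' i) (hB'' i) r x).const_mul r).congr
        (Eventually.of_forall fun z => by simp; ring))
      (PolyG.gs.integrable_mul (hf' i) (hB' i) r x)
      (fun z _ => (PolyG.gs.differentiable z).hasFDerivAt.hasLineDerivAt _) (fun z _ => hld z)
    simp only [ContinuousLinearMap.mul_apply', fderiv_gs] at h
    rw [avg, ← integral_const_mul]
    calc ∫ z, r * (gs z * f'' i (x + r • z)) = ∫ z, gs z * (r * f'' i (x + r • z)) :=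
          integral_congr_ae (Eventually.of_forall fun z => by ring)
      _ = ∫ z, z i * gs z * f' i (x + r • z) := by
          rw [h, ← integral_neg]
          exact integral_congr_ae (Eventually.of_forall fun z => by ring)
  rw [avg_add PolyG.gs (hf'' 0) (hf'' 1) (hB'' 0) (hB'' 1), mul_add, h3, h3, ← integral_add
    ((g 0).integrable_mul (hf' 0) (hB' 0) r x) ((g 1).integrable_mul (hf' 1) (hB' 1) r x)]
  refine integral_congr_ae (Eventually.of_forall fun z => ?_)
  simp only
  ring

namespace Fld

/-! ### Gaussian averages of fields -/

/-- The Laplacian of a field. -/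
def Lap (f : Fld) : Fld := Dx 0 (Dx 0 f) + Dx 1 (Dx 1 f)

instance (f : Fld) [IsL2 f] : IsL2 (Lap f) := by unfold Lap; infer_instance

lemma bdd (f : Fld) (t : ℝ) : ∃ B, ∀ x, |f.1 t x| ≤ B := by
  obtain ⟨C, hC⟩ := f.adm.self (max t 0)
  rw [f.val_max]
  exact ⟨C, fun x => hC _ ⟨le_max_right _ _, le_rfl⟩ x⟩

lemma differentiable (f : Fld) (t : ℝ) : Differentiable ℝ (f.1 t) :=
  (f.contDiff t).differentiable (by simp)

lemma fderiv_apply (f : Fld) (t : ℝ) (x z : Plane) :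
    fderiv ℝ (f.1 t) x z = z 0 * (Dx 0 f).1 t x + z 1 * (Dx 1 f).1 t x := by
  have hz : z = z 0 • e 0 + z 1 • e 1 := by
    ext i; fin_cases i <;> simp [e]
  conv_lhs => rw [hz]
  simp [Dx_val]

lemma hasDerivAt_comp_line (f : Fld) (t : ℝ) (x z : Plane) (r : ℝ) :
    HasDerivAt (fun r : ℝ => f.1 t (x + r • z))
      (z 0 * (Dx 0 f).1 t (x + r • z) + z 1 * (Dx 1 f).1 t (x + r • z)) r := by
  have h2 : HasDerivAt (fun r : ℝ => x + r • z) z r := by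
    simpa using ((hasDerivAt_id r).smul_const z).const_add x
  rw [← fderiv_apply]
  exact (f.differentiable t _).hasFDerivAt.comp_hasDerivAt r h2

lemma hasDerivAt_avg (f : Fld) (t : ℝ) (x : Plane) (r : ℝ) :
    HasDerivAt (fun r => avg gs r (f.1 t) x) (r * avg gs r ((Lap f).1 t) x) r := by
  obtain ⟨B, hB⟩ := f.bdd t
  choose B' hB' using fun i => (Dx i f).bdd t
  choose B'' hB'' using fun i => (Dx i (Dx i f)).bdd t
  set M := max B (max (max (B' 0) (B' 1)) (max (B'' 0) (B'' 1)))
  refine INS2D.hasDerivAt_avg (f := f.1 t) (f' := fun i => (Dx i f).1 t)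
    (f'' := fun i => (Dx i (Dx i f)).1 t) (B := M) (f.continuous t) (fun i => (Dx i f).continuous t)
    (fun i => (Dx i (Dx i f)).continuous t) (fun x => (hB x).trans (by simp [M]))
    (fun i x => (hB' i x).trans ?_) (fun i x => (hB'' i x).trans ?_)
    (f.hasDerivAt_comp_line t) (fun i x => ?_) x r
  · fin_cases i <;> simp [M]
  · fin_cases i <;> simp [M]
  · exact ((Dx i f).differentiable t x).hasFDerivAt.hasLineDerivAt _

lemma avg_Dx {k : Plane → ℝ} (hk : PolyG k) (f : Fld) (i : Fin 2) (t r : ℝ) (x : Plane) :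
    r * avg k r ((Dx i f).1 t) x = -avg (fun z => fderiv ℝ k z (e i)) r (f.1 t) x := by
  obtain ⟨B, hB⟩ := f.bdd t
  obtain ⟨B', hB'⟩ := (Dx i f).bdd t
  exact avg_fderiv hk ((f.contDiff t).of_le (by exact_mod_cast le_top)) hB i hB' r x

lemma avg_add (f g : Fld) (t r : ℝ) (x : Plane) :
    avg gs r ((f + g).1 t) x = avg gs r (f.1 t) x + avg gs r (g.1 t) x := by
  obtain ⟨B, hB⟩ := f.bdd t
  obtain ⟨B', hB'⟩ := g.bdd t
  exact INS2D.avg_add .gs (f.continuous t) (g.continuous t) hB hB' r x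

lemma avg_neg (f : Fld) (t r : ℝ) (x : Plane) :
    avg gs r ((-f).1 t) x = -avg gs r (f.1 t) x := INS2D.avg_neg _ _ _ _

lemma integrable_sq (f : Fld) [IsL2 f] (t : ℝ) : Integrable fun x => f.1 t x ^ 2 := by
  have := (f * f).integrable t
  refine this.congr (Eventually.of_forall fun x => ?_)
  simp [sq]

lemma integral_sq (f : Fld) (t : ℝ) : ∫ x, f.1 t x ^ 2 = Int (f * f) t :=
  integral_congr_ae (Eventually.of_forall fun x => by simp [sq])

/-- Agmon's inequality. -/
lemma exists_agmon : ∃ C : ℝ, 0 < C ∧ ∀ (f : Fld) [IsL2 f] (t : ℝ) (x : Plane),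
    (f.1 t x) ^ 4 ≤ C * (Int (f * f) t * Int (Lap f * Lap f) t) := by
  obtain ⟨C, hC, h⟩ := PolyG.gs.avg_sq_le
  refine ⟨(16 : ℝ) * C ^ 2, by positivity, fun f _ t x => ?_⟩
  set A := √(C * Int (f * f) t)
  set B := √(C * Int (Lap f * Lap f) t)
  have hA : A ^ 2 = C * Int (f * f) t := Real.sq_sqrt (mul_nonneg hC.le (Int_sq_nonneg _ _))
  have hB : B ^ 2 = C * Int (Lap f * Lap f) t :=
    Real.sq_sqrt (mul_nonneg hC.le (Int_sq_nonneg _ _))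
  have hA0 : 0 ≤ A := Real.sqrt_nonneg _
  have hB0 : 0 ≤ B := Real.sqrt_nonneg _
  have h1 : ∀ r, 0 < r → |r * avg gs r (f.1 t) x| ≤ A := fun r hr => by
    refine Real.abs_le_sqrt ?_
    rw [← integral_sq]
    exact h _ r x (f.continuous t) (f.integrable_sq t) hr
  have h2 : ∀ r, 0 ≤ r → ‖r * avg gs r ((Lap f).1 t) x‖ ≤ B := fun r hr => by
    rcases hr.eq_or_lt with rfl | hr
    · simpa using hB0
    refine Real.abs_le_sqrt ?_
    rw [← integral_sq]
    exact h _ r x ((Lap f).continuous t) ((Lap f).integrable_sq t) hr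
  have h3 : ∀ r, 0 < r → |f.1 t x| ≤ A / r + B * r := fun r hr => by
    have h4 := (convex_Icc 0 r).norm_image_sub_le_of_norm_hasDerivWithin_le
      (fun s _ => (hasDerivAt_avg f t x s).hasDerivWithinAt) (fun s hs => h2 s hs.1)
      (left_mem_Icc.2 hr.le) (right_mem_Icc.2 hr.le)
    rw [avg_zero_radius, sub_zero, Real.norm_eq_abs, Real.norm_eq_abs, abs_of_pos hr] at h4
    have h5 := h1 r hr
    rw [abs_mul, abs_of_pos hr, mul_comm, ← le_div_iff₀ hr] at h5
    have h6 : |f.1 t x| ≤ |avg gs r (f.1 t) x| + |avg gs r (f.1 t) x - f.1 t x| := by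
      have := abs_sub_abs_le_abs_sub (f.1 t x) (avg gs r (f.1 t) x)
      rw [abs_sub_comm] at this
      linarith
    linarith
  have h7 : |f.1 t x| ^ 2 ≤ 4 * (A * B) := by
    rcases (abs_nonneg (f.1 t x)).eq_or_lt with h0 | h0
    · rw [← h0, zero_pow two_ne_zero]; positivity
    rcases hB0.eq_or_lt with hb | hb
    · exfalso
      have h8 := h3 ((2 * A + 1) / |f.1 t x|) (by positivity)
      rw [← hb, zero_mul, add_zero, div_div_eq_mul_div, le_div_iff₀ (by linarith : (0 : ℝ) < 2 * A + 1)] at h8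
      nlinarith
    · have h8 := h3 (|f.1 t x| / (2 * B)) (by positivity)
      have h9 : A / (|f.1 t x| / (2 * B)) + B * (|f.1 t x| / (2 * B)) =
          2 * (A * B) / |f.1 t x| + |f.1 t x| / 2 := by field_simp
      rw [h9] at h8
      have h10 : |f.1 t x| / 2 ≤ 2 * (A * B) / |f.1 t x| := by linarith
      rw [le_div_iff₀ h0] at h10
      nlinarith
  calc (f.1 t x) ^ 4 = (|f.1 t x| ^ 2) ^ 2 := by rw [sq_abs]; ring
    _ ≤ (4 * (A * B)) ^ 2 := pow_le_pow_left₀ (sq_nonneg _) h7 2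
    _ = 16 * (A ^ 2 * B ^ 2) := by ring
    _ = _ := by rw [hA, hB]; ring

/-! ### Correlations and the orthogonality of gradients and solenoidal fields -/

/-- The correlation of two fields at time `t`. -/
def corr (t : ℝ) (q w : Fld) (h : Plane) : ℝ := ∫ x, q.1 t (x + h) * w.1 t x

section corr
variable (t : ℝ) (q w : Fld) [IsL2 q] [IsL2 w]

lemma integrable_corr (h : Plane) : Integrable fun x => q.1 t (x + h) * w.1 t x := by
  have h1 : Integrable fun x => q.1 t (x + h) ^ 2 := (q.integrable_sq t).comp_add_right h
  have cq := q.continuous t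
  have cw := w.continuous t
  refine (h1.add (w.integrable_sq t)).mono'
    (by fun_prop : Continuous fun x => q.1 t (x + h) * w.1 t x).aestronglyMeasurable
    (Eventually.of_forall fun x => ?_)
  rw [Real.norm_eq_abs, abs_mul, Pi.add_apply, ← sq_abs, ← sq_abs (w.1 t x)]
  nlinarith [sq_nonneg (|q.1 t (x + h)| - |w.1 t x|)]

lemma integral_abs_corr_le (h : Plane) :
    ∫ x, |q.1 t (x + h) * w.1 t x| ≤ Int (q * q) t + Int (w * w) t := by
  have h1 : Integrable fun x => q.1 t (x + h) ^ 2 := (q.integrable_sq t).comp_add_right h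
  rw [← integral_sq, ← integral_sq, ← integral_add_right_eq_self (fun x => q.1 t x ^ 2) h,
    ← integral_add h1 (w.integrable_sq t)]
  refine integral_mono (integrable_corr t q w h).abs (h1.add (w.integrable_sq t)) fun x => ?_
  simp only
  rw [abs_mul, ← sq_abs, ← sq_abs (w.1 t x)]
  nlinarith [sq_nonneg (|q.1 t (x + h)| - |w.1 t x|)]

lemma abs_corr_le (h : Plane) : |corr t q w h| ≤ Int (q * q) t + Int (w * w) t :=
  (abs_integral_le_integral_abs (f := fun x => q.1 t (x + h) * w.1 t x)).trans
    (integral_abs_corr_le t q w h)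

lemma corr_sub (h z : Plane) {a b : ℝ} (hab : a ≤ b) :
    corr t q w (h + b • z) - corr t q w (h + a • z) =
      ∫ s in a..b, (z 0 * corr t (Dx 0 q) w (h + s • z) + z 1 * corr t (Dx 1 q) w (h + s • z)) := by
  have cw := w.continuous t
  have c0 := (Dx 0 q).continuous t
  have c1 := (Dx 1 q).continuous t
  have hi : ∀ (i : Fin 2) (s : ℝ), Integrable fun x => z i * ((Dx i q).1 t (x + (h + s • z)) * w.1 t x) :=
    fun i s => (integrable_corr t (Dx i q) w (h + s • z)).const_mul (z i)
  have key := (integral_sub_eq_of_deriv (F := fun s x => q.1 t (x + (h + s • z)) * w.1 t x)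
    (F' := fun s x => z 0 * ((Dx 0 q).1 t (x + (h + s • z)) * w.1 t x) +
      z 1 * ((Dx 1 q).1 t (x + (h + s • z)) * w.1 t x))
    (C := |z 0| * (Int (Dx 0 q * Dx 0 q) t + Int (w * w) t) +
      |z 1| * (Int (Dx 1 q * Dx 1 q) t + Int (w * w) t)) hab
    (fun s _ x => ?_) (by fun_prop) (fun s _ => ⟨(hi 0 s).add (hi 1 s), ?_⟩)
    (integrable_corr t q w _) (integrable_corr t q w _)).2
  · rw [corr, corr, key]
    refine intervalIntegral.integral_congr fun s _ => ?_
    simp only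
    rw [integral_add (hi 0 s) (hi 1 s), integral_const_mul, integral_const_mul]
    rfl
  · have h1 := (q.hasDerivAt_comp_line t (x + h) z s).mul_const (w.1 t x)
    simp only [add_assoc] at h1
    refine (h1.congr_deriv ?_).hasDerivWithinAt
    ring
  · calc ∫ x, |z 0 * ((Dx 0 q).1 t (x + (h + s • z)) * w.1 t x) +
        z 1 * ((Dx 1 q).1 t (x + (h + s • z)) * w.1 t x)|
        ≤ ∫ x, (|z 0| * |(Dx 0 q).1 t (x + (h + s • z)) * w.1 t x| +
          |z 1| * |(Dx 1 q).1 t (x + (h + s • z)) * w.1 t x|) := by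
          refine integral_mono ((hi 0 s).add (hi 1 s)).abs
            (((integrable_corr t (Dx 0 q) w _).abs.const_mul _).add
              ((integrable_corr t (Dx 1 q) w _).abs.const_mul _)) fun x => ?_
          simp only [← abs_mul]
          exact abs_add_le _ _
      _ = _ := by
          rw [integral_add ((integrable_corr t (Dx 0 q) w _).abs.const_mul _)
            ((integrable_corr t (Dx 1 q) w _).abs.const_mul _), integral_const_mul,
            integral_const_mul]
      _ ≤ _ := add_le_add
          (mul_le_mul_of_nonneg_left (integral_abs_corr_le t (Dx 0 q) w _) (abs_nonneg _))
          (mul_le_mul_of_nonneg_left (integral_abs_corr_le t (Dx 1 q) w _) (abs_nonneg _))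

lemma continuous_corr : Continuous (corr t q w) := by
  set B := (Int (Dx 0 q * Dx 0 q) t + Int (w * w) t) + (Int (Dx 1 q * Dx 1 q) t + Int (w * w) t)
  have hb : ∀ h z, |corr t q w (h + z) - corr t q w h| ≤ B * ‖z‖ := fun h z => by
    have h1 := corr_sub t q w h z zero_le_one
    rw [one_smul, zero_smul, add_zero] at h1
    rw [h1, ← Real.norm_eq_abs]
    have := intervalIntegral.norm_integral_le_of_norm_le_const (a := 0) (b := 1) (C := B * ‖z‖)
      (f := fun s => z 0 * corr t (Dx 0 q) w (h + s • z) + z 1 * corr t (Dx 1 q) w (h + s • z))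
      fun s _ => ?_
    · simpa using this
    · rw [Real.norm_eq_abs]
      refine (abs_add_le _ _).trans ?_
      rw [abs_mul, abs_mul]
      have h0 : |z 0| ≤ ‖z‖ := by simpa using PiLp.norm_apply_le z 0
      have h1 : |z 1| ≤ ‖z‖ := by simpa using PiLp.norm_apply_le z 1
      have k0 := mul_le_mul h0 (abs_corr_le t (Dx 0 q) w (h + s • z)) (abs_nonneg _)
        (norm_nonneg z)
      have k1 := mul_le_mul h1 (abs_corr_le t (Dx 1 q) w (h + s • z)) (abs_nonneg _)
        (norm_nonneg z)
      simp only [B]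
      linarith
  have hB : 0 ≤ B := by
    have := Int_sq_nonneg w t
    have := Int_sq_nonneg (Dx 0 q) t
    have := Int_sq_nonneg (Dx 1 q) t
    simp only [B]; linarith
  have : LipschitzWith B.toNNReal (corr t q w) := by
    refine LipschitzWith.of_dist_le_mul fun x y => ?_
    rw [Real.dist_eq, dist_eq_norm, Real.coe_toNNReal _ hB]
    have := hb y (x - y)
    rwa [add_sub_cancel] at this
  exact this.continuous

lemma hasDerivAt_corr (h z : Plane) (r : ℝ) :
    HasDerivAt (fun r : ℝ => corr t q w (h + r • z))
      (z 0 * corr t (Dx 0 q) w (h + r • z) + z 1 * corr t (Dx 1 q) w (h + r • z)) r := by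
  have c0 := continuous_corr t (Dx 0 q) w
  have c1 := continuous_corr t (Dx 1 q) w
  have hc : Continuous fun s : ℝ => z 0 * corr t (Dx 0 q) w (h + s • z) +
    z 1 * corr t (Dx 1 q) w (h + s • z) := by fun_prop
  have h1 := (intervalIntegral.integral_hasDerivAt_right (hc.intervalIntegrable (r - 1) r)
    (hc.stronglyMeasurableAtFilter _ _) hc.continuousAt).const_add (corr t q w (h + (r - 1) • z))
  refine h1.congr_of_eventuallyEq ?_
  filter_upwards [Ioi_mem_nhds (show r - 1 < r by linarith)] with s hs
  rw [← corr_sub t q w h z (le_of_lt hs)]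
  ring

lemma corr_Dx (i : Fin 2) (h : Plane) : corr t (Dx i q) w h = -corr t q (Dx i w) h := by
  have hd : ∀ x, fderiv ℝ (fun x => q.1 t (x + h)) x (e i) = (Dx i q).1 t (x + h) := fun x => by
    rw [fderiv_comp_add_right, Dx_val]
  have h1 := integral_mul_fderiv_eq_neg_fderiv_mul_of_integrable (μ := (volume : Measure Plane))
    (f := fun x => q.1 t (x + h)) (g := w.1 t) (v := e i)
    (by simp_rw [hd]; exact integrable_corr t (Dx i q) w h)
    (integrable_corr t q (Dx i w) h) (integrable_corr t q w h)
    (fun x _ => ((q.differentiable t _).comp x (by fun_prop)))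
    (fun x _ => w.differentiable t x)
  simp_rw [hd] at h1
  have h2 : corr t q (Dx i w) h = -corr t (Dx i q) w h := h1
  rw [h2, neg_neg]

lemma corr_tendsto_zero {z : Plane} (hz : z ≠ 0) :
    Tendsto (fun n : ℕ => corr t q w ((0 : Plane) + (n : ℝ) • z)) atTop (𝓝 0) := by
  set N := Int (q * q) t + Int (w * w) t
  have hN : 0 ≤ N := add_nonneg (Int_sq_nonneg _ _) (Int_sq_nonneg _ _)
  set S : ℕ → Set Plane := fun n => {x | (n : ℝ) * (‖z‖ / 2) ≤ ‖x‖}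
  have hS : ∀ n, MeasurableSet (S n) := fun n =>
    (isClosed_le continuous_const continuous_norm).measurableSet
  have hz' : 0 < ‖z‖ := norm_pos_iff.2 hz
  have tail : ∀ (f : Fld) [IsL2 f],
      Tendsto (fun n => ∫ x, (S n).indicator (fun x => f.1 t x ^ 2) x) atTop (𝓝 0) := by
    intro f _
    have h1 : Tendsto (fun n => ∫ x, (S n).indicator (fun x => f.1 t x ^ 2) x) atTop
        (𝓝 (∫ _ : Plane, (0 : ℝ))) := by
      refine tendsto_integral_of_dominated_convergence (fun x => f.1 t x ^ 2)
        (fun n => ((f.integrable_sq t).indicator (hS n)).aestronglyMeasurable) (f.integrable_sq t)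
        (fun n => Eventually.of_forall fun x => ?_) (Eventually.of_forall fun x => ?_)
      · refine (norm_indicator_le_norm_self _ _).trans ?_
        rw [Real.norm_eq_abs, abs_of_nonneg (sq_nonneg _)]
      · refine tendsto_const_nhds.congr' ?_
        obtain ⟨n, hn⟩ := exists_nat_gt (‖x‖ / (‖z‖ / 2))
        filter_upwards [eventually_ge_atTop n] with m hm
        rw [indicator_of_notMem]
        simp only [S, mem_ofPred_eq, not_le]
        rw [div_lt_iff₀ (by positivity)] at hn
        refine hn.trans_le (mul_le_mul_of_nonneg_right ?_ (by positivity))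
        exact_mod_cast hm
    simpa using h1
  have hb : ∀ (K : ℝ), 0 < K → ∀ n : ℕ, |corr t q w ((0 : Plane) + (n : ℝ) • z)| ≤
      K * (∫ x, (S n).indicator (fun x => q.1 t x ^ 2) x) +
      K * (∫ x, (S n).indicator (fun x => w.1 t x ^ 2) x) + N / K := by
    intro K hK n
    set h : Plane := (0 : Plane) + (n : ℝ) • z
    have i1 : Integrable fun x => K * (S n).indicator (fun x => q.1 t x ^ 2) (x + h) :=
      (((q.integrable_sq t).indicator (hS n)).comp_add_right h).const_mul K
    have i2 : Integrable fun x => K * (S n).indicator (fun x => w.1 t x ^ 2) x :=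
      ((w.integrable_sq t).indicator (hS n)).const_mul K
    have i3 : Integrable fun x => q.1 t (x + h) ^ 2 / K :=
      ((q.integrable_sq t).comp_add_right h).div_const K
    have i4 : Integrable fun x => w.1 t x ^ 2 / K := (w.integrable_sq t).div_const K
    have pw : ∀ x, |q.1 t (x + h) * w.1 t x| ≤
        (K * (S n).indicator (fun x => q.1 t x ^ 2) (x + h) +
          K * (S n).indicator (fun x => w.1 t x ^ 2) x) + (q.1 t (x + h) ^ 2 / K +
            w.1 t x ^ 2 / K) := by
      intro x
      have young : ∀ a b : ℝ, |a * b| ≤ K * a ^ 2 + b ^ 2 / K := fun a b => by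
        rw [abs_mul, ← sq_abs a, ← sq_abs b]
        have h1 : K * (K * |a| ^ 2 + |b| ^ 2 / K) = (K * |a|) ^ 2 + |b| ^ 2 := by field_simp
        have h2 : K * (|a| * |b|) ≤ K * (K * |a| ^ 2 + |b| ^ 2 / K) := by
          rw [h1]
          have : 0 ≤ K * (|a| * |b|) := by positivity
          nlinarith [sq_nonneg (K * |a| - |b|)]
        exact le_of_mul_le_mul_left h2 hK
      have p1 : 0 ≤ q.1 t (x + h) ^ 2 / K := by positivity
      have p2 : 0 ≤ w.1 t x ^ 2 / K := by positivity
      have p3 : 0 ≤ (S n).indicator (fun x => q.1 t x ^ 2) (x + h) :=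
        indicator_nonneg (fun _ _ => sq_nonneg _) _
      have p4 : 0 ≤ (S n).indicator (fun x => w.1 t x ^ 2) x :=
        indicator_nonneg (fun _ _ => sq_nonneg _) _
      by_cases hx : x ∈ S n
      · rw [indicator_of_mem hx]
        have := young (w.1 t x) (q.1 t (x + h))
        rw [mul_comm (w.1 t x)] at this
        nlinarith [mul_nonneg hK.le p3]
      · have hx' : x + h ∈ S n := by
          simp only [S, mem_ofPred_eq, not_le] at hx ⊢
          have h1 : ‖h‖ = n * ‖z‖ := by simp [h, norm_smul]
          have h2 : ‖h‖ ≤ ‖x + h‖ + ‖x‖ := by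
            have := norm_sub_le (x + h) x
            rwa [add_sub_cancel_left] at this
          nlinarith
        rw [indicator_of_mem hx']
        have := young (q.1 t (x + h)) (w.1 t x)
        nlinarith [mul_nonneg hK.le p4]
    calc |corr t q w h| ≤ ∫ x, |q.1 t (x + h) * w.1 t x| := abs_integral_le_integral_abs
      _ ≤ _ := integral_mono (integrable_corr t q w h).abs ((i1.add i2).add (i3.add i4)) pw
      _ = _ := by
        rw [integral_add' (i1.add i2) (i3.add i4), integral_add' i1 i2, integral_add' i3 i4,
          integral_const_mul, integral_const_mul, integral_div, integral_div,
          integral_add_right_eq_self ((S n).indicator fun x => q.1 t x ^ 2) h,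
          integral_add_right_eq_self (fun x => q.1 t x ^ 2) h, integral_sq, integral_sq, ← add_div]
  rw [Metric.tendsto_atTop]
  intro ε hε
  have hK : 0 < 2 * (N + 1) / ε := by positivity
  have h0 : Tendsto (fun n => (2 * (N + 1) / ε) *
      (∫ x, (S n).indicator (fun x => q.1 t x ^ 2) x) + (2 * (N + 1) / ε) *
      (∫ x, (S n).indicator (fun x => w.1 t x ^ 2) x) + N / (2 * (N + 1) / ε)) atTop
      (𝓝 ((2 * (N + 1) / ε) * 0 + (2 * (N + 1) / ε) * 0 + N / (2 * (N + 1) / ε))) :=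
    (((tail q).const_mul _).add ((tail w).const_mul _)).add_const _
  have hlt : (2 * (N + 1) / ε) * 0 + (2 * (N + 1) / ε) * 0 + N / (2 * (N + 1) / ε) < ε := by
    rw [mul_zero, add_zero, zero_add, div_div_eq_mul_div, div_lt_iff₀ (by positivity)]
    nlinarith
  obtain ⟨n, hn⟩ := eventually_atTop.1 (h0.eventually_lt_const hlt)
  refine ⟨n, fun m hm => ?_⟩
  rw [Real.dist_eq, sub_zero]
  exact (hb _ hK m).trans_lt (hn m hm)

end corr

/-- Curl-free fields are orthogonal to divergence-free fields. -/
lemma Int_gradient_solenoidal (q0 q1 w0 w1 : Fld) [IsL2 q0] [IsL2 q1] [IsL2 w0] [IsL2 w1]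
    (hq : Dx 0 q1 = Dx 1 q0) (hw : Dx 0 w0 + Dx 1 w1 = 0) (t : ℝ) :
    Int (q0 * w0 + q1 * w1) t = 0 := by
  set c : Plane → ℝ := fun h => corr t q0 w0 h + corr t q1 w1 h with hc
  have hc0 : c 0 = Int (q0 * w0 + q1 * w1) t := by
    rw [Int_add]
    simp [hc, corr, Int]
  set d := Dx 0 q0 + Dx 1 q1 with hd
  have hlap0 : Lap q0 = Dx 0 d := by
    rw [Lap, hd, map_add, D_comm (some 0) (some 1) q1, hq]
  have hlap1 : Lap q1 = Dx 1 d := by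
    rw [Lap, hd, map_add, D_comm (some 1) (some 0) q0, ← hq]
  have hzero : ∀ h, (corr t (Dx 0 (Dx 0 q0)) w0 h + corr t (Dx 0 (Dx 0 q1)) w1 h) +
      (corr t (Dx 1 (Dx 1 q0)) w0 h + corr t (Dx 1 (Dx 1 q1)) w1 h) = 0 := by
    intro h
    have add1 : ∀ (f g w : Fld) [IsL2 f] [IsL2 g] [IsL2 w],
        corr t (f + g) w h = corr t f w h + corr t g w h := fun f g w _ _ _ => by
      rw [corr, corr, corr, ← integral_add (integrable_corr t f w h) (integrable_corr t g w h)]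
      exact integral_congr_ae (Eventually.of_forall fun x => by simp; ring)
    have add2 : ∀ (f g w : Fld) [IsL2 f] [IsL2 g] [IsL2 w],
        corr t w (f + g) h = corr t w f h + corr t w g h := fun f g w _ _ _ => by
      rw [corr, corr, corr, ← integral_add (integrable_corr t w f h) (integrable_corr t w g h)]
      exact integral_congr_ae (Eventually.of_forall fun x => by simp; ring)
    have e0 := add1 (Dx 0 (Dx 0 q0)) (Dx 1 (Dx 1 q0)) w0
    have e1 := add1 (Dx 0 (Dx 0 q1)) (Dx 1 (Dx 1 q1)) w1
    have k0 := corr_Dx t d w0 0 h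
    have k1 := corr_Dx t d w1 1 h
    have k2 := add2 (Dx 0 w0) (Dx 1 w1) d
    rw [hw] at k2
    have k3 : corr t d 0 h = 0 := by simp [corr]
    rw [← Lap, hlap0] at e0
    rw [← Lap, hlap1] at e1
    linarith
  set B := max (max (Int (q0 * q0) t + Int (w0 * w0) t + (Int (q1 * q1) t + Int (w1 * w1) t))
    (max (Int (Dx 0 q0 * Dx 0 q0) t + Int (w0 * w0) t +
        (Int (Dx 0 q1 * Dx 0 q1) t + Int (w1 * w1) t))
      (Int (Dx 1 q0 * Dx 1 q0) t + Int (w0 * w0) t + (Int (Dx 1 q1 * Dx 1 q1) t +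
        Int (w1 * w1) t))))
    (max (Int (Dx 0 (Dx 0 q0) * Dx 0 (Dx 0 q0)) t + Int (w0 * w0) t +
        (Int (Dx 0 (Dx 0 q1) * Dx 0 (Dx 0 q1)) t + Int (w1 * w1) t))
      (Int (Dx 1 (Dx 1 q0) * Dx 1 (Dx 1 q0)) t + Int (w0 * w0) t +
        (Int (Dx 1 (Dx 1 q1) * Dx 1 (Dx 1 q1)) t + Int (w1 * w1) t)))
  have bd : ∀ (f g : Fld) [IsL2 f] [IsL2 g] (h : Plane),
      |corr t f w0 h + corr t g w1 h| ≤ Int (f * f) t + Int (w0 * w0) t +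
        (Int (g * g) t + Int (w1 * w1) t) := fun f g _ _ h =>
    (abs_add_le _ _).trans (add_le_add (abs_corr_le t f w0 h) (abs_corr_le t g w1 h))
  have ct : ∀ (f g : Fld) [IsL2 f] [IsL2 g],
      Continuous fun h => corr t f w0 h + corr t g w1 h := fun f g _ _ =>
    (continuous_corr t f w0).add (continuous_corr t g w1)
  have hder : ∀ r, HasDerivAt (fun r => avg gs r c 0) 0 r := by
    intro r
    have := INS2D.hasDerivAt_avg (f := c)
      (f' := fun i h => corr t (Dx i q0) w0 h + corr t (Dx i q1) w1 h)
      (f'' := fun i h => corr t (Dx i (Dx i q0)) w0 h + corr t (Dx i (Dx i q1)) w1 h) (B := B)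
      (ct q0 q1) (fun i => ct _ _) (fun i => ct _ _)
      (fun h => (bd q0 q1 h).trans (by simp [B]))
      (fun i h => (bd _ _ h).trans (by fin_cases i <;> simp [B]))
      (fun i h => (bd _ _ h).trans (by fin_cases i <;> simp [B]))
      (fun x z r => (((hasDerivAt_corr t q0 w0 x z r).add
        (hasDerivAt_corr t q1 w1 x z r)).congr_deriv (by ring)))
      (fun i x => ?_) 0 r
    · simpa [hzero, avg] using this
    · have h1 := (hasDerivAt_corr t (Dx i q0) w0 x (e i) 0).add
        (hasDerivAt_corr t (Dx i q1) w1 x (e i) 0)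
      have h2 : HasDerivAt (fun r : ℝ => corr t (Dx i q0) w0 (x + r • e i) +
        corr t (Dx i q1) w1 (x + r • e i)) _ 0 := h1
      refine h2.congr_deriv ?_
      fin_cases i <;> simp [e]
  have hconst : ∀ r, avg gs r c 0 = c 0 := fun r => by
    have hd : Differentiable ℝ fun r => avg gs r c 0 := fun r => (hder r).differentiableAt
    rw [← avg_zero_radius c 0]
    exact is_const_of_deriv_eq_zero hd (fun r => (hder r).deriv) r 0
  have hlim : Tendsto (fun n : ℕ => avg gs (n : ℝ) c 0) atTop (𝓝 (∫ _ : Plane, (0 : ℝ))) := by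
    refine tendsto_integral_of_dominated_convergence (fun z => gs z * B)
      (fun n => (PolyG.gs.integrable_mul (ct q0 q1) (bd q0 q1) n 0).aestronglyMeasurable)
      (PolyG.gs.integrable.mul_const B) (fun n => Eventually.of_forall fun z => ?_) ?_
    · rw [norm_mul, Real.norm_eq_abs, Real.norm_eq_abs, abs_of_pos (gs_pos z)]
      exact mul_le_mul_of_nonneg_left ((bd q0 q1 _).trans (by simp [B])) (gs_pos z).le
    · have : ∀ᵐ z : Plane, z ≠ 0 := by
        rw [ae_iff]; simp
      filter_upwards [this] with z hz
      have := ((corr_tendsto_zero t q0 w0 hz).add (corr_tendsto_zero t q1 w1 hz)).const_mul (gs z)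
      simpa [hc] using this
  simp only [hconst, integral_zero] at hlim
  rw [← hc0]
  exact tendsto_nhds_unique tendsto_const_nhds hlim

end Fld

lemma cube_le_of_forall_scale {a α β K : ℝ} (ha : 0 ≤ a) (hα : 0 ≤ α) (hβ : 0 ≤ β) (hK : 0 < K)
    (h : ∀ s : ℝ, 0 < s → a ≤ K * (β * s + α / s ^ 2)) : a ^ 3 ≤ 8 * K ^ 3 * (α * β ^ 2) := by
  rcases ha.eq_or_lt with rfl | ha
  · rw [zero_pow (by norm_num)]; positivity
  rcases hβ.eq_or_lt with rfl | hβ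
  · exfalso
    have h1 : 0 < K * α / a := by
      have := h 1 one_pos
      have : 0 < K * α := by nlinarith
      positivity
    set s := √(2 * (K * α / a)) with hs
    have hs2 : s ^ 2 = 2 * (K * α / a) := Real.sq_sqrt (by positivity)
    have h2 := h s (Real.sqrt_pos.2 (by positivity))
    have hα' : 0 < α := by
      rcases hα.eq_or_lt with h0 | h0
      · rw [← h0] at h1; simp at h1
      · exact h0
    rw [hs2] at h2
    have : K * (0 * s + α / (2 * (K * α / a))) = a / 2 := by field_simp; ring
    linarith
  · have h1 := h (a / (2 * K * β)) (by positivity)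
    have h2 : K * (β * (a / (2 * K * β)) + α / (a / (2 * K * β)) ^ 2) =
        a / 2 + 4 * K ^ 3 * (α * β ^ 2) / a ^ 2 := by field_simp; ring
    rw [h2] at h1
    have h3 : a / 2 ≤ 4 * K ^ 3 * (α * β ^ 2) / a ^ 2 := by linarith
    rw [le_div_iff₀ (by positivity)] at h3
    nlinarith

lemma abs_le_of_pow_four_le {a C β : ℝ} (hC : 0 < C) (hβ : 0 ≤ β) (h : a ^ 4 ≤ C * β ^ 4) :
    |a| ≤ (C + 1) * β := by
  refine abs_le_of_sq_le_sq ?_ (by positivity)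
  refine le_of_abs_le (abs_le_of_sq_le_sq ?_ (by positivity))
  have h1 : C ≤ (C + 1) ^ 4 := by nlinarith [sq_nonneg (C + 1), sq_nonneg C, mul_pos hC hC]
  have h2 : C * β ^ 4 ≤ (C + 1) ^ 4 * β ^ 4 := mul_le_mul_of_nonneg_right h1 (by positivity)
  calc (a ^ 2) ^ 2 = a ^ 4 := by ring
    _ ≤ _ := h.trans h2
    _ = _ := by ring

namespace Fld

/-- Pointwise gradient bound for the Stokes system. -/
lemma exists_stokes_gradient : ∃ C : ℝ, 0 < C ∧ ∀ (u p F : Fin 2 → Fld) (_ : ∀ j, IsL2 (u j))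
    (_ : ∀ j, IsL2 (p j)) (_ : ∀ j, IsL2 (F j)), (∀ j, Lap (u j) = F j + p j) →
    Dx 0 (u 0) + Dx 1 (u 1) = 0 → Dx 0 (p 1) = Dx 1 (p 0) → ∀ (t α β : ℝ), 0 ≤ α → 0 ≤ β →
    (∀ j, ∫ x, (F j).1 t x ^ 4 ≤ β ^ 4) → ∀ i j, Int (Dx i (u j) * Dx i (u j)) t ≤ α ^ 2 →
    ∀ x, |(Dx i (u j)).1 t x| ^ 3 ≤ C * (α * β ^ 2) := by
  obtain ⟨C0, hC0, h0⟩ := PolyG.gs.avg_sq_le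
  choose C1 hC1 h1 using fun i => (PolyG.gs.fderiv i).avg_pow_four_le
  choose C3 hC3 h3 using fun i j l => (((PolyG.gs.fderiv i).fderiv j).fderiv l).avg_pow_four_le
  set c1 : ℝ := (C1 0 + 1) + (C1 1 + 1) with hc1
  set c3 : ℝ := ∑ i, ∑ j, ∑ l, (C3 i j l + 1) with hc3
  have hc1' : ∀ i, C1 i + 1 ≤ c1 :=
    Fin.forall_fin_two.2 ⟨by linarith [hC1 1], by linarith [hC1 0]⟩
  have hc3' : ∀ i j l, C3 i j l + 1 ≤ c3 := fun i j l => by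
    have p : ∀ i j l, 0 ≤ C3 i j l + 1 := fun i j l => by linarith [hC3 i j l]
    calc C3 i j l + 1 ≤ ∑ l, (C3 i j l + 1) :=
          Finset.single_le_sum (f := fun l => C3 i j l + 1) (fun l _ => p i j l)
            (Finset.mem_univ l)
      _ ≤ ∑ j, ∑ l, (C3 i j l + 1) :=
          Finset.single_le_sum (f := fun j => ∑ l, (C3 i j l + 1))
            (fun j _ => Finset.sum_nonneg fun l _ => p i j l) (Finset.mem_univ j)
      _ ≤ _ := Finset.single_le_sum (f := fun i => ∑ j, ∑ l, (C3 i j l + 1))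
            (fun i _ => Finset.sum_nonneg fun j _ => Finset.sum_nonneg fun l _ => p i j l)
            (Finset.mem_univ i)
  have hc1p : 0 < c1 := lt_of_lt_of_le (by linarith [hC1 0]) (hc1' 0)
  have hc3p : 0 < c3 := lt_of_lt_of_le (by linarith [hC3 0 0 0]) (hc3' 0 0 0)
  set K : ℝ := max (2 * (c1 + 4 * c3)) (C0 + 1) with hKdef
  have hK : 0 < K := lt_of_lt_of_le (by linarith) (le_max_right _ _)
  refine ⟨8 * K ^ 3, by positivity, fun u p F _ _ _ hS hdiv hcurl t α β hα hβ hF i j hN x => ?_⟩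
  have hFint : ∀ j, Integrable fun y => (F j).1 t y ^ 4 := fun j => by
    have := ((F j * F j) * (F j * F j)).integrable t
    refine this.congr (Eventually.of_forall fun y => ?_)
    simp only [mul_val]; ring
  -- bounds for averages of the force
  have b1 : ∀ i j (s : ℝ), 0 < s → |s * avg (fun z => fderiv ℝ gs z (e i)) (s ^ 2) ((F j).1 t) x|
      ≤ c1 * β := fun i j s hs => by
    obtain ⟨B, hB⟩ := (F j).bdd t
    have := h1 i _ (s ^ 2) x B ((F j).continuous t) hB (hFint j) (by positivity)
    refine (abs_le_of_pow_four_le (hC1 i) hβ ?_).trans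
      (mul_le_mul_of_nonneg_right (hc1' i) hβ)
    calc _ = (s ^ 2) ^ 2 * avg (fun z => fderiv ℝ gs z (e i)) (s ^ 2) ((F j).1 t) x ^ 4 := by ring
      _ ≤ _ := this.trans (mul_le_mul_of_nonneg_left (hF j) (hC1 i).le)
  have b3 : ∀ i j l m (s : ℝ), 0 < s →
      |s * ((s ^ 2) ^ 3 * avg gs (s ^ 2) ((Dx l (Dx j (Dx i (F m)))).1 t) x)| ≤ c3 * β := by
    intro i j l m s hs
    obtain ⟨B, hB⟩ := (F m).bdd t
    have e1 : (s ^ 2) ^ 3 * avg gs (s ^ 2) ((Dx l (Dx j (Dx i (F m)))).1 t) x =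
        -avg (fun z => fderiv ℝ (fun z => fderiv ℝ (fun z => fderiv ℝ gs z (e l)) z (e j)) z (e i))
          (s ^ 2) ((F m).1 t) x := by
      have k1 := avg_Dx .gs (Dx j (Dx i (F m))) l t (s ^ 2) x
      have k2 := avg_Dx (PolyG.gs.fderiv l) (Dx i (F m)) j t (s ^ 2) x
      have k3 := avg_Dx ((PolyG.gs.fderiv l).fderiv j) (F m) i t (s ^ 2) x
      linear_combination (s ^ 2) ^ 2 * k1 - s ^ 2 * k2 + k3
    rw [e1]
    have := h3 l j i _ (s ^ 2) x B ((F m).continuous t) hB (hFint m) (by positivity)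
    refine (abs_le_of_pow_four_le (hC3 l j i) hβ ?_).trans
      (mul_le_mul_of_nonneg_right (hc3' l j i) hβ)
    calc _ = (s ^ 2) ^ 2 * avg (fun z => fderiv ℝ (fun z => fderiv ℝ
          (fun z => fderiv ℝ gs z (e l)) z (e j)) z (e i)) (s ^ 2) ((F m).1 t) x ^ 4 := by ring
      _ ≤ _ := this.trans (mul_le_mul_of_nonneg_left (hF m) (hC3 l j i).le)
  -- the pressure
  have hdp : Dx 0 (p 0) + Dx 1 (p 1) = -(Dx 0 (F 0) + Dx 1 (F 1)) := by
    have e1 : Dx 0 (Lap (u 0)) + Dx 1 (Lap (u 1)) = Lap (Dx 0 (u 0) + Dx 1 (u 1)) := by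
      simp only [Lap, map_add]
      rw [D_comm (some 1) (some 0) (Dx 0 (u 1)), D_comm (some 1) (some 0) (u 1),
        D_comm (some 0) (some 1) (Dx 1 (u 0)), D_comm (some 0) (some 1) (u 0)]
      ring
    rw [hdiv, hS, hS] at e1
    have e2 : Lap (0 : Fld) = 0 := by simp [Lap]
    rw [e2, map_add, map_add] at e1
    linear_combination e1
  have hLp : ∀ j, Lap (p j) = -Dx j (Dx 0 (F 0) + Dx 1 (F 1)) := fun j => by
    rw [← map_neg, ← hdp]
    fin_cases j
    · simp only [Lap, map_add, Fin.zero_eta]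
      rw [D_comm (some 0) (some 1) (p 1), hcurl]
    · simp only [Lap, map_add, Fin.mk_one]
      rw [D_comm (some 1) (some 0) (p 0), ← hcurl]
  have hLp' : Lap (Dx i (p j)) = -(Dx i (Dx j (Dx 0 (F 0)))) + -(Dx i (Dx j (Dx 1 (F 1)))) := by
    have : Lap (Dx i (p j)) = Dx i (Lap (p j)) := by
      simp only [Lap, map_add]
      rw [D_comm (some i) (some 0), D_comm (some i) (some 1), D_comm (some i) (some 0) (p j),
        D_comm (some i) (some 1) (p j)]
    rw [this, hLp]; simp only [map_neg, map_add]; ring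
  set b : ℝ → ℝ := fun s => avg gs (s ^ 2) ((Dx i (p j)).1 t) x with hb
  have hb' : ∀ s, HasDerivAt b ((s ^ 2 * avg gs (s ^ 2) ((Lap (Dx i (p j))).1 t) x) * (2 * s)) s :=
    fun s => by
      have h2 : HasDerivAt (fun s : ℝ => s ^ 2) (2 * s) s := by simpa using hasDerivAt_pow 2 s
      exact (hasDerivAt_avg (Dx i (p j)) t x (s ^ 2)).comp s h2
  have hbb : ∀ s, 0 < s → |(s ^ 2 * avg gs (s ^ 2) ((Lap (Dx i (p j))).1 t) x) * (2 * s)| ≤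
      4 * c3 * β / s ^ 4 := fun s hs => by
    rw [hLp', avg_add, avg_neg, avg_neg, le_div_iff₀ (by positivity)]
    have k0 := b3 0 j i 0 s hs
    have k1 := b3 1 j i 1 s hs
    have e4 : s ^ 4 = |s ^ 4| := (abs_of_pos (by positivity)).symm
    rw [e4, ← abs_mul]
    set A0 := avg gs (s ^ 2) ((Dx i (Dx j (Dx 0 (F 0)))).1 t) x
    set A1 := avg gs (s ^ 2) ((Dx i (Dx j (Dx 1 (F 1)))).1 t) x
    have : s ^ 2 * (-A0 + -A1) * (2 * s) * s ^ 4 =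
      -2 * (s * ((s ^ 2) ^ 3 * A0)) + -2 * (s * ((s ^ 2) ^ 3 * A1)) := by ring
    rw [this]
    refine (abs_add_le _ _).trans ?_
    rw [abs_mul (-2), abs_mul (-2), show |(-2 : ℝ)| = 2 by norm_num]
    linarith
  have hlim : Tendsto b atTop (𝓝 0) := by
    have h5 : ∀ s, 1 < s → |b s| ≤ √(C0 * Int (Dx i (p j) * Dx i (p j)) t) / s := fun s hs => by
      have h6 := h0 _ (s ^ 2) x ((Dx i (p j)).continuous t) ((Dx i (p j)).integrable_sq t)
        (by positivity)
      rw [integral_sq] at h6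
      have h7 := Real.abs_le_sqrt h6
      rw [abs_mul, abs_of_pos (by positivity : 0 < s ^ 2)] at h7
      rw [le_div_iff₀ (by linarith)]
      have : |b s| * s ≤ s ^ 2 * |b s| := by
        rw [mul_comm]; exact mul_le_mul_of_nonneg_right (by nlinarith) (abs_nonneg _)
      exact this.trans h7
    refine squeeze_zero_norm' (a := fun s => √(C0 * Int (Dx i (p j) * Dx i (p j)) t) / s) ?_
      (tendsto_const_nhds.div_atTop tendsto_id)
    filter_upwards [eventually_gt_atTop 1] with s hs
    exact h5 s hs
  have hbs : ∀ s, 0 < s → |b s| ≤ 4 * c3 * β / s ^ 3 := by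
    have hden : ∀ s : ℝ, 0 < s → HasDerivAt (fun s : ℝ => 4 * c3 * β / s ^ 3)
        (-(12 * c3 * β / s ^ 4)) s := fun s hs => by
      have := (hasDerivAt_const s (4 * c3 * β)).div (hasDerivAt_pow 3 s) (by positivity)
      refine this.congr_deriv ?_
      field_simp; ring
    have hlim2 : Tendsto (fun s : ℝ => 4 * c3 * β / s ^ 3) atTop (𝓝 0) :=
      tendsto_const_nhds.div_atTop (tendsto_pow_atTop (by norm_num))
    have main : ∀ σ : ℝ, |σ| = 1 → ∀ s, 0 < s → 0 ≤ σ * b s + 4 * c3 * β / s ^ 3 := by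
      intro σ hσ s hs
      have hanti : AntitoneOn (fun s => σ * b s + 4 * c3 * β / s ^ 3) (Ioi 0) := by
        refine antitoneOn_of_hasDerivWithinAt_nonpos (convex_Ioi 0)
          (f' := fun s => σ * ((s ^ 2 * avg gs (s ^ 2) ((Lap (Dx i (p j))).1 t) x) * (2 * s)) +
            -(12 * c3 * β / s ^ 4)) (fun s hs => ?_) (fun s hs => ?_) (fun s hs => ?_)
        · exact ((((hb' s).const_mul σ).add (hden s hs)).continuousAt).continuousWithinAt
        · rw [interior_Ioi] at hs
          exact (((hb' s).const_mul σ).add (hden s hs)).hasDerivWithinAt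
        · rw [interior_Ioi] at hs
          have hs' : 0 < s := hs
          have h6 := hbb s hs
          have h7 : σ * ((s ^ 2 * avg gs (s ^ 2) ((Lap (Dx i (p j))).1 t) x) * (2 * s)) ≤
              4 * c3 * β / s ^ 4 := by
            refine (le_abs_self _).trans ?_
            rw [abs_mul, hσ, one_mul]; exact h6
          have h8 : 4 * c3 * β / s ^ 4 ≤ 12 * c3 * β / s ^ 4 := by
            apply div_le_div_of_nonneg_right _ (by positivity)
            nlinarith [mul_nonneg hc3p.le hβ]
          linarith
      have h9 : Tendsto (fun s => σ * b s + 4 * c3 * β / s ^ 3) atTop (𝓝 (σ * 0 + 0)) :=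
        (hlim.const_mul σ).add hlim2
      rw [mul_zero, add_zero] at h9
      refine le_of_tendsto h9 ?_
      filter_upwards [eventually_ge_atTop s] with s' hs'
      exact hanti hs (hs.trans_le hs') hs'
    intro s hs
    rw [abs_le]
    constructor
    · linarith [main 1 (by simp) s hs]
    · linarith [main (-1) (by simp) s hs]
  -- the velocity gradient
  have hLu : Lap (Dx i (u j)) = Dx i (F j) + Dx i (p j) := by
    rw [← map_add, ← hS]
    simp only [Lap, map_add]
    rw [D_comm (some i) (some 0), D_comm (some i) (some 1), D_comm (some i) (some 0) (u j),
      D_comm (some i) (some 1) (u j)]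
  set a : ℝ → ℝ := fun s => avg gs (s ^ 2) ((Dx i (u j)).1 t) x with ha
  have ha' : ∀ s, HasDerivAt a ((s ^ 2 * avg gs (s ^ 2) ((Lap (Dx i (u j))).1 t) x) * (2 * s)) s :=
    fun s => by
      have h2 : HasDerivAt (fun s : ℝ => s ^ 2) (2 * s) s := by simpa using hasDerivAt_pow 2 s
      exact (hasDerivAt_avg (Dx i (u j)) t x (s ^ 2)).comp s h2
  have hab : ∀ s, 0 ≤ s → ‖(s ^ 2 * avg gs (s ^ 2) ((Lap (Dx i (u j))).1 t) x) * (2 * s)‖ ≤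
      2 * (c1 + 4 * c3) * β := fun s hs => by
    rcases hs.eq_or_lt with rfl | hs
    · simp; positivity
    rw [hLu, avg_add, mul_add, avg_Dx .gs (F j) i, Real.norm_eq_abs]
    have k1 := b1 i j s hs
    have k2 := hbs s hs
    rw [le_div_iff₀ (by positivity), ← abs_of_pos (by positivity : 0 < s ^ 3), ← abs_mul] at k2
    have e5 : (-avg (fun z => fderiv ℝ gs z (e i)) (s ^ 2) ((F j).1 t) x +
        s ^ 2 * avg gs (s ^ 2) ((Dx i (p j)).1 t) x) * (2 * s) =
        -2 * (s * avg (fun z => fderiv ℝ gs z (e i)) (s ^ 2) ((F j).1 t) x) + 2 * (b s * s ^ 3) := by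
      simp only [hb]; ring
    rw [e5]
    refine (abs_add_le _ _).trans ?_
    rw [abs_mul (-2), abs_mul 2, show |(-2 : ℝ)| = 2 by norm_num, abs_two]
    linarith
  refine cube_le_of_forall_scale (abs_nonneg _) hα hβ hK fun s hs => ?_
  have h4 := (convex_Icc 0 s).norm_image_sub_le_of_norm_hasDerivWithin_le
    (fun s _ => (ha' s).hasDerivWithinAt) (fun s hs => hab s hs.1)
    (left_mem_Icc.2 hs.le) (right_mem_Icc.2 hs.le)
  have ha0 : a 0 = (Dx i (u j)).1 t x := by
    simp only [ha]; rw [zero_pow two_ne_zero, avg_zero_radius]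
  rw [ha0, sub_zero, Real.norm_eq_abs, Real.norm_eq_abs, abs_of_pos hs] at h4
  have h5 := h0 _ (s ^ 2) x ((Dx i (u j)).continuous t) ((Dx i (u j)).integrable_sq t)
    (by positivity)
  rw [integral_sq] at h5
  have h6 : |s ^ 2 * a s| ≤ (C0 + 1) * α := by
    refine abs_le_of_sq_le_sq (h5.trans ?_) (by positivity)
    calc C0 * Int (Dx i (u j) * Dx i (u j)) t ≤ C0 * α ^ 2 := mul_le_mul_of_nonneg_left hN hC0.le
      _ ≤ (C0 + 1) ^ 2 * α ^ 2 := mul_le_mul_of_nonneg_right (by nlinarith) (sq_nonneg _)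
      _ = _ := by ring
  rw [abs_mul, abs_of_pos (by positivity : 0 < s ^ 2), mul_comm, ← le_div_iff₀ (by positivity)] at h6
  have h7 : |(Dx i (u j)).1 t x| ≤ |a s| + |a s - (Dx i (u j)).1 t x| := by
    have := abs_sub_abs_le_abs_sub ((Dx i (u j)).1 t x) (a s)
    rw [abs_sub_comm] at this
    linarith
  have h8 : 2 * (c1 + 4 * c3) * β * s ≤ K * (β * s) := by
    rw [mul_assoc]
    exact mul_le_mul_of_nonneg_right (le_max_left _ _) (by positivity)
  have h9 : (C0 + 1) * α / s ^ 2 ≤ K * (α / s ^ 2) := by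
    rw [mul_div_assoc]
    exact mul_le_mul_of_nonneg_right (le_max_right _ _) (by positivity)
  rw [mul_add]
  linarith

end Fld

/-- A continuous nonnegative function whose moments grow at most like `S ^ m` is bounded by `S`. -/
lemma le_of_integral_pow_le {g : Plane → ℝ} (hg : Continuous g) (h0 : ∀ x, 0 ≤ g x)
    (hi : ∀ m : ℕ, 1 ≤ m → Integrable fun x => g x ^ m) {B S : ℝ} (hS : 0 ≤ S)
    (h : ∀ m : ℕ, 1 ≤ m → ∫ x, g x ^ m ≤ B * S ^ m) (x : Plane) : g x ≤ S := by
  by_contra! hx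
  obtain ⟨S', hS1, hS2⟩ := exists_between hx
  have hS'0 : 0 < S' := hS.trans_lt hS1
  have hU : IsOpen {y | S' < g y} := isOpen_lt continuous_const hg
  obtain ⟨ε, hε, hball⟩ := Metric.isOpen_iff.1 hU x hS2
  set c : ℝ := (volume (Metric.ball x ε)).toReal with hc
  have hc0 : 0 < c := ENNReal.toReal_pos (Metric.measure_ball_pos _ _ hε).ne'
    measure_ball_lt_top.ne
  have hlow : ∀ m : ℕ, 1 ≤ m → c * S' ^ m ≤ B * S ^ m := fun m hm => by
    refine le_trans ?_ (h m hm)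
    calc c * S' ^ m = ∫ _ in Metric.ball x ε, S' ^ m := by
          rw [setIntegral_const, smul_eq_mul]; rfl
      _ ≤ ∫ y in Metric.ball x ε, g y ^ m := by
          refine setIntegral_mono_on (integrableOn_const measure_ball_lt_top.ne)
            (hi m hm).integrableOn measurableSet_ball fun y hy => ?_
          exact pow_le_pow_left₀ hS'0.le (le_of_lt (hball hy)) m
      _ ≤ _ := setIntegral_le_integral (hi m hm)
          (Eventually.of_forall fun y => pow_nonneg (h0 y) m)
  rcases hS.eq_or_lt with rfl | hS
  · have := hlow 1 le_rfl
    simp at this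
    nlinarith
  · have hr : 1 < S' / S := (one_lt_div hS).2 hS1
    obtain ⟨m, hm⟩ := pow_unbounded_of_one_lt (B / c) hr
    have hm' : B / c < (S' / S) ^ (m + 1) :=
      hm.trans_le (pow_le_pow_right₀ hr.le (Nat.le_succ m))
    have h1 := hlow (m + 1) (by omega)
    rw [div_pow, div_lt_div_iff₀ hc0 (by positivity)] at hm'
    nlinarith

namespace Fld

/-! ### Vector fields -/

/-- The pointwise inner product of two vector fields. -/
def dot (a b : Fin 2 → Fld) : Fld := a 0 * b 0 + a 1 * b 1

/-- The pointwise squared length of the gradient of a vector field. -/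
def gsq (w : Fin 2 → Fld) : Fld :=
  dot (fun j => Dx 0 (w j)) (fun j => Dx 0 (w j)) + dot (fun j => Dx 1 (w j)) (fun j => Dx 1 (w j))

/-- The pointwise squared length of the second gradient of a vector field. -/
def hsq (w : Fin 2 → Fld) : Fld := gsq (fun j => Dx 0 (w j)) + gsq (fun j => Dx 1 (w j))

section inst
variable (a b : Fin 2 → Fld)

instance [∀ j, IsL2 (a j)] [∀ j, IsL2 (b j)] : IsL1 (dot a b) := by unfold dot; infer_instance
instance [∀ j, IsL2 (a j)] : IsL2 (dot a b) := by unfold dot; infer_instance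
instance [∀ j, IsL2 (a j)] : IsL1 (gsq a) := by unfold gsq; infer_instance
instance [∀ j, IsL2 (a j)] : IsL2 (gsq a) := by unfold gsq; infer_instance
instance [∀ j, IsL2 (a j)] : IsL1 (hsq a) := by unfold hsq; infer_instance

end inst

lemma Dx_one_zero (f : Fld) : Dx 1 (Dx 0 f) = Dx 0 (Dx 1 f) := D_comm _ _ _

lemma derivation_two (d : Derivation ℝ Fld Fld) : d 2 = 0 := by
  have := d.map_natCast 2
  simpa using this

lemma derivation_three (d : Derivation ℝ Fld Fld) : d 3 = 0 := by
  have := d.map_natCast 3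
  simpa using this

lemma Lap_D (a) (f : Fld) : Lap (D a f) = D a (Lap f) := by
  simp only [Lap, map_add]
  rw [D_comm a (some 0), D_comm a (some 1), D_comm a (some 0) f, D_comm a (some 1) f]

lemma Int_eq_of_sub_eq_div {A B : Fld} (w₀ w₁ : Fld) [IsL1 A] [IsL1 B] [IsL1 w₀] [IsL1 w₁]
    (h : A - B = Dx 0 w₀ + Dx 1 w₁) (t : ℝ) : Int A t = Int B t := by
  have h1 := Int_sub A B t
  rw [h, Int_add, Int_Dx, Int_Dx] at h1
  linarith

lemma dot_self_nonneg (w : Fin 2 → Fld) (t x) : 0 ≤ (dot w w).1 t x := by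
  rw [dot, add_val, mul_val, mul_val]
  exact add_nonneg (mul_self_nonneg _) (mul_self_nonneg _)

lemma gsq_nonneg (w : Fin 2 → Fld) (t x) : 0 ≤ (gsq w).1 t x := by
  rw [gsq, add_val]
  exact add_nonneg (dot_self_nonneg _ _ _) (dot_self_nonneg _ _ _)

lemma hsq_nonneg (w : Fin 2 → Fld) (t x) : 0 ≤ (hsq w).1 t x := by
  rw [hsq, add_val]
  exact add_nonneg (gsq_nonneg _ _ _) (gsq_nonneg _ _ _)

lemma Int_dot_nonneg (w : Fin 2 → Fld) (t : ℝ) : 0 ≤ Int (dot w w) t :=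
  Int_nonneg (dot_self_nonneg w t)
lemma Int_gsq_nonneg (w : Fin 2 → Fld) (t : ℝ) : 0 ≤ Int (gsq w) t := Int_nonneg (gsq_nonneg w t)
lemma Int_hsq_nonneg (w : Fin 2 → Fld) (t : ℝ) : 0 ≤ Int (hsq w) t := Int_nonneg (hsq_nonneg w t)

lemma sq_le_dot (w : Fin 2 → Fld) (j t x) : (w j).1 t x ^ 2 ≤ (dot w w).1 t x := by
  simp only [dot, add_val, mul_val]
  fin_cases j
  · simp only [Fin.zero_eta]; nlinarith [sq_nonneg ((w 1).1 t x)]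
  · simp only [Fin.mk_one]; nlinarith [sq_nonneg ((w 0).1 t x)]

lemma sq_le_gsq (w : Fin 2 → Fld) (k j t x) : (Dx k (w j)).1 t x ^ 2 ≤ (gsq w).1 t x := by
  have h0 := sq_le_dot (fun j => Dx 0 (w j)) j t x
  have h1 := sq_le_dot (fun j => Dx 1 (w j)) j t x
  have h2 := dot_self_nonneg (fun j => Dx 0 (w j)) t x
  have h3 := dot_self_nonneg (fun j => Dx 1 (w j)) t x
  simp only [gsq, add_val]
  fin_cases k
  · simp only [Fin.zero_eta]; linarith
  · simp only [Fin.mk_one]; linarith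

lemma sq_le_hsq (w : Fin 2 → Fld) (i k j t x) :
    (Dx i (Dx k (w j))).1 t x ^ 2 ≤ (hsq w).1 t x := by
  have h0 := sq_le_gsq (fun j => Dx 0 (w j)) i j t x
  have h1 := sq_le_gsq (fun j => Dx 1 (w j)) i j t x
  have h2 := gsq_nonneg (fun j => Dx 0 (w j)) t x
  have h3 := gsq_nonneg (fun j => Dx 1 (w j)) t x
  simp only [hsq, add_val]
  fin_cases k
  · simp only [Fin.zero_eta]; linarith
  · simp only [Fin.mk_one]; linarith

section
variable (w : Fin 2 → Fld) [∀ j, IsL2 (w j)]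

lemma Int_dot_self (t : ℝ) : Int (dot w w) t = Int (w 0 * w 0) t + Int (w 1 * w 1) t := by
  rw [dot, Int_add]

lemma Int_gsq (t : ℝ) : Int (gsq w) t = Nd (w 0) t + Nd (w 1) t := by
  rw [gsq, Int_add, Int_dot_self, Int_dot_self, Nd, Nd]; ring

lemma Int_hsq (t : ℝ) :
    Int (hsq w) t = Int (gsq fun j => Dx 0 (w j)) t + Int (gsq fun j => Dx 1 (w j)) t := by
  rw [hsq, Int_add]

lemma Int_sq_le_dot (j : Fin 2) (t : ℝ) : Int (w j * w j) t ≤ Int (dot w w) t :=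
  Int_mono fun x => by have := sq_le_dot w j t x; rw [mul_val]; linarith

lemma Int_sq_le_gsq (k j : Fin 2) (t : ℝ) :
    Int (Dx k (w j) * Dx k (w j)) t ≤ Int (gsq w) t :=
  Int_mono fun x => by have := sq_le_gsq w k j t x; rw [mul_val]; linarith

/-- The Laplacian controls all second derivatives. -/
lemma Int_hsq_eq (t : ℝ) :
    Int (hsq w) t = Int (dot (fun j => Lap (w j)) (fun j => Lap (w j))) t := by
  refine Int_eq_of_sub_eq_div
    (2 * (Dx 1 (w 0) * Dx 0 (Dx 1 (w 0)) + Dx 1 (w 1) * Dx 0 (Dx 1 (w 1))))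
    (-2 * (Dx 1 (w 0) * Dx 0 (Dx 0 (w 0)) + Dx 1 (w 1) * Dx 0 (Dx 0 (w 1)))) ?_ t
  simp only [hsq, gsq, dot, Lap, D_mul, map_add, map_neg, Dx_one_zero, derivation_two]
  ring

lemma Int_dot_Lap (t : ℝ) : Int (dot w (fun j => Lap (w j))) t = -Int (gsq w) t := by
  rw [← Int_neg]
  refine Int_eq_of_sub_eq_div (w 0 * Dx 0 (w 0) + w 1 * Dx 0 (w 1))
    (w 0 * Dx 1 (w 0) + w 1 * Dx 1 (w 1)) ?_ t
  simp only [gsq, dot, Lap, D_mul, map_add]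
  ring

end

/-- Ladyzhenskaya's inequality for vector fields and their gradients. -/
lemma exists_ladyzhenskaya : ∃ K : ℝ, 1 ≤ K ∧ ∀ (w : Fin 2 → Fld) [∀ j, IsL2 (w j)] (t : ℝ),
    Int (dot w w * dot w w) t ≤ K * (Int (dot w w) t * Int (gsq w) t) ∧
    Int (gsq w * gsq w) t ≤ K * (Int (gsq w) t * Int (hsq w) t) := by
  obtain ⟨K, hK, h⟩ := exists_gagliardo
  have h1 : ∀ (f : Fld) [IsL2 f] (t : ℝ), Int (f * f * (f * f)) t ≤ 4 * K * (Int (f * f) t * Nd f t) := by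
    intro f _ t
    have := h f 1 le_rfl t
    norm_num at this
    rw [show f * f * (f * f) = f ^ 4 by ring, show f * f = f ^ 2 by ring]
    linarith
  have hd : ∀ (w : Fin 2 → Fld) [∀ j, IsL2 (w j)] (t : ℝ),
      Int (dot w w * dot w w) t ≤ 8 * K * (Int (dot w w) t * Int (gsq w) t) := by
    intro w _ t
    have e1 : Int (dot w w * dot w w) t ≤
        Int ((2 : ℝ) • (w 0 * w 0 * (w 0 * w 0)) + (2 : ℝ) • (w 1 * w 1 * (w 1 * w 1))) t :=
      Int_mono fun x => by
        simp only [dot, add_val, mul_val, smul_val]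
        nlinarith [sq_nonneg ((w 0).1 t x * (w 0).1 t x - (w 1).1 t x * (w 1).1 t x)]
    rw [Int_add, Int_smul, Int_smul] at e1
    have e2 := h1 (w 0) t
    have e3 := h1 (w 1) t
    rw [Int_dot_self, Int_gsq]
    have a0 := Int_sq_nonneg (w 0) t
    have a1 := Int_sq_nonneg (w 1) t
    have b0 := Nd_nonneg (w 0) t
    have b1 := Nd_nonneg (w 1) t
    nlinarith [mul_nonneg a0 b1, mul_nonneg a1 b0, mul_nonneg (mul_nonneg a0 b1) (by linarith : 0 ≤ K),
      mul_nonneg (mul_nonneg a1 b0) (by linarith : 0 ≤ K)]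
  refine ⟨16 * K, by linarith, fun w _ t => ⟨(hd w t).trans ?_, ?_⟩⟩
  · have := mul_nonneg (Int_dot_nonneg w t) (Int_gsq_nonneg w t)
    nlinarith
  · set a := fun j => Dx 0 (w j)
    set b := fun j => Dx 1 (w j)
    have e1 : Int (gsq w * gsq w) t ≤
        Int ((2 : ℝ) • (dot a a * dot a a) + (2 : ℝ) • (dot b b * dot b b)) t :=
      Int_mono fun x => by
        simp only [gsq, add_val, mul_val, smul_val, a, b]
        nlinarith [sq_nonneg ((dot a a).1 t x - (dot b b).1 t x)]
    rw [Int_add, Int_smul, Int_smul] at e1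
    have e2 := hd a t
    have e3 := hd b t
    have e4 : Int (gsq w) t = Int (dot a a) t + Int (dot b b) t := by rw [gsq, Int_add]
    rw [Int_hsq, e4]
    have a0 := Int_dot_nonneg a t
    have a1 := Int_dot_nonneg b t
    have b0 := Int_gsq_nonneg a t
    have b1 := Int_gsq_nonneg b t
    nlinarith [mul_nonneg a0 b1, mul_nonneg a1 b0, mul_nonneg (mul_nonneg a0 b1) (by linarith : 0 ≤ K),
      mul_nonneg (mul_nonneg a1 b0) (by linarith : 0 ≤ K)]

end Fld

open Fld

/-- Smooth solutions of the inhomogeneous Navier-Stokes system, in the ring of fields. -/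
structure Flow where
  /-- density -/
  r : Fld
  /-- velocity -/
  u : Fin 2 → Fld
  /-- pressure gradient -/
  p : Fin 2 → Fld
  l2r : IsL2 (r - 1)
  l2u : ∀ j, IsL2 (u j)
  l2p : ∀ j, IsL2 (p j)
  div_u : Dx 0 (u 0) + Dx 1 (u 1) = 0
  curl_p : Dx 0 (p 1) = Dx 1 (p 0)
  mass : Dt r + u 0 * Dx 0 r + u 1 * Dx 1 r = 0
  momentum : ∀ j, r * (Dt (u j) + u 0 * Dx 0 (u j) + u 1 * Dx 1 (u j)) = Lap (u j) - p j
  init : ∀ x, |r.1 0 x - 1| ≤ 1 / 4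

namespace Flow

attribute [instance] Flow.l2r Flow.l2u Flow.l2p

variable (S : Flow)

/-- The material derivative. -/
def DD : Derivation ℝ Fld Fld := Dt + S.u 0 • Dx 0 + S.u 1 • Dx 1

lemma DD_apply (f : Fld) : S.DD f = Dt f + S.u 0 * Dx 0 f + S.u 1 * Dx 1 f := rfl

lemma DD_mul (f g : Fld) : S.DD (f * g) = f * S.DD g + S.DD f * g := by
  rw [Derivation.leibniz, smul_eq_mul, smul_eq_mul, mul_comm g]

instance (f : Fld) [IsL2 f] : IsL2 (S.DD f) := by rw [DD_apply]; infer_instance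
instance (f : Fld) [IsL1 f] : IsL1 (S.DD f) := by rw [DD_apply]; infer_instance

lemma DD_Dx (k : Fin 2) (f : Fld) : S.DD (Dx k f) =
    Dx k (S.DD f) - (Dx k (S.u 0) * Dx 0 f + Dx k (S.u 1) * Dx 1 f) := by
  simp only [DD_apply, map_add, D_mul]
  rw [D_comm (some k) none, D_comm (some k) (some 0), D_comm (some k) (some 1)]
  ring

lemma Dx_one_u_one : Dx 1 (S.u 1) = -Dx 0 (S.u 0) := by linear_combination S.div_u

lemma Dx_one_p_zero : Dx 1 (S.p 0) = Dx 0 (S.p 1) := S.curl_p.symm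

lemma Int_DD (f : Fld) [IsL1 f] (t : ℝ) : Int (S.DD f) t = Int (Dt f) t := by
  refine Int_eq_of_sub_eq_div (S.u 0 * f) (S.u 1 * f) ?_ t
  simp only [DD_apply, D_mul, Dx_one_u_one]
  ring

lemma hasDerivWithinAt_Int (f : Fld) [IsL1 f] {t : ℝ} (ht : 0 ≤ t) :
    HasDerivWithinAt (Int f) (Int (S.DD f) t) (Ici 0) t := by
  rw [Int_DD]; exact Fld.hasDerivWithinAt_Int f ht

/-- The acceleration. -/
def v (j : Fin 2) : Fld := S.DD (S.u j)

/-- The material derivative of the acceleration. -/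
def s (j : Fin 2) : Fld := S.DD (S.v j)

/-- The convective term. -/
def z (j : Fin 2) : Fld := S.u 0 * Dx 0 (S.u j) + S.u 1 * Dx 1 (S.u j)

instance (j) : IsL2 (S.v j) := by unfold v; infer_instance
instance (j) : IsL2 (S.s j) := by unfold s; infer_instance
instance (j) : IsL2 (S.z j) := by unfold z; infer_instance

lemma DD_r : S.DD S.r = 0 := S.mass

lemma DD_u (j) : S.DD (S.u j) = S.v j := rfl
lemma DD_v (j) : S.DD (S.v j) = S.s j := rfl

lemma v_eq (j) : S.v j = Dt (S.u j) + S.z j := by rw [v, DD_apply, z, add_assoc]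

lemma Lap_u (j) : Lap (S.u j) = S.r * S.v j + S.p j := by
  have := S.momentum j
  rw [← DD_apply, DD_u] at this
  linear_combination -this

/-! ### The density -/

lemma Int_pow_density (m : ℕ) (hm : m ≠ 0) {t : ℝ} (ht : 0 ≤ t) :
    Int (((S.r - 1) ^ 2) ^ m) t = Int (((S.r - 1) ^ 2) ^ m) 0 := by
  have h1 : IsL1 (((S.r - 1) ^ 2) ^ m) := isL1_pow _ hm
  have h2 : S.DD (((S.r - 1) ^ 2) ^ m) = 0 := by
    rw [Derivation.leibniz_pow, Derivation.leibniz_pow, map_sub, DD_r, Derivation.map_one_eq_zero]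
    simp
  have h3 := Int_sub_eq (((S.r - 1) ^ 2) ^ m) le_rfl ht
  simp only [← S.Int_DD, h2, Int_zero, intervalIntegral.integral_zero] at h3
  linarith

lemma sq_density_le {t : ℝ} (ht : 0 ≤ t) (x : Plane) : (S.r.1 t x - 1) ^ 2 ≤ 1 / 16 := by
  have key : ∀ x, ((S.r - 1) ^ 2).1 0 x ≤ 1 / 16 := fun x => by
    have := S.init x
    simp only [pow_val, sub_val, one_val]
    nlinarith [abs_nonneg (S.r.1 0 x - 1), sq_abs (S.r.1 0 x - 1)]
  have := le_of_integral_pow_le (g := ((S.r - 1) ^ 2).1 t) (((S.r - 1) ^ 2).continuous t)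
    (fun x => by simp only [pow_val]; positivity) (fun m hm => by
      have h1 : IsL1 (((S.r - 1) ^ 2) ^ m) := isL1_pow _ (by omega)
      exact (((S.r - 1) ^ 2) ^ m).integrable t) (B := 16 * Int ((S.r - 1) ^ 2) 0) (S := 1 / 16)
    (by norm_num) (fun m hm => ?_) x
  · simpa only [pow_val, sub_val, one_val] using this
  · have h1 : IsL1 (((S.r - 1) ^ 2) ^ m) := isL1_pow _ (by omega)
    have e1 := S.Int_pow_density m (by omega) ht
    have e2 : Int (((S.r - 1) ^ 2) ^ m) 0 ≤ Int ((1 / 16 : ℝ) ^ (m - 1) • (S.r - 1) ^ 2) 0 := by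
      refine Int_mono fun x => ?_
      rw [smul_val, pow_val]
      obtain ⟨n, rfl⟩ := Nat.exists_eq_add_of_le' hm
      rw [pow_succ, Nat.add_sub_cancel]
      have h0 : 0 ≤ ((S.r - 1) ^ 2).1 0 x := by simp only [pow_val]; positivity
      exact mul_le_mul_of_nonneg_right (pow_le_pow_left₀ h0 (key x) _) h0
    rw [Int_smul] at e2
    change Int (((S.r - 1) ^ 2) ^ m) t ≤ _
    obtain ⟨n, rfl⟩ := Nat.exists_eq_add_of_le' hm
    rw [e1, pow_succ (1 / 16 : ℝ) n]
    rw [Nat.add_sub_cancel] at e2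
    linarith

lemma density_bounds {t : ℝ} (ht : 0 ≤ t) (x : Plane) :
    3 / 4 ≤ S.r.1 t x ∧ S.r.1 t x ≤ 5 / 4 := by
  have := S.sq_density_le ht x
  constructor <;> nlinarith

/-! ### Energy quantities -/

/-- kinetic energy -/
def y (t : ℝ) : ℝ := Int (S.r * dot S.u S.u) t
/-- squared norm of the velocity gradient -/
def X (t : ℝ) : ℝ := Int (gsq S.u) t
/-- squared norm of the acceleration -/
def V (t : ℝ) : ℝ := Int (dot S.v S.v) t
/-- squared norm of the gradient of the acceleration -/
def N (t : ℝ) : ℝ := Int (gsq S.v) t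

lemma X_nonneg (t) : 0 ≤ S.X t := Int_gsq_nonneg _ _
lemma V_nonneg (t) : 0 ≤ S.V t := Int_dot_nonneg _ _
lemma N_nonneg (t) : 0 ≤ S.N t := Int_gsq_nonneg _ _

lemma Int_r_dot_le (w : Fin 2 → Fld) [∀ j, IsL2 (w j)] {t : ℝ} (ht : 0 ≤ t) :
    3 / 4 * Int (dot w w) t ≤ Int (S.r * dot w w) t ∧
      Int (S.r * dot w w) t ≤ 5 / 4 * Int (dot w w) t := by
  constructor
  · rw [← Int_smul]
    refine Int_mono fun x => ?_
    rw [smul_val, mul_val]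
    exact mul_le_mul_of_nonneg_right (S.density_bounds ht x).1 (dot_self_nonneg _ _ _)
  · rw [← Int_smul]
    refine Int_mono fun x => ?_
    rw [smul_val, mul_val]
    exact mul_le_mul_of_nonneg_right (S.density_bounds ht x).2 (dot_self_nonneg _ _ _)

lemma y_nonneg {t} (ht : 0 ≤ t) : 0 ≤ S.y t := by
  have := S.Int_r_dot_le S.u ht
  have := Int_dot_nonneg S.u t
  rw [y]; linarith

lemma hasDerivWithinAt_y {t : ℝ} (ht : 0 ≤ t) :
    HasDerivWithinAt S.y (-2 * S.X t) (Ici 0) t := by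
  have h := S.hasDerivWithinAt_Int (S.r * dot S.u S.u) ht
  refine h.congr_deriv ?_
  have e1 : S.DD (S.r * dot S.u S.u) =
      (2 : ℝ) • dot S.u (fun j => Lap (S.u j)) - (2 : ℝ) • (S.p 0 * S.u 0 + S.p 1 * S.u 1) := by
    simp only [dot, DD_mul, map_add, DD_r, DD_u, Lap_u, ofNat_smul_eq_nsmul, nsmul_eq_mul]
    push_cast
    ring
  rw [e1, Int_sub, Int_smul, Int_smul, Int_dot_Lap,
    Int_gradient_solenoidal _ _ _ _ S.curl_p S.div_u, X]
  ring

/-- The Stokes estimate. -/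
lemma stokes {t : ℝ} (ht : 0 ≤ t) :
    Int (hsq S.u) t + Int (dot S.p S.p) t ≤ 25 / 16 * S.V t := by
  have e1 : dot (fun j => S.r * S.v j) (fun j => S.r * S.v j) =
      (dot (fun j => Lap (S.u j)) (fun j => Lap (S.u j)) + dot S.p S.p) -
        (2 : ℝ) • (S.p 0 * Lap (S.u 0) + S.p 1 * Lap (S.u 1)) := by
    simp only [dot, Lap_u, ofNat_smul_eq_nsmul, nsmul_eq_mul]
    push_cast
    ring
  have hdiv : Dx 0 (Lap (S.u 0)) + Dx 1 (Lap (S.u 1)) = 0 := by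
    rw [← Lap_D, ← Lap_D, Dx_one_u_one]
    simp only [Lap, map_neg]; ring
  have e2 := congrArg (Int · t) e1
  rw [Int_sub, Int_add, Int_smul, Int_gradient_solenoidal _ _ _ _ S.curl_p hdiv,
    ← Int_hsq_eq] at e2
  have e3 : Int (dot (fun j => S.r * S.v j) (fun j => S.r * S.v j)) t ≤
      Int ((25 / 16 : ℝ) • dot S.v S.v) t := by
    refine Int_mono fun x => ?_
    have hr := S.density_bounds ht x
    have hr2 : S.r.1 t x ^ 2 ≤ 25 / 16 := by nlinarith
    simp only [dot, add_val, mul_val, smul_val]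
    nlinarith [sq_nonneg ((S.v 0).1 t x), sq_nonneg ((S.v 1).1 t x)]
  rw [Int_smul] at e3
  rw [V]; linarith

/-! ### First level -/

lemma Int_p_v (t : ℝ) : Int (dot S.p S.v) t = Int (dot S.p S.z) t := by
  have e1 : dot S.p S.v = dot S.p S.z + (S.p 0 * Dt (S.u 0) + S.p 1 * Dt (S.u 1)) := by
    simp only [dot, v_eq]; ring
  have hd : Dx 0 (Dt (S.u 0)) + Dx 1 (Dt (S.u 1)) = 0 := by
    rw [D_comm (some 0) none, D_comm (some 1) none, ← map_add, div_u, map_zero]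
  rw [e1, Int_add, Int_gradient_solenoidal _ _ _ _ S.curl_p hd, add_zero]

lemma hasDerivWithinAt_X {t : ℝ} (ht : 0 ≤ t) :
    HasDerivWithinAt S.X (-2 * Int (S.r * dot S.v S.v) t - 2 * Int (dot S.p S.z) t) (Ici 0) t := by
  refine (S.hasDerivWithinAt_Int (gsq S.u) ht).congr_deriv ?_
  have e1 : Int (S.DD (gsq S.u)) t =
      Int (-((2 : ℝ) • (S.r * dot S.v S.v)) - (2 : ℝ) • dot S.p S.v) t := by
    refine Int_eq_of_sub_eq_div
      ((2 : ℝ) • (Dx 0 (S.u 0) * S.v 0 + Dx 0 (S.u 1) * S.v 1))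
      ((2 : ℝ) • (Dx 1 (S.u 0) * S.v 0 + Dx 1 (S.u 1) * S.v 1)) ?_ t
    have h0 := S.Lap_u 0
    have h1 := S.Lap_u 1
    simp only [Lap] at h0 h1
    simp only [gsq, dot, DD_mul, map_add, DD_Dx, DD_u, ofNat_smul_eq_nsmul, nsmul_eq_mul,
      D_mul]
    push_cast
    simp only [derivation_two]
    have hd := S.Dx_one_u_one
    have hd' : Dx 1 (Dx 1 (S.u 1)) = -Dx 1 (Dx 0 (S.u 0)) := by rw [hd, map_neg]
    rw [hd'] at h1
    simp only [hd, map_neg]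
    linear_combination (-2 * S.v 0) * h0 + (- 2 * S.v 1) * h1
  rw [e1, Int_sub, Int_neg, Int_smul, Int_smul, Int_p_v]
  ring

end Flow

open Fld

lemma abs_le_young {I A B ε : ℝ} (hε : 0 < ε) (hA : 0 ≤ A) (hB : 0 ≤ B) (h : I ^ 2 ≤ A * B) :
    |I| ≤ ε * A + B / (4 * ε) := by
  refine abs_le_of_sq_le_sq (h.trans ?_) (by positivity)
  have : (ε * A + B / (4 * ε)) ^ 2 = (ε * A - B / (4 * ε)) ^ 2 + A * B := by field_simp; ring
  rw [this]; nlinarith [sq_nonneg (ε * A - B / (4 * ε))]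

lemma abs_sum_three_le (f : Fin 2 → Fin 2 → Fin 2 → ℝ) (c : ℝ) (h : ∀ j k l, |f j k l| ≤ c) :
    |∑ j, ∑ k, ∑ l, f j k l| ≤ 8 * c := by
  simp only [Fin.sum_univ_two]
  have g := fun j k l => abs_le.1 (h j k l)
  rw [abs_le]
  constructor <;>
  linarith [g 0 0 0, g 0 0 1, g 0 1 0, g 0 1 1, g 1 0 0, g 1 0 1, g 1 1 0, g 1 1 1]

namespace Fld

instance (f : Fin 2 → Fld) [h : ∀ i, IsL1 (f i)] : IsL1 (∑ i, f i) := by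
  rw [Fin.sum_univ_two]; infer_instance

lemma abs_Int_dot_le (a b : Fin 2 → Fld) [∀ j, IsL2 (a j)] [∀ j, IsL2 (b j)] {ε : ℝ} (hε : 0 < ε)
    (t : ℝ) : |Int (dot a b) t| ≤ ε * Int (dot a a) t + Int (dot b b) t / (4 * ε) := by
  have h : ∀ σ : ℝ, σ ^ 2 = 1 → 0 ≤ Int (ε • dot a a + (1 / (4 * ε)) • dot b b + σ • dot a b) t := by
    intro σ hσ
    refine Int_nonneg fun x => ?_
    simp only [dot, add_val, mul_val, smul_val]
    have : ∀ p q : ℝ, 0 ≤ ε * (p * p) + 1 / (4 * ε) * (q * q) + σ * (p * q) := fun p q => by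
      have e1 : ε * (p * p) + 1 / (4 * ε) * (q * q) + σ * (p * q) =
          ε * (p + σ * q / (2 * ε)) ^ 2 + (1 - σ ^ 2) * (q * q) / (4 * ε) := by field_simp; ring
      rw [e1, hσ]; simp; positivity
    have h0 := this ((a 0).1 t x) ((b 0).1 t x)
    have h1 := this ((a 1).1 t x) ((b 1).1 t x)
    linarith
  have h1 := h 1 (by norm_num)
  have h2 := h (-1) (by norm_num)
  rw [Int_add, Int_add, Int_smul, Int_smul, Int_smul] at h1 h2
  have e : Int (dot b b) t / (4 * ε) = 1 / (4 * ε) * Int (dot b b) t := by ring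
  rw [abs_le, e]
  constructor <;> linarith

end Fld

namespace Flow
variable (S : Flow)

lemma z_sq_le (t x) : (dot S.z S.z).1 t x ≤ (dot S.u S.u * gsq S.u).1 t x := by
  simp only [dot, gsq, z, add_val, mul_val]
  nlinarith [sq_nonneg ((S.u 0).1 t x * (Dx 1 (S.u 0)).1 t x - (S.u 1).1 t x * (Dx 0 (S.u 0)).1 t x),
    sq_nonneg ((S.u 0).1 t x * (Dx 1 (S.u 1)).1 t x - (S.u 1).1 t x * (Dx 0 (S.u 1)).1 t x)]

lemma Int_u_le {t : ℝ} (ht : 0 ≤ t) : Int (dot S.u S.u) t ≤ 4 / 3 * S.y t := by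
  have := (S.Int_r_dot_le S.u ht).1
  rw [y]; linarith

lemma exists_z_le : ∃ K : ℝ, 1 ≤ K ∧ ∀ (S : Flow) (t : ℝ), 0 ≤ t → ∀ η : ℝ, 0 < η →
    Int (dot S.z S.z) t ≤ η * S.V t + K / η * (S.y t * S.X t ^ 2) := by
  obtain ⟨K, hK, h⟩ := exists_ladyzhenskaya
  refine ⟨K ^ 2, by nlinarith, fun S t ht η hη => ?_⟩
  have h1 : Int (dot S.z S.z) t ≤ Int (dot S.u S.u * gsq S.u) t := Int_mono (S.z_sq_le t)
  have h2 := Int_mul_sq_le (dot S.u S.u) (gsq S.u) t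
  have h3 := (h S.u t).1
  have h4 := (h S.u t).2
  have h5 := S.stokes ht
  have h6 := Int_dot_nonneg S.p t
  have h7 := S.Int_u_le ht
  set Y := Int (dot S.u S.u) t
  have hY : 0 ≤ Y := Int_dot_nonneg S.u t
  have hX := S.X_nonneg t
  have hV := S.V_nonneg t
  have hH := Int_hsq_nonneg S.u t
  have hy := S.y_nonneg ht
  change _ ≤ K * (Y * S.X t) at h3
  change _ ≤ K * (S.X t * _) at h4
  have h8 : Int (dot S.u S.u * gsq S.u) t ^ 2 ≤ S.V t * (4 * K ^ 2 * (S.y t * S.X t ^ 2)) := by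
    calc _ ≤ _ := h2
      _ ≤ (K * (Y * S.X t)) * (K * (S.X t * Int (hsq S.u) t)) :=
        mul_le_mul h3 h4 (Int_sq_nonneg _ _) (by positivity)
      _ = K ^ 2 * S.X t ^ 2 * (Y * Int (hsq S.u) t) := by ring
      _ ≤ K ^ 2 * S.X t ^ 2 * ((4 / 3 * S.y t) * (25 / 16 * S.V t)) := by
        gcongr; linarith
      _ ≤ _ := by
        have : 0 ≤ K ^ 2 * S.X t ^ 2 * S.y t * S.V t := by positivity
        nlinarith
  have h9 := abs_le_young hη hV (by positivity) h8
  refine h1.trans ((le_abs_self _).trans (h9.trans (le_of_eq ?_)))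
  field_simp

lemma exists_p_z_le : ∃ K : ℝ, 1 ≤ K ∧ ∀ (S : Flow) (t : ℝ), 0 ≤ t →
    |Int (dot S.p S.z) t| ≤ S.V t / 8 + K * (S.y t * S.X t ^ 2) := by
  obtain ⟨K, hK, h⟩ := exists_z_le
  refine ⟨1024 * K, by linarith, fun S t ht => ?_⟩
  have h1 := abs_Int_dot_le S.p S.z (ε := 1 / 32) (by norm_num) t
  have h2 := h S t ht (1 / 128) (by norm_num)
  have h3 := S.stokes ht
  have h4 := Int_hsq_nonneg S.u t
  have hV := S.V_nonneg t
  norm_num at h1 h2 ⊢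
  nlinarith

/-- First energy level. -/
lemma exists_X_deriv_le : ∃ K : ℝ, 1 ≤ K ∧ ∀ (S : Flow) (t : ℝ), 0 ≤ t → ∃ X' : ℝ,
    HasDerivWithinAt S.X X' (Ici 0) t ∧ X' ≤ -S.V t + K * (S.y t * S.X t ^ 2) := by
  obtain ⟨K, hK, h⟩ := exists_p_z_le
  refine ⟨2 * K, by linarith, fun S t ht => ⟨_, S.hasDerivWithinAt_X ht, ?_⟩⟩
  have h1 := abs_le.1 (h S t ht)
  have h2 := (S.Int_r_dot_le S.v ht).1
  have hV := S.V_nonneg t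
  rw [← V] at h2
  nlinarith

/-! ### Second level -/

/-- The stretching of the acceleration. -/
def n (j : Fin 2) : Fld := S.v 0 * Dx 0 (S.u j) + S.v 1 * Dx 1 (S.u j)

instance (j) : IsL2 (S.n j) := by unfold n; infer_instance

lemma Dx_v (k j : Fin 2) : Dx k (S.v j) =
    S.DD (Dx k (S.u j)) + (Dx k (S.u 0) * Dx 0 (S.u j) + Dx k (S.u 1) * Dx 1 (S.u j)) := by
  rw [DD_Dx, DD_u]; ring

lemma div_v : Dx 0 (S.v 0) + Dx 1 (S.v 1) =
    2 * (Dx 0 (S.u 0) * Dx 0 (S.u 0) + Dx 0 (S.u 1) * Dx 1 (S.u 0)) := by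
  rw [Dx_v, Dx_v, Dx_one_u_one, map_neg]
  ring

lemma div_s : Dx 0 (S.s 0 - 3 * S.n 0) + Dx 1 (S.s 1 - 3 * S.n 1) = 0 := by
  have h := congrArg S.DD S.div_v
  simp only [map_add, DD_mul, derivation_two, DD_Dx, DD_u, DD_v] at h
  simp only [n, map_sub, map_add, D_mul, derivation_three, Dx_one_zero]
  have hd := S.Dx_one_u_one
  simp only [hd, map_neg, Dx_one_zero] at h ⊢
  linear_combination h + 2 * Dx 0 (S.u 0) * S.div_v

/-- The modified second-order energy density. -/
def zf : Fld := S.r * dot S.v S.v + 2 * dot S.p S.v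

instance : IsL1 S.zf := by unfold zf; infer_instance

lemma r_s (j) : S.r * S.s j = S.DD (Lap (S.u j)) - S.DD (S.p j) := by
  rw [Lap_u, map_add, DD_mul, DD_r, DD_v]; ring

/-- Cubic terms of the second-order energy identity. -/
def cubic : Fld := ∑ j, ∑ k, ∑ l, (2 * (Dx k (S.v j) * Dx k (S.u l) * Dx l (S.u j)) +
  2 * (Dx l (S.v j) * Dx k (S.u l) * Dx k (S.u j)) -
  6 * (Dx k (S.v l) * Dx l (S.u j) * Dx k (S.u j)) +
  3 * (Dx l (S.v l) * Dx k (S.u j) * Dx k (S.u j)))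

instance : IsL1 S.cubic := by
  unfold cubic; infer_instance

lemma Int_DD_zf (t : ℝ) : Int (S.DD S.zf) t =
    -2 * S.N t + Int S.cubic t - 6 * Int (S.r * dot S.n S.v) t := by
  have e1 : S.DD S.zf = (2 : ℝ) • dot S.v (fun j => S.DD (Lap (S.u j))) +
      (6 : ℝ) • dot S.p S.n + (2 : ℝ) • (S.p 0 * (S.s 0 - 3 * S.n 0) + S.p 1 * (S.s 1 - 3 * S.n 1)) := by
    simp only [zf, dot, DD_mul, map_add, DD_r, DD_v, derivation_two, ofNat_smul_eq_nsmul,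
      nsmul_eq_mul]
    push_cast
    linear_combination 2 * S.v 0 * S.r_s 0 + 2 * S.v 1 * S.r_s 1
  have e2 : dot S.p S.n = dot S.n (fun j => Lap (S.u j)) - S.r * dot S.n S.v := by
    simp only [dot, Lap_u]; ring
  have e3 : Int ((2 : ℝ) • dot S.v (fun j => S.DD (Lap (S.u j))) +
      (6 : ℝ) • dot S.n (fun j => Lap (S.u j))) t = Int (-((2 : ℝ) • gsq S.v) + S.cubic) t := by
    set W : Fin 2 → Fld := fun m =>
      2 * (S.v 0 * (Dx m (S.v 0) - Dx m (S.u 0) * Dx 0 (S.u 0) - Dx m (S.u 1) * Dx 1 (S.u 0)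
        - Dx 0 (S.u m) * Dx 0 (S.u 0) - Dx 1 (S.u m) * Dx 1 (S.u 0)) +
       S.v 1 * (Dx m (S.v 1) - Dx m (S.u 0) * Dx 0 (S.u 1) - Dx m (S.u 1) * Dx 1 (S.u 1)
        - Dx 0 (S.u m) * Dx 0 (S.u 1) - Dx 1 (S.u m) * Dx 1 (S.u 1))) +
      6 * (S.n 0 * Dx m (S.u 0) + S.n 1 * Dx m (S.u 1)) - 3 * (S.v m * gsq S.u) with hW
    have i : ∀ m, IsL1 (W m) := fun m => by simp only [hW]; infer_instance
    refine Int_eq_of_sub_eq_div (W 0) (W 1) ?_ t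
    have h6 : ∀ i, Dx i (6 : Fld) = 0 := fun i => by simpa using (Dx i).map_natCast 6
    have hd := S.Dx_one_u_one
    simp only [hW, n, cubic, Fin.sum_univ_two, gsq, dot, Lap, map_add, map_sub, DD_Dx, DD_u, D_mul,
      derivation_two, derivation_three, h6, Dx_one_zero, ofNat_smul_eq_nsmul, nsmul_eq_mul]
    push_cast
    simp only [hd, map_neg, Dx_one_zero]
    ring
  rw [e1, Int_add, Int_smul, Int_gradient_solenoidal _ _ _ _ S.curl_p S.div_s, e2, smul_sub,
    Int_add, Int_sub, ← add_sub_assoc, ← Int_add, e3, Int_add, Int_neg, Int_smul, Int_smul, N]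
  ring

end Flow

open Fld

namespace Fld

lemma abs_val_le_sqrt_dot (w : Fin 2 → Fld) (j t x) :
    |(w j).1 t x| ≤ √((dot w w).1 t x) := Real.abs_le_sqrt (sq_le_dot w j t x)

lemma abs_val_le_sqrt_gsq (w : Fin 2 → Fld) (k j t x) :
    |(Dx k (w j)).1 t x| ≤ √((gsq w).1 t x) := Real.abs_le_sqrt (sq_le_gsq w k j t x)

lemma two_val (t x) : (2 : Fld).1 t x = 2 := by
  rw [← one_add_one_eq_two, add_val, one_val]; norm_num

lemma three_val (t x) : (3 : Fld).1 t x = 3 := by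
  rw [← two_add_one_eq_three, add_val, two_val, one_val]; norm_num

lemma six_val (t x) : (6 : Fld).1 t x = 6 := by
  rw [show (6 : Fld) = 2 * 3 by norm_num, mul_val, two_val, three_val]; norm_num

lemma sum_val {ι : Type*} (s : Finset ι) (f : ι → Fld) (t x) :
    (∑ i ∈ s, f i).1 t x = ∑ i ∈ s, (f i).1 t x := by
  classical
  induction s using Finset.induction_on with
  | empty => simp
  | insert a s ha ih => rw [Finset.sum_insert ha, Finset.sum_insert ha, add_val, ih]

end Fld

lemma abs_mul_three_le {a b c α β γ : ℝ} (ha : |a| ≤ α) (hb : |b| ≤ β) (hc : |c| ≤ γ) :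
    |a * b * c| ≤ α * β * γ := by
  rw [abs_mul, abs_mul]
  have hα := (abs_nonneg a).trans ha
  have hβ := (abs_nonneg b).trans hb
  exact mul_le_mul (mul_le_mul ha hb (abs_nonneg b) hα) hc (abs_nonneg c) (mul_nonneg hα hβ)

namespace Flow
variable (S : Flow)

lemma cubic_le (t x) : S.cubic.1 t x ≤ (gsq S.v).1 t x + 2704 * (gsq S.u * gsq S.u).1 t x := by
  set α := √((gsq S.v).1 t x)
  set β := √((gsq S.u).1 t x)
  have hα : α ^ 2 = (gsq S.v).1 t x := Real.sq_sqrt (gsq_nonneg _ _ _)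
  have hβ : β ^ 2 = (gsq S.u).1 t x := Real.sq_sqrt (gsq_nonneg _ _ _)
  have h1 : |S.cubic.1 t x| ≤ 8 * (13 * (α * β * β)) := by
    simp only [cubic, sum_val]
    refine abs_sum_three_le _ _ fun j k l => ?_
    have a := fun k j => abs_val_le_sqrt_gsq S.v k j t x
    have b := fun k j => abs_val_le_sqrt_gsq S.u k j t x
    have c1 := abs_le.1 (abs_mul_three_le (a k j) (b k l) (b l j))
    have c2 := abs_le.1 (abs_mul_three_le (a l j) (b k l) (b k j))
    have c3 := abs_le.1 (abs_mul_three_le (a k l) (b l j) (b k j))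
    have c4 := abs_le.1 (abs_mul_three_le (a l l) (b k j) (b k j))
    simp only [add_val, sub_val, mul_val, two_val, three_val, six_val]
    rw [abs_le]
    constructor <;> linarith
  refine (le_abs_self _).trans (h1.trans ?_)
  rw [mul_val, ← hα, ← hβ]
  nlinarith [sq_nonneg (α - 52 * β ^ 2)]

/-- Second energy level. -/
lemma exists_zf_deriv_le : ∃ K : ℝ, 1 ≤ K ∧ ∀ (S : Flow) (t : ℝ), 0 ≤ t →
    HasDerivWithinAt (Int S.zf) (Int (S.DD S.zf) t) (Ici 0) t ∧
    Int (S.DD S.zf) t ≤ -S.N t / 2 + K * (S.X t * S.V t) := by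
  obtain ⟨K, hK, h⟩ := exists_ladyzhenskaya
  refine ⟨8000 * K, by linarith, fun S t ht => ⟨S.hasDerivWithinAt_Int _ ht, ?_⟩⟩
  have h1 : Int S.cubic t ≤ Int (gsq S.v + (2704 : ℝ) • (gsq S.u * gsq S.u)) t :=
    Int_mono fun x => by rw [add_val, smul_val]; exact S.cubic_le t x
  rw [Int_add, Int_smul, ← N] at h1
  have hX := S.X_nonneg t
  have hV := S.V_nonneg t
  have hN := S.N_nonneg t
  have hst := S.stokes ht
  have hp := Int_dot_nonneg S.p t
  have h2 : Int (gsq S.u * gsq S.u) t ≤ 2 * K * (S.X t * S.V t) := by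
    refine (h S.u t).2.trans ?_
    rw [← X]
    have : S.X t * Int (hsq S.u) t ≤ S.X t * (2 * S.V t) :=
      mul_le_mul_of_nonneg_left (by linarith) hX
    nlinarith
  have h3 : ∀ x, |(S.r * dot S.n S.v).1 t x| ≤ 5 * ((dot S.v S.v).1 t x * √((gsq S.u).1 t x)) := by
    intro x
    set β := √((gsq S.u).1 t x)
    have b := fun k j => abs_val_le_sqrt_gsq S.u k j t x
    have a := fun j => abs_val_le_sqrt_dot S.v j t x
    set α := √((dot S.v S.v).1 t x)
    have hα : α * α = (dot S.v S.v).1 t x := Real.mul_self_sqrt (dot_self_nonneg _ _ _)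
    have c := fun k j => abs_le.1 (abs_mul_three_le (a k) (a j) (b k j))
    have hr := S.density_bounds ht x
    have hd : |(dot S.n S.v).1 t x| ≤ 4 * (α * α * β) := by
      simp only [dot, n, add_val, mul_val]
      rw [abs_le]
      constructor <;> linarith [c 0 0, c 0 1, c 1 0, c 1 1]
    rw [mul_val, abs_mul, abs_of_nonneg (by linarith : 0 ≤ S.r.1 t x), ← hα]
    calc _ ≤ 5 / 4 * (4 * (α * α * β)) := mul_le_mul hr.2 hd (abs_nonneg _) (by norm_num)
      _ = _ := by ring
  have h4 : Int (S.r * dot S.n S.v) t ^ 2 ≤ S.N t * (100 * K * (S.X t * S.V t)) := by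
    have e1 : ∀ ε : ℝ, 0 < ε → |Int (S.r * dot S.n S.v) t| ≤
        5 * ε * Int (dot S.v S.v * dot S.v S.v) t + 5 * S.X t / (4 * ε) := by
      intro ε hε
      have e2 : |Int (S.r * dot S.n S.v) t| ≤
          Int ((5 * ε) • (dot S.v S.v * dot S.v S.v) + (5 / (4 * ε)) • gsq S.u) t := by
        refine (abs_integral_le_integral_abs).trans (integral_mono ?_ ?_ fun x => ?_)
        · exact ((S.r * dot S.n S.v).integrable t).abs
        · exact ((5 * ε) • (dot S.v S.v * dot S.v S.v) + (5 / (4 * ε)) • gsq S.u).integrable t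
        · refine (h3 x).trans ?_
          have hβ : √((gsq S.u).1 t x) ^ 2 = (gsq S.u).1 t x := Real.sq_sqrt (gsq_nonneg _ _ _)
          rw [add_val, smul_val, smul_val, mul_val]
          set β := √((gsq S.u).1 t x)
          set A := (dot S.v S.v).1 t x
          rw [← hβ]
          have : 5 * ε * (A * A) + 5 / (4 * ε) * β ^ 2 - 5 * (A * β) =
              5 * ε * (A - β / (2 * ε)) ^ 2 := by field_simp; ring
          have : 0 ≤ 5 * ε * (A - β / (2 * ε)) ^ 2 := by positivity
          linarith
      rw [Int_add, Int_smul, Int_smul] at e2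
      refine e2.trans (le_of_eq ?_)
      rw [X]; ring
    have e5 := (h S.v t).1
    rw [← V, ← N] at e5
    set I := |Int (S.r * dot S.n S.v) t|
    have e6 : I ^ 2 ≤ 25 * (Int (dot S.v S.v * dot S.v S.v) t * S.X t) := by
      set A := Int (dot S.v S.v * dot S.v S.v) t
      have hA : 0 ≤ A := Int_sq_nonneg _ _
      have hI : 0 ≤ I := abs_nonneg _
      rcases hA.eq_or_lt with h0 | h0
      · rw [← h0] at e1 ⊢
        have : I = 0 := by
          by_contra hne
          have hpos : 0 < I := lt_of_le_of_ne hI (Ne.symm hne)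
          have := e1 ((5 * S.X t + 1) / I) (by positivity)
          rw [mul_zero, zero_add, ← mul_div_assoc, div_div_eq_mul_div, le_div_iff₀ (by positivity)]
            at this
          nlinarith
        rw [this]; simp
      · rcases hX.eq_or_lt with hx | hx
        · rw [← hx] at e1 ⊢
          have : I = 0 := by
            by_contra hne
            have hpos : 0 < I := lt_of_le_of_ne hI (Ne.symm hne)
            have := e1 (I / (10 * A)) (by positivity)
            have e7 : 5 * (I / (10 * A)) * A = I / 2 := by field_simp; norm_num
            rw [e7] at this
            simp at this
            linarith
          rw [this]; simp
        · have hs : 0 < √(S.X t / A) := Real.sqrt_pos.2 (by positivity)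
          have hs2 : √(S.X t / A) ^ 2 = S.X t / A := Real.sq_sqrt (by positivity)
          have := e1 (√(S.X t / A) / 2) (by positivity)
          have e8 : 5 * (√(S.X t / A) / 2) * A + 5 * S.X t / (4 * (√(S.X t / A) / 2)) =
              5 * A * √(S.X t / A) := by
            field_simp
            rw [hs2]; field_simp; ring
          rw [e8] at this
          calc I ^ 2 ≤ (5 * A * √(S.X t / A)) ^ 2 := pow_le_pow_left₀ hI this 2
            _ = 25 * (A * S.X t) := by rw [mul_pow, hs2]; field_simp; norm_num
    rw [sq_abs] at e6
    refine e6.trans ?_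
    have : Int (dot S.v S.v * dot S.v S.v) t * S.X t ≤ K * (S.V t * S.N t) * S.X t :=
      mul_le_mul_of_nonneg_right e5 hX
    have : 0 ≤ K * (S.V t * S.N t) * S.X t := by positivity
    nlinarith
  have h5 := abs_le.1 (abs_le_young (ε := 1 / 12) (by norm_num) hN (by positivity) h4)
  rw [Int_DD_zf]
  norm_num at h5
  nlinarith [mul_nonneg (mul_nonneg hX hV) (by linarith : 0 ≤ K)]

end Flow

open Fld

namespace Fld

lemma Int_dot_le_of_abs_le {a : Fin 2 → Fld} [∀ j, IsL2 (a j)] {B : Fld} [IsL1 B] {t c : ℝ}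
    (h : ∀ j x, |(a j).1 t x| ^ 2 ≤ c * B.1 t x) : Int (dot a a) t ≤ 2 * c * Int B t := by
  rw [← Int_smul]
  refine Int_mono fun x => ?_
  have h0 := h 0 x
  have h1 := h 1 x
  rw [sq_abs] at h0 h1
  simp only [dot, add_val, mul_val, smul_val]
  linarith

end Fld

namespace Flow
variable (S : Flow)

/-- The material derivative of the pressure gradient, corrected to be curl free. -/
def q (j : Fin 2) : Fld := S.DD (S.p j) + Dx j (S.u 0) * S.p 0 + Dx j (S.u 1) * S.p 1

/-- The commutator in the equation for the acceleration. -/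
def h (j : Fin 2) : Fld := S.r * S.s j + S.q j - Lap (S.v j)

instance (j) : IsL2 (S.q j) := by unfold q; infer_instance
instance (j) : IsL2 (S.h j) := by unfold h; infer_instance

lemma Lap_v (j) : Lap (S.v j) = S.r * S.s j + S.q j - S.h j := by rw [h]; ring

lemma curl_q : Dx 0 (S.q 1) = Dx 1 (S.q 0) := by
  have h := congrArg S.DD S.curl_p
  simp only [DD_Dx] at h
  simp only [q, map_add, D_mul, Dx_one_zero]
  have hp := S.Dx_one_p_zero
  simp only [hp, S.Dx_one_u_one, map_neg] at h ⊢
  linear_combination h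

lemma h_eq (j) : S.h j = Dx j (S.u 0) * S.p 0 + Dx j (S.u 1) * S.p 1 -
    (Lap (S.u 0) * Dx 0 (S.u j) + Lap (S.u 1) * Dx 1 (S.u j)) -
    2 * (Dx 0 (S.u 0) * Dx 0 (Dx 0 (S.u j)) + Dx 0 (S.u 1) * Dx 0 (Dx 1 (S.u j)) +
      Dx 1 (S.u 0) * Dx 0 (Dx 1 (S.u j)) + Dx 1 (S.u 1) * Dx 1 (Dx 1 (S.u j))) := by
  rw [h, r_s, q]
  simp only [Lap, map_add, map_sub, DD_Dx, DD_u, D_mul, Dx_one_zero]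
  ring

lemma Int_DD_gsq_v (t : ℝ) : Int (S.DD (gsq S.v)) t =
    -2 * Int (S.r * dot S.s S.s) t - 6 * Int (dot S.q S.n) t + 2 * Int (dot S.h S.s) t
      - 2 * Int (∑ j, ∑ k, ∑ l, Dx k (S.v j) * Dx l (S.v j) * Dx k (S.u l)) t := by
  have e1 : Int (S.DD (gsq S.v)) t = Int (-((2 : ℝ) • dot S.s (fun j => Lap (S.v j))) -
      (2 : ℝ) • ∑ j, ∑ k, ∑ l, Dx k (S.v j) * Dx l (S.v j) * Dx k (S.u l)) t := by
    refine Int_eq_of_sub_eq_div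
      ((2 : ℝ) • (Dx 0 (S.v 0) * S.s 0 + Dx 0 (S.v 1) * S.s 1))
      ((2 : ℝ) • (Dx 1 (S.v 0) * S.s 0 + Dx 1 (S.v 1) * S.s 1)) ?_ t
    simp only [gsq, dot, Lap, Fin.sum_univ_two, DD_mul, map_add, DD_Dx, DD_v, ofNat_smul_eq_nsmul,
      nsmul_eq_mul, D_mul]
    push_cast
    simp only [derivation_two]
    ring
  have e2 : dot S.s (fun j => Lap (S.v j)) = (S.r * dot S.s S.s + (3 : ℝ) • dot S.q S.n) +
      (S.q 0 * (S.s 0 - 3 * S.n 0) + S.q 1 * (S.s 1 - 3 * S.n 1)) - dot S.h S.s := by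
    simp only [dot, Lap_v, ofNat_smul_eq_nsmul, nsmul_eq_mul]
    push_cast
    ring
  rw [e1, Int_sub, Int_neg, Int_smul, Int_smul, e2, Int_sub, Int_add,
    Int_gradient_solenoidal _ _ _ _ S.curl_q S.div_s, Int_add, Int_smul]
  ring

/-- The divergence of the acceleration. -/
def d : Fld := Dx 0 (S.v 0) + Dx 1 (S.v 1)

instance : IsL2 S.d := by unfold d; infer_instance

lemma Int_q_Lap_v (t : ℝ) :
    Int (dot S.q (fun j => Lap (S.v j))) t = Int (dot S.q (fun j => Dx j S.d)) t := by
  have e1 : dot S.q (fun j => Lap (S.v j)) = dot S.q (fun j => Dx j S.d) +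
      (S.q 0 * (Lap (S.v 0) - Dx 0 S.d) + S.q 1 * (Lap (S.v 1) - Dx 1 S.d)) := by
    simp only [dot]; ring
  have hd : Dx 0 (Lap (S.v 0) - Dx 0 S.d) + Dx 1 (Lap (S.v 1) - Dx 1 S.d) = 0 := by
    rw [map_sub, map_sub, ← Lap_D, ← Lap_D, d]
    simp only [Lap, map_add, Dx_one_zero]; ring
  rw [e1, Int_add, Int_gradient_solenoidal _ _ _ _ S.curl_q hd, add_zero]

section bounds
variable {S} {t L : ℝ}

lemma n_le (hL : ∀ k j x, |(Dx k (S.u j)).1 t x| ^ 2 ≤ L) : Int (dot S.n S.n) t ≤ 8 * L * S.V t := by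
  have : Int (dot S.n S.n) t ≤ 2 * (4 * L) * Int (dot S.v S.v) t := by
    refine Int_dot_le_of_abs_le fun j x => ?_
    have a := fun j => abs_val_le_sqrt_dot S.v j t x
    set α := √((dot S.v S.v).1 t x)
    have hα : α ^ 2 = (dot S.v S.v).1 t x := Real.sq_sqrt (dot_self_nonneg _ _ _)
    have b := fun k j => Real.abs_le_sqrt ((sq_abs _).symm.trans_le (hL k j x))
    have hL0 : 0 ≤ L := (sq_nonneg _).trans (hL 0 0 x)
    have hs : √L ^ 2 = L := Real.sq_sqrt hL0
    have c := fun k => abs_le.1 ((abs_mul _ _).trans_le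
      (mul_le_mul (a k) (b k j) (abs_nonneg _) ((abs_nonneg _).trans (a k))))
    have : |(S.n j).1 t x| ≤ 2 * (α * √L) := by
      simp only [n, add_val, mul_val]
      rw [abs_le]
      constructor <;> linarith [c 0, c 1]
    calc _ ≤ (2 * (α * √L)) ^ 2 := pow_le_pow_left₀ (abs_nonneg _) this 2
      _ = 4 * (√L ^ 2) * α ^ 2 := by ring
      _ = _ := by rw [hs, hα]
  rw [V]; linarith

lemma h_le (hL : ∀ k j x, |(Dx k (S.u j)).1 t x| ^ 2 ≤ L)
    (ht : 0 ≤ t) : Int (dot S.h S.h) t ≤ 800 * L * S.V t := by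
  have h1 : Int (dot S.h S.h) t ≤ 2 * (196 * L) * Int (hsq S.u + dot S.p S.p) t := by
    refine Int_dot_le_of_abs_le fun j x => ?_
    set B := (hsq S.u + dot S.p S.p).1 t x
    have hh := hsq_nonneg S.u t x
    have hp := dot_self_nonneg S.p t x
    have hB : 0 ≤ B := add_nonneg hh hp
    have hB' : B = (hsq S.u).1 t x + (dot S.p S.p).1 t x := rfl
    have a1 : ∀ i k j, |(Dx i (Dx k (S.u j))).1 t x| ≤ √B := fun i k j =>
      Real.abs_le_sqrt (by have := sq_le_hsq S.u i k j t x; linarith)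
    have a2 : ∀ j, |(S.p j).1 t x| ≤ √B := fun j =>
      Real.abs_le_sqrt (by have := sq_le_dot S.p j t x; linarith)
    have b := fun k j => Real.abs_le_sqrt ((sq_abs _).symm.trans_le (hL k j x))
    have hL0 : 0 ≤ L := (sq_nonneg _).trans (hL 0 0 x)
    have hs : √L ^ 2 = L := Real.sq_sqrt hL0
    have hs' : √B ^ 2 = B := Real.sq_sqrt hB
    have c1 := fun k l i m n => abs_le.1 ((abs_mul _ _).trans_le
      (mul_le_mul (b k l) (a1 i m n) (abs_nonneg _) (Real.sqrt_nonneg _)))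
    have c2 := fun k l m => abs_le.1 ((abs_mul _ _).trans_le
      (mul_le_mul (b k l) (a2 m) (abs_nonneg _) (Real.sqrt_nonneg _)))
    have : |(S.h j).1 t x| ≤ 14 * (√L * √B) := by
      rw [h_eq]
      simp only [Lap, add_val, sub_val, mul_val, two_val]
      rw [abs_le]
      constructor <;> linarith [c2 j 0 0, c2 j 1 1, c1 0 j 0 0 0, c1 0 j 1 1 0, c1 1 j 0 0 1,
        c1 1 j 1 1 1, c1 0 0 0 0 j, c1 0 1 0 1 j, c1 1 0 0 1 j, c1 1 1 1 1 j]
    calc _ ≤ (14 * (√L * √B)) ^ 2 := pow_le_pow_left₀ (abs_nonneg _) this 2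
      _ = 196 * (√L ^ 2) * √B ^ 2 := by ring
      _ = _ := by rw [hs, hs']
  have hst := S.stokes ht
  rw [Int_add] at h1
  have hL0 : 0 ≤ L := (sq_nonneg _).trans (hL 0 0 0)
  have := mul_le_mul_of_nonneg_left hst hL0
  have := mul_nonneg hL0 (S.V_nonneg t)
  linarith

lemma d_le (hL : ∀ k j x, |(Dx k (S.u j)).1 t x| ^ 2 ≤ L)
    (ht : 0 ≤ t) : Int (dot (fun j => Dx j S.d) (fun j => Dx j S.d)) t ≤ 300 * L * S.V t := by
  have h1 : Int (dot (fun j => Dx j S.d) (fun j => Dx j S.d)) t ≤ 2 * (64 * L) * Int (hsq S.u) t := by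
    refine Int_dot_le_of_abs_le fun j x => ?_
    set B := (hsq S.u).1 t x
    have hB : 0 ≤ B := hsq_nonneg S.u t x
    have a1 : ∀ i k j, |(Dx i (Dx k (S.u j))).1 t x| ≤ √B := fun i k j =>
      Real.abs_le_sqrt (sq_le_hsq S.u i k j t x)
    have b := fun k j => Real.abs_le_sqrt ((sq_abs _).symm.trans_le (hL k j x))
    have hL0 : 0 ≤ L := (sq_nonneg _).trans (hL 0 0 x)
    have hs : √L ^ 2 = L := Real.sq_sqrt hL0
    have hs' : √B ^ 2 = B := Real.sq_sqrt hB
    have c1 := fun k l i m n => abs_le.1 ((abs_mul _ _).trans_le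
      (mul_le_mul (b k l) (a1 i m n) (abs_nonneg _) (Real.sqrt_nonneg _)))
    have : |(Dx j S.d).1 t x| ≤ 8 * (√L * √B) := by
      rw [d, div_v]
      simp only [map_add, D_mul, derivation_two, add_val, mul_val, two_val, zero_val]
      rw [abs_le]
      constructor <;> linarith [c1 0 0 j 0 0, c1 0 1 j 1 0, c1 1 0 j 0 1]
    calc _ ≤ (8 * (√L * √B)) ^ 2 := pow_le_pow_left₀ (abs_nonneg _) this 2
      _ = 64 * (√L ^ 2) * √B ^ 2 := by ring
      _ = _ := by rw [hs, hs']
  have hst := S.stokes ht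
  have hp := Int_dot_nonneg S.p t
  have hL0 : 0 ≤ L := (sq_nonneg _).trans (hL 0 0 0)
  have := mul_le_mul_of_nonneg_left hst hL0
  have := mul_nonneg hL0 (S.V_nonneg t)
  have := mul_nonneg hL0 hp
  linarith

lemma hsq_v_le (hL : ∀ k j x, |(Dx k (S.u j)).1 t x| ^ 2 ≤ L)
    (ht : 0 ≤ t) : Int (hsq S.v) t + Int (dot S.q S.q) t / 2 ≤
    4 * Int (dot S.s S.s) t + 2200 * L * S.V t := by
  have e1 : dot (fun j => Lap (S.v j)) (fun j => Lap (S.v j)) =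
      dot (fun j => S.r * S.s j - S.h j) (fun j => S.r * S.s j - S.h j) +
      (2 : ℝ) • dot S.q (fun j => Lap (S.v j)) - dot S.q S.q := by
    simp only [dot, Lap_v, ofNat_smul_eq_nsmul, nsmul_eq_mul]
    push_cast
    ring
  have e2 : Int (dot (fun j => S.r * S.s j - S.h j) (fun j => S.r * S.s j - S.h j)) t ≤
      Int ((4 : ℝ) • dot S.s S.s + (2 : ℝ) • dot S.h S.h) t := by
    refine Int_mono fun x => ?_
    have hr := S.density_bounds ht x
    have hr2 : S.r.1 t x ^ 2 ≤ 25 / 16 := by nlinarith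
    simp only [dot, add_val, sub_val, mul_val, smul_val]
    have : ∀ a b : ℝ, (S.r.1 t x * a - b) * (S.r.1 t x * a - b) ≤ 4 * (a * a) + 2 * (b * b) :=
      fun a b => by nlinarith [sq_nonneg (S.r.1 t x * a + b), sq_nonneg a]
    linarith [this ((S.s 0).1 t x) ((S.h 0).1 t x), this ((S.s 1).1 t x) ((S.h 1).1 t x)]
  have e3 := abs_le.1 (abs_Int_dot_le S.q (fun j => Dx j S.d) (ε := 1 / 4) (by norm_num) t)
  have e4 := h_le hL ht
  have e5 := d_le hL ht
  rw [Int_add, Int_smul, Int_smul] at e2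
  rw [Int_hsq_eq, e1, Int_sub, Int_add, Int_smul, Int_q_Lap_v]
  norm_num at e3
  linarith

end bounds

/-- Third energy level. -/
lemma exists_N_deriv_le_of_gradient : ∃ K : ℝ, 1 ≤ K ∧ ∀ (S : Flow) (t L : ℝ), 0 ≤ t →
    (∀ k j x, |(Dx k (S.u j)).1 t x| ^ 2 ≤ L) →
    HasDerivWithinAt S.N (Int (S.DD (gsq S.v)) t) (Ici 0) t ∧
    Int (S.DD (gsq S.v)) t ≤ K * (S.X t * S.N t + L * S.V t) := by
  obtain ⟨K, hK, hlad⟩ := exists_ladyzhenskaya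
  refine ⟨2000 * K + 20000, by linarith, fun S t L ht hL => ⟨S.hasDerivWithinAt_Int _ ht, ?_⟩⟩
  have hX := S.X_nonneg t
  have hV := S.V_nonneg t
  have hN := S.N_nonneg t
  have hL0 : 0 ≤ L := (sq_nonneg _).trans (hL 0 0 0)
  have hH := Int_hsq_nonneg S.v t
  have hQ := Int_dot_nonneg S.q t
  have hS := Int_dot_nonneg S.s t
  have e1 := (S.Int_r_dot_le S.s ht).1
  have e2 := abs_le.1 (abs_Int_dot_le S.q S.n (ε := 1 / 192) (by norm_num) t)
  have e3 := abs_le.1 (abs_Int_dot_le S.h S.s (ε := 2) (by norm_num) t)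
  have e4 := n_le hL
  have e5 := h_le hL ht
  have e6 := hsq_v_le hL ht
  have e7 : |Int (∑ j, ∑ k, ∑ l, Dx k (S.v j) * Dx l (S.v j) * Dx k (S.u l)) t| ≤
      8 * (1 / 128 * Int (hsq S.v) t + (K * (S.X t * S.N t)) / (4 * (1 / 128))) := by
    have : Int (∑ j, ∑ k, ∑ l, Dx k (S.v j) * Dx l (S.v j) * Dx k (S.u l)) t =
        ∑ j, ∑ k, ∑ l, Int (Dx k (S.v j) * Dx l (S.v j) * Dx k (S.u l)) t := by
      simp only [Fin.sum_univ_two, Int_add]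
    rw [this]
    refine abs_sum_three_le _ _ fun j k l => ?_
    refine abs_le_young (by norm_num) hH (by positivity) ?_
    refine (Int_mul_sq_le _ _ t).trans ?_
    have f1 : Int (Dx k (S.v j) * Dx l (S.v j) * (Dx k (S.v j) * Dx l (S.v j))) t ≤
        Int (gsq S.v * gsq S.v) t := Int_mono fun x => by
      have g1 := sq_le_gsq S.v k j t x
      have g2 := sq_le_gsq S.v l j t x
      simp only [mul_val]
      calc _ = (Dx k (S.v j)).1 t x ^ 2 * (Dx l (S.v j)).1 t x ^ 2 := by ring
        _ ≤ _ := mul_le_mul g1 g2 (sq_nonneg _) ((sq_nonneg _).trans g1)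
    have f2 := Int_sq_le_gsq S.u k l t
    have f3 := (hlad S.v t).2
    rw [← N] at f3
    rw [← X] at f2
    calc _ ≤ Int (gsq S.v * gsq S.v) t * S.X t :=
          mul_le_mul f1 f2 (Int_sq_nonneg _ _) (Int_sq_nonneg _ _)
      _ ≤ K * (S.N t * Int (hsq S.v) t) * S.X t := mul_le_mul_of_nonneg_right f3 hX
      _ = _ := by ring
  have e8 := abs_le.1 e7
  rw [Int_DD_gsq_v]
  generalize Int (∑ j, ∑ k, ∑ l, Dx k (S.v j) * Dx l (S.v j) * Dx k (S.u l)) t = J at e8 ⊢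
  have p1 := mul_nonneg hL0 hV
  have p2 := mul_nonneg hX hN
  have p3 := mul_nonneg (by linarith : 0 ≤ K) p1
  have p4 := mul_nonneg (by linarith : 0 ≤ K) p2
  have d1 : ∀ a : ℝ, a / (4 * (1 / 192)) = 48 * a := fun a => by ring
  have d2 : ∀ a : ℝ, a / (4 * (1 / 128)) = 32 * a := fun a => by ring
  rw [d1] at e2
  rw [d2] at e8
  obtain ⟨e2, -⟩ := e2
  obtain ⟨-, e3⟩ := e3
  obtain ⟨e8, -⟩ := e8
  linarith

lemma exists_gradient_le : ∃ K : ℝ, 1 ≤ K ∧ ∀ (S : Flow) (t : ℝ), 0 ≤ t → ∀ k j x,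
    |(Dx k (S.u j)).1 t x| ^ 6 ≤ K * (S.X t * S.V t * S.N t) := by
  obtain ⟨C, hC, hst⟩ := exists_stokes_gradient
  obtain ⟨K, hK, hlad⟩ := exists_ladyzhenskaya
  refine ⟨C ^ 2 * (4 * K) + 1, by have : 0 ≤ C ^ 2 * (4 * K) := by positivity
                                  linarith, fun S t ht k j x => ?_⟩
  have hX := S.X_nonneg t
  have hV := S.V_nonneg t
  have hN := S.N_nonneg t
  have e1 := (hlad S.v t).1
  rw [← V, ← N] at e1
  set Q := 4 * (K * (S.V t * S.N t))
  have hQ : 0 ≤ Q := by positivity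
  set β := √(√Q)
  have hβ : β ^ 4 = Q := by
    calc β ^ 4 = (√(√Q) ^ 2) ^ 2 := by ring
      _ = Q := by rw [Real.sq_sqrt (Real.sqrt_nonneg _), Real.sq_sqrt hQ]
  have e2 : ∀ j, ∫ x, (S.r * S.v j).1 t x ^ 4 ≤ β ^ 4 := fun j => by
    rw [hβ]
    have : Int ((S.r * S.v j) * (S.r * S.v j) * ((S.r * S.v j) * (S.r * S.v j))) t ≤
        Int ((4 : ℝ) • (dot S.v S.v * dot S.v S.v)) t := Int_mono fun x => by
      have hr := S.density_bounds ht x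
      have g := sq_le_dot S.v j t x
      simp only [smul_val, mul_val]
      have hr2 : S.r.1 t x ^ 2 ≤ 2 := by nlinarith
      calc _ = (S.r.1 t x ^ 2 * S.r.1 t x ^ 2) * ((S.v j).1 t x ^ 2 * (S.v j).1 t x ^ 2) := by ring
        _ ≤ (2 * 2) * ((dot S.v S.v).1 t x * (dot S.v S.v).1 t x) :=
          mul_le_mul (mul_le_mul hr2 hr2 (sq_nonneg _) (by norm_num))
            (mul_le_mul g g (sq_nonneg _) ((sq_nonneg _).trans g)) (by positivity) (by norm_num)
        _ = _ := by ring
    rw [Int_smul] at this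
    have e : ∫ x, (S.r * S.v j).1 t x ^ 4 =
        Int ((S.r * S.v j) * (S.r * S.v j) * ((S.r * S.v j) * (S.r * S.v j))) t :=
      integral_congr_ae (Eventually.of_forall fun x => by simp only [mul_val]; ring)
    rw [e]; linarith
  have hα : √(S.X t) ^ 2 = S.X t := Real.sq_sqrt hX
  have e3 := hst S.u S.p (fun j => S.r * S.v j) inferInstance inferInstance inferInstance S.Lap_u
    S.div_u S.curl_p t (√(S.X t)) β (Real.sqrt_nonneg _) (Real.sqrt_nonneg _) e2 k j
    (hα.symm ▸ Int_sq_le_gsq S.u k j t) x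
  calc |(Dx k (S.u j)).1 t x| ^ 6 = (|(Dx k (S.u j)).1 t x| ^ 3) ^ 2 := by ring
    _ ≤ (C * (√(S.X t) * β ^ 2)) ^ 2 := pow_le_pow_left₀ (by positivity) e3 2
    _ = C ^ 2 * (√(S.X t) ^ 2 * β ^ 4) := by ring
    _ = C ^ 2 * (4 * K) * (S.X t * S.V t * S.N t) := by rw [hα, hβ]; simp only [Q]; ring
    _ ≤ _ := by
      refine mul_le_mul_of_nonneg_right (by linarith) (by positivity)

lemma exists_N_deriv_le : ∃ K : ℝ, 1 ≤ K ∧ ∀ (S : Flow) (t : ℝ), 0 ≤ t → ∃ N' : ℝ,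
    HasDerivWithinAt S.N N' (Ici 0) t ∧ N' ≤ K * (S.X t * S.N t + S.V t ^ 2) := by
  obtain ⟨K, hK, h⟩ := exists_N_deriv_le_of_gradient
  obtain ⟨K', hK', hg⟩ := exists_gradient_le
  refine ⟨K * (K' + 1), by nlinarith, fun S t ht => ?_⟩
  have hX := S.X_nonneg t
  have hV := S.V_nonneg t
  have hN := S.N_nonneg t
  set Q := K' * (S.X t * S.V t * S.N t)
  have hQ : 0 ≤ Q := by positivity
  set L := Q ^ ((1 : ℝ) / 3)
  have hL : L ^ 3 = Q := by
    rw [← Real.rpow_natCast, ← Real.rpow_mul hQ]; norm_num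
  have hL0 : 0 ≤ L := by positivity
  obtain ⟨h1, h2⟩ := h S t L ht fun k j x => by
    refine le_of_pow_le_pow_left₀ (n := 3) (by norm_num) hL0 ?_
    rw [hL, ← pow_mul]; exact hg S t ht k j x
  refine ⟨_, h1, h2.trans ?_⟩
  have h3 : L * S.V t ≤ K' * (S.X t * S.N t + S.V t ^ 2) := by
    refine le_of_pow_le_pow_left₀ (n := 3) (by norm_num) (by positivity) ?_
    set a := S.X t * S.N t
    set b := S.V t ^ 2
    have ha : 0 ≤ a := by positivity
    have hb : 0 ≤ b := by positivity
    calc (L * S.V t) ^ 3 = K' * (a * b * b) := by rw [mul_pow, hL]; simp only [Q, a, b]; ring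
      _ ≤ K' ^ 3 * (a + b) ^ 3 := by
        refine mul_le_mul ?_ ?_ (by positivity) (by positivity)
        · nlinarith [sq_nonneg (K' - 1), sq_nonneg K']
        · have : (a + b) ^ 3 = a * b * b + (a ^ 3 + 3 * a ^ 2 * b + 2 * a * b ^ 2 + b ^ 3) := by ring
          rw [this]
          have : 0 ≤ a ^ 3 + 3 * a ^ 2 * b + 2 * a * b ^ 2 + b ^ 3 := by positivity
          linarith
      _ = _ := by ring
  have h4 : 0 ≤ S.X t * S.N t := by positivity
  have h5 : 0 ≤ S.V t ^ 2 := by positivity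
  rw [mul_assoc]
  refine mul_le_mul_of_nonneg_left ?_ (by linarith)
  linarith

end Flow

open Fld

/-- A function on `[0, ∞)` with nonpositive derivative on `[a, b]` decreases from `a` to `b`. -/
lemma le_of_deriv_nonpos {f : ℝ → ℝ} {a b : ℝ} (ha : 0 ≤ a) (hab : a ≤ b)
    (h : ∀ t, a ≤ t → t ≤ b → ∃ d, HasDerivWithinAt f d (Ici 0) t ∧ d ≤ 0) : f b ≤ f a := by
  choose! d hd hd0 using fun t => (fun ht : t ∈ Icc a b => h t ht.1 ht.2)
  have hsub : Icc a b ⊆ Ici 0 := fun s hs => ha.trans hs.1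
  have := antitoneOn_of_hasDerivWithinAt_nonpos (f' := d) (convex_Icc a b)
    (fun t ht => ((hd t ht).mono hsub).continuousWithinAt)
    (fun t ht => (hd t (interior_subset ht)).mono (interior_subset.trans hsub))
    (fun t ht => hd0 t (interior_subset ht))
  exact this (left_mem_Icc.2 hab) (right_mem_Icc.2 hab) hab

/-- Energy hierarchy after absorption of the growth factors. -/
structure Levels (W : ℝ) (y X V N x z n : ℝ → ℝ) : Prop where
  one_le : 1 ≤ W
  y_zero_le : y 0 ≤ W
  y_nonneg : ∀ t, 0 ≤ t → 0 ≤ y t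
  X_nonneg : ∀ t, 0 ≤ t → 0 ≤ X t
  V_nonneg : ∀ t, 0 ≤ t → 0 ≤ V t
  N_nonneg : ∀ t, 0 ≤ t → 0 ≤ N t
  dy : ∀ t, 0 ≤ t → HasDerivWithinAt y (-2 * X t) (Ici 0) t
  dx : ∀ t, 0 ≤ t → ∃ d, HasDerivWithinAt x d (Ici 0) t ∧ d ≤ -V t
  dz : ∀ t, 0 ≤ t → ∃ d, HasDerivWithinAt z d (Ici 0) t ∧ d ≤ -N t
  dn : ∀ t, 0 ≤ t → ∃ d, HasDerivWithinAt n d (Ici 0) t ∧ d ≤ W * V t ^ 2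
  X_le : ∀ t, 0 ≤ t → X t ≤ x t
  x_le : ∀ t, 0 ≤ t → x t ≤ W * X t
  V_le : ∀ t, 0 ≤ t → V t + X t ^ 2 ≤ z t
  z_le : ∀ t, 0 ≤ t → z t ≤ W * (V t + X t ^ 2)
  N_le : ∀ t, 0 ≤ t → N t ≤ n t
  n_le : ∀ t, 0 ≤ t → n t ≤ W * N t

namespace Levels
variable {W : ℝ} {y X V N x z n : ℝ → ℝ}

lemma y_anti (l : Levels W y X V N x z n) {a b : ℝ} (ha : 0 ≤ a) (hab : a ≤ b) : y b ≤ y a :=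
  le_of_deriv_nonpos ha hab fun t h _ => ⟨_, l.dy t (ha.trans h), by
    linarith [l.X_nonneg t (ha.trans h)]⟩

lemma x_anti (l : Levels W y X V N x z n) {a b : ℝ} (ha : 0 ≤ a) (hab : a ≤ b) : x b ≤ x a :=
  le_of_deriv_nonpos ha hab fun t h _ => by
    obtain ⟨d, h1, h2⟩ := l.dx t (ha.trans h)
    exact ⟨d, h1, by linarith [l.V_nonneg t (ha.trans h)]⟩

lemma z_anti (l : Levels W y X V N x z n) {a b : ℝ} (ha : 0 ≤ a) (hab : a ≤ b) : z b ≤ z a :=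
  le_of_deriv_nonpos ha hab fun t h _ => by
    obtain ⟨d, h1, h2⟩ := l.dz t (ha.trans h)
    exact ⟨d, h1, by linarith [l.N_nonneg t (ha.trans h)]⟩

lemma x_nonneg (l : Levels W y X V N x z n)
    {t : ℝ} (ht : 0 ≤ t) : 0 ≤ x t := (l.X_nonneg t ht).trans (l.X_le t ht)

lemma V_le_z (l : Levels W y X V N x z n) {t : ℝ} (ht : 0 ≤ t) : V t ≤ z t := by
  have := l.V_le t ht
  nlinarith [sq_nonneg (X t)]

lemma z_nonneg (l : Levels W y X V N x z n)
    {t : ℝ} (ht : 0 ≤ t) : 0 ≤ z t := (l.V_nonneg t ht).trans (l.V_le_z ht)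

lemma n_mod_anti (l : Levels W y X V N x z n) {c a b : ℝ} (hc : 0 ≤ c) (hca : c ≤ a) (hab : a ≤ b) :
    n b + W * z c * x b ≤ n a + W * z c * x a :=
  le_of_deriv_nonpos (f := fun t => n t + W * z c * x t) (hc.trans hca) hab fun t h _ => by
    have ht : 0 ≤ t := (hc.trans hca).trans h
    obtain ⟨d, h1, h2⟩ := l.dn t ht
    obtain ⟨d', h1', h2'⟩ := l.dx t ht
    refine ⟨_, h1.add (h1'.const_mul (W * z c)), ?_⟩
    have hW := l.one_le
    have hz := l.z_nonneg hc
    have hV := l.V_nonneg t ht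
    have e1 : V t ≤ z c := (l.V_le_z ht).trans (l.z_anti hc (hca.trans h))
    have e2 : W * V t ^ 2 ≤ W * z c * V t := by
      rw [sq, ← mul_assoc]
      exact mul_le_mul_of_nonneg_right (mul_le_mul_of_nonneg_left e1 (by linarith)) hV
    have e3 : W * z c * d' ≤ W * z c * (-V t) := mul_le_mul_of_nonneg_left h2' (by positivity)
    linarith

lemma X_le_init (l : Levels W y X V N x z n) {t : ℝ} (ht : 0 ≤ t) : X t ≤ W * X 0 :=
  (l.X_le t ht).trans ((l.x_anti le_rfl ht).trans (l.x_le 0 le_rfl))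

lemma V_le_init (l : Levels W y X V N x z n) {t : ℝ} (ht : 0 ≤ t) : V t ≤ W * (V 0 + X 0 ^ 2) :=
  (l.V_le_z ht).trans ((l.z_anti le_rfl ht).trans (l.z_le 0 le_rfl))

lemma N_le_init (l : Levels W y X V N x z n)
    {t : ℝ} (ht : 0 ≤ t) : N t ≤ W ^ 3 * (N 0 + (V 0 + X 0 ^ 2) * X 0) := by
  have hW := l.one_le
  have h1 := l.n_mod_anti le_rfl le_rfl ht
  have h2 := l.N_le t ht
  have h3 := l.n_le 0 le_rfl
  have h4 := l.z_nonneg le_rfl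
  have h5 := l.x_nonneg ht
  have h6 : W * z 0 * x 0 ≤ W * (W * (V 0 + X 0 ^ 2)) * (W * X 0) :=
    mul_le_mul (mul_le_mul_of_nonneg_left (l.z_le 0 le_rfl) (by linarith)) (l.x_le 0 le_rfl)
      (l.x_nonneg le_rfl) (by have := l.V_nonneg 0 le_rfl; positivity)
  have h7 : 0 ≤ W * z 0 * x t := by positivity
  have h8 : W * N 0 ≤ W ^ 3 * N 0 :=
    mul_le_mul_of_nonneg_right (by nlinarith [sq_nonneg (W - 1)]) (l.N_nonneg 0 le_rfl)
  nlinarith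

/-! ### Decay from one level to the next -/

lemma x_decay (l : Levels W y X V N x z n) {t : ℝ} (ht : 0 ≤ t) : t * x t ≤ W * y (t / 2) := by
  have h2 : 0 ≤ t / 2 := by linarith
  have hW := l.one_le
  have := le_of_deriv_nonpos (f := fun τ => τ * x t + W / 2 * y τ) (a := t / 2) (b := t) h2
    (by linarith) fun τ h h' => ?_
  · have := l.y_nonneg t ht
    have := mul_nonneg (by linarith : 0 ≤ W) this
    linarith
  · have hτ : 0 ≤ τ := h2.trans h
    refine ⟨_, ((hasDerivWithinAt_id τ _).mul_const (x t)).add ((l.dy τ hτ).const_mul (W / 2)), ?_⟩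
    have := l.x_anti hτ h'
    have := l.x_le τ hτ
    linarith

lemma z_decay (l : Levels W y X V N x z n) {t : ℝ} (ht : 0 ≤ t) : t * z t ≤ 4 * W ^ 2 * x (t / 2) := by
  have h2 : 0 ≤ t / 2 := by linarith
  have hW := l.one_le
  have hx := l.x_nonneg h2
  have := le_of_deriv_nonpos (f := fun τ => τ * z t + (W * x τ + W / 2 * x (t / 2) * y τ))
    (a := t / 2) (b := t) h2 (by linarith) fun τ h h' => ?_
  · have h3 := l.y_nonneg t ht
    have h4 := l.x_nonneg ht
    have h5 : y (t / 2) ≤ W := (l.y_anti le_rfl h2).trans l.y_zero_le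
    have h6 : W / 2 * x (t / 2) * y (t / 2) ≤ W / 2 * x (t / 2) * W :=
      mul_le_mul_of_nonneg_left h5 (by positivity)
    have h7 : 0 ≤ W * x t + W / 2 * x (t / 2) * y t := by positivity
    have h8 : W * x (t / 2) ≤ W ^ 2 * x (t / 2) :=
      mul_le_mul_of_nonneg_right (by nlinarith) hx
    nlinarith
  · have hτ : 0 ≤ τ := h2.trans h
    obtain ⟨d, h3, h4⟩ := l.dx τ hτ
    refine ⟨_, ((hasDerivWithinAt_id τ _).mul_const (z t)).add
      ((h3.const_mul W).add ((l.dy τ hτ).const_mul (W / 2 * x (t / 2)))), ?_⟩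
    have h5 := l.z_anti hτ h'
    have h6 := l.z_le τ hτ
    have h7 := (l.X_le τ hτ).trans (l.x_anti h2 h)
    have h8 := mul_le_mul_of_nonneg_right h7 (l.X_nonneg τ hτ)
    have h9 := mul_le_mul_of_nonneg_left h8 (by linarith : 0 ≤ W)
    have h10 := mul_le_mul_of_nonneg_left h4 (by linarith : 0 ≤ W)
    nlinarith

lemma n_decay (l : Levels W y X V N x z n) {t : ℝ} (ht : 0 ≤ t) : t * N t ≤ 4 * W ^ 3 * z (t / 2) := by
  have h2 : 0 ≤ t / 2 := by linarith
  have hW := l.one_le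
  have hz := l.z_nonneg h2
  set m := n t + W * z (t / 2) * x t with hm
  have hmN : N t ≤ m := by
    have := l.N_le t ht
    have : 0 ≤ W * z (t / 2) * x t := by have := l.x_nonneg ht; positivity
    linarith
  have := le_of_deriv_nonpos (f := fun τ => τ * m + (W * z τ + W ^ 2 / 2 * z (t / 2) * y τ))
    (a := t / 2) (b := t) h2 (by linarith) fun τ h h' => ?_
  · have h3 := l.y_nonneg t ht
    have h4 := l.z_nonneg ht
    have h5 : y (t / 2) ≤ W := (l.y_anti le_rfl h2).trans l.y_zero_le
    have h6 : W ^ 2 / 2 * z (t / 2) * y (t / 2) ≤ W ^ 2 / 2 * z (t / 2) * W :=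
      mul_le_mul_of_nonneg_left h5 (by positivity)
    have h7 : 0 ≤ W * z t + W ^ 2 / 2 * z (t / 2) * y t := by positivity
    have h8 : W * z (t / 2) ≤ W ^ 3 * z (t / 2) :=
      mul_le_mul_of_nonneg_right (by nlinarith [sq_nonneg (W - 1)]) hz
    have h9 : t * N t ≤ t * m := mul_le_mul_of_nonneg_left hmN ht
    nlinarith
  · have hτ : 0 ≤ τ := h2.trans h
    obtain ⟨d, h3, h4⟩ := l.dz τ hτ
    refine ⟨_, ((hasDerivWithinAt_id τ _).mul_const m).add
      ((h3.const_mul W).add ((l.dy τ hτ).const_mul (W ^ 2 / 2 * z (t / 2)))), ?_⟩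
    have h5 := l.n_mod_anti h2 h h'
    have h6 := l.n_le τ hτ
    have h7 : W * z (t / 2) * x τ ≤ W * z (t / 2) * (W * X τ) :=
      mul_le_mul_of_nonneg_left (l.x_le τ hτ) (by positivity)
    have h10 := mul_le_mul_of_nonneg_left h4 (by linarith : 0 ≤ W)
    rw [← hm] at h5
    nlinarith

/-! ### Weighted integrals -/

/-- Functional controlling the time integral of `X + σ V + σ² N`, where `σ = t + t₁`. -/
lemma exists_weight (l : Levels W y X V N x z n)
    {t₁ : ℝ} (ht₁ : 0 < t₁) (h1 : t₁ * X 0 ≤ 1) (h2 : t₁ ^ 2 * (V 0 + X 0 ^ 2) ≤ W) :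
    ∃ F : ℝ → ℝ, (∀ t, 0 ≤ t → ∃ d, HasDerivWithinAt F d (Ici 0) t ∧
      d ≤ -(X t + (t + t₁) * V t + (t + t₁) ^ 2 * N t)) ∧ (∀ t, 0 ≤ t → 0 ≤ F t) ∧
      F 0 ≤ 20 * W ^ 4 ∧ ∀ t, 0 ≤ t → (t + t₁) ^ 2 * V t ≤ 20 * W ^ 4 := by
  have hW := l.one_le
  have hW0 : 0 ≤ W := by linarith
  have dσ : ∀ t, HasDerivWithinAt (fun t => t + t₁) 1 (Ici 0) t := fun t =>
    (hasDerivWithinAt_id t _).add_const t₁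
  set B := 2 * W ^ 2 with hB
  have hσx : ∀ t, 0 ≤ t → (t + t₁) * x t ≤ B := fun t ht => by
    have := le_of_deriv_nonpos (f := fun τ => (τ + t₁) * x τ + W / 2 * y τ) le_rfl ht fun τ hτ _ => ?_
    · have e1 := l.x_le 0 le_rfl
      have e2 := l.y_nonneg t ht
      have e3 := l.y_zero_le
      have e4 : t₁ * x 0 ≤ W := by nlinarith
      have e5 : 0 ≤ W / 2 * y t := by positivity
      have e6 : W / 2 * y 0 ≤ W / 2 * W := mul_le_mul_of_nonneg_left e3 (by positivity)
      simp only [zero_add] at this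
      nlinarith
    · obtain ⟨d, h3, h4⟩ := l.dx τ hτ
      refine ⟨_, ((dσ τ).mul h3).add ((l.dy τ hτ).const_mul (W / 2)), ?_⟩
      have e1 := l.x_le τ hτ
      have e2 := l.V_nonneg τ hτ
      have e3 : (τ + t₁) * d ≤ 0 := mul_nonpos_of_nonneg_of_nonpos (by linarith) (by linarith)
      linarith
  set a := 2 * W + 1
  set b := (a * W + 2 * W * B + 1) / 2
  set F : ℝ → ℝ := fun t => (t + t₁) ^ 2 * z t + (a * ((t + t₁) * x t) + b * y t) with hF
  have hF0 : F 0 ≤ 20 * W ^ 4 := by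
    have e1 := l.x_le 0 le_rfl
    have e3 := l.y_zero_le
    have e4 : t₁ * x 0 ≤ W := by nlinarith
    have e5 := l.z_le 0 le_rfl
    have e6 : t₁ ^ 2 * z 0 ≤ W * W := by
      calc t₁ ^ 2 * z 0 ≤ t₁ ^ 2 * (W * (V 0 + X 0 ^ 2)) :=
            mul_le_mul_of_nonneg_left e5 (by positivity)
        _ = W * (t₁ ^ 2 * (V 0 + X 0 ^ 2)) := by ring
        _ ≤ _ := mul_le_mul_of_nonneg_left h2 hW0
    simp only [hF, zero_add]
    have e7 : a * (t₁ * x 0) ≤ a * W := mul_le_mul_of_nonneg_left e4 (by positivity)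
    have e8 : b * y 0 ≤ b * W := mul_le_mul_of_nonneg_left e3 (by positivity)
    have p2 : W ≤ W ^ 2 := by nlinarith
    have p3 : W ^ 2 ≤ W ^ 3 := by nlinarith
    have p4 : W ^ 3 ≤ W ^ 4 := by nlinarith [sq_nonneg W]
    have : b * W = W ^ 3 + W ^ 2 / 2 + 2 * W ^ 4 + W / 2 := by simp only [b, a, hB]; ring
    have : a * W = 2 * W ^ 2 + W := by simp only [a]; ring
    nlinarith
  have hFd : ∀ t, 0 ≤ t → ∃ d, HasDerivWithinAt F d (Ici 0) t ∧
      d ≤ -(X t + (t + t₁) * V t + (t + t₁) ^ 2 * N t) := fun t ht => by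
    obtain ⟨d1, h3, h4⟩ := l.dx t ht
    obtain ⟨d2, h5, h6⟩ := l.dz t ht
    refine ⟨_, (((dσ t).pow 2).mul h5).add ((((dσ t).mul h3).const_mul a).add
      ((l.dy t ht).const_mul b)), ?_⟩
    have e1 : 0 ≤ t + t₁ := by linarith
    set σ := t + t₁
    have e2 : σ ^ 2 * d2 ≤ σ ^ 2 * (-N t) := mul_le_mul_of_nonneg_left h6 (by positivity)
    have e3 : a * (σ * d1) ≤ a * (σ * (-V t)) :=
      mul_le_mul_of_nonneg_left (mul_le_mul_of_nonneg_left h4 e1) (by positivity)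
    have e4 : σ * z t ≤ σ * (W * (V t + X t ^ 2)) := mul_le_mul_of_nonneg_left (l.z_le t ht) e1
    have e5 : σ * X t ≤ B := (mul_le_mul_of_nonneg_left (l.X_le t ht) e1).trans (hσx t ht)
    have e6 : W * (σ * X t * X t) ≤ W * (B * X t) :=
      mul_le_mul_of_nonneg_left (mul_le_mul_of_nonneg_right e5 (l.X_nonneg t ht)) hW0
    have e7 : a * x t ≤ a * (W * X t) := mul_le_mul_of_nonneg_left (l.x_le t ht) (by positivity)
    have e8 : b * (-2 * X t) = -(a * W + 2 * W * B + 1) * X t := by simp only [b]; ring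
    have e9 : a * (σ * (-V t)) = -(2 * W + 1) * (σ * V t) := by simp only [a]; ring
    push_cast
    simp only [pow_one, mul_one, one_mul, Pi.pow_apply]
    linarith
  have hFn : ∀ t, 0 ≤ t → (t + t₁) ^ 2 * V t ≤ F t := fun t ht => by
    have e1 := l.x_nonneg ht
    have e2 := l.y_nonneg t ht
    have e3 : 0 ≤ a * ((t + t₁) * x t) + b * y t := by positivity
    have e4 : (t + t₁) ^ 2 * V t ≤ (t + t₁) ^ 2 * z t :=
      mul_le_mul_of_nonneg_left (l.V_le_z ht) (by positivity)
    simp only [hF]; linarith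
  refine ⟨F, hFd, fun t ht => le_trans ?_ (hFn t ht), hF0, fun t ht => (hFn t ht).trans ?_⟩
  · have := l.V_nonneg t ht; positivity
  · refine le_trans (le_of_deriv_nonpos le_rfl ht fun τ hτ _ => ?_) hF0
    obtain ⟨d, h3, h4⟩ := hFd τ hτ
    refine ⟨d, h3, h4.trans ?_⟩
    have e1 := l.X_nonneg τ hτ
    have e2 := l.V_nonneg τ hτ
    have e3 := l.N_nonneg τ hτ
    have : 0 ≤ X τ + (τ + t₁) * V τ + (τ + t₁) ^ 2 * N τ := by positivity
    linarith

end Levels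

lemma Flow.y_le_init (S : Flow) {t : ℝ} (ht : 0 ≤ t) : S.y t ≤ S.y 0 :=
  le_of_deriv_nonpos le_rfl ht fun t h _ => ⟨_, S.hasDerivWithinAt_y h, by
    linarith [S.X_nonneg t]⟩

lemma exists_levels (M : ℝ) (hM : 0 ≤ M) : ∃ W : ℝ, ∀ S : Flow, S.y 0 ≤ M →
    ∃ x z n : ℝ → ℝ, Levels W S.y S.X S.V S.N x z n := by
  obtain ⟨K1, hK1, h1⟩ := Flow.exists_X_deriv_le
  obtain ⟨K2, hK2, h2⟩ := Flow.exists_zf_deriv_le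
  obtain ⟨K3, hK3, h3⟩ := Flow.exists_N_deriv_le
  obtain ⟨K4, hK4, h4⟩ := Flow.exists_p_z_le
  set B := 2 * K4 * M + 1 with hB
  have hB1 : 1 ≤ B := by have : 0 ≤ K4 * M := by positivity
                         linarith
  set A := K1 * M + 2 * (K2 + 2 * B * (K1 * M)) + K3 with hA
  have hA0 : 0 ≤ A := by positivity
  set c := Real.exp (A / 2 * M) with hc
  have hc1 : 1 ≤ c := Real.one_le_exp (by positivity)
  set W := c * (2 * (2 + 2 * K4 * M + B) + K3 + M) with hW
  have hWl : 2 * (2 + 2 * K4 * M + B) + K3 + M ≤ W :=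
    le_mul_of_one_le_left (by positivity) hc1
  have hKM : 0 ≤ K4 * M := by positivity
  have hcW : c ≤ W := by
    rw [hW]; exact le_mul_of_one_le_right (by linarith) (by linarith)
  refine ⟨W, fun S hS => ?_⟩
  set w : ℝ → ℝ := fun t => Real.exp (A / 2 * S.y t) with hw
  have hw1 : ∀ t, 0 ≤ t → 1 ≤ w t := fun t ht =>
    Real.one_le_exp (mul_nonneg (by positivity) (S.y_nonneg ht))
  have hwc : ∀ t, 0 ≤ t → w t ≤ c := fun t ht =>
    Real.exp_le_exp.2 (mul_le_mul_of_nonneg_left ((S.y_le_init ht).trans hS) (by positivity))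
  have dw : ∀ t, 0 ≤ t → HasDerivWithinAt w (-(A * S.X t * w t)) (Ici 0) t := fun t ht => by
    refine (((S.hasDerivWithinAt_y ht).const_mul (A / 2)).exp).congr_deriv ?_
    simp only [hw]; ring
  have hyM : ∀ t, 0 ≤ t → S.y t ≤ M := fun t ht => (S.y_le_init ht).trans hS
  have hzf : ∀ t, 0 ≤ t → (S.V t + S.X t ^ 2) / 2 ≤ Int S.zf t + B * S.X t ^ 2 ∧
      Int S.zf t + B * S.X t ^ 2 ≤ (2 + 2 * K4 * M + B) * (S.V t + S.X t ^ 2) := fun t ht => by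
    have e1 := S.Int_r_dot_le S.v ht
    rw [← Flow.V] at e1
    have e2 := abs_le.1 (h4 S t ht)
    have e3 : Int S.zf t = Int (S.r * dot S.v S.v) t + 2 * Int (dot S.p S.z) t := by
      rw [Flow.zf, Int_add, ← S.Int_p_v]; congr 1; exact integral_const_mul _ _
    have hX2 := sq_nonneg (S.X t)
    have hV := S.V_nonneg t
    have e4 : K4 * (S.y t * S.X t ^ 2) ≤ K4 * (M * S.X t ^ 2) :=
      mul_le_mul_of_nonneg_left (mul_le_mul_of_nonneg_right (hyM t ht) hX2) (by linarith)
    have e5 : B * S.X t ^ 2 = 2 * (K4 * (M * S.X t ^ 2)) + S.X t ^ 2 := by rw [hB]; ring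
    have e6 : 0 ≤ K4 * M * S.V t := by positivity
    have e7 : 0 ≤ B * S.V t := by positivity
    have e8 : 0 ≤ K4 * (M * S.X t ^ 2) := by positivity
    rw [e3]
    constructor <;> linarith
  have hXd : ∀ t, 0 ≤ t → ∃ X' : ℝ, HasDerivWithinAt S.X X' (Ici 0) t ∧
      X' ≤ -S.V t + K1 * M * S.X t ^ 2 := fun t ht => by
    obtain ⟨d, e1, e2⟩ := h1 S t ht
    refine ⟨d, e1, e2.trans ?_⟩
    have := mul_le_mul_of_nonneg_left (mul_le_mul_of_nonneg_right (hyM t ht) (sq_nonneg (S.X t)))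
      (by linarith : 0 ≤ K1)
    linarith
  have hKM1 : 0 ≤ K1 * M := by positivity
  have hBK : 0 ≤ B * (K1 * M) := by positivity
  refine ⟨fun t => w t * S.X t, fun t => 2 * (w t * (Int S.zf t + B * S.X t ^ 2)),
    fun t => w t * S.N t, ?_⟩
  have wmul : ∀ t, 0 ≤ t → ∀ a : ℝ, 0 ≤ a → a ≤ w t * a ∧ w t * a ≤ c * a := fun t ht a ha =>
    ⟨le_mul_of_one_le_left ha (hw1 t ht), mul_le_mul_of_nonneg_right (hwc t ht) ha⟩
  constructor
  · linarith
  · linarith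
  · exact fun t ht => S.y_nonneg ht
  · exact fun t _ => S.X_nonneg t
  · exact fun t _ => S.V_nonneg t
  · exact fun t _ => S.N_nonneg t
  · exact fun t ht => S.hasDerivWithinAt_y ht
  · intro t ht
    obtain ⟨d, e1, e2⟩ := hXd t ht
    refine ⟨_, (dw t ht).mul e1, ?_⟩
    have hX2 := sq_nonneg (S.X t)
    have e3 : d - A * S.X t ^ 2 ≤ -S.V t := by
      have : K1 * M * S.X t ^ 2 ≤ A * S.X t ^ 2 := mul_le_mul_of_nonneg_right (by linarith) hX2
      linarith
    have e4 := mul_le_mul_of_nonneg_left e3 (by linarith [hw1 t ht] : 0 ≤ w t)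
    have e5 := (wmul t ht _ (S.V_nonneg t)).1
    linarith
  · intro t ht
    obtain ⟨d, e1, e2⟩ := hXd t ht
    obtain ⟨e3, e4⟩ := h2 S t ht
    refine ⟨2 * (w t * (Int (S.DD S.zf) t + B * (2 * S.X t * d) -
      A * S.X t * (Int S.zf t + B * S.X t ^ 2))),
      (((dw t ht).mul (e3.add ((e1.pow 2).const_mul B))).const_mul 2).congr_deriv ?_, ?_⟩
    · simp only [Nat.cast_ofNat, Nat.add_one_sub_one, pow_one, Pi.add_apply, Pi.pow_apply]
      ring
    obtain ⟨e5, e6⟩ := hzf t ht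
    have hX := S.X_nonneg t
    have hV := S.V_nonneg t
    have hN := S.N_nonneg t
    set Z := Int S.zf t + B * S.X t ^ 2
    have e7 : Int (S.DD S.zf) t + B * (2 * S.X t * d) - A * S.X t * Z ≤ -S.N t / 2 := by
      have f1 : B * (2 * S.X t * d) ≤ B * (2 * S.X t * (-S.V t + K1 * M * S.X t ^ 2)) :=
        mul_le_mul_of_nonneg_left (mul_le_mul_of_nonneg_left e2 (by positivity)) (by linarith)
      have f2 : S.X t * ((S.V t + S.X t ^ 2) / 2) ≤ S.X t * Z := mul_le_mul_of_nonneg_left e5 hX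
      have f3 : 2 * (K2 + 2 * B * (K1 * M)) * (S.X t * Z) ≤ A * (S.X t * Z) :=
        mul_le_mul_of_nonneg_right (by linarith) (by
          have : 0 ≤ S.X t * ((S.V t + S.X t ^ 2) / 2) := by positivity
          linarith)
      have f4 := mul_le_mul_of_nonneg_left f2
        (by positivity : 0 ≤ 2 * (K2 + 2 * B * (K1 * M)))
      have f5 : 0 ≤ B * (S.X t * S.V t) := by positivity
      have f6 : 0 ≤ B * (K1 * M) * (S.X t * S.V t) := by positivity
      have f7 : 0 ≤ K2 * (S.X t * S.X t ^ 2) := by positivity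
      linarith
    have e8 := mul_le_mul_of_nonneg_left e7 (by linarith [hw1 t ht] : 0 ≤ w t)
    have e9 := (wmul t ht _ hN).1
    linarith
  · intro t ht
    obtain ⟨d, e1, e2⟩ := h3 S t ht
    refine ⟨_, (dw t ht).mul e1, ?_⟩
    have hX := S.X_nonneg t
    have hN := S.N_nonneg t
    have e3 : d - A * S.X t * S.N t ≤ K3 * S.V t ^ 2 := by
      have : K3 * (S.X t * S.N t) ≤ A * (S.X t * S.N t) :=
        mul_le_mul_of_nonneg_right (by linarith) (by positivity)
      linarith
    have e4 := mul_le_mul_of_nonneg_left e3 (by linarith [hw1 t ht] : 0 ≤ w t)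
    have e5 := (wmul t ht (K3 * S.V t ^ 2) (by positivity)).2
    have e6 : c * (K3 * S.V t ^ 2) ≤ W * S.V t ^ 2 := by
      rw [← mul_assoc]
      refine mul_le_mul_of_nonneg_right ?_ (sq_nonneg _)
      rw [hW]; exact mul_le_mul_of_nonneg_left (by linarith) (by linarith)
    linarith
  · exact fun t ht => (wmul t ht _ (S.X_nonneg t)).1
  · exact fun t ht => (wmul t ht _ (S.X_nonneg t)).2.trans
      (mul_le_mul_of_nonneg_right hcW (S.X_nonneg t))
  · intro t ht
    have e1 := (hzf t ht).1
    have e2 : 0 ≤ S.V t + S.X t ^ 2 := by have := S.V_nonneg t; positivity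
    have e3 := (wmul t ht (Int S.zf t + B * S.X t ^ 2) (by linarith)).1
    linarith
  · intro t ht
    have e1 := hzf t ht
    have e2 : 0 ≤ S.V t + S.X t ^ 2 := by have := S.V_nonneg t; positivity
    have e3 := (wmul t ht (Int S.zf t + B * S.X t ^ 2) (by linarith)).2
    have e4 := mul_le_mul_of_nonneg_left e1.2 (by linarith : 0 ≤ c)
    have e5 : c * (2 * (2 + 2 * K4 * M + B)) ≤ W := by
      rw [hW]; exact mul_le_mul_of_nonneg_left (by linarith) (by linarith)
    have e6 := mul_le_mul_of_nonneg_right e5 e2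
    linarith
  · exact fun t ht => (wmul t ht _ (S.N_nonneg t)).1
  · exact fun t ht => (wmul t ht _ (S.N_nonneg t)).2.trans
      (mul_le_mul_of_nonneg_right hcW (S.N_nonneg t))

/-! ### Gaussian averages of fields -/

lemma PolyG.continuous_avg {k : Plane → ℝ} (hk : PolyG k) {f : Plane → ℝ} (hf : Continuous f)
    {B : ℝ} (hB : ∀ x, |f x| ≤ B) : Continuous fun q : ℝ × Plane => avg k q.1 f q.2 := by
  have ck := hk.continuous
  refine continuous_of_dominated (bound := fun z => |k z| * B)
    (fun q => by fun_prop) (fun q => Eventually.of_forall fun z => ?_)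
    (hk.integrable.abs.mul_const B) (Eventually.of_forall fun z => by fun_prop)
  rw [norm_mul, Real.norm_eq_abs, Real.norm_eq_abs]
  exact mul_le_mul_of_nonneg_left (hB _) (abs_nonneg _)

lemma integrable_gs_mul_shift {F : Plane → ℝ} (cF : Continuous F) (hF : Integrable F) (r : ℝ) :
    Integrable (fun q : Plane × Plane => gs q.2 * F (q.1 + r • q.2)) (volume.prod volume) := by
  have cg := PolyG.gs.continuous
  have hm : AEStronglyMeasurable (fun q : Plane × Plane => gs q.2 * F (q.1 + r • q.2))
      ((volume : Measure Plane).prod (volume : Measure Plane)) := by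
    have : Continuous (fun q : Plane × Plane => gs q.2 * F (q.1 + r • q.2)) := by fun_prop
    exact this.aestronglyMeasurable
  rw [integrable_prod_iff' hm]
  refine ⟨Eventually.of_forall fun z => ?_, ?_⟩
  · change Integrable (fun x => gs z * F (x + r • z))
    exact (hF.comp_add_right (r • z)).const_mul _
  have : (fun z : Plane => ∫ x : Plane, ‖gs z * F (x + r • z)‖) = fun z => gs z * ∫ x, |F x| := by
    funext z
    simp only [norm_mul, Real.norm_eq_abs, abs_of_pos (gs_pos z)]
    rw [integral_const_mul, integral_add_right_eq_self (fun x => |F x|) (r • z)]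
  rw [this]
  exact PolyG.gs.integrable.mul_const _

lemma integral_avg_gs {F : Plane → ℝ} (cF : Continuous F) (hF : Integrable F) (r : ℝ) :
    Integrable (avg gs r F) ∧ ∫ x, avg gs r F x = ∫ x, F x := by
  have h := integrable_gs_mul_shift cF hF r
  refine ⟨h.integral_prod_left, ?_⟩
  have := integral_integral_swap (f := fun x z => gs z * F (x + r • z)) h
  simp only [avg]
  rw [this]
  have h1 : ∀ z : Plane, ∫ x, gs z * F (x + r • z) = gs z * ∫ x, F x := fun z => by
    rw [integral_const_mul, integral_add_right_eq_self F]
  simp only [h1]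
  rw [integral_mul_const, integral_gs, one_mul]

lemma avg_gs_sq_le {f : Plane → ℝ} (cf : Continuous f) {B : ℝ} (hB : ∀ x, |f x| ≤ B) (r : ℝ)
    (x : Plane) : avg gs r f x ^ 2 ≤ avg gs r (fun y => f y ^ 2) x := by
  have cg := PolyG.gs.continuous
  have h0 : ∀ z, √(gs z) ^ 2 = gs z := fun z => Real.sq_sqrt (gs_pos z).le
  have hB2 : ∀ x, |f x ^ 2| ≤ B ^ 2 := fun x => by
    rw [abs_of_nonneg (sq_nonneg _), ← sq_abs]
    exact pow_le_pow_left₀ (abs_nonneg _) (hB x) 2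
  have h1 := (sq_integral_abs_mul_le (g := fun z => √(gs z)) (h := fun z => √(gs z) * f (x + r • z))
    (by fun_prop) (by fun_prop) (by simp only [h0]; exact PolyG.gs.integrable)
    (by simp only [mul_pow, h0]
        exact PolyG.gs.integrable_mul (f := fun y => f y ^ 2) (by fun_prop) hB2 r x)).2
  simp only [mul_pow, h0, integral_gs, one_mul] at h1
  refine le_trans ?_ h1
  rw [← sq_abs]
  refine pow_le_pow_left₀ (abs_nonneg _) ((abs_avg_le r f x).trans (le_of_eq ?_)) 2
  refine integral_congr_ae (Eventually.of_forall fun z => ?_)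
  simp only [abs_mul, abs_of_nonneg (Real.sqrt_nonneg _), abs_of_pos (gs_pos z)]
  rw [← mul_assoc, Real.mul_self_sqrt (gs_pos z).le]

namespace Fld

lemma hasFDerivAt_avg (f : Fld) (t r : ℝ) (x : Plane) :
    HasFDerivAt (avg gs r (f.1 t))
      (avg gs r ((Dx 0 f).1 t) x • (EuclideanSpace.proj 0 : Plane →L[ℝ] ℝ) +
        avg gs r ((Dx 1 f).1 t) x • (EuclideanSpace.proj 1 : Plane →L[ℝ] ℝ)) x := by
  obtain ⟨B, hB⟩ := f.bdd t
  obtain ⟨B0, hB0⟩ := (Dx 0 f).bdd t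
  obtain ⟨B1, hB1⟩ := (Dx 1 f).bdd t
  have cf := f.continuous t
  have c0 := (Dx 0 f).continuous t
  have c1 := (Dx 1 f).continuous t
  have cg := PolyG.gs.continuous
  have hd := f.differentiable t
  set L : Plane → Plane →L[ℝ] ℝ := fun y => (Dx 0 f).1 t y • (EuclideanSpace.proj 0 : Plane →L[ℝ] ℝ) +
        (Dx 1 f).1 t y • (EuclideanSpace.proj 1 : Plane →L[ℝ] ℝ) with hL
  have hLd : ∀ y, HasFDerivAt (f.1 t) (L y) y := fun y => by
    have := (hd y).hasFDerivAt
    convert! this using 1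
    ext z
    rw [f.fderiv_apply t y z]
    simp [hL]; ring
  have cL : Continuous L := by fun_prop
  have hLB : ∀ y, ‖L y‖ ≤ B0 + B1 := fun y => by
    refine (norm_clm_le _).trans ?_
    simp only [hL, e]
    simpa using add_le_add (hB0 y) (hB1 y)
  have key := hasFDerivAt_integral_of_dominated_of_fderiv_le (μ := (volume : Measure Plane))
    (F := fun x z => gs z * f.1 t (x + r • z)) (F' := fun x z => gs z • L (x + r • z))
    (x₀ := x) (s := univ) (bound := fun z => gs z * (B0 + B1)) univ_mem
    (Eventually.of_forall fun x => by
      have : Continuous fun z => gs z * f.1 t (x + r • z) := by fun_prop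
      exact this.aestronglyMeasurable)
    (PolyG.gs.integrable_mul cf hB r x)
    (by have : Continuous fun z => gs z • L (x + r • z) := by fun_prop
        exact this.aestronglyMeasurable)
    (Eventually.of_forall fun z y _ => by
      rw [norm_smul, Real.norm_eq_abs, abs_of_pos (gs_pos z)]
      exact mul_le_mul_of_nonneg_left (hLB _) (gs_pos z).le)
    (PolyG.gs.integrable.mul_const _)
    (Eventually.of_forall fun z y _ => by
      have h1 : HasFDerivAt (fun y : Plane => y + r • z) (ContinuousLinearMap.id ℝ Plane) y :=
        (hasFDerivAt_id y).add_const _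
      have h2 := (hLd (y + r • z)).comp y h1
      rw [ContinuousLinearMap.comp_id] at h2
      exact h2.const_mul (gs z))
  convert! key using 1
  have i0 := PolyG.gs.integrable_mul c0 hB0 r x
  have i1 := PolyG.gs.integrable_mul c1 hB1 r x
  simp only [hL, smul_add, smul_smul]
  rw [integral_add (i0.smul_const _) (i1.smul_const _), integral_smul_const, integral_smul_const]
  rfl

lemma contDiff_avg (n : ℕ) (f : Fld) (t r : ℝ) : ContDiff ℝ n (avg gs r (f.1 t)) := by
  induction n generalizing f with
  | zero =>
    have : Differentiable ℝ (avg gs r (f.1 t)) := fun x => (f.hasFDerivAt_avg t r x).differentiableAt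
    exact contDiff_zero.2 this.continuous
  | succ n ih =>
    have := (contDiff_succ_iff_hasFDerivAt (𝕜 := ℝ) (f := avg gs r (f.1 t)) (n := n)).2
      ⟨_, ?_, f.hasFDerivAt_avg t r⟩
    · exact_mod_cast this
    · exact ((ih (Dx 0 f)).smul contDiff_const).add ((ih (Dx 1 f)).smul contDiff_const)

/-- The Gaussian average of a field at a fixed time, as a function constant in time. -/
def heatFun (f : Fld) (t₀ r : ℝ) : ℝ → Plane → ℝ := fun _ => avg gs r (f.1 t₀)

lemma js_heatFun (f : Fld) (t₀ r : ℝ) : JS (heatFun f t₀ r) := by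
  refine ⟨fun _ => rfl, ?_⟩
  have h : ContDiff ℝ ∞ (avg gs r (f.1 t₀)) := contDiff_infty.2 fun n => f.contDiff_avg n t₀ r
  exact (h.comp contDiff_snd).contDiffOn

lemma pd_heatFun (a) (f : Fld) (t₀ r : ℝ) :
    pd a (heatFun f t₀ r) = heatFun (a.elim 0 fun i => Dx i f) t₀ r := by
  cases a with
  | none =>
    funext t x
    simp [pd, heatFun, avg]
  | some i =>
    funext t x
    simp only [pd, heatFun]
    rw [(f.hasFDerivAt_avg t₀ r x).fderiv]
    fin_cases i <;> simp [e]

lemma avg_sq_integral (f : Fld) [IsL2 f] (t r : ℝ) :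
    Integrable (fun x => avg gs r (f.1 t) x ^ 2) ∧ ∫ x, avg gs r (f.1 t) x ^ 2 ≤ Int (f * f) t := by
  obtain ⟨B, hB⟩ := f.bdd t
  have cf := f.continuous t
  have h := integral_avg_gs (F := fun y => f.1 t y ^ 2) (by fun_prop) (f.integrable_sq t) r
  have c : Continuous (avg gs r (f.1 t)) := (f.contDiff_avg 0 t r).continuous
  have hi : Integrable (fun x => avg gs r (f.1 t) x ^ 2) :=
    h.1.mono' (by fun_prop) (Eventually.of_forall fun x => by
      rw [Real.norm_eq_abs, abs_of_nonneg (sq_nonneg _)]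
      exact avg_gs_sq_le cf hB r x)
  refine ⟨hi, (integral_mono hi h.1 fun x => avg_gs_sq_le cf hB r x).trans (le_of_eq ?_)⟩
  rw [h.2, integral_sq]

instance : IsL2 (0 : Fld) := by
  refine ⟨⟨(0 : Fld).js, fun w => ?_⟩⟩
  have : pdW w (0 : Fld).1 = fun _ _ => 0 := by
    induction w with
    | nil => rfl
    | cons a w ih => rw [pdW_cons, ih, pd_const]
  rw [this]
  exact fun S => ⟨0, fun t _ => by simp⟩

lemma adm_heatFun (f : Fld) [hf : IsL2 f] (t₀ r : ℝ) : Adm BL2 (heatFun f t₀ r) := by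
  refine ⟨js_heatFun f t₀ r, fun w => ?_⟩
  have : ∃ g : Fld, IsL2 g ∧ pdW w (heatFun f t₀ r) = heatFun g t₀ r := by
    induction w with
    | nil => exact ⟨f, hf, rfl⟩
    | cons a w ih =>
      obtain ⟨g, hg, h⟩ := ih
      refine ⟨_, ?_, by rw [pdW_cons, h, pd_heatFun]⟩
      cases a with
      | none => exact inferInstanceAs (IsL2 0)
      | some i => exact inferInstanceAs (IsL2 (Dx i g))
  obtain ⟨g, hg, h⟩ := this
  rw [h]
  exact fun S => ⟨Int (g * g) t₀, fun t _ => g.avg_sq_integral t₀ r⟩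

/-- The Gaussian average of a field at a fixed time, as a field. -/
def heat (f : Fld) [IsL2 f] (t₀ r : ℝ) : Fld := ⟨heatFun f t₀ r, (adm_heatFun f t₀ r).bb⟩

section heat
variable (f : Fld) [IsL2 f] (t₀ r : ℝ)

instance : IsL2 (heat f t₀ r) := ⟨adm_heatFun f t₀ r⟩

lemma heat_val (t x) : (heat f t₀ r).1 t x = avg gs r (f.1 t₀) x := rfl

lemma Dx_heat (i) : Dx i (heat f t₀ r) = heat (Dx i f) t₀ r :=
  Fld.ext (pd_heatFun (some i) f t₀ r)

lemma Dt_heat : Dt (heat f t₀ r) = 0 := by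
  refine Fld.ext ((pd_heatFun none f t₀ r).trans ?_)
  funext t x
  simp [heatFun, avg]

lemma heat_add (g : Fld) [IsL2 g] : heat (f + g) t₀ r = heat f t₀ r + heat g t₀ r := by
  refine Fld.ext ?_
  funext t x
  exact avg_add f g t₀ r x

lemma Lap_heat : Lap (heat f t₀ r) = heat (Lap f) t₀ r := by
  rw [Lap, Dx_heat, Dx_heat, Dx_heat, Dx_heat, ← heat_add]; rfl

lemma Int_heat_sq_le (t : ℝ) : Int (heat f t₀ r * heat f t₀ r) t ≤ Int (f * f) t₀ := by
  rw [← integral_sq]; exact (f.avg_sq_integral t₀ r).2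

lemma abs_Int_mul_heat_le (g : Fld) [IsL2 g] (t : ℝ) :
    |Int (g * heat f t₀ r) t| ≤ √(Int (g * g) t) * √(Int (f * f) t₀) :=
  (abs_Int_mul_le g (heat f t₀ r) t).trans (mul_le_mul_of_nonneg_left
    (Real.sqrt_le_sqrt (Int_heat_sq_le f t₀ r t)) (Real.sqrt_nonneg _))

end heat

lemma continuousOn_avg (f : Fld) (t₀ : ℝ) {ρ : ℝ → ℝ} {A : Set ℝ} (hρ : ContinuousOn ρ A) :
    ContinuousOn (fun q : ℝ × Plane => avg gs (ρ q.1) (f.1 t₀) q.2) (A ×ˢ univ) := by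
  obtain ⟨B, hB⟩ := f.bdd t₀
  have cρ : ContinuousOn (fun q : ℝ × Plane => (ρ q.1, q.2)) (A ×ˢ univ) :=
    (hρ.comp continuousOn_fst fun q hq => hq.1).prodMk continuousOn_snd
  exact (PolyG.gs.continuous_avg (f.continuous t₀) hB).comp_continuousOn cρ

lemma integral_abs_mul_le (p q : Fld) [IsL2 p] [IsL2 q] (s : ℝ) :
    ∫ x, |(p * q).1 s x| ≤ Int (p * p) s + Int (q * q) s := by
  rw [← Int_add]
  refine integral_mono ((p * q).integrable s).abs ((p * p + q * q).integrable s) fun x => ?_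
  simp only [mul_val, add_val]
  rw [abs_le]
  constructor <;> nlinarith [sq_nonneg (p.1 s x + q.1 s x), sq_nonneg (p.1 s x - q.1 s x),
    sq_nonneg (p.1 s x), sq_nonneg (q.1 s x)]

lemma Int_mul_heat_sub (g f : Fld) [hg : IsL2 g] [IsL2 f] (t₀ : ℝ) {a b : ℝ} (ha : 0 ≤ a)
    (hab : a ≤ b) {ρ ρ' c : ℝ → ℝ} (hc : ContinuousOn c (Icc a b))
    (hρ : ∀ s ∈ Icc a b, HasDerivWithinAt ρ (ρ' s) (Icc a b) s)
    (hρc : ∀ s ∈ Icc a b, ρ s * ρ' s = c s) :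
    IntervalIntegrable (fun s => Int (Dt g * heat f t₀ (ρ s)) s +
      c s * Int (g * heat (Lap f) t₀ (ρ s)) s) volume a b ∧
    Int (g * heat f t₀ (ρ b)) b - Int (g * heat f t₀ (ρ a)) a =
      ∫ s in a..b, (Int (Dt g * heat f t₀ (ρ s)) s + c s * Int (g * heat (Lap f) t₀ (ρ s)) s) := by
  have hsub : Icc a b ⊆ Ici 0 := fun s hs => ha.trans hs.1
  have hρcont : ContinuousOn ρ (Icc a b) := fun s hs => (hρ s hs).continuousWithinAt
  obtain ⟨cm, hcm⟩ := isCompact_Icc.exists_bound_of_continuousOn hc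
  obtain ⟨C1, hC1⟩ := (hg.adm.pd none).self b
  obtain ⟨C2, hC2⟩ := hg.adm.self b
  set P : ℝ → Fld := fun s => Dt g * heat f t₀ (ρ s) + c s • (g * heat (Lap f) t₀ (ρ s)) with hP
  have hPi : ∀ s, Int (P s) s =
      Int (Dt g * heat f t₀ (ρ s)) s + c s * Int (g * heat (Lap f) t₀ (ρ s)) s := fun s => by
    rw [hP]; simp only; rw [Int_add, Int_smul]
  simp_rw [← hPi]
  refine integral_sub_eq_of_deriv (F := fun s x => g.1 s x * avg gs (ρ s) (f.1 t₀) x)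
    (F' := fun s x => (P s).1 s x)
    (C := (C1 + Int (f * f) t₀) + cm * (C2 + Int (Lap f * Lap f) t₀)) hab
    (fun s hs x => ?_) ?_ (fun s hs => ⟨?_, ?_⟩) ?_ ?_
  · have h1 : HasDerivWithinAt (fun s => g.1 s x) ((Dt g).1 s x) (Icc a b) s :=
      (g.js.hasDerivWithinAt (hsub hs) x).mono hsub
    have h2 : HasDerivWithinAt (fun s => avg gs (ρ s) (f.1 t₀) x)
        ((ρ s * avg gs (ρ s) ((Lap f).1 t₀) x) * ρ' s) (Icc a b) s :=
      (hasDerivAt_avg f t₀ x (ρ s)).comp_hasDerivWithinAt s (hρ s hs)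
    refine (h1.mul h2).congr_deriv ?_
    simp only [hP, add_val, mul_val, smul_val, heat_val, ← hρc s hs]
    ring
  · have c1 : ContinuousOn (fun q : ℝ × Plane => (Dt g).1 q.1 q.2) (Icc a b ×ˢ univ) :=
      (Dt g).js.smooth.continuousOn.mono (prod_mono hsub le_rfl)
    have c2 : ContinuousOn (fun q : ℝ × Plane => g.1 q.1 q.2) (Icc a b ×ˢ univ) :=
      g.js.smooth.continuousOn.mono (prod_mono hsub le_rfl)
    have c3 := continuousOn_avg f t₀ hρcont
    have c4 := continuousOn_avg (Lap f) t₀ hρcont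
    have c5 : ContinuousOn (fun q : ℝ × Plane => c q.1) (Icc a b ×ˢ univ) :=
      hc.comp continuousOn_fst fun q hq => hq.1
    exact (c1.mul c3).add (c5.mul (c2.mul c4))
  · have : IsL1 (P s) := by simp only [hP]; infer_instance
    exact (P s).integrable s
  · have hs0 : s ∈ Icc 0 b := ⟨hsub hs, hs.2⟩
    have i1 := (Dt g * heat f t₀ (ρ s)).integrable s
    have i2 := (g * heat (Lap f) t₀ (ρ s)).integrable s
    have hcs := hcm s hs
    rw [Real.norm_eq_abs] at hcs
    have hcm0 : 0 ≤ cm := (abs_nonneg _).trans hcs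
    have b1 := integral_abs_mul_le (Dt g) (heat f t₀ (ρ s)) s
    have b2 := integral_abs_mul_le g (heat (Lap f) t₀ (ρ s)) s
    have k1 := Int_heat_sq_le f t₀ (ρ s) s
    have k2 := Int_heat_sq_le (Lap f) t₀ (ρ s) s
    have k3 : Int (Dt g * Dt g) s ≤ C1 := by rw [← integral_sq]; exact (hC1 s hs0).2
    have k4 : Int (g * g) s ≤ C2 := by rw [← integral_sq]; exact (hC2 s hs0).2
    have t1 : ∫ x, |(P s).1 s x| ≤ (∫ x, |(Dt g * heat f t₀ (ρ s)).1 s x|) +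
        cm * ∫ x, |(g * heat (Lap f) t₀ (ρ s)).1 s x| := by
      rw [← integral_const_mul, ← integral_add i1.abs (i2.abs.const_mul cm)]
      refine integral_mono ?_ (i1.abs.add (i2.abs.const_mul cm)) fun x => ?_
      · have : IsL1 (P s) := by simp only [hP]; infer_instance
        exact ((P s).integrable s).abs
      · simp only [hP, add_val, smul_val]
        refine (abs_add_le _ _).trans (add_le_add le_rfl ?_)
        rw [abs_mul]
        exact mul_le_mul_of_nonneg_right hcs (abs_nonneg _)
    refine t1.trans (add_le_add (by linarith) (mul_le_mul_of_nonneg_left (by linarith) hcm0))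
  · exact (g * heat f t₀ (ρ a)).integrable a
  · exact (g * heat f t₀ (ρ b)).integrable b

/-- The heat semigroup moves a field by at most the Dirichlet energy. -/
lemma Int_mul_heat_ge (f : Fld) [IsL2 f] {t r : ℝ} (hr : 0 ≤ r) :
    Int (f * f) t - r ^ 2 / 2 * Nd f t ≤ Int (f * heat f t r) t := by
  have e0 : ∀ (g : Fld) [IsL2 g] (q : Fld), Int (heat g t 0 * q) t = Int (g * q) t := fun g _ q => by
    refine integral_congr_ae (Eventually.of_forall fun x => ?_)
    simp only [mul_val, heat_val, avg_zero_radius]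
  have e1 : ∀ (g : Fld) [IsL2 g] (q : Fld) [IsL2 q] (a s : ℝ),
      Int (heat g t 0 * heat q t a) s = Int (g * heat q t a) t := fun g _ q _ a s => by
    rw [← e0]; rfl
  have h := (Int_mul_heat_sub (heat f t 0) f t le_rfl hr (ρ := fun s => s) (ρ' := fun _ => 1)
    (c := fun s => s) continuousOn_id (fun s _ => hasDerivWithinAt_id s _)
    (fun s _ => mul_one s)).2
  simp only [Dt_heat, zero_mul, Int_zero, zero_add, e1] at h
  have h0 : Int (f * heat f t 0) t = Int (f * f) t := by
    rw [mul_comm, e0]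
  rw [h0] at h
  have hb : ∀ s, |Int (f * heat (Lap f) t s) t| ≤ Nd f t := fun s => by
    have e2 : Int (f * heat (Lap f) t s) t =
        Int (-(Dx 0 f * heat (Dx 0 f) t s + Dx 1 f * heat (Dx 1 f) t s)) t := by
      refine Int_eq_of_sub_eq_div (f * Dx 0 (heat f t s)) (f * Dx 1 (heat f t s)) ?_ t
      rw [← Lap_heat, ← Dx_heat, ← Dx_heat, Lap, D_mul, D_mul]
      ring
    rw [e2, Int_neg, abs_neg, Int_add, Nd]
    have k : ∀ i, |Int (Dx i f * heat (Dx i f) t s) t| ≤ Int (Dx i f * Dx i f) t := fun i => by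
      have := abs_Int_mul_heat_le (Dx i f) t s (Dx i f) t
      rwa [Real.mul_self_sqrt (Int_sq_nonneg _ _)] at this
    exact (abs_add_le _ _).trans (add_le_add (k 0) (k 1))
  have h2 : |∫ s in (0 : ℝ)..r, s * Int (f * heat (Lap f) t s) t| ≤ ∫ s in (0 : ℝ)..r, s * Nd f t := by
    rw [← Real.norm_eq_abs]
    refine intervalIntegral.norm_integral_le_of_norm_le hr (Eventually.of_forall fun s hs => ?_)
      ((continuous_id.mul continuous_const).intervalIntegrable _ _)
    rw [norm_mul, Real.norm_eq_abs, Real.norm_eq_abs, abs_of_pos hs.1]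
    exact mul_le_mul_of_nonneg_left (hb s) hs.1.le
  rw [intervalIntegral.integral_mul_const, integral_id] at h2
  have := (abs_le.1 h2).1
  rw [← h] at this
  linarith

end Fld

open Fld

namespace Fld

lemma exists_heat_bounds : ∃ C : ℝ, 1 ≤ C ∧ ∀ (f : Fld) [IsL2 f] (t₀ r : ℝ), 0 < r → ∀ t x,
    (∀ i, |(Dx i (heat f t₀ r)).1 t x| ≤ C / r ^ 2 * √(Int (f * f) t₀)) ∧
    |(Lap (heat f t₀ r)).1 t x| ≤ C / r ^ 3 * √(Int (f * f) t₀) := by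
  choose C1 hC1 h1 using fun i => (PolyG.gs.fderiv i).avg_sq_le
  choose C2 hC2 h2 using fun i => ((PolyG.gs.fderiv i).fderiv i).avg_sq_le
  set C := 1 + √(C1 0) + √(C1 1) + √(C2 0) + √(C2 1) with hC
  have p1 := fun i => Real.sqrt_nonneg (C1 i)
  have p2 := fun i => Real.sqrt_nonneg (C2 i)
  have hC1' : ∀ i, √(C1 i) ≤ C := Fin.forall_fin_two.2
    ⟨by linarith [p1 1, p2 0, p2 1], by linarith [p1 0, p2 0, p2 1]⟩
  have hC2' : √(C2 0) + √(C2 1) ≤ C := by linarith [p1 0, p1 1]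
  refine ⟨C, by linarith [p1 0, p1 1, p2 0, p2 1], fun f _ t₀ r hr t x => ⟨fun i => ?_, ?_⟩⟩
  · rw [Dx_heat, heat_val, div_mul_eq_mul_div, le_div_iff₀ (by positivity)]
    have k := Real.abs_le_sqrt (h1 i (f.1 t₀) r x (f.continuous t₀) (f.integrable_sq t₀) hr)
    rw [integral_sq, Real.sqrt_mul (hC1 i).le] at k
    have e1 := avg_Dx .gs f i t₀ r x
    calc |avg gs r ((Dx i f).1 t₀) x| * r ^ 2
        = |r * (r * avg gs r ((Dx i f).1 t₀) x)| := by
          rw [abs_mul, abs_mul, abs_of_pos hr]; ring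
      _ = |r * avg (fun z => fderiv ℝ gs z (e i)) r (f.1 t₀) x| := by
          rw [e1, mul_neg, abs_neg]
      _ ≤ _ := k.trans (mul_le_mul_of_nonneg_right (hC1' i) (Real.sqrt_nonneg _))
  · rw [div_mul_eq_mul_div, le_div_iff₀ (by positivity)]
    have k := fun i => Real.abs_le_sqrt
      (h2 i (f.1 t₀) r x (f.continuous t₀) (f.integrable_sq t₀) hr)
    simp only [integral_sq] at k
    have k' : ∀ i, |avg gs r ((Dx i (Dx i f)).1 t₀) x| * r ^ 3 ≤ √(C2 i) * √(Int (f * f) t₀) := by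
      intro i
      have e1 := avg_Dx .gs (Dx i f) i t₀ r x
      have e2 := avg_Dx (PolyG.gs.fderiv i) f i t₀ r x
      rw [← Real.sqrt_mul (hC2 i).le]
      calc |avg gs r ((Dx i (Dx i f)).1 t₀) x| * r ^ 3
          = |r * (r * (r * avg gs r ((Dx i (Dx i f)).1 t₀) x))| := by
            rw [abs_mul, abs_mul, abs_mul, abs_of_pos hr]; ring
        _ ≤ _ := by rw [e1, mul_neg, e2, neg_neg]; exact k i
    have e3 : (Lap (heat f t₀ r)).1 t x =
        avg gs r ((Dx 0 (Dx 0 f)).1 t₀) x + avg gs r ((Dx 1 (Dx 1 f)).1 t₀) x := by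
      rw [Lap, Dx_heat, Dx_heat, Dx_heat, Dx_heat]; rfl
    rw [e3]
    calc _ ≤ (|avg gs r ((Dx 0 (Dx 0 f)).1 t₀) x| + |avg gs r ((Dx 1 (Dx 1 f)).1 t₀) x|) * r ^ 3 :=
          mul_le_mul_of_nonneg_right (abs_add_le _ _) (by positivity)
      _ ≤ (√(C2 0) + √(C2 1)) * √(Int (f * f) t₀) := by
          rw [add_mul, add_mul]; exact add_le_add (k' 0) (k' 1)
      _ ≤ _ := mul_le_mul_of_nonneg_right hC2' (Real.sqrt_nonneg _)

lemma abs_Int_mul_mul_le (f g h : Fld) [IsL2 f] [IsL2 g] {t B : ℝ} (hB : 0 ≤ B)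
    (hh : ∀ x, |h.1 t x| ≤ B) :
    |Int (f * (g * h)) t| ≤ B * (√(Int (f * f) t) * √(Int (g * g) t)) := by
  have h1 := abs_Int_mul_le f (g * h) t
  have h2 : Int (g * h * (g * h)) t ≤ Int (B ^ 2 • (g * g)) t := Int_mono fun x => by
    simp only [mul_val, smul_val]
    have : h.1 t x ^ 2 ≤ B ^ 2 := sq_le_sq' (abs_le.1 (hh x)).1 (abs_le.1 (hh x)).2
    nlinarith [mul_le_mul_of_nonneg_left this (sq_nonneg (g.1 t x))]
  rw [Int_smul] at h2
  have h3 : √(Int (g * h * (g * h)) t) ≤ B * √(Int (g * g) t) := by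
    refine (Real.sqrt_le_sqrt h2).trans (le_of_eq ?_)
    rw [Real.sqrt_mul (sq_nonneg _), Real.sqrt_sq hB]
  calc _ ≤ _ := h1
    _ ≤ √(Int (f * f) t) * (B * √(Int (g * g) t)) :=
      mul_le_mul_of_nonneg_left h3 (Real.sqrt_nonneg _)
    _ = _ := by ring

end Fld

namespace Flow
variable (S : Flow)

/-- The `L²` norm of the density perturbation. -/
def a : ℝ := √(Int ((S.r - 1) * (S.r - 1)) 0)

lemma a_eq {t : ℝ} (ht : 0 ≤ t) : √(Int ((S.r - 1) * (S.r - 1)) t) = S.a := by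
  have := S.Int_pow_density 1 one_ne_zero ht
  simp only [pow_one, pow_two] at this
  rw [this, a]

lemma continuous_y : Continuous S.y := continuous_Int _

lemma Int_pairing_solenoidal (w : Fin 2 → Fld) [∀ j, IsL2 (w j)]
    (hdw : Dx 0 (w 0) + Dx 1 (w 1) = 0) (s : ℝ) :
    (Int (Dt (S.r * S.u 0) * w 0) s + -1 * Int (S.r * S.u 0 * Lap (w 0)) s) +
    (Int (Dt (S.r * S.u 1) * w 1) s + -1 * Int (S.r * S.u 1 * Lap (w 1)) s) =
    Int (∑ j, (-((S.r - 1) * (S.u j * Lap (w j)))) +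
      ∑ j, ∑ l, S.r * S.u j * (S.u l * Dx l (w j))) s := by
  have e0 : Int (S.p 0 * w 0 + S.p 1 * w 1) s = 0 :=
    Int_gradient_solenoidal _ _ _ _ S.curl_p hdw s
  obtain ⟨W, hW⟩ : ∃ W : Fin 2 → Fld, ∀ m, W m =
    (Dx m (S.u 0) * w 0 - S.u 0 * Dx m (w 0) - S.u m * (S.r * S.u 0 * w 0)) +
    (Dx m (S.u 1) * w 1 - S.u 1 * Dx m (w 1) - S.u m * (S.r * S.u 1 * w 1)) :=
    ⟨_, fun _ => rfl⟩
  have i : ∀ m, IsL1 (W m) := fun m => by rw [hW]; infer_instance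
  obtain ⟨A, hA⟩ : ∃ A, A = (Dt (S.r * S.u 0) * w 0 - S.r * S.u 0 * Lap (w 0)) +
      (Dt (S.r * S.u 1) * w 1 - S.r * S.u 1 * Lap (w 1)) + (S.p 0 * w 0 + S.p 1 * w 1) := ⟨_, rfl⟩
  obtain ⟨B, hB⟩ : ∃ B, B = ∑ j, (-((S.r - 1) * (S.u j * Lap (w j)))) +
        ∑ j, ∑ l, S.r * S.u j * (S.u l * Dx l (w j)) := ⟨_, rfl⟩
  have iA : IsL1 A := by rw [hA]; infer_instance
  have iB : IsL1 B := by rw [hB]; infer_instance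
  have e1 : Int A s = Int B s := by
    refine Int_eq_of_sub_eq_div (W 0) (W 1) ?_ s
    have h0 := S.momentum 0
    have h1 := S.momentum 1
    have hm := S.mass
    simp only [hA, hB, hW, Fin.sum_univ_two, Lap, D_mul, map_add, map_sub] at h0 h1 ⊢
    have hd := S.div_u
    linear_combination w 0 * h0 + w 1 * h1 + (S.u 0 * w 0 + S.u 1 * w 1) * hm +
      (S.r * S.u 0 * w 0 + S.r * S.u 1 * w 1) * hd
  rw [← hB, ← e1, hA, Int_add, e0, Int_add, Int_sub, Int_sub]
  ring

lemma Int_pairing_deriv (t₀ ρ s : ℝ) :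
    (Int (Dt (S.r * S.u 0) * heat (S.u 0) t₀ ρ) s + -1 * Int (S.r * S.u 0 * heat (Lap (S.u 0)) t₀ ρ) s) +
    (Int (Dt (S.r * S.u 1) * heat (S.u 1) t₀ ρ) s + -1 * Int (S.r * S.u 1 * heat (Lap (S.u 1)) t₀ ρ) s) =
    Int (∑ j, (-((S.r - 1) * (S.u j * Lap (heat (S.u j) t₀ ρ)))) +
      ∑ j, ∑ l, S.r * S.u j * (S.u l * Dx l (heat (S.u j) t₀ ρ))) s := by
  rw [← Lap_heat, ← Lap_heat]
  refine S.Int_pairing_solenoidal (fun j => heat (S.u j) t₀ ρ) ?_ s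
  simp only [Dx_heat]
  rw [← heat_add]
  refine Fld.ext ?_
  funext t x
  rw [heat_val, S.div_u]
  simp [avg]

variable {S} in
lemma integrable_of_moment (hm : ∀ j, Integrable fun x => ‖x‖ * |(S.u j).1 0 x|) (j : Fin 2) :
    Integrable ((S.u j).1 0) := by
  obtain ⟨B, hB⟩ := (S.u j).bdd 0
  have h1 : Integrable ((Metric.ball (0 : Plane) 1).indicator fun _ => B) :=
    IntegrableOn.integrable_indicator (integrableOn_const measure_ball_lt_top.ne) measurableSet_ball
  refine (h1.add (hm j)).mono' ((S.u j).continuous 0).aestronglyMeasurable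
    (Eventually.of_forall fun x => ?_)
  rw [Real.norm_eq_abs, Pi.add_apply]
  by_cases hx : x ∈ Metric.ball (0 : Plane) 1
  · rw [indicator_of_mem hx]
    have := hB x
    have : 0 ≤ ‖x‖ * |(S.u j).1 0 x| := by positivity
    linarith
  · rw [indicator_of_notMem hx, zero_add]
    have : 1 ≤ ‖x‖ := by simpa using hx
    nlinarith [abs_nonneg ((S.u j).1 0 x)]

end Flow

/-- A function with bounded partial derivatives is Lipschitz. -/
lemma Fld.abs_sub_le (f : Fld) {t B : ℝ} (hB : ∀ i x, |(Dx i f).1 t x| ≤ B) (x : Plane) :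
    |f.1 t x - f.1 t 0| ≤ 2 * B * ‖x‖ := by
  have h1 := convex_univ.norm_image_sub_le_of_norm_fderiv_le (𝕜 := ℝ) (f := f.1 t) (C := 2 * B)
    (fun y _ => f.differentiable t y) (fun y _ => ?_) (mem_univ (0 : Plane)) (mem_univ x)
  · simpa using h1
  · refine (norm_clm_le _).trans ?_
    have := hB 0 y
    have := hB 1 y
    simp only [Dx_val] at *
    linarith

/-- `L²` estimate by duality with the backward heat flow. -/
lemma exists_duality : ∃ C : ℝ, 1 ≤ C ∧ ∀ (S : Flow) (U : ℝ),
    (∀ j, Integrable fun x => ‖x‖ * |(S.u j).1 0 x|) → (∀ j, ∫ x, ‖x‖ * |(S.u j).1 0 x| ≤ U) →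
    (∀ j, Int (S.r * S.u j) 0 = 0) → ∀ t δ : ℝ, 0 ≤ t → 0 < δ →
    Int (dot S.u S.u) t ≤ 2 * δ * S.X t + C * (U / δ + (∫ s in (0 : ℝ)..t, S.y s) / δ +
      S.a / (δ * √δ) * ∫ s in (0 : ℝ)..t, √(S.y s)) ^ 2 := by
  obtain ⟨C, hC, hb⟩ := exists_heat_bounds
  set K := 20 * C with hK
  refine ⟨2 * K ^ 2, by nlinarith, fun S U hm hU h0 t δ ht hδ => ?_⟩
  set Y := Int (dot S.u S.u) t with hY
  have hY0 : 0 ≤ Y := Int_dot_nonneg _ _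
  set ρ : ℝ → ℝ := fun s => √(2 * (t + δ - s)) with hρ
  have hsδ : 0 < √δ := Real.sqrt_pos.2 hδ
  have hρδ : ∀ s, s ≤ t → √δ ≤ ρ s := fun s hs => Real.sqrt_le_sqrt (by linarith)
  have hρ0 : ∀ s, s ≤ t → 0 < ρ s := fun s hs => hsδ.trans_le (hρδ s hs)
  have hρ2 : ∀ s, s ≤ t → δ ≤ ρ s ^ 2 := fun s hs => by
    rw [← Real.sq_sqrt hδ.le]; exact pow_le_pow_left₀ hsδ.le (hρδ s hs) 2
  have hρ3 : ∀ s, s ≤ t → δ * √δ ≤ ρ s ^ 3 := fun s hs => by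
    rw [pow_succ]; exact mul_le_mul (hρ2 s hs) (hρδ s hs) hsδ.le (sq_nonneg _)
  have hρd : ∀ s ∈ Icc 0 t, HasDerivWithinAt ρ (-(1 / ρ s)) (Icc 0 t) s := fun s hs => by
    have h1 : HasDerivAt (fun s => 2 * (t + δ - s)) (2 * (-1)) s :=
      ((hasDerivAt_id s).const_sub (t + δ)).const_mul 2
    have h2 := h1.sqrt (by have := hs.2; positivity [show 0 < t + δ - s by linarith])
    refine (h2.congr_deriv ?_).hasDerivWithinAt
    have := (hρ0 s hs.2).ne'
    simp only [hρ] at this ⊢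
    field_simp
  have hρc : ∀ s ∈ Icc 0 t, ρ s * -(1 / ρ s) = (fun _ : ℝ => (-1 : ℝ)) s := fun s hs => by
    have := (hρ0 s hs.2).ne'
    field_simp
  have J := fun j => Int_mul_heat_sub (S.r * S.u j) (S.u j) t le_rfl ht (c := fun _ => -1)
    continuousOn_const hρd hρc
  have hUj : ∀ j, √(Int (S.u j * S.u j) t) ≤ √Y := fun j =>
    Real.sqrt_le_sqrt (Int_sq_le_dot S.u j t)
  -- bounds for the test function
  have w1 : ∀ s, s ≤ t → ∀ j i τ x, |(Dx i (heat (S.u j) t (ρ s))).1 τ x| ≤ C / δ * √Y :=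
    fun s hs j i τ x => ((hb (S.u j) t (ρ s) (hρ0 s hs) τ x).1 i).trans
      (mul_le_mul (div_le_div_of_nonneg_left (by linarith) hδ (hρ2 s hs)) (hUj j)
        (Real.sqrt_nonneg _) (by positivity))
  have w2 : ∀ s, s ≤ t → ∀ j τ x, |(Lap (heat (S.u j) t (ρ s))).1 τ x| ≤ C / (δ * √δ) * √Y :=
    fun s hs j τ x => ((hb (S.u j) t (ρ s) (hρ0 s hs) τ x).2).trans
      (mul_le_mul (div_le_div_of_nonneg_left (by linarith) (by positivity) (hρ3 s hs)) (hUj j)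
        (Real.sqrt_nonneg _) (by positivity))
  -- the source
  have hsrc : ∀ s, 0 ≤ s → s ≤ t →
      |Int (∑ j, (-((S.r - 1) * (S.u j * Lap (heat (S.u j) t (ρ s))))) +
      ∑ j, ∑ l, S.r * S.u j * (S.u l * Dx l (heat (S.u j) t (ρ s)))) s| ≤
      K * √Y * (S.a / (δ * √δ) * √(S.y s) + S.y s / δ) := by
    intro s hs0 hst
    have hy := S.y_nonneg hs0
    have hu := S.Int_u_le hs0
    have b1 : ∀ j, √(Int (S.u j * S.u j) s) ≤ 2 * √(S.y s) := fun j => by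
      refine (Real.sqrt_le_sqrt ((Int_sq_le_dot S.u j s).trans (hu.trans
        (by linarith : _ ≤ 2 ^ 2 * S.y s)))).trans (le_of_eq ?_)
      rw [Real.sqrt_mul (by norm_num), Real.sqrt_sq (by norm_num)]
    have b2 : ∀ j, √(Int (S.r * S.u j * (S.r * S.u j)) s) ≤ 2 * √(S.y s) := fun j => by
      have : Int (S.r * S.u j * (S.r * S.u j)) s ≤ Int ((2 : ℝ) • (S.u j * S.u j)) s :=
        Int_mono fun x => by
          have hr := S.density_bounds hs0 x
          have : S.r.1 s x ^ 2 ≤ 2 := by nlinarith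
          simp only [mul_val, smul_val]
          nlinarith [mul_le_mul_of_nonneg_right this (sq_nonneg ((S.u j).1 s x))]
      rw [Int_smul] at this
      refine (Real.sqrt_le_sqrt (this.trans
        (by linarith [Int_sq_le_dot S.u j s] : _ ≤ 2 ^ 2 * S.y s))).trans (le_of_eq ?_)
      rw [Real.sqrt_mul (by norm_num), Real.sqrt_sq (by norm_num)]
    have c1 : ∀ j, |Int ((S.r - 1) * (S.u j * Lap (heat (S.u j) t (ρ s)))) s| ≤
        2 * (C * √Y * (S.a / (δ * √δ) * √(S.y s))) := fun j => by
      refine (abs_Int_mul_mul_le _ _ _ (by positivity) (w2 s hst j s)).trans ?_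
      rw [S.a_eq hs0]
      have : S.a * √(Int (S.u j * S.u j) s) ≤ S.a * (2 * √(S.y s)) :=
        mul_le_mul_of_nonneg_left (b1 j) (Real.sqrt_nonneg _)
      refine (mul_le_mul_of_nonneg_left this (by positivity)).trans (le_of_eq ?_)
      ring
    have c2 : ∀ j l, |Int (S.r * S.u j * (S.u l * Dx l (heat (S.u j) t (ρ s)))) s| ≤
        4 * (C * √Y * (S.y s / δ)) := fun j l => by
      refine (abs_Int_mul_mul_le _ _ _ (by positivity) (w1 s hst j l s)).trans ?_
      have : √(Int (S.r * S.u j * (S.r * S.u j)) s) * √(Int (S.u l * S.u l) s) ≤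
          (2 * √(S.y s)) * (2 * √(S.y s)) :=
        mul_le_mul (b2 j) (b1 l) (Real.sqrt_nonneg _) (by positivity)
      refine (mul_le_mul_of_nonneg_left this (by positivity)).trans (le_of_eq ?_)
      have hs := Real.mul_self_sqrt hy
      calc C / δ * √Y * (2 * √(S.y s) * (2 * √(S.y s))) =
          4 * (C * √Y * ((√(S.y s) * √(S.y s)) / δ)) := by ring
        _ = _ := by rw [hs]
    simp only [Fin.sum_univ_two, Int_add, Int_neg]
    have g0 := abs_le.1 (c1 0)
    have g1 := abs_le.1 (c1 1)
    have g := fun j l => abs_le.1 (c2 j l)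
    have p1 : 0 ≤ C * √Y * (S.a / (δ * √δ) * √(S.y s)) := by
      have : 0 ≤ S.a := Real.sqrt_nonneg _
      positivity
    have p2 : 0 ≤ C * √Y * (S.y s / δ) := by positivity
    rw [hK, mul_add, abs_le]
    constructor <;> linarith [g 0 0, g 0 1, g 1 0, g 1 1]
  -- the initial pairing
  have hini : ∀ j, |Int (S.r * S.u j * heat (S.u j) t (ρ 0)) 0| ≤ 4 * (C * √Y * (U / δ)) := by
    intro j
    set w := heat (S.u j) t (ρ 0) with hw
    have hlip := w.abs_sub_le (t := 0) (B := C / δ * √Y) fun i x => w1 0 ht j i 0 x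
    have i0 := S.integrable_of_moment hm j
    obtain ⟨Bw, hBw⟩ := w.bdd 0
    have cr := S.r.continuous 0
    have cu := (S.u j).continuous 0
    have cw := w.continuous 0
    have i1 : Integrable fun x => S.r.1 0 x * (S.u j).1 0 x :=
      i0.bdd_mul (c := 5 / 4) cr.aestronglyMeasurable (Eventually.of_forall fun x => by
        have := S.density_bounds le_rfl x
        rw [Real.norm_eq_abs, abs_le]; constructor <;> linarith)
    have e1 : Int (S.r * S.u j * w) 0 =
        ∫ x, S.r.1 0 x * (S.u j).1 0 x * (w.1 0 x - w.1 0 0) := by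
      have : ∫ x, S.r.1 0 x * (S.u j).1 0 x * (w.1 0 x - w.1 0 0) =
          (∫ x, (S.r * S.u j * w).1 0 x) - ∫ x, S.r.1 0 x * (S.u j).1 0 x * w.1 0 0 := by
        rw [← integral_sub ((S.r * S.u j * w).integrable 0) (i1.mul_const _)]
        refine integral_congr_ae (Eventually.of_forall fun x => ?_)
        simp only [mul_val]; ring
      rw [this, integral_mul_const]
      have h00 : ∫ x, S.r.1 0 x * (S.u j).1 0 x = 0 := h0 j
      rw [h00, zero_mul, sub_zero]; rfl
    rw [e1, ← Real.norm_eq_abs]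
    have e2 : ∀ x, ‖S.r.1 0 x * (S.u j).1 0 x * (w.1 0 x - w.1 0 0)‖ ≤
        (4 * (C * √Y / δ)) * (‖x‖ * |(S.u j).1 0 x|) := fun x => by
      have hr := S.density_bounds le_rfl x
      rw [norm_mul, norm_mul, Real.norm_eq_abs, Real.norm_eq_abs, Real.norm_eq_abs,
        abs_of_nonneg (by linarith : 0 ≤ S.r.1 0 x)]
      calc S.r.1 0 x * |(S.u j).1 0 x| * |w.1 0 x - w.1 0 0|
          ≤ 2 * |(S.u j).1 0 x| * (2 * (C / δ * √Y) * ‖x‖) := by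
            refine mul_le_mul ?_ (hlip x) (abs_nonneg _) (by positivity)
            exact mul_le_mul_of_nonneg_right (by linarith) (abs_nonneg _)
        _ = _ := by ring
    refine (norm_integral_le_of_norm_le ((hm j).const_mul _) (Eventually.of_forall e2)).trans ?_
    rw [integral_const_mul]
    refine (mul_le_mul_of_nonneg_left (hU j) (by positivity)).trans (le_of_eq ?_)
    ring
  -- the final pairing
  have hfin : ∀ j, 3 / 4 * Int (S.u j * S.u j) t - δ * Nd (S.u j) t ≤
      Int (S.r * S.u j * heat (S.u j) t (ρ t)) t := by
    intro j
    have hρt : ρ t ^ 2 / 2 = δ := by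
      simp only [hρ]; rw [Real.sq_sqrt (by linarith)]; ring
    have e1 := Int_mul_heat_ge (S.u j) (t := t) (hρ0 t le_rfl).le
    rw [hρt] at e1
    have e2 : Int (S.r * S.u j * heat (S.u j) t (ρ t)) t =
        Int (S.u j * heat (S.u j) t (ρ t)) t + Int ((S.r - 1) * S.u j * heat (S.u j) t (ρ t)) t := by
      rw [← Int_add]; congr 1; ring
    have e3 := abs_Int_mul_heat_le (S.u j) t (ρ t) ((S.r - 1) * S.u j) t
    have e4 : Int ((S.r - 1) * S.u j * ((S.r - 1) * S.u j)) t ≤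
        Int ((1 / 4 : ℝ) ^ 2 • (S.u j * S.u j)) t := Int_mono fun x => by
      have := S.sq_density_le ht x
      simp only [mul_val, smul_val, sub_val, one_val]
      nlinarith [mul_le_mul_of_nonneg_right this (sq_nonneg ((S.u j).1 t x))]
    rw [Int_smul] at e4
    have e5 : √(Int ((S.r - 1) * S.u j * ((S.r - 1) * S.u j)) t) ≤
        1 / 4 * √(Int (S.u j * S.u j) t) := by
      refine (Real.sqrt_le_sqrt e4).trans (le_of_eq ?_)
      rw [Real.sqrt_mul (by norm_num), Real.sqrt_sq (by norm_num)]
    have e6 := e3.trans (mul_le_mul_of_nonneg_right e5 (Real.sqrt_nonneg _))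
    rw [mul_assoc (1 / 4), Real.mul_self_sqrt (Int_sq_nonneg _ _)] at e6
    rw [e2]
    linarith [(abs_le.1 e6).1]
  -- conclusion
  have cy := S.continuous_y
  have hIb : |∫ s in (0 : ℝ)..t, ((Int (Dt (S.r * S.u 0) * heat (S.u 0) t (ρ s)) s +
      -1 * Int (S.r * S.u 0 * heat (Lap (S.u 0)) t (ρ s)) s) +
      (Int (Dt (S.r * S.u 1) * heat (S.u 1) t (ρ s)) s +
      -1 * Int (S.r * S.u 1 * heat (Lap (S.u 1)) t (ρ s)) s))| ≤
      K * √Y * (S.a / (δ * √δ) * (∫ s in (0 : ℝ)..t, √(S.y s)) + (∫ s in (0 : ℝ)..t, S.y s) / δ) := by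
    have e1 : ∫ s in (0 : ℝ)..t, K * √Y * (S.a / (δ * √δ) * √(S.y s) + S.y s / δ) =
        K * √Y * (S.a / (δ * √δ) * (∫ s in (0 : ℝ)..t, √(S.y s)) +
          (∫ s in (0 : ℝ)..t, S.y s) / δ) := by
      rw [intervalIntegral.integral_const_mul, intervalIntegral.integral_add,
        intervalIntegral.integral_const_mul, intervalIntegral.integral_div]
      · exact (continuous_const.mul cy.sqrt).intervalIntegrable _ _
      · exact (cy.div_const δ).intervalIntegrable _ _
    rw [← e1, ← Real.norm_eq_abs]
    refine intervalIntegral.norm_integral_le_of_norm_le ht (Eventually.of_forall fun s hs => ?_) ?_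
    · rw [S.Int_pairing_deriv t (ρ s) s, Real.norm_eq_abs]
      exact hsrc s hs.1.le hs.2
    · have : Continuous fun s => K * √Y * (S.a / (δ * √δ) * √(S.y s) + S.y s / δ) := by fun_prop
      exact this.intervalIntegrable _ _
  have hsum := intervalIntegral.integral_add (J 0).1 (J 1).1
  rw [← (J 0).2, ← (J 1).2] at hsum
  rw [hsum] at hIb
  set D := U / δ + (∫ s in (0 : ℝ)..t, S.y s) / δ + S.a / (δ * √δ) * ∫ s in (0 : ℝ)..t, √(S.y s)
    with hD
  have hYs : Y = Int (S.u 0 * S.u 0) t + Int (S.u 1 * S.u 1) t := Int_dot_self _ _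
  have hXs : S.X t = Nd (S.u 0) t + Nd (S.u 1) t := Int_gsq _ _
  have hUδ : 0 ≤ U / δ := div_nonneg ((integral_nonneg fun x => by positivity).trans (hU 0)) hδ.le
  have hmain : 3 / 4 * Y ≤ δ * S.X t + K * √Y * D := by
    have f0 := hfin 0
    have f1 := hfin 1
    have g0 := abs_le.1 (hini 0)
    have g1 := abs_le.1 (hini 1)
    have g2 := (abs_le.1 hIb).2
    have p : 0 ≤ C * √Y * (U / δ) := by positivity
    have : K * √Y * D = K * √Y * (S.a / (δ * √δ) * (∫ s in (0 : ℝ)..t, √(S.y s)) +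
        (∫ s in (0 : ℝ)..t, S.y s) / δ) + 20 * (C * √Y * (U / δ)) := by rw [hD, hK]; ring
    have hXs' : δ * S.X t = δ * Nd (S.u 0) t + δ * Nd (S.u 1) t := by rw [hXs, mul_add]
    linarith
  have hsq : √Y ^ 2 = Y := Real.sq_sqrt hY0
  have : K * √Y * D ≤ 1 / 4 * Y + K ^ 2 * D ^ 2 := by
    nlinarith [sq_nonneg (√Y / 2 - K * D)]
  linarith

open Fld

/-- A differential inequality of the type produced by the duality estimate. -/
structure DualDecay (C E : ℝ) (Y Y' φ : ℝ → ℝ) : Prop where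
  hC : 1 ≤ C
  dY : ∀ τ, 0 ≤ τ → HasDerivWithinAt Y (Y' τ) (Ici 0) τ
  dφ : ∀ τ, 0 ≤ τ → HasDerivWithinAt φ (Y τ) (Ici 0) τ
  init_φ : φ 0 = 0
  init_Y : Y 0 = E
  nonneg : ∀ τ, 0 ≤ τ → 0 ≤ Y τ
  anti : ∀ τ, 0 ≤ τ → Y' τ ≤ 0
  ineq : ∀ τ h, 0 ≤ τ → 0 < h →
    Y' τ ≤ -(4 / 5) * h * Y τ + C * h * (h ^ 2 * E ^ 2 + h ^ 2 * φ τ ^ 2 + h ^ 3 * τ * φ τ)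

namespace DualDecay
variable {C E : ℝ} {Y Y' φ : ℝ → ℝ}

lemma init_nonneg (H : DualDecay C E Y Y' φ) : 0 ≤ E := H.init_Y ▸ H.nonneg 0 le_rfl

lemma Y_le (H : DualDecay C E Y Y' φ) {τ : ℝ} (hτ : 0 ≤ τ) : Y τ ≤ E :=
  H.init_Y ▸ le_of_deriv_nonpos le_rfl hτ fun t h _ => ⟨_, H.dY t h, H.anti t h⟩

lemma φ_nonneg (H : DualDecay C E Y Y' φ) {τ : ℝ} (hτ : 0 ≤ τ) : 0 ≤ φ τ := by
  have := le_of_deriv_nonpos (f := fun t => -φ t) le_rfl hτ fun t h _ =>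
    ⟨_, (H.dφ t h).neg, neg_nonpos.2 (H.nonneg t h)⟩
  simpa [H.init_φ] using this

lemma φ_le_of_deriv (H : DualDecay C E Y Y' φ) {f f' : ℝ → ℝ} (h0 : 0 ≤ f 0)
    (hf : ∀ τ, 0 ≤ τ → HasDerivWithinAt f (f' τ) (Ici 0) τ) (h : ∀ τ, 0 ≤ τ → Y τ ≤ f' τ)
    {τ : ℝ} (hτ : 0 ≤ τ) : φ τ ≤ f τ := by
  have := le_of_deriv_nonpos (f := fun t => φ t - f t) le_rfl hτ fun t ht _ =>
    ⟨_, (H.dφ t ht).sub (hf t ht), sub_nonpos.2 (h t ht)⟩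
  rw [H.init_φ] at this
  linarith

lemma scaled_ineq (H : DualDecay C E Y Y' φ) {τ l : ℝ} (hτ : 0 ≤ τ) (hl : 0 < l) :
    l ^ 3 * Y' τ ≤ -3 * l ^ 2 * Y τ + 200 * C * (E ^ 2 + φ τ ^ 2 + (1 + τ) / l * φ τ) := by
  have h := H.ineq τ (15 / 4 / l) hτ (by positivity)
  have h1 := mul_le_mul_of_nonneg_left h (by positivity : 0 ≤ l ^ 3)
  have h2 : l ^ 3 * (-(4 / 5) * (15 / 4 / l) * Y τ + C * (15 / 4 / l) * ((15 / 4 / l) ^ 2 * E ^ 2 +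
      (15 / 4 / l) ^ 2 * φ τ ^ 2 + (15 / 4 / l) ^ 3 * τ * φ τ)) =
      -3 * l ^ 2 * Y τ + C * ((15 / 4) ^ 3 * (E ^ 2 + φ τ ^ 2) + (15 / 4) ^ 4 * (τ / l * φ τ)) := by
    field_simp
    ring
  rw [h2] at h1
  have hφ := H.φ_nonneg hτ
  have hC := H.hC
  have h3 : τ / l * φ τ ≤ (1 + τ) / l * φ τ :=
    mul_le_mul_of_nonneg_right (div_le_div_of_nonneg_right (by linarith) hl.le) hφ
  have h4 : 0 ≤ τ / l * φ τ := by positivity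
  have h5 : (15 / 4) ^ 3 * (E ^ 2 + φ τ ^ 2) + (15 / 4) ^ 4 * (τ / l * φ τ) ≤
      200 * (E ^ 2 + φ τ ^ 2 + (1 + τ) / l * φ τ) := by
    have := sq_nonneg E
    have := sq_nonneg (φ τ)
    norm_num
    linarith
  have := mul_le_mul_of_nonneg_left h5 (by linarith : 0 ≤ C)
  linarith

lemma hasDerivWithinAt_log {τ : ℝ} (hτ : 0 ≤ τ) :
    HasDerivWithinAt (fun t => 4 + Real.log (1 + t)) (1 / (1 + τ)) (Ici 0) τ :=
  ((((hasDerivAt_id τ).const_add 1).log (by positivity)).const_add 4).hasDerivWithinAt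

lemma four_le_log {τ : ℝ} (hτ : 0 ≤ τ) : 4 ≤ 4 + Real.log (1 + τ) := by
  have := Real.log_nonneg (by linarith : 1 ≤ 1 + τ)
  linarith

lemma log_weight_le {s l P A f E : ℝ} (hs : 1 ≤ s) (hl : 1 ≤ l) (hP : 1 ≤ P) (hPs : P ≤ 4 * s)
    (hA : 0 ≤ A) (hf : 0 ≤ f) (h : f * P ≤ A * s) :
    P * (E ^ 2 + f ^ 2 + 1 / l * f) ≤ (4 * E ^ 2 + A ^ 2 + A) * s ^ 2 := by
  have hss : s ≤ s ^ 2 := by rw [pow_two]; exact le_mul_of_one_le_left (by linarith) hs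
  have hPP : P ≤ P ^ 2 := by rw [pow_two]; exact le_mul_of_one_le_left (by linarith) hP
  have a1 : P * E ^ 2 ≤ 4 * s ^ 2 * E ^ 2 :=
    mul_le_mul_of_nonneg_right (by linarith) (sq_nonneg _)
  have a2 : (f * P) ^ 2 ≤ (A * s) ^ 2 := pow_le_pow_left₀ (by positivity) h 2
  have a2' : P * f ^ 2 ≤ P ^ 2 * f ^ 2 := mul_le_mul_of_nonneg_right hPP (sq_nonneg _)
  have a3 : 1 / l * (f * P) ≤ 1 * (f * P) :=
    mul_le_mul_of_nonneg_right (by rw [div_le_one (by linarith)]; exact hl) (by positivity)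
  have a3' : A * s ≤ A * s ^ 2 := mul_le_mul_of_nonneg_left hss hA
  linarith

lemma log_improve (H : DualDecay C E Y Y' φ) {p : ℕ} (hp : p ≤ 1) {A : ℝ} (hA : 0 ≤ A)
    (h : ∀ τ, 0 ≤ τ → φ τ * (4 + Real.log (1 + τ)) ^ p ≤ A * (1 + τ)) {τ : ℝ} (hτ : 0 ≤ τ) :
    Y τ * (4 + Real.log (1 + τ)) ^ (p + 1) ≤ 16 * E + 200 * C * (4 * E ^ 2 + A ^ 2 + A) := by
  set W := 200 * C * (4 * E ^ 2 + A ^ 2 + A) with hW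
  have hC := H.hC
  have hW0 : 0 ≤ W := by positivity
  have hE := H.init_nonneg
  have key := le_of_deriv_nonpos (f := fun t => (4 + Real.log (1 + t)) ^ (p + 1) * Y t +
      W * (4 + Real.log (1 + t))⁻¹) le_rfl hτ fun t ht _ => by
    have hL4 := four_le_log ht
    have hl := hasDerivWithinAt_log ht
    refine ⟨_, ((hl.fun_pow (p + 1)).mul (H.dY t ht)).add
      ((hl.fun_inv (by positivity)).const_mul W), ?_⟩
    have hls : 4 + Real.log (1 + t) ≤ 4 * (1 + t) := by
      have := Real.log_le_sub_one_of_pos (by linarith : 0 < 1 + t)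
      linarith
    have hh := h t ht
    set l := 4 + Real.log (1 + t) with hldef
    set s := 1 + t with hs
    have hs1 : 1 ≤ s := by linarith
    have hl0 : 0 < l := by linarith
    have hY := H.nonneg t ht
    have hφ := H.φ_nonneg ht
    have k := H.scaled_ineq ht (by positivity : 0 < s * l)
    rw [← hs] at k
    have e1 : s / (s * l) = 1 / l := by field_simp
    rw [e1] at k
    have hP1 : 1 ≤ l ^ p := one_le_pow₀ (by linarith)
    have hP4 : l ^ p ≤ 4 * s := by
      interval_cases p
      · simp; linarith
      · simpa using hls
    have hpc : ((p + 1 : ℕ) : ℝ) ≤ 3 := by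
      have : (p : ℝ) ≤ 1 := by exact_mod_cast hp
      push_cast; linarith
    set P := l ^ p with hP
    have h1 := log_weight_le hs1 (by linarith : 1 ≤ l) hP1 hP4 hA hφ hh (E := E)
    have h2 := mul_le_mul_of_nonneg_left k (by positivity : 0 ≤ P)
    have h3 : P * l * Y' t ≤ -3 * (P / s) * Y t + W / (s * l ^ 2) := by
      have e2 : P * l * Y' t = P * ((s * l) ^ 3 * Y' t) / (s ^ 3 * l ^ 2) := by field_simp
      have e3 : -3 * (P / s) * Y t + W / (s * l ^ 2) =
          (-3 * P * (s * l) ^ 2 * Y t + W * s ^ 2) / (s ^ 3 * l ^ 2) := by field_simp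
      rw [e2, e3]
      refine div_le_div_of_nonneg_right (h2.trans ?_) (by positivity)
      have := mul_le_mul_of_nonneg_left h1 (by positivity : 0 ≤ 200 * C)
      rw [hW]
      linarith
    have h4 : ((p + 1 : ℕ) : ℝ) * (P / s * Y t) ≤ 3 * (P / s * Y t) :=
      mul_le_mul_of_nonneg_right hpc (by positivity)
    have e5 : l ^ (p + 1) = P * l := by rw [pow_succ]
    simp only [add_tsub_cancel_right]
    rw [e5, ← hP]
    calc _ = ((p + 1 : ℕ) : ℝ) * (P / s * Y t) + P * l * Y' t - W / (s * l ^ 2) := by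
          field_simp
          ring
      _ ≤ 0 := by linarith
  simp only [add_zero, Real.log_one, H.init_Y] at key
  have hL4 := four_le_log hτ
  have h1 : 0 ≤ W * (4 + Real.log (1 + τ))⁻¹ := by positivity
  have h2 : (4 : ℝ) ^ (p + 1) * E ≤ 16 * E := by
    refine mul_le_mul_of_nonneg_right ?_ hE
    interval_cases p <;> norm_num
  nlinarith

lemma φ_le_log (H : DualDecay C E Y Y' φ) {p : ℕ} (hp : p ≤ 2) {B : ℝ} (hB : 0 ≤ B)
    (h : ∀ τ, 0 ≤ τ → Y τ * (4 + Real.log (1 + τ)) ^ p ≤ B) {τ : ℝ} (hτ : 0 ≤ τ) :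
    φ τ * (4 + Real.log (1 + τ)) ^ p ≤ 2 * B * (1 + τ) := by
  have key : φ τ ≤ 2 * B * ((1 + τ) * ((4 + Real.log (1 + τ)) ^ p)⁻¹) := by
    refine H.φ_le_of_deriv (f := fun τ => 2 * B * ((1 + τ) * ((4 + Real.log (1 + τ)) ^ p)⁻¹))
      (f' := fun t => 2 * B * ((4 + Real.log (1 + t)) ^ p)⁻¹ *
        (1 - p * (4 + Real.log (1 + t))⁻¹))
      (by simp; positivity) (fun t ht => ?_) (fun t ht => ?_) hτ
    · have hL4 := four_le_log ht
      refine ((((hasDerivAt_id t).const_add 1).hasDerivWithinAt.mul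
        (((hasDerivWithinAt_log ht).fun_pow p).fun_inv (by positivity))).const_mul _).congr_deriv ?_
      set l := 4 + Real.log (1 + t)
      have : 0 < l := by linarith
      have : 0 < 1 + t := by linarith
      rcases p with _ | p
      · simp
      · simp only [add_tsub_cancel_right, id]
        field_simp
        ring
    · have hL4 := four_le_log ht
      have hh := h t ht
      set l := 4 + Real.log (1 + t)
      have hl : 0 < l := by linarith
      have e1 : (p : ℝ) * l⁻¹ ≤ 1 / 2 := by
        have : (p : ℝ) ≤ 2 := by exact_mod_cast hp
        rw [← div_eq_mul_inv, div_le_iff₀ hl]; linarith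
      have e2 : Y t ≤ B * (l ^ p)⁻¹ := by rwa [← div_eq_mul_inv, le_div_iff₀ (by positivity)]
      have : 0 ≤ B * (l ^ p)⁻¹ := by positivity
      nlinarith
  have hL4 := four_le_log hτ
  rw [← mul_assoc, ← div_eq_mul_inv, le_div_iff₀ (by positivity)] at key
  exact key

lemma φ_bounded (H : DualDecay C E Y Y' φ) {A : ℝ} (hA : 0 ≤ A)
    (h : ∀ τ, 0 ≤ τ → φ τ * (4 + Real.log (1 + τ)) ^ 2 ≤ A * (1 + τ)) {τ : ℝ} (hτ : 0 ≤ τ) :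
    φ τ ≤ Real.exp (200 * C * (1 + A)) * (E + 200 * C * E ^ 2) := by
  have hC := H.hC
  set Q := 200 * C with hQ
  have hQ0 : 0 ≤ Q := by positivity
  have hE := H.init_nonneg
  have key := le_of_deriv_nonpos (f := fun t => Real.exp (Q * ((1 + t)⁻¹ +
      A * (4 + Real.log (1 + t))⁻¹)) * ((1 + t) * Y t + φ t + Q * E ^ 2 * (1 + t)⁻¹))
      le_rfl hτ fun t ht _ => by
    have hL4 := four_le_log ht
    have hl := hasDerivWithinAt_log ht
    have hs := ((hasDerivAt_id t).const_add 1).hasDerivWithinAt (s := Ici 0)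
    have hsi := hs.fun_inv (show (1 + id t) ≠ 0 by simp only [id]; positivity)
    refine ⟨_, (((hsi.add ((hl.fun_inv (by positivity)).const_mul A)).const_mul Q).exp).mul
      (((hs.mul (H.dY t ht)).add (H.dφ t ht)).add (hsi.const_mul (Q * E ^ 2))), ?_⟩
    have hh := h t ht
    have k := H.scaled_ineq ht (by positivity : 0 < 1 + t)
    have hY := H.nonneg t ht
    have hφ := H.φ_nonneg ht
    simp only [id, ← hQ, Pi.add_apply] at k ⊢
    set l := 4 + Real.log (1 + t) with hldef
    set s := 1 + t with hsdef
    have hs1 : 1 ≤ s := by linarith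
    have hl0 : 0 < l := by linarith
    rw [div_self (by positivity), one_mul] at k
    have h1 : φ t ^ 2 ≤ φ t * (A * s / l ^ 2) := by
      rw [pow_two]
      exact mul_le_mul_of_nonneg_left (by rwa [le_div_iff₀ (by positivity)]) hφ
    have h2 : s * Y' t ≤ -3 * Y t + Q * (E ^ 2 / s ^ 2 + φ t * (1 / s ^ 2 + A / (s * l ^ 2))) := by
      have e1 : s * Y' t = (s ^ 3 * Y' t) / s ^ 2 := by field_simp
      rw [e1, div_le_iff₀ (by positivity)]
      refine k.trans ?_
      have e2 : (-3 * Y t + Q * (E ^ 2 / s ^ 2 + φ t * (1 / s ^ 2 + A / (s * l ^ 2)))) * s ^ 2 =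
          -3 * s ^ 2 * Y t + Q * (E ^ 2 + φ t * (A * s / l ^ 2) + φ t) := by
        field_simp
        ring
      rw [e2]
      have := mul_le_mul_of_nonneg_left h1 hQ0
      linarith
    set a := 1 / s ^ 2 + A / (s * l ^ 2) with ha
    have ha0 : 0 ≤ a := by positivity
    set X := Real.exp (Q * (s⁻¹ + A * l⁻¹)) with hX
    calc _ = X * (s * Y' t + 2 * Y t - Q * E ^ 2 / s ^ 2 -
            Q * a * (s * Y t + φ t + Q * E ^ 2 * s⁻¹)) := by
          rw [ha]
          field_simp
          ring
      _ ≤ 0 := by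
          refine mul_nonpos_of_nonneg_of_nonpos (Real.exp_pos _).le ?_
          have p1 : 0 ≤ Q * a * (s * Y t + Q * E ^ 2 * s⁻¹) := by positivity
          have e3 : Q * (E ^ 2 / s ^ 2 + φ t * a) = Q * E ^ 2 / s ^ 2 + Q * a * φ t := by ring
          rw [e3] at h2
          linarith
  simp only [add_zero, Real.log_one, H.init_Y, H.init_φ, inv_one, mul_one, one_mul] at key
  have hL4 := four_le_log hτ
  have hφ := H.φ_nonneg hτ
  have hY := H.nonneg τ hτ
  have h1 : 1 ≤ Real.exp (Q * ((1 + τ)⁻¹ + A * (4 + Real.log (1 + τ))⁻¹)) :=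
    Real.one_le_exp (by positivity)
  have h2 : φ τ ≤ (1 + τ) * Y τ + φ τ + Q * E ^ 2 * (1 + τ)⁻¹ := by
    have : 0 ≤ (1 + τ) * Y τ + Q * E ^ 2 * (1 + τ)⁻¹ := by positivity
    linarith
  have h3 : φ τ ≤ Real.exp (Q * ((1 + τ)⁻¹ + A * (4 + Real.log (1 + τ))⁻¹)) *
      ((1 + τ) * Y τ + φ τ + Q * E ^ 2 * (1 + τ)⁻¹) := by
    nlinarith
  refine h3.trans (key.trans ?_)
  refine mul_le_mul_of_nonneg_right (Real.exp_le_exp.2 ?_) (by positivity)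
  refine mul_le_mul_of_nonneg_left ?_ hQ0
  linarith

lemma Y_decay (H : DualDecay C E Y Y' φ) {B : ℝ} (h : ∀ τ, 0 ≤ τ → φ τ ≤ B) {τ : ℝ} (hτ : 0 ≤ τ) :
    Y τ * (1 + τ) ^ 2 ≤ E + 200 * C * (E ^ 2 + B ^ 2 + B) := by
  have hC := H.hC
  have hE := H.init_nonneg
  have hB : 0 ≤ B := (H.φ_nonneg le_rfl).trans (h 0 le_rfl)
  set W := 200 * C * (E ^ 2 + B ^ 2 + B) with hW
  have hW0 : 0 ≤ W := by positivity
  have key := le_of_deriv_nonpos (f := fun t => (1 + t) ^ 3 * Y t - W * t) le_rfl hτ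
    fun t ht _ => by
    have hs := ((hasDerivAt_id t).const_add 1).hasDerivWithinAt (s := Ici 0)
    refine ⟨_, ((hs.fun_pow 3).mul (H.dY t ht)).sub
      ((hasDerivAt_id t).hasDerivWithinAt.const_mul W), ?_⟩
    have k := H.scaled_ineq ht (by positivity : 0 < 1 + t)
    rw [div_self (by positivity), one_mul] at k
    have hφ := H.φ_nonneg ht
    have hb := h t ht
    have : E ^ 2 + φ t ^ 2 + φ t ≤ E ^ 2 + B ^ 2 + B := by nlinarith
    have := mul_le_mul_of_nonneg_left this (by positivity : 0 ≤ 200 * C)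
    simp only [id]
    norm_num
    linarith
  simp only [add_zero, H.init_Y, one_pow, one_mul, mul_zero, sub_zero] at key
  have : (1 + τ) * (Y τ * (1 + τ) ^ 2) ≤ (1 + τ) * (E + W) := by nlinarith
  exact le_of_mul_le_mul_left this (by positivity)

/-- Quadratic decay, with a constant depending only on a bound for the initial energy. -/
lemma exists_decay (C M : ℝ) (hC : 1 ≤ C) (hM : 0 ≤ M) : ∃ K : ℝ, 1 ≤ K ∧ ∀ E Y Y' φ, E ≤ M →
    DualDecay C E Y Y' φ → ∀ τ, 0 ≤ τ → Y τ * (1 + τ) ^ 2 ≤ K * E := by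
  set b : ℝ → ℝ := fun α => 16 + 200 * C * (4 * M + α ^ 2 * M + α) with hb
  have hb0 : ∀ α, 0 ≤ α → 0 ≤ b α := fun α hα => by simp only [hb]; positivity
  have hbE : ∀ E α, 0 ≤ E → E ≤ M → 0 ≤ α →
      16 * E + 200 * C * (4 * E ^ 2 + (α * E) ^ 2 + α * E) ≤ b α * E := by
    intro E α hE hEM hα
    have h1 : E ^ 2 ≤ M * E := by nlinarith
    have h2 : (α * E) ^ 2 ≤ α ^ 2 * M * E := by
      have := mul_le_mul_of_nonneg_left h1 (sq_nonneg α); linarith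
    have h3 : 4 * E ^ 2 + (α * E) ^ 2 + α * E ≤ (4 * M + α ^ 2 * M + α) * E := by linarith
    have := mul_le_mul_of_nonneg_left h3 (by positivity : 0 ≤ 200 * C)
    simp only [hb]
    linarith
  set β := b 1 with hβ
  set γ := b (2 * β) with hγ
  have hβ0 : 0 ≤ β := hb0 1 zero_le_one
  have hγ0 : 0 ≤ γ := hb0 _ (by positivity)
  set δ := Real.exp (200 * C * (1 + 2 * γ * M)) * (1 + 200 * C * M) with hδ
  have hδ0 : 0 ≤ δ := by positivity
  refine ⟨b δ, by simp only [hb]; nlinarith [show 0 ≤ 200 * C * (4 * M + δ ^ 2 * M + δ) by positivity],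
    fun E Y Y' φ hEM H τ hτ => ?_⟩
  have hE := H.init_nonneg
  have a0 : ∀ τ, 0 ≤ τ → φ τ * (4 + Real.log (1 + τ)) ^ 0 ≤ E * (1 + τ) := fun τ hτ => by
    rw [pow_zero, mul_one]
    refine H.φ_le_of_deriv (f := fun τ => E * (1 + τ)) (f' := fun _ => E) (by simpa using hE)
      (fun t ht => ?_) (fun t ht => H.Y_le ht) hτ
    exact ((((hasDerivAt_id t).const_add 1).const_mul E).congr_deriv (mul_one _)).hasDerivWithinAt
  have a1 : ∀ τ, 0 ≤ τ → Y τ * (4 + Real.log (1 + τ)) ^ 1 ≤ β * E := fun τ hτ =>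
    (H.log_improve zero_le_one hE a0 hτ).trans (by simpa using hbE E 1 hE hEM zero_le_one)
  have a2 := fun τ hτ => H.φ_le_log one_le_two (by positivity) a1 (τ := τ) hτ
  rw [← mul_assoc] at a2
  have a3 : ∀ τ, 0 ≤ τ → Y τ * (4 + Real.log (1 + τ)) ^ 2 ≤ γ * E := fun τ hτ =>
    (H.log_improve le_rfl (by positivity) a2 hτ).trans (hbE E (2 * β) hE hEM (by positivity))
  have a4 := fun τ hτ => H.φ_le_log le_rfl (by positivity) a3 (τ := τ) hτ
  have a5 : ∀ τ, 0 ≤ τ → φ τ ≤ δ * E := fun τ hτ => by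
    refine (H.φ_bounded (by positivity) a4 hτ).trans ?_
    have h1 : 2 * (γ * E) ≤ 2 * γ * M := by nlinarith
    have h2 : E + 200 * C * E ^ 2 ≤ (1 + 200 * C * M) * E := by
      have : E ^ 2 ≤ M * E := by nlinarith
      have := mul_le_mul_of_nonneg_left this (by positivity : 0 ≤ 200 * C)
      linarith
    rw [hδ, mul_assoc (Real.exp _)]
    exact mul_le_mul (Real.exp_le_exp.2 (mul_le_mul_of_nonneg_left (by linarith) (by positivity))) h2
      (by positivity) (by positivity)
  refine (H.Y_decay a5 hτ).trans (le_trans ?_ (hbE E δ hE hEM hδ0))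
  have : 0 ≤ 200 * C * E ^ 2 := by positivity
  linarith

end DualDecay

/-- Quadratic decay of the energy. -/
lemma exists_energy_decay (M : ℝ) (hM : 0 ≤ M) : ∃ K : ℝ, 1 ≤ K ∧ ∀ (S : Flow) (U T : ℝ), 0 < T →
    S.y 0 ≤ M → (∀ j, Integrable fun x => ‖x‖ * |(S.u j).1 0 x|) →
    (∀ j, ∫ x, ‖x‖ * |(S.u j).1 0 x| ≤ U) → (∀ j, Int (S.r * S.u j) 0 = 0) →
    U ≤ T * S.y 0 → S.a ^ 2 ≤ T → ∀ t, 0 ≤ t → S.y t * (1 + t / T) ^ 2 ≤ K * S.y 0 := by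
  obtain ⟨C, hC, hd⟩ := exists_duality
  obtain ⟨K, hK, h⟩ := DualDecay.exists_decay (3 * C) M (by linarith) hM
  refine ⟨K, hK, fun S U T hT hyM hm hU h0 hUT haT t ht => ?_⟩
  have cy := S.continuous_y
  set φ : ℝ → ℝ := fun τ => ∫ σ in (0 : ℝ)..τ, S.y (T * σ) with hφ
  have cY : Continuous fun σ => S.y (T * σ) := by fun_prop
  have hmulT : ∀ τ, HasDerivAt (fun τ => T * τ) T τ := fun τ => by
    simpa using (hasDerivAt_id τ).const_mul T
  have key : DualDecay (3 * C) (S.y 0) (fun τ => S.y (T * τ)) (fun τ => -2 * S.X (T * τ) * T) φ := by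
    refine ⟨by linarith, fun τ hτ => ?_, fun τ hτ => ?_, by simp [hφ], by simp,
      fun τ hτ => S.y_nonneg (by positivity), fun τ hτ => ?_, fun τ k hτ hk => ?_⟩
    · exact (S.hasDerivWithinAt_y (by positivity : 0 ≤ T * τ)).comp τ (hmulT τ).hasDerivWithinAt
        fun x hx => mul_nonneg hT.le hx
    · exact (intervalIntegral.integral_hasDerivAt_right (cY.intervalIntegrable _ _)
        cY.stronglyMeasurable.stronglyMeasurableAtFilter cY.continuousAt).hasDerivWithinAt
    · have := S.X_nonneg (T * τ)
      have : 0 ≤ S.X (T * τ) * T := by positivity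
      linarith
    · have hd1 := hd S U hm hU h0 (T * τ) (T / k) (by positivity) (by positivity)
      have e1 : ∫ s in (0 : ℝ)..T * τ, S.y s = T * φ τ := by
        have := intervalIntegral.mul_integral_comp_mul_left (a := 0) (b := τ) (f := S.y) T
        rw [mul_zero] at this; exact this.symm
      have e2 : ∫ s in (0 : ℝ)..T * τ, √(S.y s) = T * ∫ σ in (0 : ℝ)..τ, √(S.y (T * σ)) := by
        have := intervalIntegral.mul_integral_comp_mul_left (a := 0) (b := τ)
          (f := fun s => √(S.y s)) T
        rw [mul_zero] at this; exact this.symm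
      set ψ := ∫ σ in (0 : ℝ)..τ, √(S.y (T * σ)) with hψ
      have hφ0 : 0 ≤ φ τ := intervalIntegral.integral_nonneg hτ fun σ hσ =>
        S.y_nonneg (mul_nonneg hT.le hσ.1)
      have e3 : ψ ^ 2 ≤ τ * φ τ := by
        have q : ∀ c : ℝ, 0 ≤ φ τ - 2 * c * ψ + c ^ 2 * τ := fun c => by
          have : ∫ σ in (0 : ℝ)..τ, (√(S.y (T * σ)) - c) ^ 2 = φ τ - 2 * c * ψ + c ^ 2 * τ := by
            have cs : Continuous fun σ => √(S.y (T * σ)) := cY.sqrt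
            have : ∀ σ ∈ uIcc 0 τ, (√(S.y (T * σ)) - c) ^ 2 =
                (S.y (T * σ) - 2 * c * √(S.y (T * σ))) + c ^ 2 := fun σ hσ => by
              rw [uIcc_of_le hτ] at hσ
              have := Real.sq_sqrt (S.y_nonneg (mul_nonneg hT.le hσ.1))
              linear_combination this
            rw [intervalIntegral.integral_congr this, intervalIntegral.integral_add,
              intervalIntegral.integral_sub, intervalIntegral.integral_const_mul,
              intervalIntegral.integral_const]
            · simp only [sub_zero, smul_eq_mul]; ring
            · exact cY.intervalIntegrable _ _
            · exact (cs.const_mul _).intervalIntegrable _ _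
            · exact (cY.sub (cs.const_mul _)).intervalIntegrable _ _
            · exact continuous_const.intervalIntegrable _ _
          rw [← this]
          exact intervalIntegral.integral_nonneg hτ fun _ _ => sq_nonneg _
        rcases hτ.eq_or_lt with rfl | hτ'
        · simp [hψ]
        · have := q (ψ / τ)
          have e : φ τ - 2 * (ψ / τ) * ψ + (ψ / τ) ^ 2 * τ = φ τ - ψ ^ 2 / τ := by
            field_simp; ring
          rw [e, sub_nonneg, div_le_iff₀ hτ'] at this
          linarith
      have hyu : S.y (T * τ) ≤ 5 / 4 * Int (dot S.u S.u) (T * τ) := (S.Int_r_dot_le S.u (by positivity)).2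
      rw [e1, e2] at hd1
      have hU0 : 0 ≤ U := (integral_nonneg fun x => by positivity).trans (hU 0)
      have hy0 := S.y_nonneg le_rfl
      have hψ0 : 0 ≤ ψ := intervalIntegral.integral_nonneg hτ fun σ _ => Real.sqrt_nonneg _
      have b1 : (U / (T / k)) ^ 2 ≤ k ^ 2 * S.y 0 ^ 2 := by
        rw [← mul_pow]
        refine pow_le_pow_left₀ (by positivity) ?_ 2
        rw [div_le_iff₀ (by positivity)]
        calc U ≤ T * S.y 0 := hUT
          _ = _ := by field_simp
      have b2 : T * φ τ / (T / k) = k * φ τ := by field_simp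
      have b3 : (S.a / (T / k * √(T / k)) * (T * ψ)) ^ 2 ≤ k ^ 3 * τ * φ τ := by
        have hs : √(T / k) ^ 2 = T / k := Real.sq_sqrt (by positivity)
        have : (S.a / (T / k * √(T / k)) * (T * ψ)) ^ 2 = S.a ^ 2 / T * (k ^ 3 * ψ ^ 2) := by
          rw [mul_pow, div_pow, mul_pow, hs]; field_simp
        rw [this]
        calc _ ≤ 1 * (k ^ 3 * ψ ^ 2) :=
              mul_le_mul_of_nonneg_right (by rwa [div_le_one hT]) (by positivity)
          _ ≤ _ := by
            have := mul_le_mul_of_nonneg_left e3 (by positivity : 0 ≤ k ^ 3)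
            linarith
      rw [b2] at hd1
      set p1 := U / (T / k)
      set p3 := S.a / (T / k * √(T / k)) * (T * ψ)
      have b4 : (p1 + k * φ τ + p3) ^ 2 ≤ 3 * (k ^ 2 * S.y 0 ^ 2 + k ^ 2 * φ τ ^ 2 + k ^ 3 * τ * φ τ) := by
        nlinarith [sq_nonneg (p1 - k * φ τ), sq_nonneg (p1 - p3), sq_nonneg (p3 - k * φ τ)]
      have b5 := mul_le_mul_of_nonneg_left b4 (by linarith : 0 ≤ C)
      set R := k ^ 2 * S.y 0 ^ 2 + k ^ 2 * φ τ ^ 2 + k ^ 3 * τ * φ τ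
      have b6 : k * S.y (T * τ) ≤ 5 / 4 * (2 * T * S.X (T * τ) + k * (3 * C * R)) := by
        have : k * (2 * (T / k) * S.X (T * τ) + C * (3 * R)) =
            2 * T * S.X (T * τ) + k * (3 * C * R) := by field_simp
        rw [← this]
        have : S.y (T * τ) ≤ 5 / 4 * (2 * (T / k) * S.X (T * τ) + C * (3 * R)) := by linarith
        have := mul_le_mul_of_nonneg_left this hk.le
        linarith
      linarith
  have := h _ _ _ _ hyM key (t / T) (by positivity)
  have e : T * (t / T) = t := by field_simp
  simpa only [e] using this

open Fld

lemma sq_sum_four_le (a b c d a' b' c' d' : ℝ) :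
    (a * a' + b * b' + (c * c' + d * d')) ^ 2 ≤
      2 * ((a ^ 2 + b ^ 2) * (a' ^ 2 + b' ^ 2)) + 2 * ((c ^ 2 + d ^ 2) * (c' ^ 2 + d' ^ 2)) := by
  have h1 : (a * a' + b * b') ^ 2 ≤ (a ^ 2 + b ^ 2) * (a' ^ 2 + b' ^ 2) := by
    nlinarith [sq_nonneg (a * b' - b * a')]
  have h2 : (c * c' + d * d') ^ 2 ≤ (c ^ 2 + d ^ 2) * (c' ^ 2 + d' ^ 2) := by
    nlinarith [sq_nonneg (c * d' - d * c')]
  nlinarith [sq_nonneg ((a * a' + b * b') - (c * c' + d * d'))]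

namespace Flow
variable (S : Flow)

/-- The time derivative of the velocity. -/
def ut (j : Fin 2) : Fld := Dt (S.u j)

instance (j) : IsL2 (S.ut j) := by unfold ut; infer_instance

lemma gsq_z_le (t x) : (gsq S.z).1 t x ≤
    (2 : ℝ) * (gsq S.u * gsq S.u).1 t x + 2 * (dot S.u S.u * hsq S.u).1 t x := by
  have h : ∀ k j, (Dx k (S.z j)).1 t x ^ 2 ≤
      2 * (((Dx k (S.u 0)).1 t x ^ 2 + (Dx k (S.u 1)).1 t x ^ 2) *
        ((Dx 0 (S.u j)).1 t x ^ 2 + (Dx 1 (S.u j)).1 t x ^ 2)) +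
      2 * (((S.u 0).1 t x ^ 2 + (S.u 1).1 t x ^ 2) *
        ((Dx k (Dx 0 (S.u j))).1 t x ^ 2 + (Dx k (Dx 1 (S.u j))).1 t x ^ 2)) := fun k j => by
    refine le_of_eq_of_le ?_ (sq_sum_four_le _ _ _ _ _ _ _ _)
    congr 1
    simp only [z, map_add, D_mul, add_val, mul_val]
    ring
  have h00 := h 0 0
  have h01 := h 0 1
  have h10 := h 1 0
  have h11 := h 1 1
  simp only [gsq, hsq, dot, add_val, mul_val, Dx_one_zero] at *
  linarith

lemma Int_v_le (t : ℝ) : S.V t ≤ 2 * Int (dot S.ut S.ut) t + 2 * Int (dot S.z S.z) t := by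
  rw [← Int_smul, ← Int_smul, ← Int_add]
  refine Int_mono fun x => ?_
  simp only [dot, v_eq, add_val, mul_val, smul_val, ut]
  nlinarith [sq_nonneg ((Dt (S.u 0)).1 t x - (S.z 0).1 t x),
    sq_nonneg ((Dt (S.u 1)).1 t x - (S.z 1).1 t x)]

lemma Int_gsq_v_le (t : ℝ) : S.N t ≤ 2 * Int (gsq S.ut) t + 2 * Int (gsq S.z) t := by
  rw [← Int_smul, ← Int_smul, ← Int_add]
  refine Int_mono fun x => ?_
  have h : ∀ k j, (Dx k (S.v j)).1 t x * (Dx k (S.v j)).1 t x ≤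
      2 * ((Dx k (S.ut j)).1 t x * (Dx k (S.ut j)).1 t x) +
      2 * ((Dx k (S.z j)).1 t x * (Dx k (S.z j)).1 t x) := fun k j => by
    simp only [v_eq, map_add, add_val, ut]
    nlinarith [sq_nonneg ((Dx k (Dt (S.u j))).1 t x - (Dx k (S.z j)).1 t x)]
  have h00 := h 0 0
  have h01 := h 0 1
  have h10 := h 1 0
  have h11 := h 1 1
  simp only [gsq, dot, add_val, mul_val, smul_val]
  linarith

lemma sq_X_le {t : ℝ} (ht : 0 ≤ t) : S.X t ^ 2 ≤ 9 * (S.y t * S.V t) := by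
  have e : S.X t = -(Int (S.u 0 * Lap (S.u 0)) t + Int (S.u 1 * Lap (S.u 1)) t) := by
    have := Int_dot_Lap S.u t
    rw [← Int_add]; change S.X t = -Int (dot S.u fun j => Lap (S.u j)) t
    rw [this, neg_neg]; rfl
  have hY := S.Int_u_le ht
  have hs := S.stokes ht
  have hp := Int_dot_nonneg S.p t
  rw [Int_hsq_eq] at hs
  set Y := Int (dot S.u S.u) t
  set L : Fin 2 → Fld := fun j => Lap (S.u j)
  have iL : ∀ j, IsL2 (L j) := fun j => by simp only [L]; infer_instance
  set H := Int (dot L L) t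
  have hY0 : 0 ≤ Y := Int_dot_nonneg S.u t
  have hH0 : 0 ≤ H := Int_dot_nonneg L t
  have h : ∀ j, |Int (S.u j * Lap (S.u j)) t| ≤ √Y * √H := fun j =>
    (abs_Int_mul_le _ _ t).trans (mul_le_mul (Real.sqrt_le_sqrt (Int_sq_le_dot S.u j t))
      (Real.sqrt_le_sqrt (Int_sq_le_dot L j t)) (Real.sqrt_nonneg _) (Real.sqrt_nonneg _))
  have h0 := abs_le.1 (h 0)
  have h1 := abs_le.1 (h 1)
  have hX : S.X t ≤ 2 * (√Y * √H) := by rw [e]; linarith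
  have h2 := pow_le_pow_left₀ (S.X_nonneg t) hX 2
  have e2 : (2 * (√Y * √H)) ^ 2 = 4 * (Y * H) := by
    rw [mul_pow, mul_pow, Real.sq_sqrt hY0, Real.sq_sqrt hH0]; norm_num
  rw [e2] at h2
  have hV := S.V_nonneg t
  have hy := S.y_nonneg ht
  have : Y * H ≤ (4 / 3 * S.y t) * (25 / 16 * S.V t) :=
    mul_le_mul hY (by linarith) hH0 (by positivity)
  have : 0 ≤ S.y t * S.V t := by positivity
  linarith

lemma exists_V_le : ∃ K : ℝ, 1 ≤ K ∧ ∀ (S : Flow) (t : ℝ), 0 ≤ t →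
    S.V t ≤ 7 * (√(S.X t) * √(S.N t)) + K * (S.y t * S.X t ^ 2) := by
  obtain ⟨K, hK, h⟩ := exists_p_z_le
  refine ⟨2 * K, by linarith, fun S t ht => ?_⟩
  have h1 := h S t ht
  rw [← Int_p_v] at h1
  have e1 : Int (S.r * dot S.v S.v) t + Int (dot S.p S.v) t =
      -(Int (Dx 0 (S.u 0) * Dx 0 (S.v 0)) t + Int (Dx 0 (S.u 1) * Dx 0 (S.v 1)) t +
        Int (Dx 1 (S.u 0) * Dx 1 (S.v 0)) t + Int (Dx 1 (S.u 1) * Dx 1 (S.v 1)) t) := by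
    rw [← Int_add, ← Int_add, ← Int_add, ← Int_add, ← Int_neg]
    refine Int_eq_of_sub_eq_div (Dx 0 (S.u 0) * S.v 0 + Dx 0 (S.u 1) * S.v 1)
      (Dx 1 (S.u 0) * S.v 0 + Dx 1 (S.u 1) * S.v 1) ?_ t
    have h0 := S.Lap_u 0
    have h1 := S.Lap_u 1
    simp only [Lap] at h0 h1
    simp only [dot, map_add, D_mul]
    linear_combination -(S.v 0 * h0 + S.v 1 * h1)
  have h2 : ∀ k j, |Int (Dx k (S.u j) * Dx k (S.v j)) t| ≤ √(S.X t) * √(S.N t) := fun k j =>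
    (abs_Int_mul_le _ _ t).trans (mul_le_mul (Real.sqrt_le_sqrt (Int_sq_le_gsq S.u k j t))
      (Real.sqrt_le_sqrt (Int_sq_le_gsq S.v k j t)) (Real.sqrt_nonneg _) (Real.sqrt_nonneg _))
  have g := fun k j => abs_le.1 (h2 k j)
  have h3 := (S.Int_r_dot_le S.v ht).1
  change 3 / 4 * S.V t ≤ _ at h3
  have h4 := abs_le.1 h1
  have hV := S.V_nonneg t
  have := mul_nonneg (Real.sqrt_nonneg (S.X t)) (Real.sqrt_nonneg (S.N t))
  have := mul_nonneg (S.y_nonneg ht) (sq_nonneg (S.X t))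
  have : 0 ≤ K * (S.y t * S.X t ^ 2) := by positivity
  linarith [g 0 0, g 0 1, g 1 0, g 1 1]

lemma exists_gsq_z_le : ∃ K : ℝ, 1 ≤ K ∧ ∀ (S : Flow) (t : ℝ), 0 ≤ t →
    Int (gsq S.z) t ≤ K * ((S.X t + √(S.y t * S.V t)) * S.V t) := by
  obtain ⟨K, hK, h⟩ := exists_ladyzhenskaya
  obtain ⟨C, hC, hag⟩ := exists_agmon
  refine ⟨4 * K + 24 * (C + 1), by linarith, fun S t ht => ?_⟩
  have hs := S.stokes ht
  have hp := Int_dot_nonneg S.p t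
  have hX := S.X_nonneg t
  have hV := S.V_nonneg t
  have hy := S.y_nonneg ht
  have hY := S.Int_u_le ht
  have hH : Int (hsq S.u) t ≤ 2 * S.V t := by linarith
  have hH0 := Int_hsq_nonneg S.u t
  set B := √(S.y t * S.V t) with hB
  have hB0 : 0 ≤ B := Real.sqrt_nonneg _
  have hB2 : B ^ 2 = S.y t * S.V t := Real.sq_sqrt (by positivity)
  have hsup : ∀ x, (dot S.u S.u).1 t x ≤ 6 * (C + 1) * B := fun x => by
    have hj : ∀ j, (S.u j).1 t x ^ 2 ≤ 3 * (C + 1) * B := fun j => by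
      refine abs_le_of_sq_le_sq' ?_ (by positivity) |>.2
      have h1 := hag (S.u j) t x
      have h2 : Int (S.u j * S.u j) t * Int (Lap (S.u j) * Lap (S.u j)) t ≤
          (4 / 3 * S.y t) * (2 * S.V t) := by
        refine mul_le_mul ((Int_sq_le_dot S.u j t).trans hY) ?_ (Int_sq_nonneg _ _) (by positivity)
        rw [Int_hsq_eq] at hH
        exact (Int_sq_le_dot (fun j => Lap (S.u j)) j t).trans hH
      have h3 := mul_le_mul_of_nonneg_left h2 hC.le
      have h4 : 0 ≤ S.y t * S.V t := by positivity
      calc ((S.u j).1 t x ^ 2) ^ 2 = (S.u j).1 t x ^ 4 := by ring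
        _ ≤ C * (4 / 3 * S.y t * (2 * S.V t)) := h1.trans h3
        _ = 8 / 3 * C * (S.y t * S.V t) := by ring
        _ ≤ 9 * (C + 1) ^ 2 * (S.y t * S.V t) := mul_le_mul_of_nonneg_right (by nlinarith) h4
        _ = (3 * (C + 1) * B) ^ 2 := by rw [mul_pow, hB2]; ring
    have h0 := hj 0
    have h1 := hj 1
    simp only [dot, add_val, mul_val]
    nlinarith
  have h1 : Int (gsq S.z) t ≤ Int ((2 : ℝ) • (gsq S.u * gsq S.u) + (12 * (C + 1) * B) • hsq S.u) t :=
    Int_mono fun x => by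
      have := S.gsq_z_le t x
      have h2 := mul_le_mul_of_nonneg_right (hsup x) (hsq_nonneg S.u t x)
      simp only [add_val, smul_val, mul_val] at *
      linarith
  rw [Int_add, Int_smul, Int_smul] at h1
  have h2 := (h S.u t).2
  have h3 : Int (gsq S.u) t * Int (hsq S.u) t ≤ S.X t * (2 * S.V t) := mul_le_mul_of_nonneg_left hH hX
  have h4 := mul_le_mul_of_nonneg_left h3 (by linarith : 0 ≤ K)
  have h5 := mul_le_mul_of_nonneg_left hH (by positivity : 0 ≤ 12 * (C + 1) * B)
  have h6 : 0 ≤ K * (B * S.V t) := by positivity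
  have h7 : 0 ≤ (C + 1) * (S.X t * S.V t) := by positivity
  linarith

set_option maxHeartbeats 1000000 in
/-- Comparison of the initial energies. -/
lemma exists_initial (M : ℝ) (hM : 0 ≤ M) : ∃ C : ℝ, 1 ≤ C ∧ ∀ (S : Flow) (E2 E3 : ℝ), S.y 0 ≤ M →
    E2 = Int (S.r * dot S.ut S.ut) 0 + S.X 0 ^ 2 → Int (gsq S.ut) 0 + E2 * √E2 ≤ E3 →
    S.V 0 + S.X 0 ^ 2 ≤ C * E2 ∧ S.N 0 + (S.V 0 + S.X 0 ^ 2) * S.X 0 ≤ C * E3 ∧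
    (S.V 0 + S.X 0 ^ 2) ^ 2 ≤ C * (S.X 0 * E3) ∧ S.X 0 ^ 2 ≤ C * (S.y 0 * E2) ∧
    S.X 0 ^ 3 ≤ C * (S.y 0 ^ 2 * E3) := by
  obtain ⟨K1, hK1, h1⟩ := exists_z_le
  obtain ⟨K2, hK2, h2⟩ := exists_gsq_z_le
  obtain ⟨K3, hK3, h3⟩ := exists_V_le
  set c1 := 6 + 16 * K1 * M with hc1
  have hc10 : 0 ≤ c1 := by positivity
  set c2 := 2 + 2 * K2 * ((1 + √(M * c1)) * c1) with hc2
  have hc20 : 0 ≤ c2 := by positivity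
  set c3 := 98 * c2 + 2 * (K3 * M + 1) ^ 2 with hc3
  set c5 := 36 * K3 + 126 ^ 2 * c2 with hc5
  set C := (c1 + 1) + (c2 + c1 + 1) + c3 + 9 * c1 + c5 with hC
  have p3 : 0 ≤ c3 := by positivity
  have p5 : 0 ≤ c5 := by positivity
  refine ⟨C, by linarith, fun S E2 E3 hyM hE2 hE3 => ?_⟩
  have hX := S.X_nonneg 0
  have hV := S.V_nonneg 0
  have hN := S.N_nonneg 0
  have hy := S.y_nonneg le_rfl
  have hd := (S.Int_r_dot_le S.ut le_rfl).1
  have hd0 := Int_dot_nonneg S.ut 0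
  have hg0 := Int_gsq_nonneg S.ut 0
  have hz := h1 S 0 le_rfl (1 / 4) (by norm_num)
  have hv := S.Int_v_le 0
  have hX2 : S.X 0 ^ 2 ≤ E2 := by linarith
  have hE20 : 0 ≤ E2 := (sq_nonneg _).trans hX2
  have aV : S.V 0 ≤ c1 * E2 := by
    have e1 : K1 / (1 / 4) * (S.y 0 * S.X 0 ^ 2) = 4 * K1 * (S.y 0 * S.X 0 ^ 2) := by ring
    rw [e1] at hz
    have e2 : S.y 0 * S.X 0 ^ 2 ≤ M * E2 := mul_le_mul hyM hX2 (sq_nonneg _) hM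
    have e3 := mul_le_mul_of_nonneg_left e2 (by linarith : 0 ≤ 4 * K1)
    have e4 : Int (dot S.ut S.ut) 0 ≤ 4 / 3 * E2 := by linarith [sq_nonneg (S.X 0)]
    rw [hc1]
    linarith
  set q := √E2 with hq
  have hq0 : 0 ≤ q := Real.sqrt_nonneg _
  have hq2 : q ^ 2 = E2 := Real.sq_sqrt hE20
  have hXq : S.X 0 ≤ q := Real.le_sqrt_of_sq_le hX2
  have hE30 : 0 ≤ E3 := by linarith [mul_nonneg hE20 hq0]
  have hq3 : E2 * q ≤ E3 := by linarith
  have aN : S.N 0 ≤ c2 * E3 := by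
    have e1 := h2 S 0 le_rfl
    have e2 := S.Int_gsq_v_le 0
    have e3 : √(S.y 0 * S.V 0) ≤ √(M * c1) * q := by
      rw [hq, ← Real.sqrt_mul (by positivity)]
      refine Real.sqrt_le_sqrt ?_
      calc S.y 0 * S.V 0 ≤ M * (c1 * E2) := mul_le_mul hyM aV hV hM
        _ = _ := by ring
    have e4 : (S.X 0 + √(S.y 0 * S.V 0)) * S.V 0 ≤ ((1 + √(M * c1)) * q) * (c1 * E2) := by
      refine mul_le_mul (by linarith) aV hV (by positivity)
    have e5 : ((1 + √(M * c1)) * q) * (c1 * E2) ≤ (1 + √(M * c1)) * c1 * E3 := by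
      have := mul_le_mul_of_nonneg_left hq3 (by positivity : 0 ≤ (1 + √(M * c1)) * c1)
      linarith
    have e6 := mul_le_mul_of_nonneg_left (e4.trans e5) (by linarith : 0 ≤ K2)
    have e7 : Int (gsq S.ut) 0 ≤ E3 := by linarith [mul_nonneg hE20 hq0]
    rw [hc2]
    linarith
  have hXq3 : S.X 0 ^ 3 ≤ E3 := by
    refine le_trans ?_ hq3
    rw [← hq2]
    calc S.X 0 ^ 3 ≤ q ^ 3 := pow_le_pow_left₀ hX hXq 3
      _ = _ := by ring
  have hCle : ∀ a b, a ≤ C → 0 ≤ b → a * b ≤ C * b := fun a b ha hb =>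
    mul_le_mul_of_nonneg_right ha hb
  have hVle := h3 S 0 le_rfl
  have hsX := Real.sq_sqrt hX
  have hsN := Real.sq_sqrt hN
  have hsq := S.sq_X_le le_rfl
  set a := √(S.X 0) * √(S.N 0) with ha
  have ha0 : 0 ≤ a := by positivity
  have ha2 : a ^ 2 = S.X 0 * S.N 0 := by rw [ha, mul_pow, hsX, hsN]
  refine ⟨?_, ?_, ?_, ?_, ?_⟩
  · refine le_trans ?_ (hCle (c1 + 1) E2 (by linarith) hE20)
    linarith
  · refine le_trans ?_ (hCle (c2 + c1 + 1) E3 (by linarith) hE30)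
    have e1 : (S.V 0 + S.X 0 ^ 2) * S.X 0 ≤ ((c1 + 1) * E2) * q :=
      mul_le_mul (by linarith) hXq hX (by positivity)
    have := mul_le_mul_of_nonneg_left hq3 (by positivity : 0 ≤ c1 + 1)
    linarith
  · refine le_trans ?_ (hCle c3 _ (by linarith) (by positivity))
    have e1 : S.V 0 + S.X 0 ^ 2 ≤ 7 * a + (K3 * M + 1) * S.X 0 ^ 2 := by
      have := mul_le_mul_of_nonneg_right hyM (sq_nonneg (S.X 0))
      have := mul_le_mul_of_nonneg_left this (by linarith : 0 ≤ K3)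
      linarith
    have e2 := pow_le_pow_left₀ (by positivity) e1 2
    have e3 : (7 * a + (K3 * M + 1) * S.X 0 ^ 2) ^ 2 ≤
        98 * a ^ 2 + 2 * (K3 * M + 1) ^ 2 * (S.X 0 * S.X 0 ^ 3) := by
      nlinarith [sq_nonneg (7 * a - (K3 * M + 1) * S.X 0 ^ 2)]
    have e4 : a ^ 2 ≤ c2 * (S.X 0 * E3) := by
      rw [ha2]; have := mul_le_mul_of_nonneg_left aN hX; linarith
    have e5 := mul_le_mul_of_nonneg_left (mul_le_mul_of_nonneg_left hXq3 hX)
      (by positivity : 0 ≤ 2 * (K3 * M + 1) ^ 2)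
    rw [hc3]
    linarith
  · refine le_trans ?_ (hCle (9 * c1) _ (by linarith) (by positivity))
    have := mul_le_mul_of_nonneg_left aV hy
    linarith
  · refine le_trans ?_ (hCle c5 _ (by linarith) (by positivity))
    rw [hc5, add_mul]
    have r1 : 0 ≤ 126 ^ 2 * c2 * (S.y 0 ^ 2 * E3) := by positivity
    have r2 : 0 ≤ 36 * K3 * (S.y 0 ^ 2 * E3) := by positivity
    rcases le_or_gt 1 (36 * K3 * S.y 0 ^ 2) with hc | hc
    · have := mul_le_mul_of_nonneg_right hc hE30
      linarith
    · rcases hX.eq_or_lt with h0 | hpos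
      · rw [← h0]; norm_num; linarith
      have e1 : S.y 0 * S.V 0 ≤ S.y 0 * (7 * a + K3 * (S.y 0 * S.X 0 ^ 2)) :=
        mul_le_mul_of_nonneg_left hVle hy
      have e2 : 36 * K3 * S.y 0 ^ 2 * S.X 0 ^ 2 ≤ 1 * S.X 0 ^ 2 :=
        mul_le_mul_of_nonneg_right hc.le (sq_nonneg _)
      have e3 : S.X 0 ^ 2 ≤ 126 * (S.y 0 * a) := by linarith [mul_nonneg hy ha0]
      have e4 := pow_le_pow_left₀ (sq_nonneg _) e3 2
      have e5 : (126 * (S.y 0 * a)) ^ 2 = 126 ^ 2 * S.y 0 ^ 2 * (S.X 0 * S.N 0) := by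
        rw [← ha2]; ring
      rw [e5] at e4
      have e6 : S.X 0 * S.X 0 ^ 3 ≤ S.X 0 * (126 ^ 2 * S.y 0 ^ 2 * S.N 0) := by linarith
      have e7 := le_of_mul_le_mul_left e6 hpos
      have e8 := mul_le_mul_of_nonneg_left aN (by positivity : 0 ≤ 126 ^ 2 * S.y 0 ^ 2)
      linarith

end Flow

open Fld
namespace Flow

/-- The squared length of the density gradient. -/
def g (S : Flow) : Fld := Dx 0 S.r * Dx 0 S.r + Dx 1 S.r * Dx 1 S.r

/-- Quantitative assumptions on the initial data of a flow, at time scale `T`. -/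
structure Data (S : Flow) (T E2 E3 G : ℝ) : Prop where
  T_pos : 0 < T
  y_pos : 0 < S.y 0
  moment : ∀ j, Integrable fun x => ‖x‖ * |(S.u j).1 0 x|
  moment_le : ∀ j, ∫ x, ‖x‖ * |(S.u j).1 0 x| ≤ T * S.y 0
  mean : ∀ j, Int (S.r * S.u j) 0 = 0
  a_le : S.a ^ 2 ≤ T
  y_le : S.y 0 ≤ T * S.X 0
  E2_eq : E2 = Int (S.r * dot S.ut S.ut) 0 + S.X 0 ^ 2
  g_le : ∀ x, S.g.1 0 x ≤ G
  E3_ge : Int (gsq S.ut) 0 + E2 * √E2 + E2 * G ≤ E3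

namespace Data
variable {S : Flow} {T E2 E3 G : ℝ}

lemma G_nonneg (H : S.Data T E2 E3 G) : 0 ≤ G := by
  refine le_trans ?_ (H.g_le 0)
  simp only [g, add_val, mul_val]
  exact add_nonneg (mul_self_nonneg _) (mul_self_nonneg _)

lemma X_pos (H : S.Data T E2 E3 G) : 0 < S.X 0 :=
  pos_of_mul_pos_right (H.y_pos.trans_le H.y_le) H.T_pos.le

lemma X_sq_le (H : S.Data T E2 E3 G) : S.X 0 ^ 2 ≤ E2 := by
  have hd := (S.Int_r_dot_le S.ut le_rfl).1
  have := Int_dot_nonneg S.ut 0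
  rw [H.E2_eq]; linarith

lemma E2_pos (H : S.Data T E2 E3 G) : 0 < E2 := (pow_pos H.X_pos 2).trans_le H.X_sq_le

lemma E2_mul_sqrt_le (H : S.Data T E2 E3 G) : E2 * √E2 ≤ E3 := by
  have := H.E3_ge
  have := Int_gsq_nonneg S.ut 0
  have := mul_nonneg H.E2_pos.le H.G_nonneg
  linarith

lemma E2_mul_le (H : S.Data T E2 E3 G) : E2 * G ≤ E3 := by
  have := H.E3_ge
  have := Int_gsq_nonneg S.ut 0
  have := mul_nonneg H.E2_pos.le (Real.sqrt_nonneg E2)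
  linarith

lemma E3_pos (H : S.Data T E2 E3 G) : 0 < E3 :=
  (mul_pos H.E2_pos (Real.sqrt_pos.2 H.E2_pos)).trans_le H.E2_mul_sqrt_le

end Data

/-- Bounds for the energies of a flow in terms of its initial data. -/
structure Bounds (S : Flow) (T E2 E3 C : ℝ) : Prop where
  one_le : 1 ≤ C
  X_le : ∀ t, 0 ≤ t → S.X t ≤ C * (S.X 0 / (1 + t / T) ^ 3)
  V_le : ∀ t, 0 ≤ t → S.V t ≤ C * (E2 / (1 + t / T) ^ 4)
  V_sq_le : ∀ t, 0 ≤ t → S.V t ^ 2 ≤ C * (S.X 0 * E3 / (1 + t / T) ^ 8)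
  N_le : ∀ t, 0 ≤ t → S.N t ≤ C * (E3 / (1 + t / T) ^ 5)
  X_le' : ∀ t, T ≤ t → S.X t ≤ C * (S.y 0 / T / (1 + t / T) ^ 3)
  V_le' : ∀ t, T ≤ t → S.V t ≤ C * (S.y 0 / T ^ 2 / (1 + t / T) ^ 4)
  N_le' : ∀ t, T ≤ t → S.N t ≤ C * (S.y 0 / T ^ 3 / (1 + t / T) ^ 5)
  rate₂ : S.y 0 / T ^ 2 ≤ C * E2
  rate₃ : S.y 0 / T ^ 3 ≤ C * E3
  weight : ∃ t₁ : ℝ, 0 < t₁ ∧ 1 / t₁ = C * √E2 ∧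
    ∃ F : ℝ → ℝ, (∀ t, 0 ≤ t → ∃ d, HasDerivWithinAt F d (Ici 0) t ∧
      d ≤ -(S.X t + (t + t₁) * S.V t + (t + t₁) ^ 2 * S.N t)) ∧ (∀ t, 0 ≤ t → 0 ≤ F t) ∧
      F 0 ≤ C ∧ ∀ t, 0 ≤ t → (t + t₁) ^ 2 * S.V t ≤ C

end Flow

lemma le_of_split {f A B : ℝ} {T C₁ C₂ t : ℝ} {k : ℕ} (hT : 0 < T) (ht : 0 ≤ t) (hA : 0 ≤ A)
    (h1 : f ≤ C₁ * A) (h2 : T ≤ t → f ≤ C₂ * (B / (1 + t / T) ^ k)) (hB : B ≤ C₁ * A)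
    (hC1 : 0 ≤ C₁) (hC2 : 1 ≤ C₂) :
    f ≤ 2 ^ k * C₁ * C₂ * (A / (1 + t / T) ^ k) := by
  have hs : 1 ≤ 1 + t / T := by have : 0 ≤ t / T := by positivity
                                linarith
  have hsk : 0 < (1 + t / T) ^ k := by positivity
  have h2k : (1 : ℝ) ≤ 2 ^ k := one_le_pow₀ (by norm_num)
  rcases le_total T t with h | h
  · refine (h2 h).trans ?_
    rw [mul_div_assoc', mul_div_assoc']
    refine div_le_div_of_nonneg_right ?_ hsk.le
    have e1 := mul_le_mul_of_nonneg_left hB (by linarith : 0 ≤ C₂)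
    have : 0 ≤ C₁ * C₂ * A := by positivity
    nlinarith
  · refine h1.trans ?_
    rw [mul_div_assoc', le_div_iff₀ hsk]
    have e1 : (1 + t / T) ^ k ≤ 2 ^ k := by
      refine pow_le_pow_left₀ (by positivity) ?_ k
      have : t / T ≤ 1 := by rwa [div_le_one hT]
      linarith
    have e2 : 0 ≤ C₁ * A := by positivity
    have e3 := mul_le_mul_of_nonneg_left e1 e2
    have e4 : 0 ≤ 2 ^ k * (C₁ * A) := by positivity
    nlinarith

lemma le_div_of_mul_le {t T f c y₀ : ℝ} (k : ℕ) (hT : 0 < T) (ht : T ≤ t) (hc : 0 ≤ c)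
    (hy : 0 ≤ y₀) (h : t ^ k * f ≤ c * (y₀ / (1 + t / T) ^ 2)) :
    f ≤ 2 ^ k * c * (y₀ / T ^ k / (1 + t / T) ^ (k + 2)) := by
  have ht0 : 0 < t := hT.trans_le ht
  set s := 1 + t / T with hs
  have hs0 : 0 < s := by positivity
  have h1 : T * s ≤ 2 * t := by
    rw [hs, mul_add, mul_div_cancel₀ _ hT.ne']; linarith
  have h2 : (T * s) ^ k ≤ (2 * t) ^ k := pow_le_pow_left₀ (by positivity) h1 k
  have e : 2 ^ k * c * (y₀ / T ^ k / s ^ (k + 2)) = (2 ^ k * (c * (y₀ / s ^ 2))) / (T * s) ^ k := by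
    rw [mul_pow, pow_add]; field_simp
  rw [e, le_div_iff₀ (by positivity)]
  rcases le_total f 0 with hf | hf
  · have h3 : f * (T * s) ^ k ≤ 0 := mul_nonpos_of_nonpos_of_nonneg hf (by positivity)
    have : 0 ≤ 2 ^ k * (c * (y₀ / s ^ 2)) := by positivity
    linarith
  · calc f * (T * s) ^ k ≤ f * (2 * t) ^ k := mul_le_mul_of_nonneg_left h2 hf
      _ = 2 ^ k * (t ^ k * f) := by rw [mul_pow]; ring
      _ ≤ _ := mul_le_mul_of_nonneg_left h (by positivity)

namespace Levels
variable {W : ℝ} {y X V N x z n : ℝ → ℝ}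

lemma X_decay (l : Levels W y X V N x z n) {t : ℝ} (ht : 0 ≤ t) : t * X t ≤ W * y (t / 2) :=
  (mul_le_mul_of_nonneg_left (l.X_le t ht) ht).trans (l.x_decay ht)

lemma V_decay (l : Levels W y X V N x z n)
    {t : ℝ} (ht : 0 ≤ t) : t ^ 2 * V t ≤ 8 * W ^ 3 * y (t / 4) := by
  have hW := l.one_le
  have h1 := (mul_le_mul_of_nonneg_left (l.V_le_z ht) ht).trans (l.z_decay ht)
  have h2 := l.x_decay (by linarith : 0 ≤ t / 2)
  rw [show t / 2 / 2 = t / 4 by ring] at h2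
  have h3 := mul_le_mul_of_nonneg_left h1 ht
  have h4 := mul_le_mul_of_nonneg_left h2 (by positivity : 0 ≤ 8 * W ^ 2)
  linarith

lemma N_decay (l : Levels W y X V N x z n)
    {t : ℝ} (ht : 0 ≤ t) : t ^ 3 * N t ≤ 128 * W ^ 6 * y (t / 8) := by
  have hW := l.one_le
  have h1 := l.n_decay ht
  have h2 := l.z_decay (by linarith : 0 ≤ t / 2)
  have h3 := l.x_decay (by linarith : 0 ≤ t / 2 / 2)
  rw [show t / 2 / 2 / 2 = t / 8 by ring] at h3
  have k1 := mul_le_mul_of_nonneg_left h1 (sq_nonneg t)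
  have k2 := mul_le_mul_of_nonneg_left h2 (by positivity : 0 ≤ 8 * W ^ 3 * t)
  have k3 := mul_le_mul_of_nonneg_left h3 (by positivity : 0 ≤ 128 * W ^ 5)
  linarith

end Levels

namespace Flow

set_option maxHeartbeats 1000000 in
lemma exists_bounds (M : ℝ) (hM : 0 ≤ M) : ∃ C : ℝ, ∀ (S : Flow) (T E2 E3 G : ℝ), S.y 0 ≤ M →
    S.Data T E2 E3 G → S.Bounds T E2 E3 C := by
  obtain ⟨W, hlev⟩ := exists_levels M hM
  obtain ⟨K, hK, hdec⟩ := exists_energy_decay M hM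
  obtain ⟨I, hI, hini⟩ := exists_initial M hM
  rcases le_or_gt 1 W with hW1 | hW1
  swap
  · refine ⟨1, fun S T E2 E3 G hy H => ?_⟩
    obtain ⟨x, z, n, l⟩ := hlev S hy
    exact absurd l.one_le hW1.not_ge
  have hK0 : 0 ≤ K := by linarith
  have hI0 : 0 ≤ I := by linarith
  set D := 2 ^ 20 * W ^ 6 * K with hD
  have hD1 : 1 ≤ D := by
    have h6 : 1 ≤ W ^ 6 := one_le_pow₀ hW1
    have : 1 ≤ W ^ 6 * K := one_le_mul_of_one_le_of_one_le h6 hK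
    rw [hD]; linarith
  set A := W ^ 3 * I with hA
  have hA1 : 1 ≤ A := one_le_mul_of_one_le_of_one_le (one_le_pow₀ hW1) hI
  set C := (2 ^ 8 * A ^ 2 * D ^ 2 + 20 * W ^ 4) with hC
  have hCD : 2 ^ 8 * A * D ≤ 2 ^ 8 * A ^ 2 * D ^ 2 := by
    have : A * D ≤ (A * D) * (A * D) :=
      le_mul_of_one_le_left (by positivity) (one_le_mul_of_one_le_of_one_le hA1 hD1)
    linarith
  have hCD' : 2 ^ 8 * A * D ≤ C := by
    have : 0 ≤ 20 * W ^ 4 := by positivity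
    linarith
  have hAD : D ≤ A * D := le_mul_of_one_le_left (by positivity) hA1
  have hAD' : A ≤ A * D := le_mul_of_one_le_right (by positivity) hD1
  have hIA : I ≤ A := le_mul_of_one_le_left hI0 (one_le_pow₀ hW1)
  have hWA : W ≤ A := by
    have : W * 1 ≤ W ^ 3 * I := mul_le_mul (le_self_pow₀ hW1 (by norm_num)) hI zero_le_one (by positivity)
    linarith
  have hWIA : W * I ≤ A := mul_le_mul_of_nonneg_right (le_self_pow₀ hW1 (by norm_num)) hI0
  refine ⟨C, fun S T E2 E3 G hy H => ?_⟩
  obtain ⟨x, z, n, l⟩ := hlev S hy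
  obtain ⟨i1, i2, i3, i4, i5⟩ := hini S E2 E3 hy H.E2_eq (by
    have := H.E3_ge
    have := mul_nonneg H.E2_pos.le H.G_nonneg
    linarith)
  have hT := H.T_pos
  have hy0 := H.y_pos
  have hX0 := H.X_pos
  have hE2 := H.E2_pos
  have hE3 := H.E3_pos
  have hV0 := S.V_nonneg 0
  have hN0 := S.N_nonneg 0
  have hyd := hdec S (T * S.y 0) T hT hy H.moment H.moment_le H.mean le_rfl H.a_le
  have hdel : ∀ t c : ℝ, 0 ≤ t → 1 ≤ c → c ≤ 8 → S.y (t / c) ≤ 64 * K * (S.y 0 / (1 + t / T) ^ 2) := by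
    intro t c ht hc1 hc8
    have h1 := hyd (t / c) (by positivity)
    have h2 : (1 + t / T) / 8 ≤ 1 + t / c / T := by
      have : t / T / 8 ≤ t / T / c := div_le_div_of_nonneg_left (by positivity) (by linarith) hc8
      rw [div_right_comm t c T]
      linarith
    have h3 := pow_le_pow_left₀ (by positivity) h2 2
    have h4 := mul_le_mul_of_nonneg_left h3 (S.y_nonneg (by positivity : 0 ≤ t / c))
    rw [mul_div_assoc', le_div_iff₀ (by positivity)]
    have h5 : S.y (t / c) * ((1 + t / T) / 8) ^ 2 = S.y (t / c) * (1 + t / T) ^ 2 / 64 := by ring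
    linarith
  have hpos : ∀ t, T ≤ t → 0 ≤ t := fun t h => hT.le.trans h
  have hWp : ∀ a b : ℕ, a ≤ b → W ^ a ≤ W ^ b := fun a b h => pow_le_pow_right₀ l.one_le h
  have X' : ∀ t, T ≤ t → S.X t ≤ D * (S.y 0 / T / (1 + t / T) ^ 3) := fun t ht => by
    have h1 := l.X_decay (hpos t ht)
    have h2 := mul_le_mul_of_nonneg_left (hdel t 2 (hpos t ht) (by norm_num) (by norm_num))
      (by linarith : 0 ≤ W)
    have h3 := le_div_of_mul_le (f := S.X t) (c := W * (64 * K)) 1 hT ht (by positivity) hy0.le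
      (by rw [pow_one]; linarith)
    rw [pow_one, pow_one] at h3
    refine h3.trans (mul_le_mul_of_nonneg_right ?_ (by have := hpos t ht; positivity))
    have := mul_le_mul_of_nonneg_right (hWp 1 6 (by norm_num)) hK0
    rw [pow_one] at this
    have : 0 ≤ W ^ 6 * K := by positivity
    rw [hD]; linarith
  have V' : ∀ t, T ≤ t → S.V t ≤ D * (S.y 0 / T ^ 2 / (1 + t / T) ^ 4) := fun t ht => by
    have h1 := l.V_decay (hpos t ht)
    have h2 := mul_le_mul_of_nonneg_left (hdel t 4 (hpos t ht) (by norm_num) (by norm_num))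
      (by positivity : 0 ≤ 8 * W ^ 3)
    have h3 := le_div_of_mul_le (f := S.V t) (c := 8 * W ^ 3 * (64 * K)) 2 hT ht (by positivity) hy0.le
      (by linarith)
    refine h3.trans (mul_le_mul_of_nonneg_right ?_ (by have := hpos t ht; positivity))
    have := mul_le_mul_of_nonneg_right (hWp 3 6 (by norm_num)) hK0
    have : 0 ≤ W ^ 6 * K := by positivity
    rw [hD]; linarith
  have N' : ∀ t, T ≤ t → S.N t ≤ D * (S.y 0 / T ^ 3 / (1 + t / T) ^ 5) := fun t ht => by
    have h1 := l.N_decay (hpos t ht)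
    have h2 := mul_le_mul_of_nonneg_left (hdel t 8 (hpos t ht) (by norm_num) (by norm_num))
      (by positivity : 0 ≤ 128 * W ^ 6)
    have h3 := le_div_of_mul_le (f := S.N t) (c := 128 * W ^ 6 * (64 * K)) 3 hT ht (by positivity) hy0.le
      (by linarith)
    refine h3.trans (mul_le_mul_of_nonneg_right ?_ (by have := hpos t ht; positivity))
    have : 0 ≤ W ^ 6 * K := by positivity
    rw [hD]; linarith
  have hκ : S.y 0 / T ≤ S.X 0 := by rw [div_le_iff₀ hT]; linarith [H.y_le]
  have hκ0 : 0 ≤ S.y 0 / T := by positivity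
  have r2 : S.y 0 / T ^ 2 ≤ I * E2 := by
    have h1 := pow_le_pow_left₀ hκ0 hκ 2
    have h2 : S.y 0 * (S.y 0 / T ^ 2) ≤ S.y 0 * (I * E2) := by
      calc S.y 0 * (S.y 0 / T ^ 2) = (S.y 0 / T) ^ 2 := by field_simp
        _ ≤ _ := by linarith
    exact le_of_mul_le_mul_left h2 hy0
  have r3 : S.y 0 / T ^ 3 ≤ I * E3 := by
    have h1 := pow_le_pow_left₀ hκ0 hκ 3
    have h2 : S.y 0 ^ 2 * (S.y 0 / T ^ 3) ≤ S.y 0 ^ 2 * (I * E3) := by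
      calc S.y 0 ^ 2 * (S.y 0 / T ^ 3) = (S.y 0 / T) ^ 3 := by field_simp
        _ ≤ _ := by linarith
    exact le_of_mul_le_mul_left h2 (by positivity)
  have hs1 : ∀ t, 0 ≤ t → 0 < 1 + t / T := fun t ht => by positivity
  have up : ∀ (t b : ℝ) (c : ℝ), c ≤ C → 0 ≤ b → c * b ≤ C * b := fun _ b c hc hb =>
    mul_le_mul_of_nonneg_right hc hb
  have hADpos : 0 ≤ A * D := by positivity
  have hC8 : ∀ k ≤ 8, (2 : ℝ) ^ k * A * D ≤ C := fun k hk => by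
    have : (2 : ℝ) ^ k ≤ 2 ^ 8 := pow_le_pow_right₀ (by norm_num) hk
    have := mul_le_mul_of_nonneg_right this hADpos
    linarith
  have hDC : D ≤ C := by linarith
  have hAC : A ≤ C := by linarith
  refine ⟨by linarith, fun t ht => ?_, fun t ht => ?_, fun t ht => ?_, fun t ht => ?_, fun t ht => ?_,
    fun t ht => ?_, fun t ht => ?_, ?_, ?_, ?_⟩
  · refine (le_of_split hT ht hX0.le (C₁ := A) ?_ (X' t) ?_ (by positivity) hD1).trans
      (up t _ _ (hC8 3 (by norm_num)) (by have := hs1 t ht; positivity))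
    · exact (l.X_le_init ht).trans (mul_le_mul_of_nonneg_right hWA hX0.le)
    · exact hκ.trans (le_mul_of_one_le_left hX0.le hA1)
  · refine (le_of_split hT ht hE2.le (C₁ := A) ?_ (V' t) ?_ (by positivity) hD1).trans
      (up t _ _ (hC8 4 (by norm_num)) (by have := hs1 t ht; positivity))
    · refine (l.V_le_init ht).trans ((mul_le_mul_of_nonneg_left i1 (by linarith)).trans ?_)
      rw [← mul_assoc]
      exact mul_le_mul_of_nonneg_right hWIA hE2.le
    · exact r2.trans (mul_le_mul_of_nonneg_right hIA hE2.le)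
  · refine (le_of_split (B := S.y 0 ^ 2 / T ^ 4) (C₂ := D ^ 2) (C₁ := A ^ 2) (A := S.X 0 * E3) hT ht
      (by positivity) ?_ ?_ ?_ (by positivity) (one_le_pow₀ hD1)).trans
      (up t _ _ ?_ (by have := hs1 t ht; positivity))
    · have h1 := pow_le_pow_left₀ (S.V_nonneg t) (l.V_le_init ht) 2
      rw [mul_pow] at h1
      refine h1.trans ((mul_le_mul_of_nonneg_left i3 (by positivity)).trans ?_)
      rw [← mul_assoc]
      refine mul_le_mul_of_nonneg_right ?_ (by positivity)
      have e1 : W ^ 2 * I ≤ A := mul_le_mul_of_nonneg_right (hWp 2 3 (by norm_num)) hI0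
      have e2 : A ≤ A ^ 2 := le_self_pow₀ hA1 (by norm_num)
      linarith
    · intro h
      have h1 := pow_le_pow_left₀ (S.V_nonneg t) (V' t h) 2
      refine h1.trans (le_of_eq ?_)
      rw [mul_pow, div_pow, div_pow, ← pow_mul, ← pow_mul]
    · calc S.y 0 ^ 2 / T ^ 4 = (S.y 0 / T) * (S.y 0 / T ^ 3) := by field_simp
        _ ≤ S.X 0 * (I * E3) := mul_le_mul hκ r3 (by positivity) hX0.le
        _ = I * (S.X 0 * E3) := by ring
        _ ≤ _ := by
          refine mul_le_mul_of_nonneg_right (hIA.trans (le_self_pow₀ hA1 (by norm_num))) (by positivity)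
    · have : 0 ≤ 20 * W ^ 4 := by positivity
      linarith
  · refine (le_of_split hT ht hE3.le (C₁ := A) ?_ (N' t) ?_ (by positivity) hD1).trans
      (up t _ _ (hC8 5 (by norm_num)) (by have := hs1 t ht; positivity))
    · refine (l.N_le_init ht).trans ((mul_le_mul_of_nonneg_left i2 (by positivity)).trans ?_)
      rw [← mul_assoc]
    · exact r3.trans (mul_le_mul_of_nonneg_right hIA hE3.le)
  · have := hs1 t (hpos t ht)
    exact (X' t ht).trans (up t _ _ hDC (by positivity))
  · have := hs1 t (hpos t ht)
    exact (V' t ht).trans (up t _ _ hDC (by positivity))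
  · have := hs1 t (hpos t ht)
    exact (N' t ht).trans (up t _ _ hDC (by positivity))
  · exact r2.trans (up 0 _ _ (hIA.trans hAC) hE2.le)
  · exact r3.trans (up 0 _ _ (hIA.trans hAC) hE3.le)
  · have hq : 0 < √E2 := Real.sqrt_pos.2 hE2
    have hC0 : 0 < C := by linarith
    have hq2 : √E2 ^ 2 = E2 := Real.sq_sqrt hE2.le
    refine ⟨1 / (C * √E2), by positivity, by rw [one_div_one_div], ?_⟩
    have hXq : S.X 0 ≤ √E2 := Real.le_sqrt_of_sq_le H.X_sq_le
    have hC1 : 1 ≤ C := by linarith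
    obtain ⟨F, f1, f2, f3, f4⟩ := l.exists_weight (t₁ := 1 / (C * √E2)) (by positivity) (by
      rw [one_div_mul_eq_div, div_le_one (by positivity)]
      exact hXq.trans (le_mul_of_one_le_left hq.le hC1)) (by
      rw [div_pow, mul_pow, hq2, one_pow, one_div_mul_eq_div, div_le_iff₀ (by positivity)]
      refine i1.trans ?_
      rw [← mul_assoc]
      refine mul_le_mul_of_nonneg_right ?_ hE2.le
      have e1 : C ≤ C ^ 2 := le_self_pow₀ hC1 (by norm_num)
      have e2 : C ^ 2 ≤ W * C ^ 2 := le_mul_of_one_le_left (by positivity) l.one_le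
      linarith)
    have hCW : 20 * W ^ 4 ≤ C := by
      have : 0 ≤ 2 ^ 8 * A ^ 2 * D ^ 2 := by positivity
      linarith
    exact ⟨F, f1, f2, f3.trans hCW, fun t ht => (f4 t ht).trans hCW⟩

end Flow

open Fld
namespace Flow
variable (S : Flow)

instance (k) : IsL2 (Dx k S.r) := by
  have : Dx k S.r = Dx k (S.r - 1) := by rw [map_sub, Derivation.map_one_eq_zero, sub_zero]
  rw [this]; infer_instance

instance : IsL1 S.g := by unfold g; infer_instance

lemma g_nonneg (t x) : 0 ≤ S.g.1 t x := by
  simp only [g, add_val, mul_val]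
  exact add_nonneg (mul_self_nonneg _) (mul_self_nonneg _)

lemma abs_DD_g_le {t B : ℝ} (x : Plane) (h : ∀ k j, |(Dx k (S.u j)).1 t x| ≤ B) :
    (S.DD S.g).1 t x ≤ 4 * B * S.g.1 t x := by
  have e : S.DD S.g = -(2 * (Dx 0 S.r * (Dx 0 (S.u 0) * Dx 0 S.r + Dx 0 (S.u 1) * Dx 1 S.r) +
      Dx 1 S.r * (Dx 1 (S.u 0) * Dx 0 S.r + Dx 1 (S.u 1) * Dx 1 S.r))) := by
    simp only [g, map_add, DD_mul, DD_Dx, DD_r, map_zero]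
    ring
  have key : ∀ a b c : ℝ, |c| ≤ B → -(a * (c * b)) ≤ B * ((a ^ 2 + b ^ 2) / 2) := fun a b c hc => by
    have h1 : -(a * (c * b)) ≤ |c| * |a * b| := by
      rw [← abs_mul]; refine le_trans (neg_le_abs _) (le_of_eq ?_); congr 1; ring
    have h2 : |a * b| ≤ (a ^ 2 + b ^ 2) / 2 := by
      rw [abs_le]; constructor <;> nlinarith [sq_nonneg (a + b), sq_nonneg (a - b)]
    exact h1.trans (mul_le_mul hc h2 (abs_nonneg _) ((abs_nonneg _).trans hc))
  rw [e]
  simp only [g, add_val, mul_val, neg_val, two_val]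
  set a := (Dx 0 S.r).1 t x
  set b := (Dx 1 S.r).1 t x
  have k00 := key a a _ (h 0 0)
  have k01 := key a b _ (h 0 1)
  have k10 := key b a _ (h 1 0)
  have k11 := key b b _ (h 1 1)
  linarith

lemma Int_g_pow_le {m : ℕ} (hm : m ≠ 0) {Λ l : ℝ → ℝ} {a b : ℝ} (ha : 0 ≤ a) (hab : a ≤ b)
    (hΛ : ∀ t, a ≤ t → t ≤ b → HasDerivWithinAt Λ (l t) (Ici 0) t)
    (hl : ∀ t, a ≤ t → t ≤ b → ∀ k j x, 4 * |(Dx k (S.u j)).1 t x| ≤ l t) :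
    Int (S.g ^ m) b ≤ Real.exp (m * (Λ b - Λ a)) * Int (S.g ^ m) a := by
  have i : IsL1 (S.g ^ m) := isL1_pow _ hm
  have key := le_of_deriv_nonpos (f := fun t => Real.exp (-(m * Λ t)) * Int (S.g ^ m) t) ha hab
    fun t h1 h2 => by
    have ht := ha.trans h1
    refine ⟨_, ((((hΛ t h1 h2).const_mul (m : ℝ)).fun_neg).exp).mul
      (S.hasDerivWithinAt_Int (S.g ^ m) ht), ?_⟩
    have e1 : Int (S.DD (S.g ^ m)) t ≤ Int ((m * l t) • S.g ^ m) t := Int_mono fun x => by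
      rw [Derivation.leibniz_pow]
      obtain ⟨n, rfl⟩ := Nat.exists_eq_succ_of_ne_zero hm
      simp only [Nat.succ_eq_add_one, add_tsub_cancel_right, smul_val, nsmul_eq_mul, smul_eq_mul]
      have h3 := S.abs_DD_g_le (t := t) (B := l t / 4) x fun k j => by
        have := hl t h1 h2 k j x; linarith
      have h4 : 0 ≤ S.g.1 t x ^ n := pow_nonneg (S.g_nonneg t x) n
      have h5 := mul_le_mul_of_nonneg_left h3 h4
      have h6 := mul_le_mul_of_nonneg_left h5 (by positivity : 0 ≤ ((n + 1 : ℕ) : ℝ))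
      have ev : (((n + 1 : ℕ) : Fld) * (S.g ^ n * S.DD S.g)).1 t x =
          ((n + 1 : ℕ) : ℝ) * (S.g.1 t x ^ n * (S.DD S.g).1 t x) := by
        rw [← nsmul_eq_mul, ← Nat.cast_smul_eq_nsmul ℝ, smul_val, mul_val, pow_val]
      rw [ev, pow_val, pow_succ]
      linarith
    rw [Int_smul] at e1
    have := mul_le_mul_of_nonneg_left e1 (Real.exp_pos (-(m * Λ t))).le
    linarith
  have := mul_le_mul_of_nonneg_left key (Real.exp_pos (m * Λ b)).le
  rw [← mul_assoc, ← mul_assoc, ← Real.exp_add, ← Real.exp_add, add_neg_cancel, Real.exp_zero,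
    one_mul] at this
  rwa [show m * (Λ b - Λ a) = m * Λ b + -(m * Λ a) by ring]

lemma g_le_of_deriv {Λ l : ℝ → ℝ} {a b G : ℝ} (ha : 0 ≤ a) (hab : a ≤ b)
    (hΛ : ∀ t, a ≤ t → t ≤ b → HasDerivWithinAt Λ (l t) (Ici 0) t)
    (hl : ∀ t, a ≤ t → t ≤ b → ∀ k j x, 4 * |(Dx k (S.u j)).1 t x| ≤ l t)
    (hG : ∀ x, S.g.1 a x ≤ G) (x : Plane) : S.g.1 b x ≤ Real.exp (Λ b - Λ a) * G := by
  have hG0 : 0 ≤ G := (S.g_nonneg a 0).trans (hG 0)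
  have main : ∀ G', G < G' → S.g.1 b x ≤ Real.exp (Λ b - Λ a) * G' := fun G' hG' => by
    have hG'0 : 0 < G' := hG0.trans_lt hG'
    refine le_of_integral_pow_le (B := Int S.g a / G') (S.g.continuous b) (S.g_nonneg b)
      (fun m hm => ?_) (by positivity) (fun m hm => ?_) x
    · have i : IsL1 (S.g ^ m) := isL1_pow _ (by omega)
      exact (S.g ^ m).integrable b
    · have i : IsL1 (S.g ^ m) := isL1_pow _ (by omega)
      have h1 := S.Int_g_pow_le (by omega : m ≠ 0) ha hab hΛ hl
      obtain ⟨n, rfl⟩ := Nat.exists_eq_add_of_le' hm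
      have h2 : Int (S.g ^ (n + 1)) a ≤ Int ((G' ^ n) • S.g) a := Int_mono fun x => by
        rw [pow_val, smul_val, pow_succ]
        exact mul_le_mul_of_nonneg_right (pow_le_pow_left₀ (S.g_nonneg a x) ((hG x).trans hG'.le) n)
          (S.g_nonneg a x)
      rw [Int_smul] at h2
      calc ∫ x, S.g.1 b x ^ (n + 1) = Int (S.g ^ (n + 1)) b := rfl
        _ ≤ _ := h1.trans (mul_le_mul_of_nonneg_left h2 (Real.exp_pos _).le)
        _ = _ := by
          rw [mul_pow, ← Real.exp_nat_mul, pow_succ G']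
          field_simp
  have hc : Tendsto (fun G' => Real.exp (Λ b - Λ a) * G') (𝓝[>] G) (𝓝 (Real.exp (Λ b - Λ a) * G)) :=
    ((continuous_const.mul continuous_id).tendsto G).mono_left nhdsWithin_le_nhds
  exact ge_of_tendsto hc (eventually_nhdsWithin_of_forall fun G' h => main G' h)

end Flow

lemma abs_le_of_pow_six_le {d K X V N w : ℝ} (hK : 1 ≤ K) (hX : 0 ≤ X) (hV : 0 ≤ V) (hN : 0 ≤ N)
    {σ : ℝ} (hσ : 0 < σ) (hw : w = X + σ * V + σ ^ 2 * N) (h : |d| ^ 6 ≤ K * (X * V * N)) :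
    4 * |d| ≤ 1 / σ + 4 * K * w := by
  have hV' : 0 ≤ σ * V := by positivity
  have hN' : 0 ≤ σ ^ 2 * N := by positivity
  have hw0 : 0 ≤ w := by rw [hw]; positivity
  have h1 : X * (σ * V) * (σ ^ 2 * N) ≤ w * w * w := by
    refine mul_le_mul (mul_le_mul (by linarith) (by linarith) hV' hw0) (by linarith) hN' (by positivity)
  have h2 : (σ * |d| ^ 2) ^ 3 ≤ (K * w) ^ 3 := by
    have e1 : (σ * |d| ^ 2) ^ 3 = σ ^ 3 * |d| ^ 6 := by ring
    have e2 := mul_le_mul_of_nonneg_left h (by positivity : 0 ≤ σ ^ 3)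
    have e3 := mul_le_mul_of_nonneg_left h1 (by linarith : 0 ≤ K)
    have e4 : K ≤ K ^ 3 := le_self_pow₀ hK (by norm_num)
    have e5 := mul_le_mul_of_nonneg_right e4 (by positivity : 0 ≤ w ^ 3)
    rw [e1, mul_pow]
    linarith
  have h3 : σ * |d| ^ 2 ≤ K * w := le_of_pow_le_pow_left₀ (by norm_num) (by positivity) h2
  have h4 : 0 ≤ (1 / σ) * (1 - 2 * (σ * |d|)) ^ 2 := by positivity
  have h5 : (1 / σ) * (1 - 2 * (σ * |d|)) ^ 2 = 1 / σ - 4 * |d| + 4 * (σ * |d| ^ 2) := by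
    field_simp; ring
  linarith

namespace Flow

/-- Growth of the density gradient. -/
lemma exists_g_le (M C : ℝ) (hM : 0 ≤ M) : ∃ B : ℝ, 1 ≤ B ∧ ∀ (S : Flow) (T E2 E3 G : ℝ), S.y 0 ≤ M →
    S.Data T E2 E3 G → S.Bounds T E2 E3 C → ∀ t, 0 ≤ t →
    (∀ x, S.g.1 t x ≤ B * (1 + min t T * √E2) * G) ∧
    Int S.g t ≤ B * (1 + min t T * √E2) * Int S.g 0 := by
  obtain ⟨K, hK, hgr⟩ := exists_gradient_le
  rcases le_or_gt 1 C with hC1 | hC1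
  swap
  · exact ⟨1, le_rfl, fun S T E2 E3 G _ _ b => absurd b.one_le hC1.not_ge⟩
  set b := 4 * K * C * (1 + M) with hb
  have hb0 : 0 ≤ b := by positivity
  refine ⟨Real.exp b * (Real.exp (4 * K * C) * C), ?_, fun S T E2 E3 G hy H bd => ?_⟩
  · exact one_le_mul_of_one_le_of_one_le (Real.one_le_exp hb0)
      (one_le_mul_of_one_le_of_one_le (Real.one_le_exp (by positivity)) hC1)
  have hT := H.T_pos
  have hG := H.G_nonneg
  have hE2 := H.E2_pos
  obtain ⟨t₁, ht₁, hti, F, f1, f2, f3, f4⟩ := bd.weight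
  choose! d hd hd' using f1
  set Λ : ℝ → ℝ := fun t => Real.log (t + t₁) - 4 * K * F t with hΛ
  have dΛ : ∀ t, 0 ≤ t → HasDerivWithinAt Λ (1 / (t + t₁) - 4 * K * d t) (Ici 0) t := fun t ht =>
    ((((hasDerivAt_id t).add_const t₁).log (by simp only [id]; positivity)).hasDerivWithinAt).sub
      ((hd t ht).const_mul (4 * K))
  have lΛ : ∀ t, 0 ≤ t → ∀ k j x, 4 * |(Dx k (S.u j)).1 t x| ≤ 1 / (t + t₁) - 4 * K * d t := by
    intro t ht k j x
    have h1 := abs_le_of_pow_six_le hK (S.X_nonneg t) (S.V_nonneg t) (S.N_nonneg t)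
      (by positivity : 0 < t + t₁) rfl (hgr S t ht k j x)
    have h2 := mul_le_mul_of_nonneg_left (hd' t ht) (by linarith : 0 ≤ 4 * K)
    linarith
  have eΛ : ∀ t, 0 ≤ t → Real.exp (Λ t - Λ 0) ≤ Real.exp (4 * K * C) * C * (1 + t * √E2) := by
    intro t ht
    have h1 : Λ t - Λ 0 ≤ Real.log ((t + t₁) / t₁) + 4 * K * C := by
      rw [Real.log_div (by positivity) ht₁.ne']
      have e1 := mul_le_mul_of_nonneg_left f3 (by linarith : 0 ≤ 4 * K)
      have e2 := mul_nonneg (by linarith : 0 ≤ 4 * K) (f2 t ht)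
      simp only [hΛ, zero_add]
      linarith
    refine (Real.exp_le_exp.2 h1).trans ?_
    rw [Real.exp_add, Real.exp_log (by positivity), mul_comm, mul_assoc (Real.exp _) C]
    refine mul_le_mul_of_nonneg_left ?_ (Real.exp_pos _).le
    have e3 : (t + t₁) / t₁ = 1 + t * (1 / t₁) := by field_simp; ring
    rw [e3, hti]
    linarith
  have hI0 : 0 ≤ Int S.g 0 := Int_nonneg (S.g_nonneg 0)
  have first : ∀ t, 0 ≤ t → (∀ x, S.g.1 t x ≤ Real.exp (4 * K * C) * C * (1 + t * √E2) * G) ∧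
      Int S.g t ≤ Real.exp (4 * K * C) * C * (1 + t * √E2) * Int S.g 0 := by
    intro t ht
    refine ⟨fun x => ?_, ?_⟩
    · exact (S.g_le_of_deriv le_rfl ht (fun τ h _ => dΛ τ h) (fun τ h _ => lΛ τ h) H.g_le x).trans
        (mul_le_mul_of_nonneg_right (eΛ t ht) hG)
    · have h1 := S.Int_g_pow_le one_ne_zero le_rfl ht (fun τ h _ => dΛ τ h) (fun τ h _ => lΛ τ h)
      simp only [pow_one, Nat.cast_one, one_mul] at h1
      exact h1.trans (mul_le_mul_of_nonneg_right (eΛ t ht) hI0)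
  intro t ht
  rcases le_total t T with h | h
  · rw [min_eq_left h]
    obtain ⟨a1, a2⟩ := first t ht
    have hq := Real.sqrt_nonneg E2
    have hP : 0 ≤ Real.exp (4 * K * C) * C * (1 + t * √E2) := by positivity
    have up : ∀ z, 0 ≤ z → Real.exp (4 * K * C) * C * (1 + t * √E2) * z ≤
        Real.exp b * (Real.exp (4 * K * C) * C) * (1 + t * √E2) * z := fun z hz => by
      rw [mul_assoc (Real.exp b), mul_assoc (Real.exp b)]
      exact le_mul_of_one_le_left (by positivity) (Real.one_le_exp hb0)
    exact ⟨fun x => (a1 x).trans (up _ hG), a2.trans (up _ hI0)⟩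
  · rw [min_eq_right h]
    obtain ⟨a1, a2⟩ := first T hT.le
    set Θ : ℝ → ℝ := fun t => -(b * (1 + t / T)⁻¹) with hΘ
    have dΘ : ∀ τ, T ≤ τ → τ ≤ t → HasDerivWithinAt Θ (b / (T * (1 + τ / T) ^ 2)) (Ici 0) τ := by
      intro τ h1 _
      have hs : 0 < 1 + τ / T := by have : 0 ≤ τ := hT.le.trans h1
                                    positivity
      refine (((((((hasDerivAt_id τ).div_const T).const_add 1).fun_inv
        (by simpa using hs.ne')).const_mul b).fun_neg).congr_deriv ?_).hasDerivWithinAt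
      simp only [id]
      field_simp
    have lΘ : ∀ τ, T ≤ τ → τ ≤ t → ∀ k j x, 4 * |(Dx k (S.u j)).1 τ x| ≤
        b / (T * (1 + τ / T) ^ 2) := by
      intro τ h1 _ k j x
      have hτ : 0 ≤ τ := hT.le.trans h1
      have hs : 0 < 1 + τ / T := by positivity
      have hy0 := H.y_pos
      have g1 := hgr S τ hτ k j x
      have g2 : S.X τ * S.V τ * S.N τ ≤ (C * (S.y 0 / T / (1 + τ / T) ^ 3)) *
          (C * (S.y 0 / T ^ 2 / (1 + τ / T) ^ 4)) * (C * (S.y 0 / T ^ 3 / (1 + τ / T) ^ 5)) :=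
        mul_le_mul (mul_le_mul (bd.X_le' τ h1) (bd.V_le' τ h1) (S.V_nonneg _) (by positivity))
          (bd.N_le' τ h1) (S.N_nonneg _) (by positivity)
      have g3 := g1.trans (mul_le_mul_of_nonneg_left g2 (by linarith : 0 ≤ K))
      have g4 : |(Dx k (S.u j)).1 τ x| ≤ K * C * (1 + M) / (T * (1 + τ / T) ^ 2) := by
        refine le_of_pow_le_pow_left₀ (n := 6) (by norm_num) (by positivity) (g3.trans ?_)
        have e1 : K * ((C * (S.y 0 / T / (1 + τ / T) ^ 3)) *
          (C * (S.y 0 / T ^ 2 / (1 + τ / T) ^ 4)) * (C * (S.y 0 / T ^ 3 / (1 + τ / T) ^ 5))) =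
          (K * (C ^ 3 * S.y 0 ^ 3)) / (T * (1 + τ / T) ^ 2) ^ 6 := by field_simp
        rw [e1, div_pow]
        refine div_le_div_of_nonneg_right ?_ (by positivity)
        have e2 : K ≤ K ^ 6 := le_self_pow₀ hK (by norm_num)
        have e3 : C ^ 3 ≤ C ^ 6 := pow_le_pow_right₀ hC1 (by norm_num)
        have e4 : S.y 0 ^ 3 ≤ (1 + M) ^ 3 := pow_le_pow_left₀ hy0.le (by linarith) 3
        have e5 : (1 + M) ^ 3 ≤ (1 + M) ^ 6 := pow_le_pow_right₀ (by linarith) (by norm_num)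
        calc K * (C ^ 3 * S.y 0 ^ 3) ≤ K ^ 6 * (C ^ 6 * (1 + M) ^ 6) :=
              mul_le_mul e2 (mul_le_mul e3 (e4.trans e5) (by positivity) (by positivity))
                (by positivity) (by positivity)
          _ = _ := by ring
      have e : b / (T * (1 + τ / T) ^ 2) = 4 * (K * C * (1 + M) / (T * (1 + τ / T) ^ 2)) := by
        rw [hb]; ring
      rw [e]; linarith
    have eΘ : Real.exp (Θ t - Θ T) ≤ Real.exp b := by
      refine Real.exp_le_exp.2 ?_
      have i1 : 0 ≤ b * (1 + t / T)⁻¹ := by positivity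
      have i2 : b * (1 + T / T)⁻¹ ≤ b * 1 := by
        refine mul_le_mul_of_nonneg_left ?_ hb0
        rw [div_self hT.ne']; norm_num
      simp only [hΘ]; linarith
    have hq := Real.sqrt_nonneg E2
    have hP : 0 ≤ Real.exp (4 * K * C) * C * (1 + T * √E2) := by positivity
    refine ⟨fun x => ?_, ?_⟩
    · refine (S.g_le_of_deriv hT.le h dΘ lΘ a1 x).trans
        ((mul_le_mul_of_nonneg_right eΘ (by positivity)).trans (le_of_eq (by ring)))
    · have h1 := S.Int_g_pow_le one_ne_zero hT.le h dΘ lΘ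
      simp only [pow_one, Nat.cast_one, one_mul] at h1
      refine h1.trans ((mul_le_mul eΘ a2 (Int_nonneg (S.g_nonneg T)) (Real.exp_pos _).le).trans
        (le_of_eq (by ring)))

end Flow

open Fld

namespace Fld

lemma exists_Int_pow_le : ∃ K : ℝ, 1 ≤ K ∧ ∀ (f : Fld) [IsL2 f] (n : ℕ) (t : ℝ),
    Int ((f * f) ^ (n + 1)) t ≤ (K * (n + 1) ^ 2 * Nd f t) ^ n * Int (f * f) t := by
  obtain ⟨K, hK, h⟩ := exists_gagliardo
  refine ⟨K, hK, fun f _ n t => ?_⟩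
  have hN := Nd_nonneg f t
  have hI := Int_sq_nonneg f t
  induction n with
  | zero => simp
  | succ n ih =>
    have h1 := h f (n + 1) (by omega) t
    have e1 : f ^ (2 * (n + 1) + 2) = (f * f) ^ (n + 1 + 1) := by rw [← pow_two, ← pow_mul]; ring_nf
    have e2 : f ^ (2 * (n + 1)) = (f * f) ^ (n + 1) := by rw [← pow_two, ← pow_mul]
    rw [e1, e2] at h1
    push_cast at h1 ⊢
    refine h1.trans ?_
    set a := K * ((n : ℝ) + 1 + 1) ^ 2 with ha
    have ha0 : 0 ≤ a := by positivity
    have h2 : (K * ((n : ℝ) + 1) ^ 2 * Nd f t) ^ n ≤ (a * Nd f t) ^ n := by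
      refine pow_le_pow_left₀ (by positivity) (mul_le_mul_of_nonneg_right ?_ hN) n
      refine mul_le_mul_of_nonneg_left ?_ (by linarith)
      exact pow_le_pow_left₀ (by positivity) (by linarith) 2
    have h3 := ih.trans (mul_le_mul_of_nonneg_right h2 hI)
    calc a * Int ((f * f) ^ (n + 1)) t * Nd f t ≤ a * ((a * Nd f t) ^ n * Int (f * f) t) * Nd f t :=
          mul_le_mul_of_nonneg_right (mul_le_mul_of_nonneg_left h3 ha0) hN
      _ = _ := by rw [pow_succ]; ring

/-- A logarithmic substitute for the missing embedding of `H¹` into bounded functions. -/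
lemma exists_Int_weight_le : ∃ K : ℝ, 1 ≤ K ∧ ∀ (g f : Fld) [IsL1 g] [IsL2 f] (n : ℕ) (t A B : ℝ),
    (∀ x, 0 ≤ g.1 t x) → (∀ x, g.1 t x ≤ B) → Nd f t ≤ A → 0 < A →
    Int (g * (f * f)) t ≤ K * ((n + 1) ^ 2 * A) * Int g t + B * Real.exp (-n) * Int (f * f) t := by
  obtain ⟨K, hK, h⟩ := exists_Int_pow_le
  refine ⟨Real.exp 1 * K, one_le_mul_of_one_le_of_one_le (Real.one_le_exp zero_le_one) hK,
    fun g f _ _ n t A B hg hB hA hA0 => ?_⟩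
  have hB0 : 0 ≤ B := (hg 0).trans (hB 0)
  have i : IsL1 ((f * f) ^ (n + 1)) := isL1_pow _ (by omega)
  set ν := K * ((n : ℝ) + 1) ^ 2 * A with hν
  have hν0 : 0 < ν := by positivity
  set μ := Real.exp 1 * ν with hμ
  have hμ0 : 0 < μ := by positivity
  have h1 : Int (g * (f * f)) t ≤ Int (μ • g + (B / μ ^ n) • (f * f) ^ (n + 1)) t := Int_mono fun x => by
    simp only [mul_val, add_val, smul_val, pow_val]
    set a := f.1 t x * f.1 t x
    have ha : 0 ≤ a := mul_self_nonneg _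
    rcases le_total a μ with hc | hc
    · have e1 := mul_le_mul_of_nonneg_left hc (hg x)
      have e2 : 0 ≤ B / μ ^ n * a ^ (n + 1) := by positivity
      linarith
    · have e1 : 1 ≤ a ^ n / μ ^ n := by
        rw [le_div_iff₀ (by positivity), one_mul]; exact pow_le_pow_left₀ hμ0.le hc n
      have e2 : a * 1 ≤ a * (a ^ n / μ ^ n) := mul_le_mul_of_nonneg_left e1 ha
      have e3 : B / μ ^ n * a ^ (n + 1) = B * (a * (a ^ n / μ ^ n)) := by rw [pow_succ]; ring
      have e4 : g.1 t x * a ≤ B * a := mul_le_mul_of_nonneg_right (hB x) ha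
      have e5 : 0 ≤ μ * g.1 t x := mul_nonneg hμ0.le (hg x)
      have e6 := mul_le_mul_of_nonneg_left e2 hB0
      rw [e3]
      linarith
  rw [Int_add, Int_smul, Int_smul] at h1
  have h2 := h f n t
  have hI := Int_sq_nonneg f t
  have h3 : (K * ((n : ℝ) + 1) ^ 2 * Nd f t) ^ n ≤ ν ^ n :=
    pow_le_pow_left₀ (mul_nonneg (by positivity) (Nd_nonneg f t))
      (mul_le_mul_of_nonneg_left hA (by positivity)) n
  have h4 := mul_le_mul_of_nonneg_left (h2.trans (mul_le_mul_of_nonneg_right h3 hI))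
    (by positivity : 0 ≤ B / μ ^ n)
  have h5 : B / μ ^ n * (ν ^ n * Int (f * f) t) = B * Real.exp (-n) * Int (f * f) t := by
    rw [hμ, mul_pow, Real.exp_neg, ← Real.exp_nat_mul, mul_one]
    field_simp
  have h6 : μ = Real.exp 1 * K * ((n + 1) ^ 2 * A) := by rw [hμ, hν]; ring
  rw [h5] at h4
  rw [← h6]
  linarith

end Fld

namespace Flow
variable (S : Flow)

lemma Lap_Dx_u (k j) : Lap (Dx k (S.u j)) = Dx k (S.r * S.v j) + Dx k (S.p j) := by
  rw [Lap_D, Lap_u, map_add]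

/-- The differentiated Stokes system. -/
lemma stokes_Dx (k : Fin 2) (t : ℝ) :
    Int (hsq fun j => Dx k (S.u j)) t + Int (dot (fun j => Dx k (S.p j)) (fun j => Dx k (S.p j))) t =
      Int (dot (fun j => Dx k (S.r * S.v j)) (fun j => Dx k (S.r * S.v j))) t := by
  have e1 : dot (fun j => Dx k (S.r * S.v j)) (fun j => Dx k (S.r * S.v j)) =
      (dot (fun j => Lap (Dx k (S.u j))) (fun j => Lap (Dx k (S.u j))) +
        dot (fun j => Dx k (S.p j)) (fun j => Dx k (S.p j))) -
        (2 : ℝ) • (Dx k (S.p 0) * Lap (Dx k (S.u 0)) + Dx k (S.p 1) * Lap (Dx k (S.u 1))) := by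
    simp only [dot, Lap_Dx_u, ofNat_smul_eq_nsmul, nsmul_eq_mul]
    push_cast
    ring
  have hdiv : Dx 0 (Lap (Dx k (S.u 0))) + Dx 1 (Lap (Dx k (S.u 1))) = 0 := by
    rw [← Lap_D, ← Lap_D, D_comm (some 0) (some k) (S.u 0), D_comm (some 1) (some k) (S.u 1),
      Dx_one_u_one]
    simp only [Lap, map_neg]; ring
  have hcurl : Dx 0 (Dx k (S.p 1)) = Dx 1 (Dx k (S.p 0)) := by
    rw [D_comm (some 0) (some k), D_comm (some 1) (some k), S.curl_p]
  have e2 := congrArg (Int · t) e1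
  rw [Int_sub, Int_add, Int_smul, Int_gradient_solenoidal _ _ _ _ hcurl hdiv,
    ← Int_hsq_eq] at e2
  rw [e2]; ring

/-- The squared norm of the third derivatives of the velocity and of the second derivatives of the
pressure. -/
def Q (t : ℝ) : ℝ := Int (hsq fun j => Dx 0 (S.u j)) t + Int (hsq fun j => Dx 1 (S.u j)) t +
  Int (gsq S.p) t

lemma Q_le {t : ℝ} (ht : 0 ≤ t) : S.Q t ≤ 4 * S.N t + 2 * Int (S.g * dot S.v S.v) t := by
  have h0 := S.stokes_Dx 0 t
  have h1 := S.stokes_Dx 1 t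
  have e : S.Q t = Int (dot (fun j => Dx 0 (S.r * S.v j)) (fun j => Dx 0 (S.r * S.v j)) +
      dot (fun j => Dx 1 (S.r * S.v j)) (fun j => Dx 1 (S.r * S.v j))) t := by
    rw [Int_add, ← h0, ← h1, Q, gsq, Int_add]; ring
  rw [e, N, ← Int_smul, ← Int_smul, ← Int_add]
  refine Int_mono fun x => ?_
  have hr := S.density_bounds ht x
  have hr2 : S.r.1 t x ^ 2 ≤ 2 := by nlinarith
  have key : ∀ k j, (Dx k (S.r * S.v j)).1 t x * (Dx k (S.r * S.v j)).1 t x ≤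
      2 * ((Dx k S.r).1 t x * (Dx k S.r).1 t x * ((S.v j).1 t x * (S.v j).1 t x)) +
      4 * ((Dx k (S.v j)).1 t x * (Dx k (S.v j)).1 t x) := fun k j => by
    simp only [D_mul, add_val, mul_val]
    set a := S.r.1 t x * (Dx k (S.v j)).1 t x with ha
    set b := (S.v j).1 t x * (Dx k S.r).1 t x with hb
    have h3 : a ^ 2 ≤ 2 * (Dx k (S.v j)).1 t x ^ 2 := by
      rw [ha, mul_pow]; exact mul_le_mul_of_nonneg_right hr2 (sq_nonneg _)
    have h4 : (Dx k S.r).1 t x * (Dx k S.r).1 t x * ((S.v j).1 t x * (S.v j).1 t x) = b ^ 2 := by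
      rw [hb]; ring
    have h5 : (Dx k S.r).1 t x * (S.v j).1 t x = b := by rw [hb]; ring
    rw [h4]
    nlinarith [sq_nonneg (a - b)]
  have k00 := key 0 0
  have k01 := key 0 1
  have k10 := key 1 0
  have k11 := key 1 1
  simp only [gsq, g, dot, add_val, mul_val, smul_val] at *
  linarith

/-- The pointwise decay of the velocity gradient. -/
lemma exists_gradient_decay (C : ℝ) : ∃ B : ℝ, 0 ≤ B ∧ ∀ (S : Flow) (T E2 E3 G : ℝ),
    S.Data T E2 E3 G → S.Bounds T E2 E3 C → ∀ t, 0 ≤ t → ∀ k j x,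
    |(Dx k (S.u j)).1 t x| ^ 4 ≤ B * (S.X 0 * E3 / (1 + t / T) ^ 8) := by
  obtain ⟨K, hK, hgr⟩ := exists_gradient_le
  rcases le_or_gt 1 C with hC1 | hC1
  swap
  · exact ⟨0, le_rfl, fun S T E2 E3 G _ b => absurd b.one_le hC1.not_ge⟩
  refine ⟨K * C ^ 2, by positivity, fun S T E2 E3 G H bd t ht k j x => ?_⟩
  have hT := H.T_pos
  have hX := H.X_pos
  have hE3 := H.E3_pos
  set s := 1 + t / T with hs
  have hs0 : 0 < s := by positivity
  set Z := S.X 0 * E3 / s ^ 8 with hZ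
  have hZ0 : 0 ≤ Z := by positivity
  have h1 := hgr S t ht k j x
  set d := |(Dx k (S.u j)).1 t x| with hd
  have hd0 : 0 ≤ d := abs_nonneg _
  have hXN : S.X t * S.N t ≤ C * (S.X 0 / s ^ 3) * (C * (E3 / s ^ 5)) :=
    mul_le_mul (bd.X_le t ht) (bd.N_le t ht) (S.N_nonneg t) (by positivity)
  have e1 : C * (S.X 0 / s ^ 3) * (C * (E3 / s ^ 5)) = C ^ 2 * Z := by rw [hZ]; field_simp
  rw [e1] at hXN
  have hV := bd.V_sq_le t ht
  have h2 : (d ^ 4) ^ 3 ≤ (K * C ^ 2 * Z) ^ 3 := by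
    calc (d ^ 4) ^ 3 = (d ^ 6) ^ 2 := by ring
      _ ≤ (K * (S.X t * S.V t * S.N t)) ^ 2 := pow_le_pow_left₀ (by positivity) h1 2
      _ = K ^ 2 * (S.X t * S.N t) ^ 2 * S.V t ^ 2 := by ring
      _ ≤ K ^ 2 * (C ^ 2 * Z) ^ 2 * (C * Z) := by
        refine mul_le_mul (mul_le_mul_of_nonneg_left (pow_le_pow_left₀
          (mul_nonneg (S.X_nonneg t) (S.N_nonneg t)) hXN 2) (by positivity)) hV (sq_nonneg _)
          (by positivity)
      _ = K ^ 2 * C ^ 5 * Z ^ 3 := by ring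
      _ ≤ K ^ 3 * C ^ 6 * Z ^ 3 := by
        have e2 : K ^ 2 ≤ K ^ 3 := pow_le_pow_right₀ hK (by norm_num)
        have e3 : C ^ 5 ≤ C ^ 6 := pow_le_pow_right₀ hC1 (by norm_num)
        gcongr
      _ = _ := by ring
  exact le_of_pow_le_pow_left₀ (by norm_num) (by positivity) h2

set_option maxHeartbeats 1000000 in
/-- The decay of the third derivatives of the velocity. -/
lemma exists_Q_decay (M C : ℝ) (hM : 0 ≤ M) : ∃ B : ℝ, 0 ≤ B ∧ ∀ (S : Flow) (T E2 E3 G : ℝ),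
    S.y 0 ≤ M → S.Data T E2 E3 G → S.Bounds T E2 E3 C → ∀ t, 0 ≤ t →
    S.Q t ≤ B * ((1 + Int S.g 0) * E3 / (1 + t / T) ^ 5 * (1 + Real.log (1 + t / T)) ^ 2) := by
  obtain ⟨A, hA, hg⟩ := exists_g_le M C hM
  obtain ⟨K, hK, hw⟩ := exists_Int_weight_le
  rcases le_or_gt 1 C with hC1 | hC1
  swap
  · exact ⟨0, le_rfl, fun S T E2 E3 G _ _ b => absurd b.one_le hC1.not_ge⟩
  have hC0 : 0 ≤ C := by linarith
  refine ⟨4 * C + 2 * (64 * A * C + 16 * K * A * C ^ 2 + 4 * A * C ^ 2), by positivity,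
    fun S T E2 E3 G hy H bd t ht => ?_⟩
  have hT := H.T_pos
  have hX := H.X_pos
  have hy0 := H.y_pos
  have hE2 := H.E2_pos
  have hE3 := H.E3_pos
  have hG := H.G_nonneg
  have hI0 : 0 ≤ Int S.g 0 := Int_nonneg (S.g_nonneg 0)
  set s := 1 + t / T with hs
  have hs1 : 1 ≤ s := by have : 0 ≤ t / T := by positivity
                         linarith
  have hs0 : 0 < s := by linarith
  have hl0 : 0 ≤ Real.log s := Real.log_nonneg hs1
  set l := 1 + Real.log s with hl
  have hl1 : 1 ≤ l := by linarith
  set I := Int S.g 0 with hI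
  set R := (1 + I) * E3 / s ^ 5 * l ^ 2 with hR
  have hR0 : 0 ≤ R := by positivity
  have hER : E3 / s ^ 5 ≤ R := by
    have e1 : E3 / s ^ 5 * 1 ≤ E3 / s ^ 5 * ((1 + I) * l ^ 2) := by
      refine mul_le_mul_of_nonneg_left ?_ (by positivity)
      exact one_le_mul_of_one_le_of_one_le (by linarith) (one_le_pow₀ hl1)
    calc E3 / s ^ 5 ≤ E3 / s ^ 5 * ((1 + I) * l ^ 2) := by linarith
      _ = R := by rw [hR]; ring
  have hq := Real.sqrt_nonneg E2
  have hq2 := Real.mul_self_sqrt hE2.le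
  have hqE := H.E2_mul_sqrt_le
  have hGE := H.E2_mul_le
  set q := √E2 with hqd
  have hV := S.V_nonneg t
  obtain ⟨g1, g2⟩ := hg S T E2 E3 G hy H bd t ht
  have main : Int (S.g * dot S.v S.v) t ≤ (64 * A * C + 16 * K * A * C ^ 2 + 4 * A * C ^ 2) * R := by
    rcases le_total t T with h | h
    · rw [min_eq_left h] at g1
      have m1 : Int (S.g * dot S.v S.v) t ≤ Int ((A * (1 + t * q) * G) • dot S.v S.v) t :=
        Int_mono fun x => by
          rw [mul_val, smul_val]
          exact mul_le_mul_of_nonneg_right (g1 x) (dot_self_nonneg S.v t x)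
      rw [Int_smul] at m1
      change _ ≤ A * (1 + t * q) * G * S.V t at m1
      have v1 : S.V t ≤ C * E2 := by
        refine (bd.V_le t ht).trans (mul_le_mul_of_nonneg_left ?_ hC0)
        exact div_le_self hE2.le (one_le_pow₀ hs1)
      have v2 : t * q * S.V t ≤ C * E2 := by
        obtain ⟨t₁, ht₁, -, F, -, -, -, f4⟩ := bd.weight
        have w1 := f4 t ht
        have w2 : t ^ 2 * S.V t ≤ C :=
          (mul_le_mul_of_nonneg_right (pow_le_pow_left₀ ht (by linarith) 2) hV).trans w1
        refine abs_le_of_sq_le_sq' ?_ (by positivity) |>.2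
        calc (t * q * S.V t) ^ 2 = (t ^ 2 * S.V t) * ((q * q) * S.V t) := by ring
          _ ≤ C * ((q * q) * (C * E2)) :=
            mul_le_mul w2 (mul_le_mul_of_nonneg_left v1 (by positivity)) (by positivity) hC0
          _ = (C * E2) ^ 2 := by rw [hq2]; ring
      have v3 : S.V t + t * q * S.V t ≤ 2 * C * E2 := by linarith
      have v4 := mul_le_mul_of_nonneg_left v3 (by positivity : 0 ≤ A * G)
      have v5 := mul_le_mul_of_nonneg_left hGE (by positivity : 0 ≤ 2 * A * C)
      have v6 : E3 ≤ 32 * (E3 / s ^ 5) := by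
        rw [mul_div_assoc', le_div_iff₀ (by positivity), mul_comm]
        refine mul_le_mul_of_nonneg_right ?_ hE3.le
        have : s ≤ 2 := by
          have : t / T ≤ 1 := by rwa [div_le_one hT]
          linarith
        calc s ^ 5 ≤ 2 ^ 5 := pow_le_pow_left₀ hs0.le this 5
          _ = 32 := by norm_num
      have v7 := mul_le_mul_of_nonneg_left (v6.trans (mul_le_mul_of_nonneg_left hER (by norm_num)))
        (by positivity : 0 ≤ 2 * A * C)
      have v8 : 0 ≤ (16 * K * A * C ^ 2 + 4 * A * C ^ 2) * R := by positivity
      linarith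
    · rw [min_eq_right h] at g1 g2
      set κ := S.y 0 / T ^ 3 with hκ
      have hκ0 : 0 < κ := by positivity
      obtain ⟨n, hn⟩ : ∃ n : ℕ, n = ⌈Real.log s⌉₊ := ⟨_, rfl⟩
      have n1 : Real.log s ≤ n := by rw [hn]; exact Nat.le_ceil _
      have n2 : (n : ℝ) ≤ Real.log s + 1 := by rw [hn]; exact (Nat.ceil_lt_add_one hl0).le
      have n3 : ((n : ℝ) + 1) ^ 2 ≤ 4 * l ^ 2 := by
        have := pow_le_pow_left₀ (by positivity) (by linarith : (n : ℝ) + 1 ≤ 2 * l) 2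
        linarith
      have n4 : Real.exp (-n) ≤ 1 / s := by
        rw [Real.exp_neg, one_div]
        refine inv_anti₀ hs0 ?_
        calc s = Real.exp (Real.log s) := (Real.exp_log hs0).symm
          _ ≤ _ := Real.exp_le_exp.2 n1
      have hNb := bd.N_le' t h
      have hVb := bd.V_le' t h
      rw [← hs, ← hκ] at hNb
      rw [← hs] at hVb
      set β := A * (1 + T * q) * G with hβ
      have hβ0 : 0 ≤ β := by positivity
      have w := fun j => hw S.g (S.v j) n t (C * (κ / s ^ 5)) β (S.g_nonneg t) g1
        (le_trans (by
          have e1 := Int_gsq S.v t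
          have e2 := Nd_nonneg (S.v 0) t
          have e3 := Nd_nonneg (S.v 1) t
          change S.N t = _ at e1
          revert j
          rw [Fin.forall_fin_two]
          constructor <;> linarith) hNb) (by positivity)
      have m1 : Int (S.g * dot S.v S.v) t =
          Int (S.g * (S.v 0 * S.v 0)) t + Int (S.g * (S.v 1 * S.v 1)) t := by
        rw [← Int_add, ← mul_add]; rfl
      have m2 : S.V t = Int (S.v 0 * S.v 0) t + Int (S.v 1 * S.v 1) t := Int_dot_self _ _
      have w0 := w 0
      have w1 := w 1
      have m3 : Int (S.g * dot S.v S.v) t ≤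
          2 * (K * ((n + 1) ^ 2 * (C * (κ / s ^ 5))) * Int S.g t) + β * Real.exp (-n) * S.V t := by
        rw [m1, m2]; linarith
      have r3 := bd.rate₃
      have r2 := bd.rate₂
      rw [← hκ] at r3
      have k1 : κ * (1 + T * q) ≤ 2 * C * E3 := by
        have e1 : κ * (T * q) = S.y 0 / T ^ 2 * q := by rw [hκ]; field_simp
        have e2 := mul_le_mul_of_nonneg_right r2 hq
        have e3 := mul_le_mul_of_nonneg_left hqE hC0
        rw [mul_add, e1]; linarith
      have k2 : S.y 0 / T ^ 2 * (1 + T * q) * G ≤ 2 * C * E3 := by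
        have e1 : S.y 0 / T ^ 2 * (T * q) = S.y 0 / T * q := by field_simp
        have e2 : S.y 0 / T ≤ q := by
          have : S.y 0 / T ≤ S.X 0 := by rw [div_le_iff₀ hT]; linarith [H.y_le]
          exact this.trans (Real.le_sqrt_of_sq_le H.X_sq_le)
        have e3 := mul_le_mul_of_nonneg_right e2 hq
        have e4 : S.y 0 / T ^ 2 * (1 + T * q) ≤ 2 * C * E2 := by
          rw [mul_add, e1]
          have : E2 ≤ C * E2 := le_mul_of_one_le_left hE2.le hC1
          linarith
        have e5 := mul_le_mul_of_nonneg_right e4 hG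
        have e6 := mul_le_mul_of_nonneg_left hGE (by positivity : 0 ≤ 2 * C)
        linarith
      have f1 : K * ((n + 1) ^ 2 * (C * (κ / s ^ 5))) * Int S.g t ≤ 8 * K * A * C ^ 2 * R := by
        calc K * ((n + 1) ^ 2 * (C * (κ / s ^ 5))) * Int S.g t
            ≤ K * ((4 * l ^ 2) * (C * (κ / s ^ 5))) * (A * (1 + T * q) * I) := by
              refine mul_le_mul ?_ g2 (Int_nonneg (S.g_nonneg t)) (by positivity)
              exact mul_le_mul_of_nonneg_left (mul_le_mul_of_nonneg_right n3 (by positivity))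
                (by positivity)
          _ = 4 * K * A * C * (I / s ^ 5 * l ^ 2) * (κ * (1 + T * q)) := by ring
          _ ≤ 4 * K * A * C * (I / s ^ 5 * l ^ 2) * (2 * C * E3) :=
              mul_le_mul_of_nonneg_left k1 (by positivity)
          _ = 8 * K * A * C ^ 2 * (I * E3 / s ^ 5 * l ^ 2) := by ring
          _ ≤ 8 * K * A * C ^ 2 * R := by
              refine mul_le_mul_of_nonneg_left ?_ (by positivity)
              refine mul_le_mul_of_nonneg_right ?_ (by positivity)
              refine div_le_div_of_nonneg_right ?_ (by positivity)
              exact mul_le_mul_of_nonneg_right (by linarith) hE3.le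
      have f2 : β * Real.exp (-n) * S.V t ≤ 2 * A * C ^ 2 * R := by
        calc β * Real.exp (-n) * S.V t ≤ β * (1 / s) * (C * (S.y 0 / T ^ 2 / s ^ 4)) :=
              mul_le_mul (mul_le_mul_of_nonneg_left n4 hβ0) hVb hV (by positivity)
          _ = A * C * (S.y 0 / T ^ 2 * (1 + T * q) * G) / s ^ 5 := by rw [hβ]; field_simp
          _ ≤ A * C * (2 * C * E3) / s ^ 5 :=
              div_le_div_of_nonneg_right (mul_le_mul_of_nonneg_left k2 (by positivity)) (by positivity)
          _ = 2 * A * C ^ 2 * (E3 / s ^ 5) := by ring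
          _ ≤ _ := mul_le_mul_of_nonneg_left hER (by positivity)
      have f3 : 0 ≤ (64 * A * C + 2 * A * C ^ 2) * R := by positivity
      linarith
  have hQ := S.Q_le ht
  have hN := (bd.N_le t ht).trans (mul_le_mul_of_nonneg_left hER hC0)
  linarith

end Flow

open Fld

/-! ### Iterated partial derivatives and Sobolev regularity -/

section
variable {F F' : Type*} [NormedAddCommGroup F] [NormedSpace ℝ F] [NormedAddCommGroup F']
  [NormedSpace ℝ F']

lemma partialD_zero (v : Fin 0 → Fin 2) (f : Plane → F) (x : Plane) : partialD v f x = f x := by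
  simp [partialD]

lemma partialD_succ {k : ℕ} (v : Fin (k + 1) → Fin 2) {f : Plane → F} (hf : ContDiff ℝ ∞ f)
    (x : Plane) : partialD v f x = fderiv ℝ (partialD (Fin.tail v) f) x (e (v 0)) := by
  have h1 : DifferentiableAt ℝ (iteratedFDeriv ℝ k f) x :=
    (hf.differentiable_iteratedFDeriv (by exact_mod_cast WithTop.coe_lt_top _)) x
  have h2 := fderiv_continuousMultilinear_apply_const h1 fun j => e (Fin.tail v j)
  change _ = fderiv ℝ (fun y => iteratedFDeriv ℝ k f y fun j => e (Fin.tail v j)) x (e (v 0))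
  rw [h2, partialD, iteratedFDeriv_succ_apply_left]
  rfl

lemma partialD_clm {k : ℕ} (v : Fin k → Fin 2) {f : Plane → F} (hf : ContDiff ℝ ∞ f)
    (L : F →L[ℝ] F') (x : Plane) : partialD v (fun y => L (f y)) x = L (partialD v f x) := by
  have := L.iteratedFDeriv_comp_left (hf.contDiffAt (x := x)) (i := k)
    (by exact_mod_cast le_top)
  change iteratedFDeriv ℝ k (L ∘ f) x _ = _
  rw [this]; rfl

end

lemma JS.partialD_eq {F : ℝ → Plane → ℝ} (hF : JS F) {k : ℕ} (v : Fin k → Fin 2) (t : ℝ) :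
    partialD v (F t) = INS2D.pdW (List.ofFn fun j => some (v j)) F t := by
  induction k with
  | zero => funext x; simp [partialD_zero]
  | succ k ih =>
    funext x
    rw [partialD_succ v (hF.contDiff t), ih, List.ofFn_succ]
    rfl

/-- Smooth curves in `L²`. -/
def SmoothL2 (F : ℝ → Plane → ℝ) : Prop :=
  ∃ g : ℝ → Lp ℝ 2 (volume : Measure Plane), ContDiffOn ℝ ∞ g (Ici 0) ∧
    ∀ t, 0 ≤ t → g t =ᵐ[volume] F t

lemma SmoothL2.pd_none {F : ℝ → Plane → ℝ} (hF : JS F) (h : SmoothL2 F) : SmoothL2 (pd none F) := by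
  obtain ⟨g, hg, hgF⟩ := h
  refine ⟨derivWithin g (Ici 0), hg.derivWithin (uniqueDiffOn_Ici 0) (by simp), fun t ht => ?_⟩
  have hd : HasDerivWithinAt g (derivWithin g (Ici 0) t) (Ici 0) t :=
    ((hg t ht).differentiableWithinAt (by simp)).hasDerivWithinAt
  set s : ℕ → ℝ := fun n => t + 1 / (n + 1) with hs
  have hst : ∀ n, t < s n := fun n => by
    have : (0 : ℝ) < 1 / (n + 1) := by positivity
    simp only [hs]; linarith
  have hlim : Tendsto s atTop (𝓝[Ici 0 \ {t}] t) := by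
    refine tendsto_nhdsWithin_iff.2 ⟨?_, Eventually.of_forall fun n =>
      ⟨(ht.trans (hst n).le : (0 : ℝ) ≤ s n), (hst n).ne'⟩⟩
    simpa [hs] using tendsto_one_div_add_atTop_nhds_zero_nat.const_add t
  have h1 := (hasDerivWithinAt_iff_tendsto_slope.1 hd).comp hlim
  obtain ⟨ns, hns, hae⟩ := (tendstoInMeasure_of_tendsto_Lp h1).exists_seq_tendsto_ae
  have h2 : ∀ᵐ x : Plane, ∀ n, (slope g t (s n) : Plane → ℝ) x = slope (fun r => F r x) t (s n) := by
    rw [ae_all_iff]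
    intro n
    filter_upwards [Lp.coeFn_smul (s n - t)⁻¹ (g (s n) - g t), Lp.coeFn_sub (g (s n)) (g t),
      hgF t ht, hgF (s n) (ht.trans (hst n).le)] with x e1 e2 e3 e4
    rw [slope_def_module, slope_def_module, e1, Pi.smul_apply, e2, Pi.sub_apply, e3, e4]
  filter_upwards [hae, h2] with x e1 e2
  have h3 := ((hasDerivWithinAt_iff_tendsto_slope.1 (hF.hasDerivWithinAt ht x)).comp hlim).comp
    hns.tendsto_atTop
  refine tendsto_nhds_unique e1 (h3.congr fun n => ?_)
  simp only [Function.comp_apply]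
  rw [e2]

lemma SmoothL2.bl2 {F : ℝ → Plane → ℝ} (hF : JS F) (h : SmoothL2 F) : BL2 F := fun S => by
  obtain ⟨g, hg, hgF⟩ := h
  obtain ⟨C, hC⟩ := (isCompact_Icc (a := (0 : ℝ)) (b := S)).exists_bound_of_continuousOn
    (hg.continuousOn.mono fun t ht => ht.1)
  refine ⟨C ^ 2, fun t ht => ?_⟩
  have hm : MemLp (F t) 2 volume := (memLp_congr_ae (hgF t ht.1)).1 (Lp.memLp (g t))
  refine ⟨(memLp_two_iff_integrable_sq (hF.contDiff t).continuous.aestronglyMeasurable).1 hm, ?_⟩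
  have h1 : ∫ x, F t x ^ 2 = ‖g t‖ ^ 2 := by
    rw [← real_inner_self_eq_norm_sq, L2.inner_def]
    refine integral_congr_ae ?_
    filter_upwards [hgF t ht.1] with x hx
    rw [hx]; simp [pow_two]
  rw [h1]
  exact pow_le_pow_left₀ (norm_nonneg _) (hC t ht) 2

lemma Adm.of_smoothL2 {F : ℝ → Plane → ℝ} (hF : JS F)
    (h : ∀ w : List (Fin 2), SmoothL2 (pdW (w.map some) F)) : Adm BL2 F := by
  refine ⟨hF, fun w => ?_⟩
  have key : ∀ w : List (Option (Fin 2)), ∀ w' : List (Fin 2), SmoothL2 (pdW (w'.map some) (pdW w F)) := by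
    intro w
    induction w with
    | nil => exact h
    | cons a w ih =>
      intro w'
      rw [pdW_cons]
      cases a with
      | none =>
        rw [pdW_pd (hF.pdW w)]
        exact (ih w').pd_none ((hF.pdW w).pdW _)
      | some i =>
        have := ih (w' ++ [i])
        rwa [List.map_append, pdW_append] at this
  exact SmoothL2.bl2 (hF.pdW w) (key w [])

lemma SmoothInSobolev.adm {F' : Type*} [NormedAddCommGroup F'] [NormedSpace ℝ F']
    {f : ℝ → Plane → F'} (hf : SmoothInSobolev f) (hs : ∀ t, 0 ≤ t → ContDiff ℝ ∞ (f t))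
    (L : F' →L[ℝ] ℝ) {F : ℝ → Plane → ℝ} (hF : JS F) (h : ∀ t, 0 ≤ t → ∀ x, F t x = L (f t x)) :
    Adm BL2 F := by
  refine Adm.of_smoothL2 hF fun w => ?_
  obtain ⟨g, hg, hgf⟩ := hf w.length w.get
  refine ⟨fun t => ContinuousLinearMap.compLpL 2 volume L (g t),
    (ContinuousLinearMap.contDiff _).comp_contDiffOn hg, fun t ht => ?_⟩
  filter_upwards [ContinuousLinearMap.coeFn_compLpL L (g t), hgf t ht] with x e1 e2
  have e3 : F t = fun y => L (f t y) := funext (h t ht)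
  have e4 := congrFun (hF.partialD_eq w.get t) x
  rw [e1, e2, ← partialD_clm _ (hs t ht), ← e3, e4]
  congr 1
  change List.ofFn (some ∘ w.get) = _
  rw [← List.map_ofFn, List.ofFn_get]

/-! ### Norms -/

lemma LpN_two_sq {F : Type*} [NormedAddCommGroup F] {f : Plane → F} {q : Plane → ℝ}
    (h : ∀ x, ‖f x‖ ^ 2 = q x) (hc : Continuous q) (hi : Integrable q) : LpN 2 f ^ 2 = ∫ x, q x := by
  have h1 : eLpNorm f 2 volume = eLpNorm (fun x => √(q x)) 2 volume :=
    eLpNorm_congr_norm_ae (Eventually.of_forall fun x => by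
      rw [← h x, Real.sqrt_sq (norm_nonneg _), norm_norm])
  have hq : ∀ x, √(q x) ^ 2 = q x := fun x => Real.sq_sqrt (by rw [← h x]; positivity)
  have hm : MemLp (fun x => √(q x)) 2 volume := by
    rw [memLp_two_iff_integrable_sq hc.sqrt.aestronglyMeasurable]
    simpa only [hq] using hi
  have h0 : 0 ≤ ∫ x, q x := integral_nonneg fun x => by rw [← h x]; positivity
  rw [LpN, h1, hm.eLpNorm_eq_integral_rpow_norm (by norm_num) (by norm_num)]
  simp only [ENNReal.toReal_ofNat, Real.rpow_ofNat, Real.norm_eq_abs, sq_abs, hq]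
  rw [ENNReal.toReal_ofReal (by positivity), ← Real.rpow_natCast, ← Real.rpow_mul h0]
  norm_num

lemma LpN_top_le {F : Type*} [NormedAddCommGroup F] {f : Plane → F} {C : ℝ} (h : ∀ x, ‖f x‖ ≤ C) :
    LpN ⊤ f ≤ C := by
  have h0 : 0 ≤ C := (norm_nonneg _).trans (h 0)
  rw [LpN, eLpNorm_exponent_top]
  exact ENNReal.toReal_le_of_le_ofReal h0 (eLpNormEssSup_le_of_ae_bound (Eventually.of_forall h))

lemma norm_le_LpN_top {f : Plane → ℝ} (hc : Continuous f) {C : ℝ} (h : ∀ x, ‖f x‖ ≤ C) (x : Plane) :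
    ‖f x‖ ≤ LpN ⊤ f := by
  have hfin : eLpNormEssSup f volume ≠ ⊤ :=
    ((eLpNormEssSup_le_of_ae_bound (Eventually.of_forall h)).trans_lt ENNReal.ofReal_lt_top).ne
  have h1 : ∀ᵐ y : Plane, ‖f y‖ ≤ LpN ⊤ f := by
    filter_upwards [ae_le_eLpNormEssSup (f := f) (μ := volume)] with y hy
    rw [LpN, eLpNorm_exponent_top, ← toReal_enorm]
    exact ENNReal.toReal_mono hfin hy
  have h2 := Measure.dense_of_ae h1
  have h3 : IsClosed {y | ‖f y‖ ≤ LpN ⊤ f} := isClosed_le hc.norm continuous_const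
  have := h3.closure_eq ▸ h2.closure_eq
  exact (this ▸ mem_univ x : x ∈ {y | ‖f y‖ ≤ LpN ⊤ f})

lemma sum_fin_succ {k : ℕ} (G : (Fin (k + 1) → Fin 2) → ℝ) :
    ∑ v, G v = ∑ w, (G (Fin.cons 0 w) + G (Fin.cons 1 w)) := by
  rw [← (Fin.consEquiv fun _ => Fin 2).sum_comp, Fintype.sum_prod_type, Fin.sum_univ_two,
    ← Finset.sum_add_distrib]
  rfl

lemma sum_fin_zero (G : (Fin 0 → Fin 2) → ℝ) : ∑ v, G v = G Fin.elim0 := by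
  rw [Fintype.sum_unique]; congr 1

lemma sq_gradLen {F : Type*} [NormedAddCommGroup F] [NormedSpace ℝ F] (k : ℕ) (f : Plane → F) (x) :
    gradLen k f x ^ 2 = ∑ v : Fin k → Fin 2, ‖partialD v f x‖ ^ 2 :=
  Real.sq_sqrt (Finset.sum_nonneg fun _ _ => sq_nonneg _)

open Fld

/-! ### Flows of smooth solutions -/

lemma clm_apply_eq (L : Plane →L[ℝ] ℝ) (v : Plane) : L v = v 0 * L (e 0) + v 1 * L (e 1) := by
  have : v = v 0 • e 0 + v 1 • e 1 := by
    ext i; fin_cases i <;> simp [e]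
  conv_lhs => rw [this]
  rw [map_add, map_smul, map_smul, smul_eq_mul, smul_eq_mul]

lemma fderiv_coord {w : Plane → Plane} {x : Plane} (hw : DifferentiableAt ℝ w x) (j : Fin 2)
    (h : Plane) : fderiv ℝ w x h j = fderiv ℝ (fun y => w y j) x h := by
  have := ((EuclideanSpace.proj (𝕜 := ℝ) j).hasFDerivAt (x := w x)).comp x hw.hasFDerivAt
  have h2 : HasFDerivAt (fun y => w y j) _ x := this
  rw [h2.fderiv]; rfl

lemma JS.of_contDiffOn {f : ℝ → Plane → ℝ} (hf : ContDiffOn ℝ ∞ (fun q : ℝ × Plane => f q.1 q.2) slab) :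
    JS fun t x => f (max t 0) x :=
  ⟨fun t => by simp, hf.congr fun q hq => by rw [max_eq_left (mem_Ici.1 hq.1)]⟩

lemma contDiff_slice {F : Type*} [NormedAddCommGroup F] [NormedSpace ℝ F] {f : ℝ → Plane → F}
    (hf : ContDiffOn ℝ ∞ (fun q : ℝ × Plane => f q.1 q.2) slab) {t : ℝ} (ht : 0 ≤ t) :
    ContDiff ℝ ∞ (f t) := by
  rw [← contDiffOn_univ]
  exact hf.comp (f := fun x : Plane => (t, x)) (by fun_prop) (fun x _ => mem_slab ht x)

lemma pd_none_max (f : ℝ → Plane → ℝ) {t : ℝ} (ht : 0 ≤ t) (x : Plane) :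
    pd none (fun t x => f (max t 0) x) t x = tderiv f t x := by
  simp only [pd, tderiv, max_eq_left ht]
  exact derivWithin_congr (fun s hs => by rw [max_eq_left (mem_Ici.1 hs)]) (by rw [max_eq_left ht])

lemma tderiv_coord {f : ℝ → Plane → Plane}
    (hf : ContDiffOn ℝ ∞ (fun q : ℝ × Plane => f q.1 q.2) slab) (j : Fin 2) {t : ℝ} (ht : 0 ≤ t)
    (x : Plane) : tderiv f t x j = tderiv (fun t x => f t x j) t x := by
  have h1 : ContDiffOn ℝ ∞ (fun s => f s x) (Ici 0) :=
    hf.comp (f := fun s : ℝ => (s, x)) (by fun_prop) fun s hs => mem_slab hs x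
  have h2 := ((h1 t ht).differentiableWithinAt (by simp)).hasDerivWithinAt
  have h3 := (EuclideanSpace.proj (𝕜 := ℝ) j).hasFDerivAt.comp_hasDerivWithinAt t h2
  have h4 : HasDerivWithinAt (fun s => f s x j) _ (Ici 0) t := h3
  exact (h4.derivWithin (uniqueDiffOn_Ici 0 t ht)).symm

lemma gradient_coord (f : Plane → ℝ) (x : Plane) (j : Fin 2) :
    gradient f x j = fderiv ℝ f x (e j) := by
  rw [← inner_gradient_left, e, EuclideanSpace.inner_single_right]
  simp

namespace IsSmoothSolution
variable {ρ : ℝ → Plane → ℝ} {u : ℝ → Plane → Plane} {P : ℝ → Plane → ℝ}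

lemma smooth_u_coord (H : IsSmoothSolution ρ u P) (j : Fin 2) :
    ContDiffOn ℝ ∞ (fun q : ℝ × Plane => u q.1 q.2 j) slab := contDiffOn_euclidean.1 H.smooth_u j

lemma js_u (H : IsSmoothSolution ρ u P) (j : Fin 2) : JS fun t x => u (max t 0) x j :=
  .of_contDiffOn (f := fun t x => u t x j) (H.smooth_u_coord j)

lemma js_P (H : IsSmoothSolution ρ u P) : JS fun t x => P (max t 0) x := .of_contDiffOn H.smooth_P

lemma adm_rho (H : IsSmoothSolution ρ u P) : Adm BL2 fun t x => ρ (max t 0) x - 1 := by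
  have hs : ContDiffOn ℝ ∞ (fun q : ℝ × Plane => ρ q.1 q.2 - 1) slab :=
    H.smooth_rho.sub contDiffOn_const
  refine H.sobolev_rho.adm (fun t ht => contDiff_slice (f := fun t x => ρ t x - 1) hs ht)
    (ContinuousLinearMap.id ℝ ℝ) (.of_contDiffOn (f := fun t x => ρ t x - 1) hs) fun t ht x => ?_
  rw [max_eq_left ht]; rfl

lemma adm_u (H : IsSmoothSolution ρ u P) (j : Fin 2) : Adm BL2 fun t x => u (max t 0) x j :=
  H.sobolev_u.adm (fun _ ht => contDiff_slice H.smooth_u ht) (EuclideanSpace.proj j) (H.js_u j)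
    fun t ht x => by rw [max_eq_left ht]; rfl

lemma adm_p (H : IsSmoothSolution ρ u P) (j : Fin 2) :
    Adm BL2 (pd (some j) fun t x => P (max t 0) x) := by
  have hg : ∀ t, 0 ≤ t → ∀ x j, (pd (some j) fun t x => P (max t 0) x) t x = gradient (P t) x j :=
    fun t ht x j => by rw [gradient_coord]; simp only [pd, max_eq_left ht]
  refine H.sobolev_gradP.adm (fun t ht => contDiff_euclidean.2 fun i => ?_) (EuclideanSpace.proj j)
    (H.js_P.pd _) fun t ht x => hg t ht x j
  have := (H.js_P.pd (some i)).contDiff t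
  rwa [funext fun x => hg t ht x i] at this

/-- The density perturbation. -/
def rFld (H : IsSmoothSolution ρ u P) : Fld := ⟨_, H.adm_rho.bb⟩

/-- The components of the velocity. -/
def uFld (H : IsSmoothSolution ρ u P) (j : Fin 2) : Fld := ⟨_, (H.adm_u j).bb⟩

/-- The components of the pressure gradient. -/
def pFld (H : IsSmoothSolution ρ u P) (j : Fin 2) : Fld := ⟨_, (H.adm_p j).bb⟩

lemma rFld_val (H : IsSmoothSolution ρ u P) : (H.rFld + 1).1 = fun t x => ρ (max t 0) x := by
  funext t x
  simp [rFld]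

lemma Dx_rFld (H : IsSmoothSolution ρ u P) (i : Fin 2) {t : ℝ} (ht : 0 ≤ t) (x : Plane) :
    (Dx i (H.rFld + 1)).1 t x = fderiv ℝ (ρ t) x (e i) := by
  rw [Dx_val, rFld_val]; simp only [max_eq_left ht]

lemma Dx_uFld (H : IsSmoothSolution ρ u P) (i j : Fin 2) {t : ℝ} (ht : 0 ≤ t) (x : Plane) :
    (Dx i (H.uFld j)).1 t x = fderiv ℝ (fun y => u t y j) x (e i) := by
  rw [Dx_val, uFld]; simp only [max_eq_left ht]

lemma Dt_uFld (H : IsSmoothSolution ρ u P) (j : Fin 2) {t : ℝ} (ht : 0 ≤ t) (x : Plane) :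
    (Dt (H.uFld j)).1 t x = tderiv u t x j := by
  rw [tderiv_coord H.smooth_u j ht]
  exact pd_none_max (fun t x => u t x j) ht x

lemma partialD_u (H : IsSmoothSolution ρ u P) {k : ℕ} (v : Fin k → Fin 2) (j : Fin 2) {t : ℝ}
    (ht : 0 ≤ t) (x : Plane) :
    partialD v (u t) x j = pdW (List.ofFn fun i => some (v i)) (H.uFld j).1 t x := by
  have h1 := partialD_clm v (contDiff_slice H.smooth_u ht) (EuclideanSpace.proj (𝕜 := ℝ) j) x
  change _ = partialD v (u t) x j at h1
  rw [← h1, uFld, ← (H.js_u j).partialD_eq v t]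
  simp only [max_eq_left ht]
  rfl

/-- The flow of a smooth solution. -/
def flow (H : IsSmoothSolution ρ u P) (A : AdmissibleData ρ u) : Flow where
  r := H.rFld + 1
  u := H.uFld
  p := H.pFld
  l2r := by rw [add_sub_cancel_right]; exact ⟨H.adm_rho⟩
  l2u j := ⟨H.adm_u j⟩
  l2p j := ⟨H.adm_p j⟩
  div_u := ext_nonneg fun t ht x => by
    have hd := (contDiff_slice H.smooth_u ht).differentiable (by simp) x
    have h := H.incomp t ht x
    rw [div, Fin.sum_univ_two, fderiv_coord hd, fderiv_coord hd] at h
    rw [add_val, Dx_uFld H 0 0 ht, Dx_uFld H 1 1 ht, zero_val, h]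
  curl_p := Fld.ext (pd_comm H.js_P (some 0) (some 1))
  mass := ext_nonneg fun t ht x => by
    have h := H.mass t ht x
    rw [clm_apply_eq] at h
    have e1 : (Dt (H.rFld + 1)).1 t x = tderiv ρ t x := by
      change pd none (H.rFld + 1).1 t x = _
      rw [rFld_val]; exact pd_none_max ρ ht x
    simp only [add_val, mul_val, zero_val, Dx_rFld H _ ht, e1]
    have e2 : ∀ j, (H.uFld j).1 t x = u t x j := fun j => by simp only [uFld, max_eq_left ht]
    rw [e2, e2]
    linarith
  momentum j := ext_nonneg fun t ht x => by
    have hd := (contDiff_slice H.smooth_u ht).differentiable (by simp) x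
    have h := congrArg (fun z : Plane => z j) (H.momentum t ht x)
    simp only [PiLp.add_apply, PiLp.sub_apply, PiLp.smul_apply, PiLp.zero_apply, smul_eq_mul] at h
    rw [fderiv_coord hd, clm_apply_eq, gradient_coord, ← Dt_uFld H j ht, ← Dx_uFld H 0 j ht,
      ← Dx_uFld H 1 j ht] at h
    have e1 : lap (u t) x j = (Lap (H.uFld j)).1 t x := by
      simp only [lap, Fin.sum_univ_two, PiLp.add_apply]
      rw [H.partialD_u _ j ht, H.partialD_u _ j ht]
      rfl
    have e2 : ∀ j, (H.uFld j).1 t x = u t x j := fun j => by simp only [uFld, max_eq_left ht]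
    have e3 : (H.rFld + 1).1 t x = ρ t x := by rw [rFld_val]; simp only [max_eq_left ht]
    have e4 : (H.pFld j).1 t x = fderiv ℝ (P t) x (e j) := by simp only [pFld, pd, max_eq_left ht]
    rw [e1] at h
    rw [mul_val, e3, add_val, add_val, mul_val, mul_val, sub_val, e2, e2, e4]
    linarith
  init x := by
    have := A.bounds x
    rw [rFld_val]; simp only [max_self]; rw [abs_le]
    constructor <;> linarith

end IsSmoothSolution

open Fld

/-! ### Norms of solutions and of their flows -/

lemma Fld.eq_zero_of_Int_eq_zero {f : Fld} [IsL1 f] {t : ℝ} (h0 : ∀ x, 0 ≤ f.1 t x)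
    (h : Int f t = 0) (x : Plane) : f.1 t x = 0 := by
  have h1 := (integral_eq_zero_iff_of_nonneg h0 (f.integrable t)).1 h
  have h2 := (Continuous.ae_eq_iff_eq volume (f.continuous t) continuous_const).1 h1
  exact congrFun h2 x

section coordinates
variable {w : Plane → Plane} {W : Fin 2 → Fld} {t : ℝ}

lemma norm_sq_eq_dot (h : ∀ x j, w x j = (W j).1 t x) (x : Plane) :
    ‖w x‖ ^ 2 = (dot W W).1 t x := by
  rw [EuclideanSpace.real_norm_sq_eq, Fin.sum_univ_two, h, h, dot, add_val, mul_val, mul_val, pow_two,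
    pow_two]

lemma partialD_coord (h : ∀ x j, w x j = (W j).1 t x) {k : ℕ} (v : Fin k → Fin 2) (j : Fin 2)
    (x : Plane) : partialD v w x j = pdW (List.ofFn fun i => some (v i)) (W j).1 t x := by
  have hw : ContDiff ℝ ∞ w := contDiff_euclidean.2 fun j => by
    rw [funext fun x => h x j]; exact (W j).contDiff t
  have h1 := partialD_clm v hw (EuclideanSpace.proj (𝕜 := ℝ) j) x
  change partialD v (fun y => w y j) x = partialD v w x j at h1
  rw [← h1, ← (W j).js.partialD_eq v t, funext fun x => h x j]

lemma gradLen_one_sq (h : ∀ x j, w x j = (W j).1 t x) (x : Plane) :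
    gradLen 1 w x ^ 2 = (gsq W).1 t x := by
  rw [sq_gradLen, sum_fin_succ, sum_fin_zero]
  simp only [EuclideanSpace.real_norm_sq_eq, Fin.sum_univ_two, partialD_coord h, gsq, dot, add_val,
    ← pow_two]
  rfl

lemma gradLen_three_sq (h : ∀ x j, w x j = (W j).1 t x) (x : Plane) :
    gradLen 3 w x ^ 2 = (hsq (fun j => Dx 0 (W j)) + hsq (fun j => Dx 1 (W j))).1 t x := by
  rw [sq_gradLen, sum_fin_succ, sum_fin_succ, sum_fin_succ, sum_fin_zero]
  simp only [EuclideanSpace.real_norm_sq_eq, Fin.sum_univ_two, partialD_coord h, hsq, gsq, dot,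
    add_val, ← pow_two]
  simp only [List.ofFn_succ, List.ofFn_zero, Fin.cons_zero, Fin.cons_succ, pdW_cons, pdW_nil, pow_val, D_val]

end coordinates

namespace Flow
variable (S : Flow)

lemma u_eq_zero {t : ℝ} (ht : 0 ≤ t) (h : S.y t = 0) (j : Fin 2) (x : Plane) : (S.u j).1 t x = 0 := by
  have h1 := S.Int_r_dot_le S.u ht
  have h2 := Int_dot_nonneg S.u t
  rw [y] at h
  have h3 := eq_zero_of_Int_eq_zero (dot_self_nonneg S.u t) (by linarith) x
  have h4 := sq_le_dot S.u j t x
  rw [h3] at h4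
  exact pow_eq_zero_iff two_ne_zero |>.1 (le_antisymm h4 (sq_nonneg _))

lemma X_zero_pos (h : 0 < S.y 0) : 0 < S.X 0 := by
  refine lt_of_le_of_ne (S.X_nonneg 0) fun h0 => h.ne' ?_
  obtain ⟨K, -, hK⟩ := exists_ladyzhenskaya
  have h1 := (hK S.u 0).1
  rw [← X, ← h0, mul_zero, mul_zero] at h1
  have h2 : ∀ x, 0 ≤ (dot S.u S.u * dot S.u S.u).1 0 x := fun x => mul_self_nonneg _
  have h3 := eq_zero_of_Int_eq_zero h2 (le_antisymm h1 (Int_nonneg h2))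
  have h4 : ∀ x, (S.r * dot S.u S.u).1 0 x = 0 := fun x => by
    rw [mul_val, (mul_self_eq_zero.1 (h3 x) : (dot S.u S.u).1 0 x = 0), mul_zero]
  rw [y, Fld.Int, integral_congr_ae (Eventually.of_forall h4), integral_zero]

/-- A flow starting at rest stays at rest. -/
lemma at_rest (h : S.y 0 = 0) : (∀ j, S.u j = 0) ∧ ∀ j, S.p j = 0 := by
  have hu : ∀ j, S.u j = 0 := fun j => ext_nonneg fun t ht x =>
    S.u_eq_zero ht (le_antisymm (h ▸ S.y_le_init ht) (S.y_nonneg ht)) j x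
  refine ⟨hu, fun j => ?_⟩
  have := S.momentum j
  simpa [hu, Lap] using this

end Flow

namespace IsSmoothSolution
variable {ρ : ℝ → Plane → ℝ} {u : ℝ → Plane → Plane} {P : ℝ → Plane → ℝ}
  (H : IsSmoothSolution ρ u P) (A : AdmissibleData ρ u)

lemma flow_u {t : ℝ} (ht : 0 ≤ t) (x : Plane) (j : Fin 2) : u t x j = ((H.flow A).u j).1 t x := by
  change _ = (H.uFld j).1 t x
  simp only [uFld, max_eq_left ht]

lemma flow_r (x : Plane) : (H.flow A).r.1 0 x = ρ 0 x := by
  change (H.rFld + 1).1 0 x = _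
  rw [rFld_val]; simp only [max_self]

lemma flow_ut (x : Plane) (j : Fin 2) : tderiv u 0 x j = ((H.flow A).ut j).1 0 x :=
  (H.Dt_uFld j le_rfl x).symm

lemma E0_eq : E0 ρ u = (H.flow A).y 0 := by
  refine integral_congr_ae (Eventually.of_forall fun x => ?_)
  simp only [mul_val, norm_sq_eq_dot (H.flow_u A le_rfl), H.flow_r A]

lemma E1_eq : E1 u = (H.flow A).X 0 :=
  LpN_two_sq (fun x => by rw [Real.norm_eq_abs, sq_abs, gradLen_one_sq (H.flow_u A le_rfl)])
    (Fld.continuous _ 0) (Fld.integrable _ 0)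

lemma E2_eq : E2 ρ u = Int ((H.flow A).r * dot (H.flow A).ut (H.flow A).ut) 0 + (H.flow A).X 0 ^ 2 := by
  have h1 := H.E1_eq A
  rw [E1] at h1
  rw [E2, show LpN 2 (gradLen 1 (u 0)) ^ 4 = (LpN 2 (gradLen 1 (u 0)) ^ 2) ^ 2 by ring, h1]
  congr 1
  refine LpN_two_sq (fun x => ?_) (Fld.continuous _ 0) (Fld.integrable _ 0)
  rw [norm_smul, mul_pow, norm_sq_eq_dot (H.flow_ut A), mul_val, H.flow_r A, Real.norm_eq_abs, sq_abs,
    Real.sq_sqrt (H.rho_pos 0 le_rfl x).le]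

lemma LpN_grad_ut : LpN 2 (gradLen 1 (tderiv u 0)) ^ 2 = Int (gsq (H.flow A).ut) 0 :=
  LpN_two_sq (fun x => by rw [Real.norm_eq_abs, sq_abs, gradLen_one_sq (H.flow_ut A)])
    (Fld.continuous _ 0) (Fld.integrable _ 0)

lemma gradLen_rho_sq (x : Plane) : gradLen 1 (ρ 0) x ^ 2 = (H.flow A).g.1 0 x := by
  have h : ρ 0 = (H.flow A).r.1 0 := funext fun x => (H.flow_r A x).symm
  rw [sq_gradLen, sum_fin_succ, sum_fin_zero, h]
  simp only [(H.flow A).r.js.partialD_eq, Real.norm_eq_abs, sq_abs, Flow.g, add_val, ← pow_two]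
  rfl

lemma LpN_grad_rho : LpN 2 (gradLen 1 (ρ 0)) ^ 2 = Int (H.flow A).g 0 :=
  LpN_two_sq (fun x => by rw [Real.norm_eq_abs, sq_abs, H.gradLen_rho_sq A])
    (Fld.continuous _ 0) (Fld.integrable _ 0)

lemma g_le (x : Plane) : (H.flow A).g.1 0 x ≤ LpN ⊤ (gradLen 1 (ρ 0)) ^ 2 := by
  have h : gradLen 1 (ρ 0) = fun x => √((H.flow A).g.1 0 x) := funext fun x => by
    rw [← H.gradLen_rho_sq A]; exact (Real.sqrt_sq (Real.sqrt_nonneg _)).symm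
  obtain ⟨B, hB⟩ := (H.flow A).g.bdd 0
  have h1 := norm_le_LpN_top (h ▸ ((H.flow A).g.continuous 0).sqrt) (C := √B) (fun x => by
    rw [h, Real.norm_eq_abs, abs_of_nonneg (Real.sqrt_nonneg _)]
    exact Real.sqrt_le_sqrt ((le_abs_self _).trans (hB x))) x
  rw [← H.gradLen_rho_sq A, ← sq_abs (gradLen 1 (ρ 0) x)]
  exact pow_le_pow_left₀ (abs_nonneg _) h1 2

lemma LpN_rho_sub_one : LpN 2 (fun x => ρ 0 x - 1) ^ 2 = (H.flow A).a ^ 2 := by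
  rw [Flow.a, Real.sq_sqrt (Int_sq_nonneg _ _)]
  refine LpN_two_sq (fun x => ?_) (Fld.continuous _ 0) (Fld.integrable _ 0)
  rw [Real.norm_eq_abs, sq_abs, mul_val, sub_val, one_val, H.flow_r A, pow_two]

lemma LpN_third_order {t : ℝ} (ht : 0 ≤ t) :
    LpN 2 (gradLen 3 (u t)) ^ 2 + LpN 2 (gradLen 2 (P t)) ^ 2 = (H.flow A).Q t := by
  have h1 : LpN 2 (gradLen 3 (u t)) ^ 2 = Int (hsq (fun j => Dx 0 ((H.flow A).u j)) +
      hsq (fun j => Dx 1 ((H.flow A).u j))) t :=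
    LpN_two_sq (fun x => by rw [Real.norm_eq_abs, sq_abs, gradLen_three_sq (H.flow_u A ht)])
      (Fld.continuous _ t) (Fld.integrable _ t)
  have h2 : LpN 2 (gradLen 2 (P t)) ^ 2 = Int (gsq (H.flow A).p) t := by
    refine LpN_two_sq (fun x => ?_) (Fld.continuous _ t) (Fld.integrable _ t)
    have h : P t = (fun t x => P (max t 0) x) t := by simp only [max_eq_left ht]
    rw [Real.norm_eq_abs, sq_abs, sq_gradLen, sum_fin_succ, sum_fin_succ, sum_fin_zero, h]
    simp only [H.js_P.partialD_eq, Real.norm_eq_abs, sq_abs, gsq, dot, add_val, ← pow_two]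
    simp only [List.ofFn_succ, List.ofFn_zero, Fin.cons_zero, Fin.cons_succ, pdW_cons, pdW_nil]
    change _ = pd (some 0) (H.pFld 0).1 t x ^ 2 + pd (some 0) (H.pFld 1).1 t x ^ 2 +
      (pd (some 1) (H.pFld 0).1 t x ^ 2 + pd (some 1) (H.pFld 1).1 t x ^ 2)
    simp only [pFld]
    ring
  rw [h1, h2, Int_add, Flow.Q]

lemma LpN_top_grad_le {t B : ℝ} (ht : 0 ≤ t) (hB : 0 ≤ B)
    (h : ∀ k j x, |(Dx k ((H.flow A).u j)).1 t x| ≤ B) : LpN ⊤ (gradLen 1 (u t)) ≤ 2 * B := by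
  refine LpN_top_le fun x => abs_le_of_sq_le_sq ?_ (by linarith)
  have h' : ∀ k j, (Dx k ((H.flow A).u j)).1 t x * (Dx k ((H.flow A).u j)).1 t x ≤ B ^ 2 := fun k j => by
    rw [← pow_two]; exact sq_le_sq' (neg_le_of_abs_le (h k j x)) (le_of_abs_le (h k j x))
  rw [gradLen_one_sq (H.flow_u A ht)]
  simp only [gsq, dot, add_val, mul_val]
  linarith [h' 0 0, h' 0 1, h' 1 0, h' 1 1]

end IsSmoothSolution

open Fld

namespace IsSmoothSolution
variable {ρ : ℝ → Plane → ℝ} {u : ℝ → Plane → Plane} {P : ℝ → Plane → ℝ}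

lemma data (H : IsSmoothSolution ρ u P) (A : AdmissibleData ρ u) (h0 : 0 < E0 ρ u) {T : ℝ}
    (hT : T3 ρ u ≤ T) :
    (H.flow A).Data T (E2 ρ u) (E3 ρ u) (LpN ⊤ (gradLen 1 (ρ 0)) ^ 2) := by
  simp only [T3, T2, T1, T0, max_le_iff] at hT
  obtain ⟨⟨⟨⟨hU, ha⟩, hE⟩, -⟩, -⟩ := hT
  have hy : 0 < (H.flow A).y 0 := H.E0_eq A ▸ h0
  have hX := (H.flow A).X_zero_pos hy
  rw [H.E0_eq A, H.E1_eq A] at hE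
  have hTp : 0 < T := (div_pos hy hX).trans_le hE
  have hle : ∀ j x, ‖x‖ * |((H.flow A).u j).1 0 x| ≤ ‖x‖ * ‖u 0 x‖ := fun j x => by
    rw [← H.flow_u A le_rfl]
    exact mul_le_mul_of_nonneg_left (PiLp.norm_apply_le (u 0 x) j) (norm_nonneg _)
  have hm : ∀ j, Integrable fun x => ‖x‖ * |((H.flow A).u j).1 0 x| := fun j =>
    A.moment.mono' (continuous_norm.mul (Fld.continuous _ 0).abs).aestronglyMeasurable
      (Eventually.of_forall fun x => by
        rw [Real.norm_eq_abs, abs_of_nonneg (by positivity)]; exact hle j x)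
  have hv : ∀ j x, (ρ 0 x • u 0 x) j = ((H.flow A).r * (H.flow A).u j).1 0 x := fun j x => by
    rw [PiLp.smul_apply, smul_eq_mul, mul_val, H.flow_r A, H.flow_u A le_rfl]
  refine ⟨hTp, hy, hm, fun j => ?_, fun j => ?_, ?_, ?_, H.E2_eq A, H.g_le A, ?_⟩
  · refine (integral_mono (hm j) A.moment (hle j)).trans ?_
    rw [← H.E0_eq A]
    exact (div_le_iff₀ h0).1 hU
  · have hi : ∀ j, Integrable (((H.flow A).r * (H.flow A).u j).1 0) := fun j =>
      (((H.flow A).integrable_of_moment hm j).abs.const_mul (5 / 4)).mono'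
        (Fld.continuous _ 0).aestronglyMeasurable (Eventually.of_forall fun x => by
          have := (H.flow A).density_bounds le_rfl x
          rw [mul_val, Real.norm_eq_abs, abs_mul, abs_of_nonneg (by linarith : 0 ≤ (H.flow A).r.1 0 x)]
          exact mul_le_mul_of_nonneg_right this.2 (abs_nonneg _))
    have hI : Integrable fun x => ρ 0 x • u 0 x := by
      refine Integrable.of_eval_piLp fun j => ?_
      rw [funext (hv j)]
      exact hi j
    have h1 := (EuclideanSpace.proj (𝕜 := ℝ) j).integral_comp_comm hI
    rw [A.momentum_zero, map_zero] at h1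
    exact (integral_congr_ae (Eventually.of_forall fun x => (hv j x).symm)).trans h1
  · rw [← H.LpN_rho_sub_one A]; exact ha
  · exact (div_le_iff₀ hX).1 hE
  · have h2 : 0 < E2 ρ u := by
      have := ((H.flow A).Int_r_dot_le (H.flow A).ut le_rfl).1
      have := Int_dot_nonneg (H.flow A).ut 0
      have := pow_pos hX 2
      rw [H.E2_eq A]; linarith
    rw [E3, H.LpN_grad_ut A, show (3 / 2 : ℝ) = 1 + 1 / 2 by norm_num, Real.rpow_add h2, Real.rpow_one,
      ← Real.sqrt_eq_rpow]

end IsSmoothSolution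

/-! ### Comparison of weights -/

lemma third_order_weight_le {B R G E s b : ℝ} (hB : 0 ≤ B) (hE : 0 ≤ E) (hR : 0 ≤ R) (hG : R ^ 2 = G)
    (hs : 1 ≤ s) (hb : b = s + (Real.exp 1 - 1)) :
    B * ((1 + G) * E / s ^ 5 * (1 + Real.log s) ^ 2) ≤
      972 * B * ((1 + R) ^ 2 * E * b ^ (-5 : ℝ) * Real.log b ^ 2) := by
  have he := Real.exp_one_lt_three
  have he' : Real.exp 1 > 2 := by have := Real.exp_one_gt_d9; linarith
  have hbs : b ≤ 3 * s := by linarith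
  have hsb : s ≤ b := by linarith
  have hb0 : 0 < b := by linarith
  have hl : 1 ≤ Real.log b := by
    rw [Real.le_log_iff_exp_le hb0]; linarith
  have hl2 : 1 + Real.log s ≤ 2 * Real.log b := by
    have := Real.log_le_log (by linarith) hsb
    linarith
  have hl0 : 0 ≤ Real.log s := Real.log_nonneg hs
  have e1 : b ^ (-5 : ℝ) = (b ^ 5)⁻¹ := by
    rw [Real.rpow_neg hb0.le]; norm_cast
  have h5 : (s ^ 5)⁻¹ ≤ 243 * (b ^ 5)⁻¹ := by
    rw [← div_eq_mul_inv, le_div_iff₀ (by positivity), inv_mul_le_iff₀ (by positivity)]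
    calc b ^ 5 ≤ (3 * s) ^ 5 := pow_le_pow_left₀ hb0.le hbs 5
      _ = s ^ 5 * 243 := by ring
  have hG' : 1 + G ≤ (1 + R) ^ 2 := by nlinarith
  rw [e1]
  calc B * ((1 + G) * E / s ^ 5 * (1 + Real.log s) ^ 2)
      = B * ((1 + G) * E * (s ^ 5)⁻¹ * (1 + Real.log s) ^ 2) := by rw [div_eq_mul_inv]
    _ ≤ B * ((1 + R) ^ 2 * E * (243 * (b ^ 5)⁻¹) * (2 * Real.log b) ^ 2) := by
        gcongr
    _ = 972 * B * ((1 + R) ^ 2 * E * (b ^ 5)⁻¹ * Real.log b ^ 2) := by ring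

lemma gradient_weight_le {B R E E' s b d : ℝ} (hB : 0 ≤ B) (hE : 0 ≤ E) (hE' : 0 ≤ E') (hR : 0 ≤ R)
    (hs : 1 ≤ s) (hb : b = s + (Real.exp 1 - 1)) (hd : |d| ^ 4 ≤ B * (E * E' / s ^ 8)) :
    |d| ≤ 9 * (B + 1) * ((1 + R) ^ (1 / 4 : ℝ) * E ^ (1 / 4 : ℝ) * E' ^ (1 / 4 : ℝ) * b ^ (-2 : ℝ) *
      Real.log b ^ (1 / 2 : ℝ)) := by
  have he := Real.exp_one_lt_three
  have he' : Real.exp 1 > 2 := by have := Real.exp_one_gt_d9; linarith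
  have hbs : b ≤ 3 * s := by linarith
  have hb0 : 0 < b := by linarith
  have hl : 1 ≤ Real.log b := by
    rw [Real.le_log_iff_exp_le hb0]; linarith
  have e1 : b ^ (-2 : ℝ) = (b ^ 2)⁻¹ := by
    rw [Real.rpow_neg hb0.le]; norm_cast
  have e4 : ∀ z : ℝ, 0 ≤ z → (z ^ (1 / 4 : ℝ)) ^ 4 = z := fun z hz => by
    rw [← Real.rpow_natCast, ← Real.rpow_mul hz]; norm_num
  obtain ⟨w, hw⟩ : ∃ w, w = E ^ (1 / 4 : ℝ) * E' ^ (1 / 4 : ℝ) * (b ^ 2)⁻¹ := ⟨_, rfl⟩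
  have hw0 : 0 ≤ w := by rw [hw]; positivity
  have hw4 : w ^ 4 = E * E' * (b ^ 8)⁻¹ := by
    rw [hw, mul_pow, mul_pow, e4 _ hE, e4 _ hE', inv_pow, ← pow_mul]
  have h8 : (s ^ 8)⁻¹ ≤ 6561 * (b ^ 8)⁻¹ := by
    rw [← div_eq_mul_inv, le_div_iff₀ (by positivity), inv_mul_le_iff₀ (by positivity)]
    calc b ^ 8 ≤ (3 * s) ^ 8 := pow_le_pow_left₀ hb0.le hbs 8
      _ = s ^ 8 * 6561 := by ring
  have hB4 : B ≤ (B + 1) ^ 4 := by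
    have : (B + 1) ^ 1 ≤ (B + 1) ^ 4 := pow_le_pow_right₀ (by linarith) (by norm_num)
    linarith
  have h1 : |d| ≤ 9 * (B + 1) * w := by
    refine le_of_pow_le_pow_left₀ four_ne_zero (by positivity) (hd.trans ?_)
    calc B * (E * E' / s ^ 8) = B * (E * E' * (s ^ 8)⁻¹) := by rw [div_eq_mul_inv]
      _ ≤ (B + 1) ^ 4 * (E * E' * (6561 * (b ^ 8)⁻¹)) := by gcongr
      _ = (9 * (B + 1) * w) ^ 4 := by rw [mul_pow, hw4]; ring
  have h2 : (1 : ℝ) ≤ (1 + R) ^ (1 / 4 : ℝ) := Real.one_le_rpow (by linarith) (by norm_num)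
  have h3 : 1 ≤ Real.log b ^ (1 / 2 : ℝ) := Real.one_le_rpow hl (by norm_num)
  rw [e1]
  refine h1.trans (mul_le_mul_of_nonneg_left ?_ (by positivity))
  calc w = 1 * w * 1 := by ring
    _ ≤ (1 + R) ^ (1 / 4 : ℝ) * w * Real.log b ^ (1 / 2 : ℝ) := by gcongr
    _ = _ := by rw [hw]; ring

/-- Bounds with constants depending on a natural number can be made to hold with a monotone
constant. -/
lemma exists_monotone_const (c : ℕ → ℝ) (hc : ∀ n, 0 ≤ c n) :
    ∃ C : ℝ → ℝ, Monotone C ∧ ∀ x, 0 ≤ C x ∧ c ⌈x⌉₊ ≤ C x := by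
  refine ⟨fun x => ∑ i ∈ Finset.range (⌈x⌉₊ + 1), c i, fun x y h => ?_, fun x => ⟨?_, ?_⟩⟩
  · exact Finset.sum_le_sum_of_subset_of_nonneg
      (Finset.range_mono (Nat.succ_le_succ (Nat.ceil_mono h))) fun i _ _ => hc i
  · exact Finset.sum_nonneg fun i _ => hc i
  · exact Finset.single_le_sum (f := c) (fun i _ => hc i) (Finset.self_mem_range_succ _)

/-- Decay of smooth solutions whose initial energy is at most `M`. -/
theorem exists_decay (M : ℝ) (hM : 0 ≤ M) : ∃ c : ℝ, 0 ≤ c ∧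
    ∀ (ρ : ℝ → Plane → ℝ) (u : ℝ → Plane → Plane) (P : ℝ → Plane → ℝ),
      IsSmoothSolution ρ u P → AdmissibleData ρ u → E0 ρ u ≤ M → 0 < E0 ρ u →
      ∀ T : ℝ, T3 ρ u ≤ T → ∀ t : ℝ, 0 ≤ t →
        LpN 2 (gradLen 3 (u t)) ^ 2 + LpN 2 (gradLen 2 (P t)) ^ 2
          ≤ c * ((1 + LpN 2 (gradLen 1 (ρ 0))) ^ 2 * E3 ρ u
              * brk T t ^ (-5 : ℝ) * Real.log (brk T t) ^ 2) ∧
        LpN ⊤ (gradLen 1 (u t))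
          ≤ c * ((1 + LpN 2 (gradLen 1 (ρ 0))) ^ ((1 : ℝ) / 4)
              * E1 u ^ ((1 : ℝ) / 4) * E3 ρ u ^ ((1 : ℝ) / 4)
              * brk T t ^ (-2 : ℝ) * Real.log (brk T t) ^ ((1 : ℝ) / 2)) := by
  obtain ⟨C, hC⟩ := Flow.exists_bounds M hM
  obtain ⟨B, hB, hBQ⟩ := Flow.exists_Q_decay M C hM
  obtain ⟨B', hB', hBG⟩ := Flow.exists_gradient_decay C
  refine ⟨972 * B + 18 * (B' + 1), by positivity, fun ρ u P H A hE h0 T hT t ht => ?_⟩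
  have D := H.data A h0 hT
  have hy : (H.flow A).y 0 ≤ M := H.E0_eq A ▸ hE
  have bd := hC _ _ _ _ _ hy D
  have hR : 0 ≤ LpN 2 (gradLen 1 (ρ 0)) := ENNReal.toReal_nonneg
  have hs : 1 ≤ 1 + t / T := by have := div_nonneg ht D.T_pos.le; linarith
  have hb : brk T t = 1 + t / T + (Real.exp 1 - 1) := by rw [brk]; ring
  have hb0 : 0 ≤ brk T t := by rw [brk]; have := Real.exp_pos 1; linarith
  have hlog : 0 ≤ Real.log (brk T t) := Real.log_nonneg (by
    rw [brk]; have := Real.add_one_le_exp (1 : ℝ); linarith)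
  have hE3 := D.E3_pos.le
  have hE1 : 0 ≤ E1 u := sq_nonneg _
  constructor
  · rw [H.LpN_third_order A ht]
    refine (hBQ _ _ _ _ _ hy D bd t ht).trans
      ((third_order_weight_le hB hE3 hR (H.LpN_grad_rho A) hs hb).trans ?_)
    exact mul_le_mul_of_nonneg_right (by linarith) (by positivity)
  · have h1 := H.LpN_top_grad_le A ht (by positivity) fun k j x => gradient_weight_le hB' hE1 hE3 hR hs hb
      (H.E1_eq A ▸ hBG _ _ _ _ _ D bd t ht k j x)
    refine h1.trans ?_
    rw [← mul_assoc]
    exact mul_le_mul_of_nonneg_right (by linarith) (by positivity)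

lemma IsSmoothSolution.norms_eq_zero {ρ : ℝ → Plane → ℝ} {u : ℝ → Plane → Plane}
    {P : ℝ → Plane → ℝ} (H : IsSmoothSolution ρ u P) (A : AdmissibleData ρ u) (h : E0 ρ u = 0) {t : ℝ}
    (ht : 0 ≤ t) : LpN 2 (gradLen 3 (u t)) ^ 2 + LpN 2 (gradLen 2 (P t)) ^ 2 = 0 ∧
      LpN ⊤ (gradLen 1 (u t)) ≤ 0 := by
  obtain ⟨hu, hp⟩ := (H.flow A).at_rest (H.E0_eq A ▸ h)
  constructor
  · rw [H.LpN_third_order A ht]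
    simp [Flow.Q, hsq, gsq, dot, hu, hp, Int_zero]
  · have := H.LpN_top_grad_le A ht le_rfl fun k j x => by simp [hu]
    simpa using this

end INS2D

end

theorem stmt_12 :
    ∃ C : ℝ → ℝ, Monotone C ∧
      ∀ (ρ : ℝ → INS2D.Plane → ℝ) (u : ℝ → INS2D.Plane → INS2D.Plane) (P : ℝ → INS2D.Plane → ℝ),
        INS2D.IsSmoothSolution ρ u P → INS2D.AdmissibleData ρ u →
        ∀ T : ℝ, INS2D.T3 ρ u ≤ T → ∀ t : ℝ, 0 ≤ t →
          INS2D.LpN 2 (INS2D.gradLen 3 (u t)) ^ 2 + INS2D.LpN 2 (INS2D.gradLen 2 (P t)) ^ 2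
            ≤ C (INS2D.E0 ρ u) *
                ((1 + INS2D.LpN 2 (INS2D.gradLen 1 (ρ 0))) ^ 2 * INS2D.E3 ρ u
                  * INS2D.brk T t ^ (-5 : ℝ) * Real.log (INS2D.brk T t) ^ 2) ∧
          INS2D.LpN ⊤ (INS2D.gradLen 1 (u t))
            ≤ C (INS2D.E0 ρ u) *
                ((1 + INS2D.LpN 2 (INS2D.gradLen 1 (ρ 0))) ^ ((1 : ℝ) / 4)
                  * INS2D.E1 u ^ ((1 : ℝ) / 4) * INS2D.E3 ρ u ^ ((1 : ℝ) / 4)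
                  * INS2D.brk T t ^ (-2 : ℝ) * Real.log (INS2D.brk T t) ^ ((1 : ℝ) / 2)) := by
  choose c hc hd using fun n : ℕ => INS2D.exists_decay n n.cast_nonneg
  obtain ⟨C, hC, hCc⟩ := INS2D.exists_monotone_const c hc
  refine ⟨C, hC, fun ρ u P H A T hT t ht => ?_⟩
  obtain ⟨hC0, hcC⟩ := hCc (INS2D.E0 ρ u)
  have hE0 : 0 ≤ INS2D.E0 ρ u := H.E0_eq A ▸ (H.flow A).y_nonneg le_rfl
  have hE2 : 0 ≤ INS2D.E2 ρ u := by rw [INS2D.E2]; positivity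
  have hE3 : 0 ≤ INS2D.E3 ρ u := by rw [INS2D.E3]; positivity
  have hE1 : 0 ≤ INS2D.E1 u := sq_nonneg _
  have hR : 0 ≤ INS2D.LpN 2 (INS2D.gradLen 1 (ρ 0)) := ENNReal.toReal_nonneg
  have hT0 : 0 ≤ T := by
    simp only [INS2D.T3, INS2D.T2, INS2D.T1, INS2D.T0, max_le_iff] at hT
    exact (sq_nonneg _).trans hT.1.1.1.2
  have hb : 1 ≤ INS2D.brk T t := by
    have := Real.add_one_le_exp (1 : ℝ)
    have := div_nonneg ht hT0
    rw [INS2D.brk]; linarith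
  have hb0 : 0 ≤ INS2D.brk T t := by linarith
  have hlog := Real.log_nonneg hb
  rcases hE0.eq_or_lt with h0 | h0
  · obtain ⟨h1, h2⟩ := H.norms_eq_zero A h0.symm ht
    exact ⟨h1.le.trans (by positivity), h2.trans (by positivity)⟩
  · obtain ⟨h1, h2⟩ := hd _ ρ u P H A (Nat.le_ceil _) h0 T hT t ht
    exact ⟨h1.trans (mul_le_mul_of_nonneg_right hcC (by positivity)),
      h2.trans (mul_le_mul_of_nonneg_right hcC (by positivity))⟩
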